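/- Let B = (B^{(0)},…,B^{(p)}) be a collection of HTL normal forms of size n with associated quiver Q, dimension vector α, parameter λ and lattice L as in the context. Then there exists a bijection Φ_B from the moduli space M(B) onto M_λ(Q,α)^dif. -/

import Mathlib

/-!
STATEMENT 8: the moduli space `M(B)` of stable meromorphic connections with formal
types `B` is in bijection with the space `M_λ(Q,α)^dif` inside the quiver variety
attached to `B`.
-/

open Matrix BigOperators

noncomputable section

/-! ### Formal Laurent series preliminaries -/

/-- Evaluation of a polynomial at `z⁻¹`. -/
def polyZinv (q : Polynomial ℂ) : LaurentSeries ℂ :=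
  q.sum fun k c => HahnSeries.single (-(k : ℤ)) c

/-- A Laurent series lies in `ℂ[[z]]`. -/
def Tame (f : LaurentSeries ℂ) : Prop := ∀ k : ℤ, k < 0 → f.coeff k = 0

/-- A Laurent series is a principal part (class representative in `ℂ((z))/ℂ[[z]]`). -/
def IsPrincipal (f : LaurentSeries ℂ) : Prop := ∀ k : ℤ, 0 ≤ k → f.coeff k = 0

/-- `GL(n, ℂ[[z]])`. -/
abbrev GLps (n : ℕ) := (Matrix (Fin n) (Fin n) (PowerSeries ℂ))ˣ

/-- `GL(n, ℂ)`. -/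
abbrev GLc (n : ℕ) := (Matrix (Fin n) (Fin n) ℂ)ˣ

/-- The inclusion `GL(n, ℂ[[z]]) → GL(n, ℂ((z)))`. -/
def glMap {n : ℕ} : GLps n →* (Matrix (Fin n) (Fin n) (LaurentSeries ℂ))ˣ :=
  Units.map ((HahnSeries.ofPowerSeries ℤ ℂ).mapMatrix).toMonoidHom

/-- The inclusion `GL(n, ℂ) → GL(n, ℂ((z)))`. -/
def glC {n : ℕ} : GLc n →* (Matrix (Fin n) (Fin n) (LaurentSeries ℂ))ˣ :=
  Units.map ((HahnSeries.C : ℂ →+* LaurentSeries ℂ).mapMatrix).toMonoidHom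

/-- Conjugation of a matrix of Laurent series by `X ∈ GL(n, ℂ[[z]])`. -/
def conjPS {n : ℕ} (X : GLps n) (B : Matrix (Fin n) (Fin n) (LaurentSeries ℂ)) :
    Matrix (Fin n) (Fin n) (LaurentSeries ℂ) :=
  (glMap X).val * B * ((glMap X)⁻¹).val

/-- Conjugation by a constant invertible matrix. -/
def conjC {n : ℕ} (g : GLc n) (B : Matrix (Fin n) (Fin n) (LaurentSeries ℂ)) :
    Matrix (Fin n) (Fin n) (LaurentSeries ℂ) :=
  (glC g).val * B * ((glC g)⁻¹).val

/-- The matrix of `z^k`-coefficients of a matrix of Laurent series. -/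
def coeffM {n : ℕ} (M : Matrix (Fin n) (Fin n) (LaurentSeries ℂ)) (k : ℤ) :
    Matrix (Fin n) (Fin n) ℂ := fun a b => (M a b).coeff k

/-! ### Finite quivers and representations of double quivers -/

/-- A finite quiver. -/
structure FinQuiver where
  V : Type
  E : Type
  [fintypeV : Fintype V]
  [decEqV : DecidableEq V]
  [fintypeE : Fintype E]
  [decEqE : DecidableEq E]
  src : E → V
  tgt : E → V

attribute [instance] FinQuiver.fintypeV FinQuiver.decEqV FinQuiver.fintypeE FinQuiver.decEqE

namespace FinQuiver

variable (Q : FinQuiver) (α : Q.V → ℕ)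

/-- The representation space of the double quiver `Q̄` with dimension vector `α`. -/
abbrev Rep :=
  ∀ e : Q.E, Matrix (Fin (α (Q.tgt e))) (Fin (α (Q.src e))) ℂ ×
    Matrix (Fin (α (Q.src e))) (Fin (α (Q.tgt e))) ℂ

/-- The group `G = ∏_{a ∈ Q₀} GL(α_a, ℂ)`. -/
abbrev GGroup := ∀ a : Q.V, (Matrix (Fin (α a)) (Fin (α a)) ℂ)ˣ

variable {Q α}

/-- The action of `G` on `Rep(Q̄,α)`. -/
def act (g : Q.GGroup α) (x : Q.Rep α) : Q.Rep α := fun e =>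
  ((g (Q.tgt e)).val * (x e).1 * ((g (Q.src e))⁻¹).val,
   (g (Q.src e)).val * (x e).2 * ((g (Q.tgt e))⁻¹).val)

/-- The moment map `μ`. -/
def mu (x : Q.Rep α) (a : Q.V) : Matrix (Fin (α a)) (Fin (α a)) ℂ :=
  (∑ e : Q.E, if h : Q.tgt e = a then
      (Matrix.reindex (finCongr (congrArg α h)) (finCongr (congrArg α h))
        ((x e).1 * (x e).2)) else 0)
  - ∑ e : Q.E, if h : Q.src e = a then
      (Matrix.reindex (finCongr (congrArg α h)) (finCongr (congrArg α h))
        ((x e).2 * (x e).1)) else 0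

/-- A collection of subspaces invariant under all the components of `x`. -/
def InvFamily (x : Q.Rep α) (W : ∀ a : Q.V, Submodule ℂ (Fin (α a) → ℂ)) : Prop :=
  ∀ e : Q.E, (∀ v ∈ W (Q.src e), (x e).1.mulVec v ∈ W (Q.tgt e)) ∧
             (∀ v ∈ W (Q.tgt e), (x e).2.mulVec v ∈ W (Q.src e))

/-- `x` is an irreducible representation of the double quiver. -/
def Irred (x : Q.Rep α) : Prop :=
  ∀ W : ∀ a : Q.V, Submodule ℂ (Fin (α a) → ℂ),
    InvFamily x W → (∀ a, W a = ⊥) ∨ (∀ a, W a = ⊤)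

end FinQuiver

/-! ### The data of a collection of HTL normal forms -/

/-- A collection `B = (B^{(0)}, …, B^{(p)})` of unramified HTL normal forms of size `n`,
`B^{(i)} = diag(q^{(i)}_j(z⁻¹)I_{n^{(i)}_j} + R^{(i)}_j z⁻¹)_{j=1,…,m^{(i)}}`,
together with eigenvalue data `ξ^{[i,j]}_1, …, ξ^{[i,j]}_{e_{[i,j]}}` with
`∏_k (R^{(i)}_j − ξ^{[i,j]}_k) = 0`. -/
structure ConnData where
  n : ℕ
  hn : 0 < n
  p : ℕ
  m : Fin (p+1) → ℕ
  hm : ∀ i, 0 < m i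
  nb : (i : Fin (p+1)) → Fin (m i) → ℕ
  hnb : ∀ i j, 0 < nb i j
  hsum : ∀ i, ∑ j, nb i j = n
  q : (i : Fin (p+1)) → Fin (m i) → Polynomial ℂ
  hq0 : ∀ i j, (q i j).coeff 0 = 0
  hq1 : ∀ i j, (q i j).coeff 1 = 0
  hqd : ∀ i (j j' : Fin (m i)), j ≠ j' → q i j ≠ q i j'
  hreg : ∀ i, i ≠ 0 → m i = 1 → ∀ j, q i j = 0
  R : (i : Fin (p+1)) → (j : Fin (m i)) → Matrix (Fin (nb i j)) (Fin (nb i j)) ℂ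
  e : (i : Fin (p+1)) → Fin (m i) → ℕ
  he : ∀ i j, 0 < e i j
  xi : (i : Fin (p+1)) → (j : Fin (m i)) → Fin (e i j) → ℂ
  hxi : ∀ i j,
    (List.ofFn fun k => R i j - xi i j k • (1 : Matrix (Fin (nb i j)) (Fin (nb i j)) ℂ)).prod = 0

namespace ConnData

variable (D : ConnData)

/-- `i ∈ I_irr`. -/
def isIrr (i : Fin (D.p+1)) : Prop := 1 < D.m i ∨ i = 0

instance : DecidablePred D.isIrr := fun _ => inferInstanceAs (Decidable (_ ∨ _))

/-- The set of indices of irregular type. -/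
abbrev IrrIdx := {i : Fin (D.p+1) // D.isIrr i}

/-- The set of indices of irregular type other than `0`. -/
abbrev IrrNz := {i : Fin (D.p+1) // D.isIrr i ∧ i ≠ 0}

/-- The unique block index at a point. -/
def j1 (i : Fin (D.p+1)) : Fin (D.m i) := ⟨0, D.hm i⟩

/-- `d_i(j,j') = deg(q^{(i)}_j − q^{(i)}_{j'}) − 2`. -/
def dd (i : Fin (D.p+1)) (j j' : Fin (D.m i)) : ℕ := ((D.q i j) - (D.q i j')).natDegree - 2

/-- The vertex set of the quiver: mid vertices `[i,j]` (for `i ∈ I_irr`) and leg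
vertices `[i,j,k]`, `1 ≤ k ≤ e_{[i,j]}−1`. -/
abbrev Vq :=
  (Σ i : D.IrrIdx, Fin (D.m i.1)) ⊕ (Σ i : Fin (D.p+1), Σ j : Fin (D.m i), Fin (D.e i j - 1))

/-- The vertex `[i,j]`, `i ∈ I_irr`. -/
def vmid (i : D.IrrIdx) (j : Fin (D.m i.1)) : D.Vq := Sum.inl ⟨i, j⟩

/-- `0 ∈ I_irr`. -/
def irr0 : D.IrrIdx := ⟨0, Or.inr rfl⟩

/-- The vertex `[0,j]`. -/
def vmid0 (j : Fin (D.m 0)) : D.Vq := Sum.inl ⟨D.irr0, j⟩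

/-- The leg vertex `[i,j,k+1]` (`k` is 0-based). -/
def vleg (i : Fin (D.p+1)) (j : Fin (D.m i)) (k : Fin (D.e i j - 1)) : D.Vq :=
  Sum.inr ⟨i, j, k⟩

/-- Arrows `[0,j] → [i,j']`, `i ∈ I_irr \ {0}`. -/
abbrev Arr1 := Fin (D.m 0) × (Σ i : D.IrrNz, Fin (D.m i.1))
/-- `d_i(j,j')` arrows `[i,j] → [i,j']` for `i ∈ I_irr`, `j < j'`. -/
abbrev Arr2 := Σ i : D.IrrIdx, Σ jj : {x : Fin (D.m i.1) × Fin (D.m i.1) // x.1 < x.2},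
  Fin (D.dd i.1 jj.1.1 jj.1.2)
/-- Leg arrows `[i,j,k] → [i,j,k−1]`, `k ≥ 2`. -/
abbrev Arr3 := Σ i : Fin (D.p+1), Σ j : Fin (D.m i), Fin (D.e i j - 2)
/-- Arrows `[i,j,1] → [i,j]`, `i ∈ I_irr`. -/
abbrev Arr4 := Σ i : D.IrrIdx, {j : Fin (D.m i.1) // 2 ≤ D.e i.1 j}
/-- Arrows `[i,1,1] → [0,j]`, `i ∈ I_reg`. -/
abbrev Arr5 := {i : Fin (D.p+1) // ¬ D.isIrr i ∧ 2 ≤ D.e i (D.j1 i)} × Fin (D.m 0)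

/-- The arrow set of the quiver. -/
abbrev Arr := D.Arr1 ⊕ D.Arr2 ⊕ D.Arr3 ⊕ D.Arr4 ⊕ D.Arr5

/-- Sources of arrows. -/
def qsrc : D.Arr → D.Vq
  | .inl (j, ⟨_, _⟩) => D.vmid0 j
  | .inr (.inl ⟨i, jj, _⟩) => D.vmid i jj.1.1
  | .inr (.inr (.inl ⟨i, j, t⟩)) => D.vleg i j ⟨t.1 + 1, by have := t.isLt; omega⟩
  | .inr (.inr (.inr (.inl ⟨i, j⟩))) => D.vleg i.1 j.1 ⟨0, by have := j.2; omega⟩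
  | .inr (.inr (.inr (.inr (i, _)))) => D.vleg i.1 (D.j1 i.1) ⟨0, by have := i.2.2; omega⟩

/-- Targets of arrows. -/
def qtgt : D.Arr → D.Vq
  | .inl (_, ⟨i, j'⟩) => D.vmid ⟨i.1, i.2.1⟩ j'
  | .inr (.inl ⟨i, jj, _⟩) => D.vmid i jj.1.2
  | .inr (.inr (.inl ⟨i, j, t⟩)) => D.vleg i j ⟨t.1, by have := t.isLt; omega⟩
  | .inr (.inr (.inr (.inl ⟨i, j⟩))) => D.vmid i j.1
  | .inr (.inr (.inr (.inr (_, j)))) => D.vmid0 j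

/-- The quiver `Q` associated with `B`. -/
def quiv : FinQuiver := FinQuiver.mk (V := D.Vq) (E := D.Arr) D.qsrc D.qtgt

/-- The dimension vector `α`. -/
def alphaV : D.Vq → ℕ
  | .inl ⟨i, j⟩ => D.nb i.1 j
  | .inr ⟨i, j, k⟩ =>
      ((List.ofFn fun l : Fin (k.1 + 1) =>
          D.R i j - D.xi i j ⟨l.1, by have := l.isLt; have := k.isLt; omega⟩ •
            (1 : Matrix (Fin (D.nb i j)) (Fin (D.nb i j)) ℂ)).prod).rank

/-- The dimension vector `α` as an integral vector. -/
def alphaZ : D.Vq → ℤ := fun a => (D.alphaV a : ℤ)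

/-- `Σ_{i ∈ I_reg} ξ^{[i,1]}_1`. -/
def regSumXi : ℂ :=
  ∑ i : Fin (D.p+1), if D.isIrr i then 0 else D.xi i (D.j1 i) ⟨0, D.he _ _⟩

/-- The parameter `λ`. -/
def lamV : D.Vq → ℂ
  | .inl ⟨⟨i, _⟩, j⟩ =>
      if h : i = 0 then - D.xi 0 (h ▸ j) ⟨0, D.he _ _⟩ - D.regSumXi
      else - D.xi i j ⟨0, D.he _ _⟩
  | .inr ⟨i, j, k⟩ =>
      D.xi i j ⟨k.1, by have := k.isLt; omega⟩ - D.xi i j ⟨k.1 + 1, by have := k.isLt; omega⟩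

/-- The lattice `L ⊆ ℤ^{Q₀}`. -/
def latt : Set (D.Vq → ℤ) :=
  {β | ∀ i : D.IrrNz,
    (∑ j : Fin (D.m 0), β (D.vmid0 j)) = ∑ j : Fin (D.m i.1), β (D.vmid ⟨i.1, i.2.1⟩ j)}

/-- `L`-irreducibility of a representation: no nontrivial proper invariant collection
of subspaces whose dimension vector lies in `L`. -/
def LIrred {αd : D.Vq → ℕ} (x : D.quiv.Rep αd) : Prop :=
  ∀ W : ∀ a : D.Vq, Submodule ℂ (Fin (αd a) → ℂ),
    FinQuiver.InvFamily x W →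
    (fun a => (Module.finrank ℂ (W a) : ℤ)) ∈ D.latt →
    (∀ a, W a = ⊥) ∨ (∀ a, W a = ⊤)

/-- The block matrix formed by the components of `x` along the arrows `[0,j] → [i,j']`
for a fixed `i ∈ I_irr \ {0}`. -/
def detMat {αd : D.Vq → ℕ} (x : D.quiv.Rep αd) (i : D.IrrNz) :
    Matrix (Σ j' : Fin (D.m i.1), Fin (αd (D.vmid ⟨i.1, i.2.1⟩ j')))
      (Σ j : Fin (D.m 0), Fin (αd (D.vmid0 j))) ℂ :=
  fun rc cc => (x (Sum.inl (cc.1, ⟨i, rc.1⟩))).1 rc.2 cc.2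

/-- The determinant conditions: the block matrices along the arrows `[0,j] → [i,j']`
are invertible for all `i ∈ I_irr \ {0}`. -/
def DetCond {αd : D.Vq → ℕ} (x : D.quiv.Rep αd) : Prop :=
  ∀ i : D.IrrNz, Function.Bijective (Matrix.mulVecLin (D.detMat x i))

/-- The set underlying `M_λ(Q,α)^dif`. -/
def MdifSub (lam : D.Vq → ℂ) (αd : D.Vq → ℕ) :=
  {x : D.quiv.Rep αd //
    (∀ a, FinQuiver.mu x a = lam a • (1 : Matrix (Fin (αd a)) (Fin (αd a)) ℂ)) ∧
    D.LIrred x ∧ D.DetCond x}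

/-- `M_λ(Q,α)^dif`: the quotient of the `L`-irreducible locus (with the determinant
conditions) of `μ⁻¹(λ)` by `G`. -/
def Mdif (lam : D.Vq → ℂ) (αd : D.Vq → ℕ) :=
  Quot (fun x y : D.MdifSub lam αd => ∃ g : D.quiv.GGroup αd, FinQuiver.act g x.1 = y.1)

/-- Identification of the disjoint union of the blocks of `B^{(i)}` with `Fin n`. -/
def sigmaEquiv (i : Fin (D.p+1)) : (Σ j : Fin (D.m i), Fin (D.nb i j)) ≃ Fin D.n :=
  Fintype.equivFinOfCardEq (by simpa using D.hsum i)

/-- The matrix of the HTL normal form `B^{(i)}`. -/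
def BmatAt (i : Fin (D.p+1)) : Matrix (Fin D.n) (Fin D.n) (LaurentSeries ℂ) :=
  Matrix.reindex (D.sigmaEquiv i) (D.sigmaEquiv i)
    (Matrix.blockDiagonal' fun j =>
      (fun a b => (if a = b then polyZinv (D.q i j) else 0) +
        HahnSeries.single (-1 : ℤ) (D.R i j a b)))

/-- Membership in the moduli space data: a tuple of principal parts, lying in the
truncated orbits of the `B^{(i)}`, with vanishing total residue, which is
irreducible. -/
def MBMem (A : Fin (D.p+1) → Matrix (Fin D.n) (Fin D.n) (LaurentSeries ℂ)) : Prop :=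
  (∀ i a b, IsPrincipal (A i a b)) ∧
  (∀ i, ∃ X : GLps D.n, ∀ a b, Tame ((A i - conjPS X (D.BmatAt i)) a b)) ∧
  (∑ i, coeffM (A i) (-1)) = 0 ∧
  (∀ W : Submodule ℂ (Fin D.n → ℂ),
    (∀ i (k : ℤ), ∀ v ∈ W, (coeffM (A i) k).mulVec v ∈ W) → W = ⊥ ∨ W = ⊤)

/-- The set underlying the moduli space `M(B)`. -/
def MBSub := {A : Fin (D.p+1) → Matrix (Fin D.n) (Fin D.n) (LaurentSeries ℂ) // D.MBMem A}

/-- The moduli space `M(B)` of stable meromorphic connections on trivial bundles with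
formal types `B`: the quotient by simultaneous `GL(n,ℂ)`-conjugation. -/
def MB := Quot (fun A A' : D.MBSub => ∃ g : GLc D.n, ∀ i, conjC g (A.1 i) = A'.1 i)

end ConnData

end

namespace HTL
set_option linter.unusedSectionVars false

/-! ### Matrices of Laurent series, their coefficients and the pole filtration -/

section Series

variable {ι κ τ : Type} [Fintype ι] [Fintype κ] [Fintype τ]
  [DecidableEq ι] [DecidableEq κ] [DecidableEq τ]

/-- Matrices with entries in `ℂ((z))`. -/
abbrev LMat (ι κ : Type) := Matrix ι κ (LaurentSeries ℂ)

/-- The matrix of coefficients of `z ^ k`. -/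
def cf (M : LMat ι κ) (k : ℤ) : Matrix ι κ ℂ := fun a b => (M a b).coeff k

/-- The matrix `a z ^ k`. -/
noncomputable def mono (k : ℤ) (a : Matrix ι κ ℂ) : LMat ι κ :=
  fun i j => HahnSeries.single k (a i j)

theorem cf_ext {M N : LMat ι κ} (h : ∀ n, cf M n = cf N n) : M = N := by
  ext i j n
  exact congrFun (congrFun (h n) i) j

@[simp] theorem cf_add (M N : LMat ι κ) (n : ℤ) : cf (M + N) n = cf M n + cf N n := by
  ext; simp [cf]

@[simp] theorem cf_sub (M N : LMat ι κ) (n : ℤ) : cf (M - N) n = cf M n - cf N n := by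
  ext; simp [cf]

@[simp] theorem cf_neg (M : LMat ι κ) (n : ℤ) : cf (-M) n = -cf M n := by
  ext; simp [cf]

@[simp] theorem cf_zero (n : ℤ) : cf (0 : LMat ι κ) n = 0 := by
  ext; simp [cf]

@[simp] theorem cf_sum {β : Type*} (s : Finset β) (f : β → LMat ι κ) (n : ℤ) :
    cf (∑ b ∈ s, f b) n = ∑ b ∈ s, cf (f b) n := by
  ext i j
  simp [cf, Matrix.sum_apply, HahnSeries.coeff_sum]

theorem cf_mono (k n : ℤ) (a : Matrix ι κ ℂ) : cf (mono k a) n = if n = k then a else 0 := by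
  ext i j
  by_cases h : n = k <;> simp [cf, mono, h]

@[simp] theorem cf_mono_mul (k n : ℤ) (a : Matrix ι κ ℂ) (M : LMat κ τ) :
    cf (mono k a * M) n = a * cf M (n - k) := by
  ext i j
  simp [cf, mono, Matrix.mul_apply, HahnSeries.coeff_sum, HahnSeries.coeff_single_mul]

@[simp] theorem cf_mul_mono (k n : ℤ) (a : Matrix κ τ ℂ) (M : LMat ι κ) :
    cf (M * mono k a) n = cf M (n - k) * a := by
  ext i j
  simp [cf, mono, Matrix.mul_apply, HahnSeries.coeff_sum, HahnSeries.coeff_mul_single]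

theorem mono_mul_mono (k l : ℤ) (a : Matrix ι κ ℂ) (b : Matrix κ τ ℂ) :
    mono k a * mono l b = mono (k + l) (a * b) := by
  apply cf_ext; intro n
  rw [cf_mono_mul, cf_mono, cf_mono]
  by_cases h : n = k + l
  · rw [if_pos h, if_pos (by omega)]
  · rw [if_neg h, if_neg (by omega), Matrix.mul_zero]

theorem mono_add (k : ℤ) (a b : Matrix ι κ ℂ) : mono k (a + b) = mono k a + mono k b := by
  apply cf_ext; intro n
  simp only [cf_add, cf_mono]; split_ifs <;> simp

@[simp] theorem mono_zero (k : ℤ) : mono k (0 : Matrix ι κ ℂ) = 0 := by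
  apply cf_ext; intro n
  simp [cf_mono]

theorem mono_neg (k : ℤ) (a : Matrix ι κ ℂ) : mono k (-a) = -mono k a := by
  apply cf_ext; intro n
  simp only [cf_neg, cf_mono]; split_ifs <;> simp

theorem mono_sum {β : Type*} (k : ℤ) (s : Finset β) (f : β → Matrix ι κ ℂ) :
    mono k (∑ b ∈ s, f b) = ∑ b ∈ s, mono k (f b) := by
  apply cf_ext; intro n
  simp only [cf_sum, cf_mono]; split_ifs <;> simp

theorem mono_one : mono 0 (1 : Matrix ι ι ℂ) = 1 := by
  ext i j n
  by_cases h : i = j <;> simp [mono, h, Matrix.one_apply]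

/-- Matrices all of whose entries have order at least `k`. -/
def Fil (ι κ : Type) [Fintype ι] [Fintype κ] [DecidableEq ι] [DecidableEq κ] (k : ℤ) :
    AddSubgroup (LMat ι κ) where
  carrier := {M | ∀ n < k, cf M n = 0}
  add_mem' := by
    intro a b ha hb n hn
    rw [cf_add, ha n hn, hb n hn, add_zero]
  zero_mem' := by intro n _; exact cf_zero n
  neg_mem' := by
    intro a ha n hn
    rw [cf_neg, ha n hn, neg_zero]

theorem mem_fil {k : ℤ} {M : LMat ι κ} : M ∈ Fil ι κ k ↔ ∀ n < k, cf M n = 0 := Iff.rfl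

theorem fil_mono {k l : ℤ} (h : l ≤ k) {M : LMat ι κ} (hM : M ∈ Fil ι κ k) :
    M ∈ Fil ι κ l := fun n hn => hM n (by omega)

theorem mono_mem_fil {k l : ℤ} (h : l ≤ k) (a : Matrix ι κ ℂ) : mono k a ∈ Fil ι κ l := by
  intro n hn
  rw [cf_mono, if_neg (by omega)]

theorem exists_fil (M : LMat ι κ) : ∃ k, M ∈ Fil ι κ k := by
  obtain ⟨k, hk⟩ := (Set.finite_range fun p : ι × κ => (M p.1 p.2).order).bddBelow
  refine ⟨k, fun n hn => ?_⟩
  ext i j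
  apply HahnSeries.coeff_eq_zero_of_lt_order
  have := hk (Set.mem_range_self (i, j))
  exact lt_of_lt_of_le hn this

/-- The truncation of a matrix in `Fil a` below order `b` is a finite sum of monomials. -/
theorem sub_sum_mono_mem_fil {a b : ℤ} {M : LMat ι κ} (hM : M ∈ Fil ι κ a) :
    M - ∑ i ∈ Finset.Ico a b, mono i (cf M i) ∈ Fil ι κ b := by
  intro n hn
  simp only [cf_sub, cf_sum, cf_mono]
  rw [Finset.sum_ite_eq]
  split_ifs with h
  · simp
  · rw [hM n (by simp at h; omega)]; simp

private theorem entry_mul_fil {f g : LaurentSeries ℂ} {a b n : ℤ}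
    (hf : ∀ i < a, f.coeff i = 0) (hg : ∀ i < b, g.coeff i = 0) (hn : n < a + b) :
    (f * g).coeff n = 0 := by
  rw [HahnSeries.coeff_mul]
  apply Finset.sum_eq_zero
  rintro ⟨i, j⟩ hij
  rw [Finset.mem_antidiagonal] at hij
  obtain ⟨_, _, h⟩ := hij
  simp only at h ⊢
  by_cases hi : i < a
  · rw [hf i hi, zero_mul]
  · rw [hg j (by omega), mul_zero]

theorem mul_mem_fil {a b : ℤ} {M : LMat ι κ} {N : LMat κ τ} (hM : M ∈ Fil ι κ a)
    (hN : N ∈ Fil κ τ b) : M * N ∈ Fil ι τ (a + b) := by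
  intro n hn
  ext i j
  simp only [cf, Matrix.mul_apply, HahnSeries.coeff_sum, Matrix.zero_apply]
  apply Finset.sum_eq_zero
  intro k _
  exact entry_mul_fil (fun m hm => congrFun (congrFun (hM m hm) i) k)
    (fun m hm => congrFun (congrFun (hN m hm) k) j) hn

theorem mul_mem_fil' {a b c : ℤ} {M : LMat ι κ} {N : LMat κ τ} (hM : M ∈ Fil ι κ a)
    (hN : N ∈ Fil κ τ b) (h : c ≤ a + b) : M * N ∈ Fil ι τ c :=
  fil_mono h (mul_mem_fil hM hN)

/-- The coefficient formula for products. -/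
theorem cf_mul {a b : ℤ} {M : LMat ι κ} {N : LMat κ τ} (hM : M ∈ Fil ι κ a)
    (hN : N ∈ Fil κ τ b) (n : ℤ) :
    cf (M * N) n = ∑ i ∈ Finset.Ico a (n - b + 1), cf M i * cf N (n - i) := by
  have h := mul_mem_fil (sub_sum_mono_mem_fil (b := n - b + 1) hM) hN n (by omega)
  rw [Matrix.sub_mul, cf_sub, Matrix.sum_mul, cf_sum, sub_eq_zero] at h
  simpa using h

theorem one_mem_fil : (1 : LMat ι ι) ∈ Fil ι ι 0 := by
  rw [← mono_one]; exact mono_mem_fil le_rfl _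

/-- Matrices of power series, viewed as matrices of Laurent series. -/
noncomputable def psMap (ι : Type) [Fintype ι] [DecidableEq ι] :
    Matrix ι ι (PowerSeries ℂ) →+* LMat ι ι :=
  (HahnSeries.ofPowerSeries ℤ ℂ).mapMatrix

theorem psMap_mem_fil (t : Matrix ι ι (PowerSeries ℂ)) : psMap ι t ∈ Fil ι ι 0 := by
  intro n hn
  ext i j
  simp only [cf, psMap, RingHom.mapMatrix_apply, Matrix.map_apply, Matrix.zero_apply]
  rw [HahnSeries.ofPowerSeries_apply, HahnSeries.embDomain_of_notMem_range]
  rintro ⟨m, rfl⟩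
  simp at hn
  omega

theorem exists_psMap {M : LMat ι ι} (hM : M ∈ Fil ι ι 0) : ∃ t, psMap ι t = M := by
  refine ⟨Matrix.of fun i j => PowerSeries.mk fun n => (M i j).coeff n, cf_ext fun n => ?_⟩
  rcases lt_or_ge n 0 with h | h
  · rw [hM n h, psMap_mem_fil _ n h]
  · lift n to ℕ using h
    ext i j
    rw [cf, psMap, RingHom.mapMatrix_apply, Matrix.map_apply, Matrix.of_apply,
      LaurentSeries.coeff_coe_powerSeries, PowerSeries.coeff_mk]
    rfl

theorem exists_units_of_cf_zero {M : LMat ι ι} (hM : M ∈ Fil ι ι 0) (h0 : IsUnit (cf M 0)) :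
    ∃ t : (Matrix ι ι (PowerSeries ℂ))ˣ, psMap ι t.val = M := by
  obtain ⟨t, rfl⟩ := exists_psMap hM
  have ht : IsUnit t := by
    rw [Matrix.isUnit_iff_isUnit_det, PowerSeries.isUnit_iff_constantCoeff, RingHom.map_det]
    rw [Matrix.isUnit_iff_isUnit_det] at h0
    convert h0 using 2
    ext i j
    rw [cf, psMap, RingHom.mapMatrix_apply, RingHom.mapMatrix_apply, Matrix.map_apply,
      Matrix.map_apply]
    have := (LaurentSeries.coeff_coe_powerSeries (t i j) 0).symm
    rwa [PowerSeries.coeff_zero_eq_constantCoeff_apply] at this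
  exact ⟨ht.unit, rfl⟩

theorem cf_mul_zero {M : LMat ι κ} {N : LMat κ τ} (hM : M ∈ Fil ι κ 0) (hN : N ∈ Fil κ τ 0) :
    cf (M * N) 0 = cf M 0 * cf N 0 := by
  rw [cf_mul hM hN, show Finset.Ico (0 : ℤ) (0 - 0 + 1) = {0} from rfl]; simp

theorem exists_inv_of_sub_one_mem {b : LMat ι ι} (hb : b - 1 ∈ Fil ι ι 1) :
    ∃ b', b * b' = 1 ∧ b' * b = 1 ∧ b' - 1 ∈ Fil ι ι 1 := by
  have hb0 : b ∈ Fil ι ι 0 := by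
    have := (Fil ι ι 0).add_mem (fil_mono (by omega) hb) one_mem_fil
    simpa using this
  have h1 : cf b 0 = 1 := by
    have := hb 0 (by omega)
    rw [cf_sub, sub_eq_zero, ← mono_one, cf_mono, if_pos rfl] at this
    exact this
  obtain ⟨t, rfl⟩ := exists_units_of_cf_zero hb0 (by rw [h1]; exact isUnit_one)
  have e1 : psMap ι t.val * psMap ι (t⁻¹).val = 1 := by rw [← map_mul]; simp
  have e2 : psMap ι (t⁻¹).val * psMap ι t.val = 1 := by rw [← map_mul]; simp
  refine ⟨psMap ι (t⁻¹).val, e1, e2, ?_⟩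
  have : psMap ι (t⁻¹).val - 1 = -(psMap ι (t⁻¹).val * (psMap ι t.val - 1)) := by
    rw [mul_sub, e2, mul_one]; abel
  rw [this]
  exact (Fil ι ι 1).neg_mem (mul_mem_fil' (psMap_mem_fil _) hb (by omega))

/-! ### Polynomials in `z⁻¹` -/

theorem coeff_polyZinv (q : Polynomial ℂ) (n : ℤ) :
    (polyZinv q).coeff n = if n ≤ 0 then q.coeff (-n).toNat else 0 := by
  rw [polyZinv, Polynomial.sum_def, HahnSeries.coeff_sum]
  simp only [HahnSeries.coeff_single]
  split_ifs with h
  · rw [Finset.sum_eq_single (-n).toNat]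
    · rw [if_pos (by omega)]
    · intro b _ hb
      rw [if_neg (by omega)]
    · intro hb
      rw [Polynomial.notMem_support_iff.mp hb]; simp
  · apply Finset.sum_eq_zero
    intro b _
    rw [if_neg (by omega)]

theorem polyZinv_sub (p q : Polynomial ℂ) : polyZinv (p - q) = polyZinv p - polyZinv q := by
  ext n
  simp only [HahnSeries.coeff_sub, coeff_polyZinv]
  split_ifs <;> simp

/-- The matrix `q(z⁻¹) a`. -/
noncomputable def pmat (q : Polynomial ℂ) (a : Matrix ι κ ℂ) : LMat ι κ :=
  Matrix.of fun i j => polyZinv q * HahnSeries.single 0 (a i j)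

theorem cf_pmat (q : Polynomial ℂ) (a : Matrix ι κ ℂ) (n : ℤ) :
    cf (pmat q a) n = (polyZinv q).coeff n • a := by
  ext i j
  simp [cf, pmat, HahnSeries.coeff_mul_single]

theorem pmat_mul_mono (q : Polynomial ℂ) (a : Matrix ι κ ℂ) (b : Matrix κ τ ℂ) :
    pmat q a * mono 0 b = pmat q (a * b) := by
  apply cf_ext; intro n
  rw [cf_mul_mono, cf_pmat, cf_pmat, Matrix.smul_mul, sub_zero]

theorem mono_mul_pmat (q : Polynomial ℂ) (a : Matrix ι κ ℂ) (b : Matrix κ τ ℂ) :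
    mono 0 a * pmat q b = pmat q (a * b) := by
  apply cf_ext; intro n
  rw [cf_mono_mul, cf_pmat, cf_pmat, Matrix.mul_smul, sub_zero]

theorem pmat_one_comm (q : Polynomial ℂ) (M : LMat ι ι) : pmat q 1 * M = M * pmat q 1 := by
  have : pmat q (1 : Matrix ι ι ℂ) = Matrix.scalar ι (polyZinv q) := by
    ext i j : 2
    by_cases h : i = j <;> simp [pmat, h, Matrix.one_apply]
  rw [this]
  exact (Matrix.scalar_commute _ (fun _ => Commute.all _ _) M).eq

theorem pmat_mem_fil {q : Polynomial ℂ} {D : ℕ} (h : q.natDegree ≤ D) (a : Matrix ι κ ℂ) :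
    pmat q a ∈ Fil ι κ (-(D : ℤ)) := by
  intro n hn
  rw [cf_pmat, coeff_polyZinv, if_pos (by omega), Polynomial.coeff_eq_zero_of_natDegree_lt,
    zero_smul]
  omega

theorem pmat_sub (p q : Polynomial ℂ) (a : Matrix ι κ ℂ) :
    pmat (p - q) a = pmat p a - pmat q a := by
  apply cf_ext; intro n
  rw [cf_sub, cf_pmat, cf_pmat, cf_pmat, polyZinv_sub, HahnSeries.coeff_sub, sub_smul]

end Series
end HTL

namespace HTL
set_option linter.unusedSectionVars false

/-! ### Corners of a ring -/

section Corner

variable {R : Type*} [Ring R]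

/-- `x` lies in the corner `a R b`. -/
def Cor (a b x : R) : Prop := a * x = x ∧ x * b = x

theorem Cor.mul {a b c x y : R} (hx : Cor a b x) (hy : Cor b c y) : Cor a c (x * y) :=
  ⟨by rw [← mul_assoc, hx.1], by rw [mul_assoc, hy.2]⟩

theorem Cor.add {a b x y : R} (hx : Cor a b x) (hy : Cor a b y) : Cor a b (x + y) :=
  ⟨by rw [mul_add, hx.1, hy.1], by rw [add_mul, hx.2, hy.2]⟩

theorem Cor.neg {a b x : R} (hx : Cor a b x) : Cor a b (-x) :=
  ⟨by rw [mul_neg, hx.1], by rw [neg_mul, hx.2]⟩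

theorem Cor.sub {a b x y : R} (hx : Cor a b x) (hy : Cor a b y) : Cor a b (x - y) :=
  ⟨by rw [mul_sub, hx.1, hy.1], by rw [sub_mul, hx.2, hy.2]⟩

theorem Cor.zero {a b : R} : Cor a b 0 := ⟨mul_zero _, zero_mul _⟩

theorem Cor.mul_eq_zero {a b c d x y : R} (hx : Cor a b x) (hy : Cor c d y) (h : b * c = 0) :
    x * y = 0 := by
  rw [← hx.2, ← hy.1, mul_assoc, ← mul_assoc b, h, zero_mul, mul_zero]

theorem Cor.sum {β : Type*} {a b : R} {s : Finset β} {f : β → R} (h : ∀ i ∈ s, Cor a b (f i)) :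
    Cor a b (∑ i ∈ s, f i) :=
  ⟨by rw [Finset.mul_sum]; exact Finset.sum_congr rfl fun i hi => (h i hi).1,
   by rw [Finset.sum_mul]; exact Finset.sum_congr rfl fun i hi => (h i hi).2⟩

theorem Cor.of_mul {a b x : R} (ha : a * a = a) (hb : b * b = b) : Cor a b (a * x * b) :=
  ⟨by rw [← mul_assoc, ← mul_assoc, ha], by rw [mul_assoc, hb]⟩

theorem Cor.mono {a b a' b' x : R} (h : Cor a b x) (ha : a' * a = a) (hb : b * b' = b) :
    Cor a' b' x :=
  ⟨by rw [← h.1, ← mul_assoc, ha], by rw [← h.2, mul_assoc, hb]⟩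

theorem Cor.left_zero {a b c x : R} (h : Cor a b x) (hc : c * a = 0) : c * x = 0 := by
  rw [← h.1, ← mul_assoc, hc, zero_mul]

theorem Cor.right_zero {a b c x : R} (h : Cor a b x) (hc : b * c = 0) : x * c = 0 := by
  rw [← h.2, mul_assoc, hc, mul_zero]

end Corner

/-! ### Splitting trees -/

/-- Binary trees recording an iterated splitting of an index set. -/
inductive FTree (ι : Type) : Type
  | leaf (j : ι) : FTree ι
  | node (d : ℕ) (l r : FTree ι) : FTree ι

namespace FTree

variable {ι : Type} [DecidableEq ι]

/-- The labels of a tree. -/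
def leaves : FTree ι → Finset ι
  | leaf j => {j}
  | node _ l r => l.leaves ∪ r.leaves

/-- The sign recording on which side of their splitting two labels lie: `-1` if `j` is on the left
and `j'` on the right, `1` in the opposite case. -/
def sg : FTree ι → ι → ι → ℂ
  | leaf _, _, _ => 0
  | node _ l r, j, j' => (if j ∈ l.leaves ∧ j' ∈ r.leaves then -1 else 0) +
      (if j ∈ r.leaves ∧ j' ∈ l.leaves then 1 else 0) + l.sg j j' + r.sg j j'

/-- A tree is adapted to the exponents `q` if at every splitting the left exponents agree with a
common polynomial `s` up to degree `< d + 2`, from which the right ones differ in degree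
exactly `d + 2`. -/
def Valid (q : ι → Polynomial ℂ) : FTree ι → Prop
  | leaf _ => True
  | node d l r => l.Valid q ∧ r.Valid q ∧ Disjoint l.leaves r.leaves ∧
      ∃ s : Polynomial ℂ, (∀ j ∈ l.leaves, (q j - s).natDegree < d + 2) ∧
        ∀ j ∈ r.leaves, (q j - s).natDegree = d + 2

theorem leaves_nonempty : ∀ t : FTree ι, t.leaves.Nonempty
  | leaf j => Finset.singleton_nonempty j
  | node _ l _ => l.leaves_nonempty.mono Finset.subset_union_left

theorem natDegree_cross {q : ι → Polynomial ℂ} {d : ℕ} {s : Polynomial ℂ} {j j' : ι}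
    (h1 : (q j - s).natDegree < d + 2) (h2 : (q j' - s).natDegree = d + 2) :
    (q j - q j').natDegree = d + 2 ∧ (q j' - q j).natDegree = d + 2 := by
  have e : (q j' - q j).natDegree = d + 2 := by
    have : q j' - q j = (q j' - s) - (q j - s) := by ring
    rw [this, Polynomial.natDegree_sub_eq_left_of_natDegree_lt (by omega), h2]
  refine ⟨?_, e⟩
  rw [← neg_sub, Polynomial.natDegree_neg, e]

theorem exists_valid (q : ι → Polynomial ℂ) (s : Finset ι) (hs : s.Nonempty)
    (hq : ∀ i ∈ s, ∀ j ∈ s, i ≠ j → 2 ≤ (q i - q j).natDegree) :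
    ∃ t : FTree ι, t.leaves = s ∧ t.Valid q := by
  induction s using Finset.strongInduction with
  | H s ih =>
    by_cases hcard : ∃ j, s = {j}
    · obtain ⟨j, rfl⟩ := hcard
      exact ⟨leaf j, rfl, trivial⟩
    · obtain ⟨p, hp, hmax⟩ := Finset.exists_max_image (s ×ˢ s)
        (fun p => (q p.1 - q p.2).natDegree) (hs.product hs)
      obtain ⟨j0, j1⟩ := p
      rw [Finset.mem_product] at hp
      obtain ⟨h0, h1⟩ := hp
      simp only at h0 h1 hmax
      have hD : 2 ≤ (q j0 - q j1).natDegree := by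
        have : ∃ i ∈ s, i ≠ j0 := by
          by_contra! hc
          exact hcard ⟨j0, Finset.eq_singleton_iff_unique_mem.2 ⟨h0, hc⟩⟩
        obtain ⟨i, hi, hne⟩ := this
        exact (hq i hi j0 h0 hne).trans (hmax (i, j0) (Finset.mk_mem_product hi h0))
      obtain ⟨d, hd⟩ := Nat.exists_eq_add_of_le' hD
      rw [hd] at hmax
      set sl := s.filter fun j => (q j - q j0).natDegree < d + 2 with hsl
      set sr := s.filter fun j => ¬ (q j - q j0).natDegree < d + 2 with hsr
      have m0 : j0 ∈ sl := by simp [hsl, h0]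
      have m1 : j1 ∈ sr := by
        rw [hsr, Finset.mem_filter, ← neg_sub, Polynomial.natDegree_neg]
        exact ⟨h1, by omega⟩
      have dis : Disjoint sl sr := Finset.disjoint_filter_filter_not _ _ _
      have un : sl ∪ sr = s := Finset.filter_union_filter_not_eq _ _
      have ssl : sl ⊂ s := by
        refine Finset.ssubset_iff_subset_ne.2 ⟨Finset.filter_subset _ _, fun h => ?_⟩
        exact Finset.disjoint_left.1 dis (h ▸ h1) m1
      have ssr : sr ⊂ s := by
        refine Finset.ssubset_iff_subset_ne.2 ⟨Finset.filter_subset _ _, fun h => ?_⟩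
        exact Finset.disjoint_left.1 dis m0 (h ▸ h0)
      obtain ⟨l, hl, vl⟩ := ih sl ssl ⟨j0, m0⟩
        fun i hi j hj => hq i (ssl.1 hi) j (ssl.1 hj)
      obtain ⟨r, hr, vr⟩ := ih sr ssr ⟨j1, m1⟩
        fun i hi j hj => hq i (ssr.1 hi) j (ssr.1 hj)
      refine ⟨node d l r, by rw [leaves, hl, hr, un], vl, vr, by rw [hl, hr]; exact dis, q j0,
        ?_, ?_⟩
      · rw [hl]; intro j hj; exact (Finset.mem_filter.1 hj).2
      · rw [hr]; intro j hj
        obtain ⟨hj1, hj2⟩ := Finset.mem_filter.1 hj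
        have := hmax (j, j0) (Finset.mk_mem_product hj1 h0)
        simp only at this
        omega

theorem sg_eq_zero_left {t : FTree ι} {j j' : ι} (h : j ∉ t.leaves) : t.sg j j' = 0 := by
  induction t with
  | leaf => rfl
  | node d l r ihl ihr =>
    simp only [leaves, Finset.mem_union, not_or] at h
    simp [sg, h.1, h.2, ihl h.1, ihr h.2]

theorem sg_swap (t : FTree ι) (j j' : ι) : t.sg j' j = -t.sg j j' := by
  induction t with
  | leaf => simp [sg]
  | node d l r ihl ihr =>
    simp only [sg, ihl, ihr, and_comm (a := j' ∈ _)]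
    split_ifs <;> ring

theorem sg_eq_zero_right {t : FTree ι} {j j' : ι} (h : j' ∉ t.leaves) : t.sg j j' = 0 := by
  rw [sg_swap, sg_eq_zero_left h, neg_zero]

theorem sg_mul_self {q : ι → Polynomial ℂ} {t : FTree ι} (ht : t.Valid q) {j j' : ι}
    (hj : j ∈ t.leaves) (hj' : j' ∈ t.leaves) (hne : j ≠ j') : t.sg j j' * t.sg j j' = 1 := by
  induction t with
  | leaf i =>
    simp only [leaves, Finset.mem_singleton] at hj hj'
    exact (hne (hj.trans hj'.symm)).elim
  | node d l r ihl ihr =>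
    simp only [leaves, Finset.mem_union] at hj hj'
    obtain ⟨vl, vr, dis, -⟩ := ht
    have d1 := fun i (h : i ∈ l.leaves) => Finset.disjoint_left.1 dis h
    have d2 := fun i (h : i ∈ r.leaves) => Finset.disjoint_right.1 dis h
    rcases hj with hj | hj <;> rcases hj' with hj' | hj'
    · simp [sg, hj, hj', d1 _ hj, d1 _ hj', sg_eq_zero_left (d1 _ hj), ihl vl hj hj']
    · simp [sg, hj, hj', d1 _ hj, d2 _ hj', sg_eq_zero_left (d1 _ hj), sg_eq_zero_right (d2 _ hj')]
    · simp [sg, hj, hj', d2 _ hj, d1 _ hj', sg_eq_zero_right (d1 _ hj'), sg_eq_zero_left (d2 _ hj)]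
    · simp [sg, hj, hj', d2 _ hj, d2 _ hj', sg_eq_zero_left (d2 _ hj), ihr vr hj hj']

end FTree
end HTL

namespace HTL
set_option linter.unusedSectionVars false
set_option linter.unusedSimpArgs false

/-! ### Block idempotents and the local normal form -/

section Normal

variable {ι S : Type} [DecidableEq ι] [Fintype S] [DecidableEq S]

/-- A family of orthogonal idempotents. -/
def Orth {R : Type*} [Ring R] (e : ι → R) : Prop := ∀ i j, e i * e j = if i = j then e i else 0

/-- The sum of the idempotents labelled by `s`. -/
noncomputable def idem (e : ι → Matrix S S ℂ) (s : Finset ι) : Matrix S S ℂ := ∑ j ∈ s, e j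

/-- The constant series `idem e s`. -/
noncomputable def EE (e : ι → Matrix S S ℂ) (s : Finset ι) : LMat S S := mono 0 (idem e s)

/-- The strictly lower triangular part built from `X`. -/
noncomputable def lowr (e : ι → Matrix S S ℂ) (X : ℕ → Matrix S S ℂ) (d : ℕ) (s t : Finset ι) :
    LMat S S :=
  ∑ k ∈ Finset.range d, mono ((k : ℤ) + 1) (idem e t * X k * idem e s)

/-- The strictly upper triangular part built from `X`. -/
noncomputable def uppr (e : ι → Matrix S S ℂ) (X : ℕ → Matrix S S ℂ) (d : ℕ) (s t : Finset ι) :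
    LMat S S :=
  ∑ k ∈ Finset.range d, mono (-((k : ℤ) + 2)) (idem e s * X k * idem e t)

/-- The parametrized normal form: iterated conjugates of block triangular matrices. -/
noncomputable def FF (e : ι → Matrix S S ℂ) (q : ι → Polynomial ℂ) (X : ℕ → Matrix S S ℂ)
    (N : Matrix S S ℂ) : FTree ι → LMat S S
  | .leaf j => pmat (q j) (e j) + mono (-1) (e j * N * e j)
  | .node d l r => (1 + lowr e X d l.leaves r.leaves) *
      (FF e q X N l + FF e q X N r + uppr e X d l.leaves r.leaves) *
      (1 - lowr e X d l.leaves r.leaves)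

/-- The block diagonal normal form. -/
noncomputable def BB (e : ι → Matrix S S ℂ) (q : ι → Polynomial ℂ) (N : Matrix S S ℂ)
    (s : Finset ι) : LMat S S :=
  ∑ j ∈ s, (pmat (q j) (e j) + mono (-1) (e j * N * e j))

variable {e : ι → Matrix S S ℂ} {q : ι → Polynomial ℂ}

theorem pmat_add (q : Polynomial ℂ) (a b : Matrix S S ℂ) :
    pmat q (a + b) = pmat q a + pmat q b := by
  apply cf_ext; intro n; simp [cf_pmat]

theorem pmat_sum {β : Type*} (q : Polynomial ℂ) (s : Finset β) (f : β → Matrix S S ℂ) :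
    pmat q (∑ b ∈ s, f b) = ∑ b ∈ s, pmat q (f b) := by
  apply cf_ext; intro n; simp [cf_pmat, Finset.smul_sum]

theorem pmat_eq (q : Polynomial ℂ) (a : Matrix S S ℂ) : pmat q a = pmat q 1 * mono 0 a := by
  rw [pmat_mul_mono, Matrix.one_mul]

theorem cor_mono {a b c : Matrix S S ℂ} (h : Cor a b c) (k : ℤ) :
    Cor (mono 0 a) (mono 0 b) (mono k c) := by
  constructor <;> rw [mono_mul_mono]
  · rw [h.1, zero_add]
  · rw [h.2, add_zero]

theorem cor_pmat {a b c : Matrix S S ℂ} (h : Cor a b c) (q : Polynomial ℂ) :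
    Cor (mono 0 a) (mono 0 b) (pmat q c) := by
  constructor
  · rw [mono_mul_pmat, h.1]
  · rw [pmat_mul_mono, h.2]

theorem cor_cf {a b : Matrix S S ℂ} {M : LMat S S} (h : Cor (mono 0 a) (mono 0 b) M) (n : ℤ) :
    Cor a b (cf M n) := by
  constructor
  · have := congrArg (cf · n) h.1
    simpa using this
  · have := congrArg (cf · n) h.2
    simpa using this

section Idem

variable (he : Orth e)
include he

theorem idem_mul_e (s : Finset ι) (j : ι) : idem e s * e j = if j ∈ s then e j else 0 := by
  simp only [idem, Finset.sum_mul, he _ j]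
  rw [Finset.sum_ite_eq' s j]

theorem e_mul_idem (s : Finset ι) (j : ι) : e j * idem e s = if j ∈ s then e j else 0 := by
  simp only [idem, Finset.mul_sum, he j]
  rw [Finset.sum_ite_eq s j]

theorem idem_mul (s t : Finset ι) : idem e s * idem e t = idem e (s ∩ t) := by
  conv_lhs => rw [idem, Finset.sum_mul]
  simp only [e_mul_idem he]
  rw [idem, Finset.sum_ite_mem]

theorem idem_self (s : Finset ι) : idem e s * idem e s = idem e s := by
  rw [idem_mul he, Finset.inter_self]

theorem EE_mul (s t : Finset ι) : EE e s * EE e t = EE e (s ∩ t) := by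
  rw [EE, EE, mono_mul_mono, idem_mul he]; rfl

theorem EE_self (s : Finset ι) : EE e s * EE e s = EE e s := by
  rw [EE_mul he, Finset.inter_self]

theorem EE_disj {s t : Finset ι} (h : Disjoint s t) : EE e s * EE e t = 0 := by
  rw [EE_mul he, Finset.disjoint_iff_inter_eq_empty.1 h]; simp [EE, idem]

theorem EE_left {s t : Finset ι} (h : s ⊆ t) : EE e t * EE e s = EE e s := by
  rw [EE_mul he, Finset.inter_eq_right.2 h]

theorem EE_right {s t : Finset ι} (h : s ⊆ t) : EE e s * EE e t = EE e s := by
  rw [EE_mul he, Finset.inter_eq_left.2 h]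

end Idem

theorem EE_mem (s : Finset ι) : EE e s ∈ Fil S S 0 := mono_mem_fil le_rfl _

theorem EE_union {s t : Finset ι} (h : Disjoint s t) : EE e (s ∪ t) = EE e s + EE e t := by
  rw [EE, idem, Finset.sum_union h, mono_add]; rfl

variable (he : Orth e)
include he

theorem cor_lowr (X : ℕ → Matrix S S ℂ) (d : ℕ) (s t : Finset ι) :
    Cor (EE e t) (EE e s) (lowr e X d s t) :=
  Cor.sum fun _ _ => cor_mono (Cor.of_mul (idem_self he t) (idem_self he s)) _

theorem cor_uppr (X : ℕ → Matrix S S ℂ) (d : ℕ) (s t : Finset ι) :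
    Cor (EE e s) (EE e t) (uppr e X d s t) :=
  Cor.sum fun _ _ => cor_mono (Cor.of_mul (idem_self he s) (idem_self he t)) _

omit he

theorem lowr_mem (X : ℕ → Matrix S S ℂ) (d : ℕ) (s t : Finset ι) :
    lowr e X d s t ∈ Fil S S 1 :=
  sum_mem fun k _ => mono_mem_fil (by omega) _

theorem uppr_mem (X : ℕ → Matrix S S ℂ) (d : ℕ) (s t : Finset ι) :
    uppr e X d s t ∈ Fil S S (-((d : ℤ) + 1)) :=
  sum_mem fun k hk => mono_mem_fil (by have := Finset.mem_range.1 hk; omega) _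

theorem cf_lowr (X : ℕ → Matrix S S ℂ) (d : ℕ) (s t : Finset ι) {k : ℕ} (hk : k < d) :
    cf (lowr e X d s t) ((k : ℤ) + 1) = idem e t * X k * idem e s := by
  rw [lowr, cf_sum, Finset.sum_eq_single k]
  · rw [cf_mono, if_pos rfl]
  · intro b _ hb
    rw [cf_mono, if_neg (by omega)]
  · intro h; simp [hk] at h

theorem cf_uppr (X : ℕ → Matrix S S ℂ) (d : ℕ) (s t : Finset ι) {k : ℕ} (hk : k < d) :
    cf (uppr e X d s t) (-((k : ℤ) + 2)) = idem e s * X k * idem e t := by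
  rw [uppr, cf_sum, Finset.sum_eq_single k]
  · rw [cf_mono, if_pos rfl]
  · intro b _ hb
    rw [cf_mono, if_neg (by omega)]
  · intro h; simp [hk] at h

theorem cf_lowr_of_lt (X : ℕ → Matrix S S ℂ) (d : ℕ) (s t : Finset ι) {n : ℤ} (hn : d < n) :
    cf (lowr e X d s t) n = 0 := by
  rw [lowr, cf_sum]
  refine Finset.sum_eq_zero fun k hk => ?_
  have := Finset.mem_range.1 hk
  rw [cf_mono, if_neg (by omega)]

theorem cf_uppr_of_lt (X : ℕ → Matrix S S ℂ) (d : ℕ) (s t : Finset ι) {n : ℤ} (hn : -2 < n) :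
    cf (uppr e X d s t) n = 0 := by
  rw [uppr, cf_sum]
  refine Finset.sum_eq_zero fun k hk => ?_
  rw [cf_mono, if_neg (by omega)]

include he

theorem cor_FF (X : ℕ → Matrix S S ℂ) (N : Matrix S S ℂ) (t : FTree ι) :
    Cor (EE e t.leaves) (EE e t.leaves) (FF e q X N t) := by
  have hs : ∀ j, e j * e j = e j := fun j => by rw [he, if_pos rfl]
  induction t with
  | leaf j =>
    have : EE e {j} = mono 0 (e j) := by simp [EE, idem]
    simp only [FTree.leaves, this, FF]
    exact (cor_pmat ⟨hs j, hs j⟩ _).add (cor_mono (Cor.of_mul (hs j) (hs j)) _)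
  | node d l r ihl ihr =>
    have hl : l.leaves ⊆ l.leaves ∪ r.leaves := Finset.subset_union_left
    have hr : r.leaves ⊆ l.leaves ∪ r.leaves := Finset.subset_union_right
    have cL := (cor_lowr he X d l.leaves r.leaves).mono (EE_left he hr) (EE_right he hl)
    have cP := (cor_uppr he X d l.leaves r.leaves).mono (EE_left he hl) (EE_right he hr)
    have c1 := ((ihl.mono (EE_left he hl) (EE_right he hl)).add
      (ihr.mono (EE_left he hr) (EE_right he hr))).add cP
    simp only [FTree.leaves, FF]
    rw [add_mul, one_mul, mul_sub, mul_one]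
    have c2 := c1.add (cL.mul c1)
    exact c2.sub (c2.mul cL)

theorem cor_BB (N : Matrix S S ℂ) (s : Finset ι) : Cor (EE e s) (EE e s) (BB e q N s) := by
  have hs : ∀ j, e j * e j = e j := fun j => by rw [he, if_pos rfl]
  refine Cor.sum fun j hj => Cor.add ?_ ?_
  · exact cor_pmat ⟨by rw [idem_mul_e he, if_pos hj], by rw [e_mul_idem he, if_pos hj]⟩ _
  · refine cor_mono ((Cor.of_mul (hs j) (hs j)).mono ?_ ?_) _
    · rw [idem_mul_e he, if_pos hj]
    · rw [e_mul_idem he, if_pos hj]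

omit he in
theorem conj_sub_mem {D k : ℤ} {L A σ : LMat S S} (hk : 0 ≤ k) (hL : L ∈ Fil S S k)
    (hLL : L * L = 0) (hA : A - σ ∈ Fil S S (-D)) (hσ : σ * L = L * σ) :
    (1 + L) * A * (1 - L) - A ∈ Fil S S (k - D) := by
  have : (1 + L) * A * (1 - L) - A = L * (A - σ) - (A - σ) * L - L * (A - σ) * L := by
    linear_combination (norm := skip) -hσ - L * hσ - hLL * σ
    simp only [mul_add, add_mul, mul_sub, sub_mul, mul_one, one_mul, mul_assoc, zero_mul]
    abel
  rw [this]
  exact sub_mem (sub_mem (mul_mem_fil' hL hA (by omega)) (mul_mem_fil' hA hL (by omega)))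
    (mul_mem_fil' (mul_mem_fil hL hA) hL (by omega))

omit he in
theorem pmat_comm_cor {s : Finset ι} (p : Polynomial ℂ) {L : LMat S S}
    (hL : Cor (EE e s) (EE e s) L) : pmat p (idem e s) * L = L * pmat p (idem e s) := by
  have h1 : mono 0 (idem e s) * L = L := hL.1
  have h2 : L * mono 0 (idem e s) = L := hL.2
  rw [pmat_eq, mul_assoc, h1, pmat_one_comm, ← mul_assoc, ← pmat_one_comm p L, mul_assoc, h2]

omit he in
theorem leaf_sub_pmat (D : ℕ) (s : Finset ι) (p : Polynomial ℂ)
    (h : ∀ j ∈ s, (q j - p).natDegree ≤ D) :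
    ∑ j ∈ s, pmat (q j) (e j) - pmat p (idem e s) ∈ Fil S S (-D) := by
  rw [idem, pmat_sum, ← Finset.sum_sub_distrib]
  refine sum_mem fun j hj => ?_
  rw [← pmat_sub]
  exact pmat_mem_fil (h j hj) _

theorem FF_top (X : ℕ → Matrix S S ℂ) (N : Matrix S S ℂ) {t : FTree ι} (ht : t.Valid q) {D : ℕ}
    (hD : 2 ≤ D) (h : ∀ j ∈ t.leaves, ∀ j' ∈ t.leaves, (q j - q j').natDegree ≤ D) :
    FF e q X N t - ∑ j ∈ t.leaves, pmat (q j) (e j) ∈ Fil S S (1 - D) := by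
  induction t with
  | leaf j =>
    simp only [FF, FTree.leaves, Finset.sum_singleton, add_sub_cancel_left]
    exact mono_mem_fil (by omega) _
  | node d l r ihl ihr =>
    obtain ⟨vl, vr, dis, s, hsl, hsr⟩ := ht
    have hl : l.leaves ⊆ l.leaves ∪ r.leaves := Finset.subset_union_left
    have hr : r.leaves ⊆ l.leaves ∪ r.leaves := Finset.subset_union_right
    obtain ⟨j0, hj0⟩ := l.leaves_nonempty
    obtain ⟨j1, hj1⟩ := r.leaves_nonempty
    have hd : d + 2 ≤ D := by
      rw [← (FTree.natDegree_cross (hsl j0 hj0) (hsr j1 hj1)).1]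
      exact h j0 (hl hj0) j1 (hr hj1)
    have il := ihl vl fun j hj j' hj' => h j (hl hj) j' (hl hj')
    have ir := ihr vr fun j hj j' hj' => h j (hr hj) j' (hr hj')
    simp only [FTree.leaves] at h ⊢
    rw [FF]
    set L := lowr e X d l.leaves r.leaves with hL
    set P := uppr e X d l.leaves r.leaves with hP
    have cL := cor_lowr he X d l.leaves r.leaves
    rw [← hL] at cL
    have hA : FF e q X N l + FF e q X N r + P -
        ∑ j ∈ l.leaves ∪ r.leaves, pmat (q j) (e j) ∈ Fil S S (1 - D) := by
      rw [Finset.sum_union dis]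
      have : P ∈ Fil S S (1 - D) := fil_mono (by omega) (uppr_mem X d l.leaves r.leaves)
      convert add_mem (add_mem il ir) this using 1
      abel
    have hA' : FF e q X N l + FF e q X N r + P - pmat (q j0) (idem e (l.leaves ∪ r.leaves))
        ∈ Fil S S (-D) := by
      have := add_mem (fil_mono (by omega) hA) (leaf_sub_pmat (e := e) D (l.leaves ∪ r.leaves)
        (q j0) fun j hj => h j hj j0 (hl hj0))
      simpa using this
    have hc := conj_sub_mem (k := 1) (by omega) (lowr_mem X d l.leaves r.leaves)
      (cL.mul_eq_zero cL (EE_disj he dis)) hA'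
      (pmat_comm_cor (q j0) (cL.mono (EE_left he hr) (EE_right he hl)))
    have := add_mem hc hA
    simpa using this

/-- The leading coefficient of the right-hand block at a splitting. -/
noncomputable def lead (e : ι → Matrix S S ℂ) (q : ι → Polynomial ℂ) (p : Polynomial ℂ) (d : ℕ)
    (s : Finset ι) : Matrix S S ℂ :=
  ∑ j ∈ s, (q j - p).coeff (d + 2) • e j

omit he in
theorem natDegree_sub_le_of_sub {p : Polynomial ℂ} {D : ℕ} {j j' : ι}
    (h : (q j - p).natDegree ≤ D) (h' : (q j' - p).natDegree ≤ D) :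
    (q j - q j').natDegree ≤ D := by
  rw [show q j - q j' = (q j - p) - (q j' - p) by ring]
  exact (Polynomial.natDegree_sub_le _ _).trans (max_le h h')

theorem FF_left (X : ℕ → Matrix S S ℂ) (N : Matrix S S ℂ) {l : FTree ι} (vl : l.Valid q)
    {p : Polynomial ℂ} {d : ℕ} (hl : ∀ j ∈ l.leaves, (q j - p).natDegree < d + 2) :
    FF e q X N l - pmat p (idem e l.leaves) ∈ Fil S S (-((d : ℤ) + 1)) := by
  have h1 := FF_top he X N vl (D := d + 2) (by omega) fun j hj j' hj' =>
    natDegree_sub_le_of_sub (hl j hj).le (hl j' hj').le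
  have h2 := leaf_sub_pmat (e := e) (d + 1) l.leaves p fun j hj => Nat.lt_succ_iff.1 (hl j hj)
  have := add_mem (fil_mono (l := -((d : ℤ) + 1)) (by omega) h1) (fil_mono (by omega) h2)
  simpa using this

theorem FF_right (X : ℕ → Matrix S S ℂ) (N : Matrix S S ℂ) {r : FTree ι} (vr : r.Valid q)
    {p : Polynomial ℂ} {d : ℕ} (hr : ∀ j ∈ r.leaves, (q j - p).natDegree = d + 2) :
    FF e q X N r - pmat p (idem e r.leaves) - mono (-((d : ℤ) + 2)) (lead e q p d r.leaves)
      ∈ Fil S S (-((d : ℤ) + 1)) := by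
  have h1 := FF_top he X N vr (D := d + 2) (by omega) fun j hj j' hj' =>
    natDegree_sub_le_of_sub (hr j hj).le (hr j' hj').le
  have h2 : ∑ j ∈ r.leaves, pmat (q j) (e j) - pmat p (idem e r.leaves) -
      mono (-((d : ℤ) + 2)) (lead e q p d r.leaves) ∈ Fil S S (-((d : ℤ) + 1)) := by
    rw [idem, pmat_sum, lead, mono_sum, ← Finset.sum_sub_distrib, ← Finset.sum_sub_distrib]
    refine sum_mem fun j hj n hn => ?_
    rw [← pmat_sub, cf_sub, cf_pmat, cf_mono, coeff_polyZinv, if_pos (by omega)]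
    by_cases h : n = -((d : ℤ) + 2)
    · rw [if_pos h, h, show (-(-((d : ℤ) + 2))).toNat = d + 2 by omega, sub_self]
    · rw [if_neg h, Polynomial.coeff_eq_zero_of_natDegree_lt, zero_smul, sub_zero]
      rw [hr j hj]; omega
  have := add_mem (fil_mono (l := -((d : ℤ) + 1)) (by omega) h1) h2
  convert this using 1
  abel

omit he in
theorem cf_uppr_mul_lowr (X : ℕ → Matrix S S ℂ) (d : ℕ) (s t : Finset ι) :
    cf (uppr e X d s t * lowr e X d s t) (-1) = ∑ k ∈ Finset.range d,
      (idem e s * X k * idem e t) * (idem e t * X k * idem e s) := by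
  rw [uppr, Finset.sum_mul, cf_sum]
  refine Finset.sum_congr rfl fun k hk => ?_
  rw [cf_mono_mul, show (-1 : ℤ) - (-((k : ℤ) + 2)) = k + 1 by ring,
    cf_lowr X d s t (Finset.mem_range.1 hk)]

omit he in
theorem cf_lowr_mul_uppr (X : ℕ → Matrix S S ℂ) (d : ℕ) (s t : Finset ι) :
    cf (lowr e X d s t * uppr e X d s t) (-1) = ∑ k ∈ Finset.range d,
      (idem e t * X k * idem e s) * (idem e s * X k * idem e t) := by
  rw [lowr, Finset.sum_mul, cf_sum]
  refine Finset.sum_congr rfl fun k hk => ?_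
  rw [cf_mono_mul, show (-1 : ℤ) - ((k : ℤ) + 1) = -(k + 2) by ring,
    cf_uppr X d s t (Finset.mem_range.1 hk)]

theorem block_sq (X : Matrix S S ℂ) {s t : Finset ι} {j : ι} (hj : j ∈ s) :
    e j * ((idem e s * X * idem e t) * (idem e t * X * idem e s)) * e j =
      ∑ j' ∈ t, e j * X * e j' * X * e j := by
  have h1 : e j * idem e s = e j := by rw [e_mul_idem he, if_pos hj]
  have h2 : idem e s * e j = e j := by rw [idem_mul_e he, if_pos hj]
  have h3 := idem_self he t
  have : e j * ((idem e s * X * idem e t) * (idem e t * X * idem e s)) * e j =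
      (e j * idem e s) * X * (idem e t * idem e t) * X * (idem e s * e j) := by
    simp only [mul_assoc]
  rw [this, h1, h2, h3, idem, Finset.mul_sum, Finset.sum_mul, Finset.sum_mul]

/-- The diagonal blocks of the residue of the normal form. -/
theorem cf_FF_diag (h1 : ∀ j, (q j).coeff 1 = 0) (X : ℕ → Matrix S S ℂ) (N : Matrix S S ℂ)
    {t : FTree ι} (ht : t.Valid q) {j : ι} (hj : j ∈ t.leaves) :
    e j * cf (FF e q X N t) (-1) * e j = e j * N * e j + ∑ j' ∈ t.leaves, t.sg j j' •
      ∑ k ∈ Finset.range ((q j - q j').natDegree - 2), e j * X k * e j' * X k * e j := by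
  have hs : e j * e j = e j := by rw [he, if_pos rfl]
  induction t with
  | leaf i =>
    obtain rfl : j = i := by simpa [FTree.leaves] using hj
    simp only [FF, FTree.sg, zero_smul, Finset.sum_const_zero, add_zero, cf_add, cf_pmat,
      cf_mono, if_true, coeff_polyZinv]
    simp [h1, ← mul_assoc, hs]
    simp [mul_assoc, hs]
  | node d l r ihl ihr =>
    obtain ⟨vl, vr, dis, s, hsl, hsr⟩ := ht
    have cL := cor_lowr he X d l.leaves r.leaves
    have cP := cor_uppr he X d l.leaves r.leaves
    have cl := cor_FF he (q := q) X N l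
    have cr := cor_FF he (q := q) X N r
    have drl := EE_disj he dis.symm
    have dlr := EE_disj he dis
    simp only [FTree.leaves, Finset.mem_union] at hj ⊢
    rw [Finset.sum_union dis, FF]
    simp only [FTree.sg]
    have cfe : ∀ M : LMat S S, e j * cf M (-1) * e j = cf (mono 0 (e j) * M * mono 0 (e j)) (-1) :=
      fun M => by simp
    set L := lowr e X d l.leaves r.leaves with hL
    set P := uppr e X d l.leaves r.leaves with hP
    have d1 := fun i (h : i ∈ l.leaves) => Finset.disjoint_left.1 dis h
    have d2 := fun i (h : i ∈ r.leaves) => Finset.disjoint_right.1 dis h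
    have lL := cl.mul_eq_zero cL dlr
    have LL := cL.mul_eq_zero cL dlr
    rcases hj with hj | hj
    · have z : ∀ {b : LMat S S} {x}, Cor (EE e r.leaves) b x → mono 0 (e j) * x = 0 := fun h =>
        h.left_zero (by rw [EE, mono_mul_mono, e_mul_idem he, if_neg (d1 _ hj), mono_zero])
      have z' : ∀ {b : LMat S S} {x}, Cor b (EE e r.leaves) x → x * mono 0 (e j) = 0 := fun h =>
        h.right_zero (by rw [EE, mono_mul_mono, idem_mul_e he, if_neg (d1 _ hj), mono_zero])
      have key : mono 0 (e j) * ((1 + L) * (FF e q X N l + FF e q X N r + P) * (1 - L)) *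
          mono 0 (e j) = mono 0 (e j) * FF e q X N l * mono 0 (e j) -
          mono 0 (e j) * (P * L) * mono 0 (e j) := by
        linear_combination (norm := skip) z cL * ((FF e q X N l + FF e q X N r + P) * (1 - L) *
          mono 0 (e j)) + z cr * ((1 - L) * mono 0 (e j)) + mono 0 (e j) * z' cP -
          mono 0 (e j) * lL * mono 0 (e j)
        simp only [mul_add, add_mul, mul_sub, sub_mul, mul_one, one_mul, mul_assoc, zero_mul,
          mul_zero]
        abel
      rw [cfe, key, cf_sub, ← cfe, ← cfe, ihl vl hj, add_sub_assoc, add_right_inj, sub_eq_add_neg,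
        hP, hL, cf_uppr_mul_lowr]
      congr 1
      · refine Finset.sum_congr rfl fun j' hj' => ?_
        simp [d1 _ hj, d1 _ hj', FTree.sg_eq_zero_left (d1 _ hj)]
      · rw [Finset.mul_sum, Finset.sum_mul, ← Finset.sum_neg_distrib]
        simp only [block_sq he _ hj]
        rw [Finset.sum_neg_distrib, Finset.sum_comm, ← Finset.sum_neg_distrib]
        refine Finset.sum_congr rfl fun j' hj' => ?_
        rw [(FTree.natDegree_cross (hsl j hj) (hsr j' hj')).1]
        simp [d1 _ hj, d2 _ hj', hj, hj', FTree.sg_eq_zero_left (d1 _ hj),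
          FTree.sg_eq_zero_right (d2 _ hj')]
    · have z : ∀ {b : LMat S S} {x}, Cor (EE e l.leaves) b x → mono 0 (e j) * x = 0 := fun h =>
        h.left_zero (by rw [EE, mono_mul_mono, e_mul_idem he, if_neg (d2 _ hj), mono_zero])
      have z' : ∀ {b : LMat S S} {x}, Cor b (EE e l.leaves) x → x * mono 0 (e j) = 0 := fun h =>
        h.right_zero (by rw [EE, mono_mul_mono, idem_mul_e he, if_neg (d2 _ hj), mono_zero])
      have key : mono 0 (e j) * ((1 + L) * (FF e q X N l + FF e q X N r + P) * (1 - L)) *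
          mono 0 (e j) = mono 0 (e j) * FF e q X N r * mono 0 (e j) +
          mono 0 (e j) * (L * P) * mono 0 (e j) := by
        linear_combination (norm := skip) mono 0 (e j) * (1 + L) * z' cl - mono 0 (e j) * (1 + L) *
          (FF e q X N l + FF e q X N r + P) * z' cL
          + z cP * mono 0 (e j) + mono 0 (e j) * cL.mul_eq_zero cr dlr * mono 0 (e j)
        simp only [mul_add, add_mul, mul_sub, sub_mul, mul_one, one_mul, mul_assoc, zero_mul,
          mul_zero, neg_mul]
        abel
      rw [cfe, key, cf_add, ← cfe, ← cfe, ihr vr hj, add_assoc, add_right_inj, add_comm,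
        hP, hL, cf_lowr_mul_uppr]
      congr 1
      · rw [Finset.mul_sum, Finset.sum_mul]
        simp only [block_sq he _ hj]
        rw [Finset.sum_comm]
        refine Finset.sum_congr rfl fun j' hj' => ?_
        rw [(FTree.natDegree_cross (hsl j' hj') (hsr j hj)).2]
        simp [d2 _ hj, d1 _ hj', hj, hj', FTree.sg_eq_zero_left (d2 _ hj),
          FTree.sg_eq_zero_right (d1 _ hj')]
      · refine Finset.sum_congr rfl fun j' hj' => ?_
        simp [d2 _ hj, d2 _ hj', FTree.sg_eq_zero_left (d2 _ hj)]

end Normal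
end HTL

namespace HTL
set_option linter.unusedSectionVars false
set_option linter.unusedSimpArgs false

/-! ### Transport of linear conditions through the normal form -/

section Transport

variable {ι S : Type} [DecidableEq ι] [Fintype S] [DecidableEq S]
  {e : ι → Matrix S S ℂ} {q : ι → Polynomial ℂ}
  (ρ : Subalgebra ℂ (Matrix S S ℂ × Matrix S S ℂ))

theorem prod_mk_sum {β M N : Type*} [AddCommMonoid M] [AddCommMonoid N] (s : Finset β)
    (f : β → M) (g : β → N) : (∑ b ∈ s, f b, ∑ b ∈ s, g b) = ∑ b ∈ s, (f b, g b) :=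
  Prod.ext (by simp [Prod.fst_sum]) (by simp [Prod.snd_sum])

/-- The pairs of coefficients of order at most `m` lie in `ρ`. -/
def RC (m : ℤ) (A A' : LMat S S) : Prop := ∀ n ≤ m, (cf A n, cf A' n) ∈ ρ

variable {ρ}

theorem RC.add {m : ℤ} {A A' B B' : LMat S S} (h : RC ρ m A A') (h' : RC ρ m B B') :
    RC ρ m (A + B) (A' + B') := fun n hn => by
  rw [cf_add, cf_add]; exact ρ.add_mem (h n hn) (h' n hn)

theorem RC.sub {m : ℤ} {A A' B B' : LMat S S} (h : RC ρ m A A') (h' : RC ρ m B B') :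
    RC ρ m (A - B) (A' - B') := fun n hn => by
  rw [cf_sub, cf_sub]; exact ρ.sub_mem (h n hn) (h' n hn)

theorem RC.mono {m m' : ℤ} {A A' : LMat S S} (h : RC ρ m A A') (hm : m' ≤ m) : RC ρ m' A A' :=
  fun n hn => h n (hn.trans hm)

theorem RC.mul {a b m m' k : ℤ} {A A' B B' : LMat S S} (hA : A ∈ Fil S S a) (hA' : A' ∈ Fil S S a)
    (hB : B ∈ Fil S S b) (hB' : B' ∈ Fil S S b) (h : RC ρ m A A') (h' : RC ρ m' B B')
    (hk : k ≤ m + b) (hk' : k ≤ m' + a) : RC ρ k (A * B) (A' * B') := by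
  intro n hn
  rw [cf_mul hA hB, cf_mul hA' hB']
  rw [show (∑ i ∈ Finset.Ico a (n - b + 1), cf A i * cf B (n - i),
      ∑ i ∈ Finset.Ico a (n - b + 1), cf A' i * cf B' (n - i)) =
      ∑ i ∈ Finset.Ico a (n - b + 1), (cf A i, cf A' i) * (cf B (n - i), cf B' (n - i)) by
    simp only [Prod.mk_mul_mk, prod_mk_sum]]
  refine ρ.sum_mem fun i hi => ρ.mul_mem (h _ ?_) (h' _ ?_)
  all_goals simp only [Finset.mem_Ico] at hi; omega

theorem RC.all_mul {A A' B B' : LMat S S} (h : ∀ m, RC ρ m A A') (h' : ∀ m, RC ρ m B B') (m : ℤ) :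
    RC ρ m (A * B) (A' * B') := by
  obtain ⟨a, ha⟩ := exists_fil A
  obtain ⟨a', ha'⟩ := exists_fil A'
  obtain ⟨b, hb⟩ := exists_fil B
  obtain ⟨b', hb'⟩ := exists_fil B'
  exact RC.mul (fil_mono (min_le_left a a') ha) (fil_mono (min_le_right a a') ha')
    (fil_mono (min_le_left b b') hb) (fil_mono (min_le_right b b') hb') (h (m - min b b'))
    (h' (m - min a a')) (by omega) (by omega)

theorem RC.mono_of {a a' : Matrix S S ℂ} (h : (a, a') ∈ ρ) (k m : ℤ) :
    RC ρ m (HTL.mono k a) (HTL.mono k a') := by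
  intro n _
  rw [cf_mono, cf_mono]
  split_ifs
  · exact h
  · exact ρ.zero_mem

theorem RC.pmat_of {a a' : Matrix S S ℂ} (h : (a, a') ∈ ρ) (p : Polynomial ℂ) (m : ℤ) :
    RC ρ m (pmat p a) (pmat p a') := by
  intro n _
  rw [cf_pmat, cf_pmat]
  exact ρ.smul_mem h ((polyZinv p).coeff n)

theorem RC.sum {β : Type*} {s : Finset β} {f f' : β → LMat S S} {m : ℤ}
    (h : ∀ b ∈ s, RC ρ m (f b) (f' b)) : RC ρ m (∑ b ∈ s, f b) (∑ b ∈ s, f' b) := by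
  intro n hn
  rw [cf_sum, cf_sum, prod_mk_sum]
  exact ρ.sum_mem fun b hb => h b hb n hn

theorem RC.one (m : ℤ) : RC ρ m (1 : LMat S S) 1 := by
  rw [← mono_one]; exact RC.mono_of ρ.one_mem _ _

theorem idem_block_mem {X X' : Matrix S S ℂ} {s t : Finset ι}
    (h : ∀ j ∈ s, ∀ j' ∈ t, (e j * X * e j', e j * X' * e j') ∈ ρ) :
    (idem e s * X * idem e t, idem e s * X' * idem e t) ∈ ρ := by
  have : ∀ X : Matrix S S ℂ, idem e s * X * idem e t = ∑ j ∈ s, ∑ j' ∈ t, e j * X * e j' := by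
    intro X
    rw [idem, idem, Finset.sum_mul, Finset.sum_mul]
    simp only [Finset.mul_sum]
  rw [this, this, prod_mk_sum]
  refine ρ.sum_mem fun j hj => ?_
  rw [prod_mk_sum]
  exact ρ.sum_mem fun j' hj' => h j hj j' hj'

/-- The normal form satisfies every linear condition closed under products that its parameters
satisfy. -/
theorem RC_FF {X X' : ℕ → Matrix S S ℂ} {N N' : Matrix S S ℂ} {t : FTree ι} (ht : t.Valid q)
    (h1 : ∀ j ∈ t.leaves, (e j, e j) ∈ ρ)
    (h2 : ∀ j ∈ t.leaves, ∀ j' ∈ t.leaves, j ≠ j' → ∀ k < (q j - q j').natDegree - 2,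
      (e j * X k * e j', e j * X' k * e j') ∈ ρ)
    (h3 : ∀ j ∈ t.leaves, (e j * N * e j, e j * N' * e j) ∈ ρ) (m : ℤ) :
    RC ρ m (FF e q X N t) (FF e q X' N' t) := by
  induction t generalizing m with
  | leaf j =>
    have hj : j ∈ (FTree.leaf j).leaves := Finset.mem_singleton_self j
    exact (RC.pmat_of (h1 j hj) _ _).add (RC.mono_of (h3 j hj) _ _)
  | node d l r ihl ihr =>
    obtain ⟨vl, vr, dis, s, hsl, hsr⟩ := ht
    simp only [FTree.leaves, Finset.mem_union] at h1 h2 h3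
    have il := ihl vl (fun j hj => h1 j (.inl hj))
      (fun j hj j' hj' => h2 j (.inl hj) j' (.inl hj')) fun j hj => h3 j (.inl hj)
    have ir := ihr vr (fun j hj => h1 j (.inr hj))
      (fun j hj j' hj' => h2 j (.inr hj) j' (.inr hj')) fun j hj => h3 j (.inr hj)
    have hne : ∀ {j j'}, j ∈ l.leaves → j' ∈ r.leaves → j ≠ j' := fun h h' e =>
      Finset.disjoint_left.1 dis h (e ▸ h')
    have hL : ∀ m, RC ρ m (lowr e X d l.leaves r.leaves) (lowr e X' d l.leaves r.leaves) :=
      fun m => RC.sum fun k hk => RC.mono_of (idem_block_mem fun j hj j' hj' =>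
        h2 j (.inr hj) j' (.inl hj') (hne hj' hj).symm k (by
          rw [(FTree.natDegree_cross (hsl j' hj') (hsr j hj)).2]
          simpa using Finset.mem_range.1 hk)) _ _
    have hP : ∀ m, RC ρ m (uppr e X d l.leaves r.leaves) (uppr e X' d l.leaves r.leaves) :=
      fun m => RC.sum fun k hk => RC.mono_of (idem_block_mem fun j hj j' hj' =>
        h2 j (.inl hj) j' (.inr hj') (hne hj hj') k (by
          rw [(FTree.natDegree_cross (hsl j hj) (hsr j' hj')).1]
          simpa using Finset.mem_range.1 hk)) _ _
    rw [FF, FF]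
    exact RC.all_mul (RC.all_mul (fun m => (RC.one m).add (hL m))
      fun m => ((il m).add (ir m)).add (hP m)) (fun m => (RC.one m).sub (hL m)) m

/-- The normal form only depends on the relevant blocks of the parameters. -/
theorem FF_congr {X X' : ℕ → Matrix S S ℂ} {N N' : Matrix S S ℂ} {t : FTree ι} (ht : t.Valid q)
    (h2 : ∀ j ∈ t.leaves, ∀ j' ∈ t.leaves, ∀ k, e j * X k * e j' = e j * X' k * e j')
    (h3 : ∀ j ∈ t.leaves, e j * N * e j = e j * N' * e j) :
    FF e q X N t = FF e q X' N' t := by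
  let ρ : Subalgebra ℂ (Matrix S S ℂ × Matrix S S ℂ) :=
    AlgHom.equalizer (AlgHom.fst ℂ _ _) (AlgHom.snd ℂ _ _)
  refine cf_ext fun n => ?_
  exact RC_FF (ρ := ρ) ht (fun _ _ => rfl) (fun j hj j' hj' _ k _ => h2 j hj j' hj' k) h3 n n le_rfl

/-- Functional calculus for a combination of orthogonal idempotents. -/
theorem sum_smul_mem {R : Type*} [Ring R] [Algebra ℂ R] (τ : Subalgebra ℂ R) {ε : ι → R}
    (hε : Orth ε) (s : Finset ι) (c φ : ι → ℂ) (hc : ∀ j ∈ s, c j ≠ 0)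
    (hφ : ∀ j ∈ s, ∀ j' ∈ s, c j = c j' → φ j = φ j') (h : ∑ j ∈ s, c j • ε j ∈ τ) :
    ∑ j ∈ s, φ j • ε j ∈ τ := by
  set T := ∑ j ∈ s, c j • ε j with hT
  have mul_T : ∀ f : ι → ℂ, (∑ j ∈ s, f j • ε j) * T = ∑ j ∈ s, (f j * c j) • ε j := by
    intro f
    rw [Finset.sum_mul]
    refine Finset.sum_congr rfl fun j hj => ?_
    rw [hT, Finset.mul_sum, Finset.sum_eq_single_of_mem j hj]
    · rw [smul_mul_smul_comm, hε, if_pos rfl]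
    · intro b _ hb
      rw [smul_mul_smul_comm, hε, if_neg hb.symm, smul_zero]
  have pw : ∀ k : ℕ, T ^ (k + 1) = ∑ j ∈ s, (c j ^ (k + 1)) • ε j := by
    intro k
    induction k with
    | zero => simp [hT]
    | succ k ih => rw [pow_succ, ih, mul_T]; simp only [← pow_succ]
  have poly : ∀ f : Polynomial ℂ, ∑ j ∈ s, (c j * f.eval (c j)) • ε j ∈ τ := by
    intro f
    induction f using Polynomial.induction_on' with
    | add p q hp hq =>
      convert τ.add_mem hp hq using 1
      simp only [Polynomial.eval_add, mul_add, add_smul, Finset.sum_add_distrib]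
    | monomial k a =>
      have := τ.smul_mem (τ.pow_mem h (k + 1)) a
      rw [pw, Finset.smul_sum] at this
      convert this using 2 with j
      rw [smul_smul, Polynomial.eval_monomial]; ring_nf
  classical
  set f := Lagrange.interpolate (s.image c) id
    (fun x => if h : ∃ j ∈ s, c j = x then φ h.choose * x⁻¹ else 0) with hf
  convert poly f using 2 with j hj
  congr 1
  have hx : ∃ j' ∈ s, c j' = c j := ⟨j, hj, rfl⟩
  have := Lagrange.eval_interpolate_at_node (v := id) (s := s.image c) (i := c j)
    (fun x => if h : ∃ j ∈ s, c j = x then φ h.choose * x⁻¹ else 0) (Set.injOn_id _)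
    (Finset.mem_image_of_mem c hj)
  rw [id, ← hf] at this
  rw [this, dif_pos hx, hφ j hj _ hx.choose_spec.1 hx.choose_spec.2.symm]
  field_simp [hc j hj]

theorem RC.of_eq_zero {m m' : ℤ} {A A' : LMat S S} (h : RC ρ m A A')
    (hA : ∀ n, m < n → cf A n = 0) (hA' : ∀ n, m < n → cf A' n = 0) : RC ρ m' A A' := by
  intro n _
  by_cases hn : n ≤ m
  · exact h n hn
  · rw [hA n (by omega), hA' n (by omega)]; exact ρ.zero_mem

theorem conj_blocks {R : Type*} [Ring R] {El Er L P A A' B : R} (drl : Er * El = 0)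
    (dlr : El * Er = 0) (cL : Cor Er El L) (cP : Cor El Er P) (cl : Cor El El A)
    (cr : Cor Er Er A') (hB : B = (1 + L) * (A + A' + P) * (1 - L)) :
    El * B * El = A - P * L ∧ El * B * Er = P ∧ Er * B * Er = A' + L * P ∧
      Er * B * El = L * (El * B * El) + L * P * L - (Er * B * Er) * L := by
  have hB' : B = A + A' + P + L * A + L * P - A' * L - P * L - L * P * L := by
    rw [hB]
    linear_combination (norm := skip) -(cL.mul_eq_zero cr dlr * L) + cL.mul_eq_zero cr dlr -
      cl.mul_eq_zero cL dlr - L * cl.mul_eq_zero cL dlr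
    simp only [mul_add, add_mul, mul_sub, sub_mul, mul_one, one_mul, mul_assoc, zero_mul, mul_zero,
      neg_mul]
    abel
  have lz : ∀ {x b}, Cor Er b x → El * x = 0 := fun h => h.left_zero dlr
  have lz' : ∀ {x b}, Cor El b x → Er * x = 0 := fun h => h.left_zero drl
  have rz : ∀ {x b}, Cor b Er x → x * El = 0 := fun h => h.right_zero drl
  have rz' : ∀ {x b}, Cor b El x → x * Er = 0 := fun h => h.right_zero dlr
  have e1 : El * B = A + P - P * L := by
    rw [hB']
    simp only [mul_add, mul_sub, cl.1, lz cr, cP.1, lz (cL.mul cl), lz (cL.mul cP),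
      lz (cr.mul cL), (cP.mul cL).1, lz ((cL.mul cP).mul cL)]
    abel
  have e2 : Er * B = A' + L * A + L * P - A' * L - L * P * L := by
    rw [hB']
    simp only [mul_add, mul_sub, cr.1, lz' cl, lz' cP, (cL.mul cl).1, (cL.mul cP).1,
      (cr.mul cL).1, lz' (cP.mul cL), ((cL.mul cP).mul cL).1]
    abel
  have r1 : El * B * El = A - P * L := by
    rw [e1]; simp only [add_mul, sub_mul, cl.2, rz cP, (cP.mul cL).2]; abel
  have r3 : Er * B * Er = A' + L * P := by
    rw [e2]
    simp only [add_mul, sub_mul, cr.2, rz' (cL.mul cl), (cL.mul cP).2, rz' (cr.mul cL),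
      rz' ((cL.mul cP).mul cL)]
    abel
  refine ⟨r1, ?_, r3, ?_⟩
  · rw [e1]; simp only [add_mul, sub_mul, cP.2, rz' cl, rz' (cP.mul cL)]; abel
  · rw [r1, r3, e2]
    simp only [add_mul, sub_mul, mul_sub, rz cr, (cL.mul cl).2, rz (cL.mul cP), (cr.mul cL).2,
      ((cL.mul cP).mul cL).2, mul_assoc, cL.2]
    abel

/-- The blocks at a splitting of the normal form, shifted by a common scalar. -/
theorem FF_blocks (he : Orth e) (X : ℕ → Matrix S S ℂ) (N : Matrix S S ℂ) (d : ℕ)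
    {l r : FTree ι} (dis : Disjoint l.leaves r.leaves) (s : Polynomial ℂ) {El Er L P B : LMat S S}
    (hEl : El = EE e l.leaves) (hEr : Er = EE e r.leaves) (hL : L = lowr e X d l.leaves r.leaves)
    (hP : P = uppr e X d l.leaves r.leaves)
    (hB : B = FF e q X N (.node d l r) - pmat s (idem e (l.leaves ∪ r.leaves))) :
    El * B * El = FF e q X N l - pmat s (idem e l.leaves) - P * L ∧
    El * B * Er = P ∧
    Er * B * Er = FF e q X N r - pmat s (idem e r.leaves) + L * P ∧
    Er * B * El = L * (El * B * El) + L * P * L - (Er * B * Er) * L := by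
  have hll : l.leaves ⊆ l.leaves ∪ r.leaves := Finset.subset_union_left
  have hrr : r.leaves ⊆ l.leaves ∪ r.leaves := Finset.subset_union_right
  have drl : Er * El = 0 := by rw [hEr, hEl]; exact EE_disj he dis.symm
  have dlr : El * Er = 0 := by rw [hEr, hEl]; exact EE_disj he dis
  have cL : Cor Er El L := by rw [hEr, hEl, hL]; exact cor_lowr he X d l.leaves r.leaves
  have cP : Cor El Er P := by rw [hEr, hEl, hP]; exact cor_uppr he X d l.leaves r.leaves
  have cl : Cor El El (FF e q X N l - pmat s (idem e l.leaves)) := by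
    rw [hEl]; exact (cor_FF he X N l).sub (cor_pmat ⟨idem_self he _, idem_self he _⟩ s)
  have cr : Cor Er Er (FF e q X N r - pmat s (idem e r.leaves)) := by
    rw [hEr]; exact (cor_FF he X N r).sub (cor_pmat ⟨idem_self he _, idem_self he _⟩ s)
  refine conj_blocks drl dlr cL cP cl cr ?_
  have hc : pmat s (idem e (l.leaves ∪ r.leaves)) * L =
      L * pmat s (idem e (l.leaves ∪ r.leaves)) := by
    refine pmat_comm_cor s (cL.mono ?_ ?_)
    · rw [hEr]; exact EE_left he hrr
    · rw [hEl]; exact EE_right he hll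
  have hu : pmat s (idem e (l.leaves ∪ r.leaves)) =
      pmat s (idem e l.leaves) + pmat s (idem e r.leaves) := by
    rw [← pmat_add, idem, Finset.sum_union dis]; rfl
  have hLL : L * L = 0 := cL.mul_eq_zero cL dlr
  rw [hB, FF, ← hL, ← hP]
  rw [hu] at hc ⊢
  generalize pmat s (idem e l.leaves) = a at *
  generalize pmat s (idem e r.leaves) = b at *
  linear_combination (norm := skip) -hc - L * hc - hLL * (a + b)
  simp only [mul_add, add_mul, mul_sub, sub_mul, mul_one, one_mul, mul_assoc, zero_mul]
  abel

/-- Conversely, the parameters satisfy every linear condition closed under products that the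
polar part of order at least two of the normal form satisfies. -/
theorem mem_of_RC_FF (he : Orth e) {X X' : ℕ → Matrix S S ℂ} {N N' : Matrix S S ℂ} {t : FTree ι}
    (ht : t.Valid q) (h0 : (idem e t.leaves, idem e t.leaves) ∈ ρ)
    (h : RC ρ (-2) (FF e q X N t) (FF e q X' N' t)) :
    (∀ j ∈ t.leaves, (e j, e j) ∈ ρ) ∧
    (∀ j ∈ t.leaves, ∀ j' ∈ t.leaves, j ≠ j' → ∀ k < (q j - q j').natDegree - 2,
      (e j * X k * e j', e j * X' k * e j') ∈ ρ) := by
  have hs : ∀ j, e j * e j = e j := fun j => by rw [he, if_pos rfl]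
  induction t with
  | leaf j =>
    simp only [FTree.leaves, Finset.mem_singleton]
    refine ⟨?_, ?_⟩
    · rintro i rfl
      simpa [FTree.leaves, idem] using h0
    · rintro i rfl i' rfl hne
      exact (hne rfl).elim
  | node d l r ihl ihr =>
    obtain ⟨vl, vr, dis, s, hsl, hsr⟩ := ht
    have hll : l.leaves ⊆ l.leaves ∪ r.leaves := Finset.subset_union_left
    have hrr : r.leaves ⊆ l.leaves ∪ r.leaves := Finset.subset_union_right
    simp only [FTree.leaves] at h0 ⊢
    have drl := EE_disj he dis.symm
    have dlr := EE_disj he dis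
    set D : ℤ := (d : ℤ) + 2 with hD
    set El := EE e l.leaves with hEl
    set Er := EE e r.leaves with hEr
    set Sg := lead e q s d r.leaves with hSg
    have cSg : Cor (idem e r.leaves) (idem e r.leaves) Sg := Cor.sum fun j hj => by
      constructor
      · rw [mul_smul_comm, idem_mul_e he, if_pos hj]
      · rw [smul_mul_assoc, e_mul_idem he, if_pos hj]
    have hsplit : EE e (l.leaves ∪ r.leaves) = El + Er := EE_union dis
    set L := lowr e X d l.leaves r.leaves with hL
    set L' := lowr e X' d l.leaves r.leaves with hL'
    set P := uppr e X d l.leaves r.leaves with hP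
    set P' := uppr e X' d l.leaves r.leaves with hP'
    set B := FF e q X N (.node d l r) - pmat s (idem e (l.leaves ∪ r.leaves)) with hB
    set B' := FF e q X' N' (.node d l r) - pmat s (idem e (l.leaves ∪ r.leaves)) with hB'
    obtain ⟨b1, b2, b3, b4⟩ := FF_blocks he X N d dis s hEl hEr hL hP hB
    obtain ⟨b1', b2', b3', b4'⟩ := FF_blocks he X' N' d dis s hEl hEr hL' hP' hB'
    have rB : RC ρ (-2) B B' := h.sub (RC.pmat_of h0 _ _)
    -- the leading coefficient
    have hEl0 : El ∈ Fil S S 0 := EE_mem _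
    have hEr0 : Er ∈ Fil S S 0 := EE_mem _
    have hP1 : ∀ X : ℕ → Matrix S S ℂ, uppr e X d l.leaves r.leaves ∈ Fil S S (1 - D) :=
      fun X => fil_mono (by omega) (uppr_mem X d _ _)
    have hL1 : ∀ X : ℕ → Matrix S S ℂ, lowr e X d l.leaves r.leaves ∈ Fil S S 1 :=
      fun X => lowr_mem X d _ _
    have top : ∀ (X : ℕ → Matrix S S ℂ) (N : Matrix S S ℂ),
        FF e q X N (.node d l r) - pmat s (idem e (l.leaves ∪ r.leaves)) - mono (-D) Sg
          ∈ Fil S S (1 - D) := by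
      intro X N
      have h1 := FF_top he (q := q) X N (t := .node d l r) ⟨vl, vr, dis, s, hsl, hsr⟩ (D := d + 2)
        (by omega) (by
          have hle : ∀ j ∈ (FTree.node d l r).leaves, (q j - s).natDegree ≤ d + 2 := by
            intro j hj
            rcases Finset.mem_union.1 hj with hj | hj
            · exact (hsl j hj).le
            · exact (hsr j hj).le
          exact fun j hj j' hj' => natDegree_sub_le_of_sub (hle j hj) (hle j' hj'))
      have hl := FF_left he X N vl hsl
      have hr := FF_right he X N vr hsr
      have hl' := FF_top he (q := q) X N vl (D := d + 2) (by omega) fun j hj j' hj' =>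
        natDegree_sub_le_of_sub (hsl j hj).le (hsl j' hj').le
      have hr' := FF_top he (q := q) X N vr (D := d + 2) (by omega) fun j hj j' hj' =>
        natDegree_sub_le_of_sub (hsr j hj).le (hsr j' hj').le
      have hu : pmat s (idem e (l.leaves ∪ r.leaves)) =
          pmat s (idem e l.leaves) + pmat s (idem e r.leaves) := by
        rw [← pmat_add, idem, Finset.sum_union dis]; rfl
      simp only [FTree.leaves] at h1
      rw [Finset.sum_union dis] at h1
      have := sub_mem (sub_mem (add_mem (add_mem (fil_mono (l := 1 - D) (by push_cast; omega) h1)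
        (fil_mono (by omega) hl)) (fil_mono (by omega) hr))
        (fil_mono (by push_cast; omega) hl')) (fil_mono (by push_cast; omega) hr')
      convert this using 1
      rw [hu]
      abel
    have tB : B - mono (-D) Sg ∈ Fil S S (1 - D) := top X N
    have tB' : B' - mono (-D) Sg ∈ Fil S S (1 - D) := top X' N'
    have hSgρ : (Sg, Sg) ∈ ρ := by
      have h1 := tB (-D) (by omega)
      have h2 := tB' (-D) (by omega)
      rw [cf_sub, cf_mono, if_pos rfl, sub_eq_zero] at h1 h2
      have := rB (-D) (by omega)
      rwa [h1, h2] at this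
    have lin : ∀ φ : ℂ → ℂ, (∑ j ∈ r.leaves, φ ((q j - s).coeff (d + 2)) • e j,
        ∑ j ∈ r.leaves, φ ((q j - s).coeff (d + 2)) • e j) ∈ ρ := by
      intro φ
      have hO : Orth fun j => (e j, e j) := fun i j => by
        rw [Prod.mk_mul_mk, he]; split_ifs <;> rfl
      have := sum_smul_mem ρ hO r.leaves (fun j => (q j - s).coeff (d + 2))
        (fun j => φ ((q j - s).coeff (d + 2))) ?_ ?_ ?_
      · simp only [Prod.smul_mk, ← prod_mk_sum] at this
        exact this
      · intro j hj h0
        have hn := hsr j hj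
        rw [← hn, Polynomial.coeff_natDegree, Polynomial.leadingCoeff_eq_zero] at h0
        rw [h0] at hn
        simp at hn
      · intro j _ j' _ h; rw [h]
      · simp only [Prod.smul_mk, ← prod_mk_sum]
        exact hSgρ
    have hEr' : (idem e r.leaves, idem e r.leaves) ∈ ρ := by
      have := lin fun _ => 1
      simpa [idem] using this
    have hEl' : (idem e l.leaves, idem e l.leaves) ∈ ρ := by
      have := ρ.sub_mem h0 hEr'
      rw [idem, Finset.sum_union dis] at this
      simpa [idem] using this
    set T : Matrix S S ℂ := ∑ j ∈ r.leaves, ((q j - s).coeff (d + 2))⁻¹ • e j with hT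
    have hTρ : (T, T) ∈ ρ := lin fun x => x⁻¹
    have hTS : T * Sg = idem e r.leaves := by
      rw [hT, hSg, lead, Finset.sum_mul, idem]
      refine Finset.sum_congr rfl fun j hj => ?_
      have hn : (q j - s).coeff (d + 2) ≠ 0 := by
        intro h0
        have hn := hsr j hj
        rw [← hn, Polynomial.coeff_natDegree, Polynomial.leadingCoeff_eq_zero] at h0
        rw [h0] at hn
        simp at hn
      rw [Finset.mul_sum, Finset.sum_eq_single_of_mem j hj, smul_mul_smul_comm, he, if_pos rfl,
        inv_mul_cancel₀ hn, one_smul]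
      intro b _ hb
      rw [smul_mul_smul_comm, he, if_neg hb.symm, smul_zero]
    have cL : ∀ X : ℕ → Matrix S S ℂ, Cor Er El (lowr e X d l.leaves r.leaves) :=
      fun X => cor_lowr he X d _ _
    have cSM : Cor Er Er (mono (-D) Sg) := cor_mono cSg _
    have El_mem : ∀ m, RC ρ m El El := fun m => RC.mono_of hEl' _ _
    have Er_mem : ∀ m, RC ρ m Er Er := fun m => RC.mono_of hEr' _ _
    have hSD : mono (-D) Sg ∈ Fil S S (-D) := mono_mem_fil le_rfl _
    have fB : ∀ {B : LMat S S}, B - mono (-D) Sg ∈ Fil S S (1 - D) → B ∈ Fil S S (-D) := by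
      intro B hB
      have := add_mem (fil_mono (l := -D) (by omega) hB) hSD
      rwa [sub_add_cancel] at this
    have sand : ∀ {E F : LMat S S}, (∀ m, RC ρ m E E) → (∀ m, RC ρ m F F) → E ∈ Fil S S 0 →
        F ∈ Fil S S 0 → RC ρ (-2) (E * B * F) (E * B' * F) := by
      intro E F hE hF hE0 hF0
      have h1 : RC ρ (-2) (E * B) (E * B') :=
        RC.mul hE0 hE0 (fB tB) (fB tB') (hE (D - 2)) rB (by omega) (by omega)
      exact RC.mul (mul_mem_fil hE0 (fB tB)) (mul_mem_fil hE0 (fB tB')) hF0 hF0 h1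
        (hF (D - 2)) (by omega) (by omega)
    have fll : ∀ {B : LMat S S}, B - mono (-D) Sg ∈ Fil S S (1 - D) →
        El * B * El ∈ Fil S S (1 - D) := by
      intro B hB
      have h1 := mul_mem_fil' (c := 1 - D) (mul_mem_fil hEl0 hB) hEl0 (by omega)
      rwa [mul_sub, cSM.left_zero dlr, sub_zero] at h1
    have frr : ∀ {B : LMat S S}, B - mono (-D) Sg ∈ Fil S S (1 - D) →
        Er * B * Er - mono (-D) Sg ∈ Fil S S (1 - D) := by
      intro B hB
      have h1 := mul_mem_fil' (c := 1 - D) (mul_mem_fil hEr0 hB) hEr0 (by omega)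
      rwa [mul_sub, cSM.1, sub_mul, cSM.2] at h1
    have rP : ∀ m, RC ρ m P P' := fun m => by
      have h1 := sand El_mem Er_mem hEl0 hEr0
      rw [b2, b2'] at h1
      exact h1.of_eq_zero (fun n hn => cf_uppr_of_lt _ _ _ _ hn)
        fun n hn => cf_uppr_of_lt _ _ _ _ hn
    have rll := sand El_mem El_mem hEl0 hEl0
    have rrr := (sand Er_mem Er_mem hEr0 hEr0).sub (RC.mono_of hSgρ (-D) (-2))
    have rrl := sand Er_mem El_mem hEr0 hEl0
    have key : ∀ {L P B : LMat S S}, Er * B * El = L * (El * B * El) + L * P * L -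
        (Er * B * Er) * L → mono (-D) Sg * L = L * (El * B * El) + L * P * L -
          (Er * B * Er - mono (-D) Sg) * L - Er * B * El := by
      intro L P B h
      rw [h, sub_mul]
      abel
    have rLn : ∀ n : ℕ, n ≤ d → RC ρ n L L' := by
      intro n
      induction n with
      | zero =>
        intro _ n hn
        rw [hL1 X n (by push_cast at hn; omega), hL1 X' n (by push_cast at hn; omega)]
        exact ρ.zero_mem
      | succ k ih =>
        intro hk n hn
        have ih := ih (by omega)
        rcases lt_or_eq_of_le hn with hn | rfl
        · exact ih n (by push_cast at hn; omega)
        have q1 : RC ρ (k + 1 - D) (mono (-D) Sg * L) (mono (-D) Sg * L') := by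
          rw [key b4, key b4']
          refine RC.sub (RC.sub (RC.add ?_ ?_) ?_) (rrl.mono (by omega))
          · exact RC.mul (hL1 X) (hL1 X') (fll tB) (fll tB') ih rll (by omega) (by omega)
          · refine RC.mul (mul_mem_fil (hL1 X) (hP1 X)) (mul_mem_fil (hL1 X') (hP1 X')) (hL1 X)
              (hL1 X') (m := k + 1 - D) ?_ ih (by omega) (by omega)
            exact RC.mul (hL1 X) (hL1 X') (hP1 X) (hP1 X') ih (rP k) (by omega) (by omega)
          · exact RC.mul (frr tB) (frr tB') (hL1 X) (hL1 X') rrr ih (by omega) (by omega)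
        have q2 := q1 _ le_rfl
        rw [cf_mono_mul, cf_mono_mul] at q2
        have q3 := ρ.mul_mem hTρ q2
        have cc : ∀ (X : ℕ → Matrix S S ℂ) (n : ℤ), T * (Sg * cf (lowr e X d l.leaves r.leaves) n) =
            cf (lowr e X d l.leaves r.leaves) n := by
          intro X n
          rw [← mul_assoc, hTS]
          exact (cor_cf (cL X) n).1
        rw [Prod.mk_mul_mk, hL, hL', cc, cc] at q3
        convert q3 using 3 <;> (push_cast; ring)
    have rL : ∀ m, RC ρ m L L' := fun m => (rLn d le_rfl).of_eq_zero
      (fun n hn => cf_lowr_of_lt _ _ _ _ hn) fun n hn => cf_lowr_of_lt _ _ _ _ hn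
    have rl : RC ρ (-2) (FF e q X N l) (FF e q X' N' l) := by
      have h1 := (rll.add ((RC.all_mul rP rL) (-2))).add (RC.pmat_of hEl' s (-2))
      rw [b1, b1'] at h1
      convert h1 using 1 <;> abel
    have rr : RC ρ (-2) (FF e q X N r) (FF e q X' N' r) := by
      have h1 := ((sand Er_mem Er_mem hEr0 hEr0).sub ((RC.all_mul rL rP) (-2))).add
        (RC.pmat_of hEr' s (-2))
      rw [b3, b3'] at h1
      convert h1 using 1 <;> abel
    obtain ⟨il1, il2⟩ := ihl vl hEl' rl
    obtain ⟨ir1, ir2⟩ := ihr vr hEr' rr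
    have ej : ∀ j ∈ l.leaves ∪ r.leaves, (e j, e j) ∈ ρ := fun j hj =>
      (Finset.mem_union.1 hj).elim (il1 j) (ir1 j)
    refine ⟨ej, fun j hj j' hj' hne k hk => ?_⟩
    rcases Finset.mem_union.1 hj with hjl | hjr <;> rcases Finset.mem_union.1 hj' with hjl' | hjr'
    · exact il2 j hjl j' hjl' hne k hk
    · rw [(FTree.natDegree_cross (hsl j hjl) (hsr j' hjr')).1] at hk
      have h1 := ρ.mul_mem (ρ.mul_mem (ej j hj) (rP _ (-((k : ℤ) + 2)) le_rfl)) (ej j' hj')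
      simp only [Prod.mk_mul_mk] at h1
      rw [hP, hP', cf_uppr _ _ _ _ (by omega), cf_uppr _ _ _ _ (by omega)] at h1
      simpa only [← mul_assoc, e_mul_idem he, if_pos hjl, mul_assoc _ (idem e r.leaves) (e j'),
        idem_mul_e he, if_pos hjr'] using h1
    · rw [(FTree.natDegree_cross (hsl j' hjl') (hsr j hjr)).2] at hk
      have h1 := ρ.mul_mem (ρ.mul_mem (ej j hj) (rL _ ((k : ℤ) + 1) le_rfl)) (ej j' hj')
      simp only [Prod.mk_mul_mk] at h1
      rw [hL, hL', cf_lowr _ _ _ _ (by omega), cf_lowr _ _ _ _ (by omega)] at h1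
      simpa only [← mul_assoc, e_mul_idem he, if_pos hjr, mul_assoc _ (idem e l.leaves) (e j'),
        idem_mul_e he, if_pos hjl'] using h1
    · exact ir2 j hjr j' hjr' hne k hk

end Transport
end HTL

namespace HTL
set_option linter.unusedSectionVars false
set_option linter.unusedSimpArgs false

/-! ### Gauge equivalence in a corner -/

section Gauge

variable {S : Type} [Fintype S] [DecidableEq S]

/-- Unipotent gauge transformations in the corner cut out by `E`. -/
def Gau (E b : LMat S S) : Prop := Cor E E b ∧ b - E ∈ Fil S S 1

/-- Gauge equivalence up to regular terms. -/
def Rel (E M M' : LMat S S) : Prop := ∃ b, Gau E b ∧ M * b - b * M' ∈ Fil S S 0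

variable {E : LMat S S}

theorem Gau.mem_fil (hE : E ∈ Fil S S 0) {b : LMat S S} (h : Gau E b) : b ∈ Fil S S 0 := by
  have := add_mem (fil_mono (l := 0) (by omega) h.2) hE
  rwa [sub_add_cancel] at this

theorem Gau.mul (hE : E ∈ Fil S S 0) {b c : LMat S S} (hb : Gau E b) (hc : Gau E c) :
    Gau E (b * c) := by
  refine ⟨hb.1.mul hc.1, ?_⟩
  have h1 := mul_mem_fil' (c := 1) hb.2 (hc.mem_fil hE) (by omega)
  have := add_mem h1 hc.2
  rw [sub_mul, hc.1.1] at this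
  simpa using this

theorem Gau.add_of (hEE : E * E = E) {p : LMat S S} (hp : Cor E E p) (h1 : p ∈ Fil S S 1) :
    Gau E (E + p) := by
  refine ⟨Cor.add ⟨hEE, hEE⟩ hp, ?_⟩
  rwa [add_sub_cancel_left]

theorem Gau.exists_inv (hEE : E * E = E) (hE : E ∈ Fil S S 0) {b : LMat S S} (hb : Gau E b) :
    ∃ b', Gau E b' ∧ b * b' = E ∧ b' * b = E := by
  obtain ⟨c, h1, h2, h3⟩ := exists_inv_of_sub_one_mem (b := b + (1 - E)) (by
    convert hb.2 using 1; abel)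
  have e1 : E * (b + (1 - E)) = b := by rw [mul_add, mul_sub, hb.1.1, hEE, mul_one]; simp
  have e2 : (b + (1 - E)) * E = b := by rw [add_mul, sub_mul, hb.1.2, hEE, one_mul]; simp
  have h4 : b * c = E := by rw [← e1, mul_assoc, h1, mul_one]
  have h5 : c * b = E := by rw [← e2, ← mul_assoc, h2, one_mul]
  refine ⟨E * c * E, ⟨Cor.of_mul hEE hEE, ?_⟩, ?_, ?_⟩
  · have := mul_mem_fil' (c := 1) (mul_mem_fil hE h3) hE (by omega)
    rw [mul_sub, sub_mul, mul_one, hEE] at this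
    exact this
  · rw [← mul_assoc, ← mul_assoc, hb.1.2, h4, hEE]
  · rw [mul_assoc, hb.1.1, mul_assoc, h5, hEE]

theorem Rel.trans (hE : E ∈ Fil S S 0) {M M' M'' : LMat S S} (h : Rel E M M')
    (h' : Rel E M' M'') : Rel E M M'' := by
  obtain ⟨b, hb, h1⟩ := h
  obtain ⟨c, hc, h2⟩ := h'
  refine ⟨b * c, hb.mul hE hc, ?_⟩
  have h3 := mul_mem_fil' (c := 0) h1 (hc.mem_fil hE) (by omega)
  have h4 := mul_mem_fil' (c := 0) (hb.mem_fil hE) h2 (by omega)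
  convert add_mem h3 h4 using 1
  simp only [sub_mul, mul_sub, mul_assoc]
  abel

theorem Rel.add {El Er M1 M2 M1' M2' : LMat S S} (dlr : El * Er = 0) (drl : Er * El = 0)
    (c1 : Cor El El M1) (c2 : Cor Er Er M2) (c1' : Cor El El M1') (c2' : Cor Er Er M2')
    (h1 : Rel El M1 M1') (h2 : Rel Er M2 M2') : Rel (El + Er) (M1 + M2) (M1' + M2') := by
  obtain ⟨b, hb, h1⟩ := h1
  obtain ⟨c, hc, h2⟩ := h2
  refine ⟨b + c, ⟨⟨?_, ?_⟩, ?_⟩, ?_⟩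
  · rw [add_mul, mul_add, mul_add, hb.1.1, hc.1.1, hc.1.left_zero dlr, hb.1.left_zero drl]; simp
  · rw [mul_add, add_mul, add_mul, hb.1.2, hc.1.2, hc.1.right_zero drl, hb.1.right_zero dlr]; simp
  · convert add_mem hb.2 hc.2 using 1; abel
  · convert add_mem h1 h2 using 1
    have z1 := c1.mul_eq_zero hc.1 dlr
    have z2 := c2.mul_eq_zero hb.1 drl
    have z3 := hb.1.mul_eq_zero c2' dlr
    have z4 := hc.1.mul_eq_zero c1' drl
    simp only [mul_add, add_mul, z1, z2, z3, z4]
    abel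

/-- The data of a splitting `E = El + Er` together with block diagonal matrices whose difference
of leading terms is invertible. -/
structure Split (D : ℤ) (El Er : LMat S S) (er Sg T : Matrix S S ℂ) (σ : LMat S S) : Prop where
  hD : 2 ≤ D
  dlr : El * Er = 0
  drl : Er * El = 0
  ll : El * El = El
  rr : Er * Er = Er
  hl : El ∈ Fil S S 0
  hr : Er ∈ Fil S S 0
  her : Er = mono 0 er
  TS : T * Sg = er
  ST : Sg * T = er
  cT : Cor er er T
  hσ : ∀ M, σ * M = M * σ

variable {D : ℤ} {El Er σ : LMat S S} {er Sg T : Matrix S S ℂ}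

namespace Split

theorem EEl (h : Split D El Er er Sg T σ) : (El + Er) * El = El := by
  rw [add_mul, h.ll, h.drl, add_zero]

theorem EEr (h : Split D El Er er Sg T σ) : (El + Er) * Er = Er := by
  rw [add_mul, h.rr, h.dlr, zero_add]

theorem ElE (h : Split D El Er er Sg T σ) : El * (El + Er) = El := by
  rw [mul_add, h.ll, h.dlr, add_zero]

theorem ErE (h : Split D El Er er Sg T σ) : Er * (El + Er) = Er := by
  rw [mul_add, h.rr, h.drl, zero_add]

theorem EE (h : Split D El Er er Sg T σ) : (El + Er) * (El + Er) = El + Er := by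
  rw [add_mul, h.ElE, h.ErE]

theorem corlr (h : Split D El Er er Sg T σ) {x : LMat S S} (hx : Cor El Er x) :
    Cor (El + Er) (El + Er) x := hx.mono h.EEl h.ErE

theorem corrl (h : Split D El Er er Sg T σ) {x : LMat S S} (hx : Cor Er El x) :
    Cor (El + Er) (El + Er) x := hx.mono h.EEr h.ElE

theorem memE (h : Split D El Er er Sg T σ) : El + Er ∈ Fil S S 0 := add_mem h.hl h.hr

theorem sylv_r (h : Split D El Er er Sg T σ) {M1 M2 L : LMat S S} {a : ℤ}
    (h1 : M1 - σ * El ∈ Fil S S (1 - D)) (h2 : M2 - σ * Er - mono (-D) Sg ∈ Fil S S (1 - D))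
    (cL : Cor Er El L) (hL : L ∈ Fil S S a) :
    M2 * L - L * M1 - mono (-D) Sg * L ∈ Fil S S (1 - D + a) := by
  have h3 := mul_mem_fil h2 hL
  have h4 := mul_mem_fil' (c := 1 - D + a) hL h1 (by omega)
  convert sub_mem h3 h4 using 1
  have e1 : σ * Er * L = σ * L := by rw [mul_assoc, cL.1]
  have e2 : L * (σ * El) = σ * L := by rw [← mul_assoc, ← h.hσ, mul_assoc, cL.2]
  rw [sub_mul, sub_mul, mul_sub, e1, e2]
  abel

theorem sylv_l (h : Split D El Er er Sg T σ) {M1 M2 p : LMat S S} {a : ℤ}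
    (h1 : M1 - σ * El ∈ Fil S S (1 - D)) (h2 : M2 - σ * Er - mono (-D) Sg ∈ Fil S S (1 - D))
    (cp : Cor El Er p) (hp : p ∈ Fil S S a) :
    M1 * p - p * M2 + p * mono (-D) Sg ∈ Fil S S (1 - D + a) := by
  have h3 := mul_mem_fil h1 hp
  have h4 := mul_mem_fil' (c := 1 - D + a) hp h2 (by omega)
  convert sub_mem h3 h4 using 1
  have e1 : σ * El * p = σ * p := by rw [mul_assoc, cp.1]
  have e2 : p * (σ * Er) = σ * p := by rw [← mul_assoc, ← h.hσ, mul_assoc, cp.2]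
  rw [sub_mul, mul_sub, mul_sub, e1, e2]
  abel

theorem lower_expand {R : Type*} [Ring R] {El Er M1 M2 P O L : R} (drl : Er * El = 0)
    (dlr : El * Er = 0) (c1 : Cor El El M1) (c2 : Cor Er Er M2) (cP : Cor El Er P)
    (cO : Cor Er El O) (cL : Cor Er El L) :
    (M1 + M2 + P + O) * (El + Er + L) - (El + Er + L) * (M1 + M2 + P) =
      O + (M2 * L - L * M1) + P * L - L * P := by
  have e1 := c1.right_zero dlr
  have e2 := c2.right_zero drl
  have e3 := cP.right_zero drl
  have e4 := cO.right_zero dlr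
  have e5 := c1.left_zero drl
  have e6 := c2.left_zero dlr
  have e7 := cP.left_zero drl
  have e8 := c1.mul_eq_zero cL dlr
  have e9 := cO.mul_eq_zero cL dlr
  have e10 := cL.mul_eq_zero c2 dlr
  simp only [mul_add, add_mul, c1.2, c2.2, cP.2, cO.2, e1, e2, e3, e4, e5, e6, e7, e8, e9, e10,
    c1.1, c2.1, cP.1]
  abel

theorem stepA (h : Split D El Er er Sg T σ) {M1 M2 P O : LMat S S}
    (c1 : Cor El El M1) (c2 : Cor Er Er M2) (cP : Cor El Er P) (cO : Cor Er El O)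
    (h1 : M1 - σ * El ∈ Fil S S (1 - D)) (h2 : M2 - σ * Er - mono (-D) Sg ∈ Fil S S (1 - D))
    (hP : P ∈ Fil S S (1 - D)) (hO : O ∈ Fil S S (-1)) :
    Rel (El + Er) (M1 + M2 + P + O) (M1 + M2 + P) := by
  have hD := h.hD
  have cT : Cor Er Er (mono D (-T)) := by
    rw [h.her]; exact cor_mono h.cT.neg D
  have cL : Cor Er El (mono D (-T) * O) := cT.mul cO
  have hL : mono D (-T) * O ∈ Fil S S (D - 1) :=
    mul_mem_fil' (mono_mem_fil le_rfl _) hO (by omega)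
  refine ⟨El + Er + mono D (-T) * O, Gau.add_of h.EE (h.corrl cL) (fil_mono (by omega) hL), ?_⟩
  rw [lower_expand h.drl h.dlr c1 c2 cP cO cL]
  have h3 := h.sylv_r h1 h2 cL hL
  have h4 : mono (-D) Sg * (mono D (-T) * O) = -O := by
    rw [← mul_assoc, mono_mul_mono, mul_neg, h.ST, mono_neg, neg_add_cancel, ← h.her, Matrix.neg_mul, cO.1]
  rw [h4] at h3
  have h5 := mul_mem_fil' (c := 0) hP hL (by omega)
  have h6 := mul_mem_fil' (c := 0) hL hP (by omega)
  have h7 := sub_mem (add_mem (fil_mono (l := 0) (by omega) h3) h5) h6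
  convert h7 using 1
  abel

theorem upper_expand {R : Type*} [Ring R] {El Er M1 M2 P p : R} (drl : Er * El = 0)
    (dlr : El * Er = 0) (c1 : Cor El El M1) (c2 : Cor Er Er M2) (cP : Cor El Er P)
    (cp : Cor El Er p) :
    (M1 + M2 + P) * (El + Er + p) - (El + Er + p) * (M1 + M2) = P + M1 * p - p * M2 := by
  have e1 := c1.right_zero dlr
  have e2 := c2.right_zero drl
  have e3 := cP.right_zero drl
  have e5 := c1.left_zero drl
  have e6 := c2.left_zero dlr
  have e8 := c2.mul_eq_zero cp drl
  have e9 := cP.mul_eq_zero cp drl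
  have e10 := cp.mul_eq_zero c1 drl
  simp only [mul_add, add_mul, c1.2, c2.2, cP.2, e1, e2, e3, e5, e6, e8, e9, e10, c1.1, c2.1]
  abel

theorem stepB (h : Split D El Er er Sg T σ) {M1 M2 P : LMat S S}
    (c1 : Cor El El M1) (c2 : Cor Er Er M2) (cP : Cor El Er P)
    (h1 : M1 - σ * El ∈ Fil S S (1 - D)) (h2 : M2 - σ * Er - mono (-D) Sg ∈ Fil S S (1 - D))
    (hP : P ∈ Fil S S (1 - D)) : Rel (El + Er) (M1 + M2 + P) (M1 + M2) := by
  have hD := h.hD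
  have cT : Cor Er Er (mono D T) := by
    rw [h.her]; exact cor_mono h.cT D
  have key : ∀ m : ℕ, ∃ p ∈ Fil S S 1, Cor El Er p ∧ P + M1 * p - p * M2 ∈ Fil S S (1 - D + m) := by
    intro m
    induction m with
    | zero => exact ⟨0, zero_mem _, Cor.zero, by simpa using hP⟩
    | succ m ih =>
      obtain ⟨p, hp, cp, hr⟩ := ih
      set r := P + M1 * p - p * M2 with hrd
      have cr : Cor El Er r := (cP.add (c1.mul cp)).sub (cp.mul c2)
      have cd : Cor El Er (r * mono D T) := cr.mul cT
      have hd : r * mono D T ∈ Fil S S (1 + m) := mul_mem_fil' hr (mono_mem_fil le_rfl _) (by omega)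
      refine ⟨p + r * mono D T, add_mem hp (fil_mono (by omega) hd), cp.add cd, ?_⟩
      have h3 := h.sylv_l h1 h2 cd hd
      have h4 : r * mono D T * mono (-D) Sg = r := by
        rw [mul_assoc, mono_mul_mono, h.TS, add_neg_cancel, ← h.her, cr.2]
      rw [h4] at h3
      convert fil_mono (l := 1 - D + (m + 1 : ℕ)) (by push_cast; omega) h3 using 1
      rw [mul_add, add_mul]
      generalize r * mono D T = δ
      rw [hrd]
      abel
  obtain ⟨p, hp, cp, hr⟩ := key (D.toNat)
  refine ⟨El + Er + p, Gau.add_of h.EE (h.corlr cp) hp, ?_⟩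
  rw [upper_expand h.drl h.dlr c1 c2 cP cp]
  exact fil_mono (by omega) hr

end Split
end Gauge
end HTL

namespace HTL
set_option linter.unusedSectionVars false
set_option linter.unusedSimpArgs false

/-! ### The parametrization of the truncated orbits -/

section Param

variable {ι S : Type} [DecidableEq ι] [Fintype S] [DecidableEq S]
  {e : ι → Matrix S S ℂ} {q : ι → Polynomial ℂ}

/-- The inverse of `lead`. -/
noncomputable def leadInv (e : ι → Matrix S S ℂ) (q : ι → Polynomial ℂ) (p : Polynomial ℂ) (d : ℕ)
    (s : Finset ι) : Matrix S S ℂ :=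
  ∑ j ∈ s, ((q j - p).coeff (d + 2))⁻¹ • e j

variable (he : Orth e)
include he

theorem sum_smul_mul_sum_smul (s : Finset ι) (c c' : ι → ℂ) (h : ∀ j ∈ s, c j * c' j = 1) :
    (∑ j ∈ s, c j • e j) * ∑ j ∈ s, c' j • e j = idem e s := by
  rw [Finset.sum_mul, idem]
  refine Finset.sum_congr rfl fun j hj => ?_
  rw [Finset.mul_sum, Finset.sum_eq_single_of_mem j hj, smul_mul_smul_comm, he, if_pos rfl,
    h j hj, one_smul]
  intro b _ hb
  rw [smul_mul_smul_comm, he, if_neg hb.symm, smul_zero]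

theorem cor_sum_smul (s : Finset ι) (c : ι → ℂ) :
    Cor (idem e s) (idem e s) (∑ j ∈ s, c j • e j) := Cor.sum fun j hj => by
  constructor
  · rw [mul_smul_comm, idem_mul_e he, if_pos hj]
  · rw [smul_mul_assoc, e_mul_idem he, if_pos hj]

theorem split_node {d : ℕ} {s : Polynomial ℂ} {l r : Finset ι} (dis : Disjoint l r)
    (hr : ∀ j ∈ r, (q j - s).natDegree = d + 2) :
    Split ((d : ℤ) + 2) (EE e l) (EE e r) (idem e r) (lead e q s d r) (leadInv e q s d r)
      (pmat s 1) := by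
  have hn : ∀ j ∈ r, (q j - s).coeff (d + 2) ≠ 0 := by
    intro j hj h0
    have hn := hr j hj
    rw [← hn, Polynomial.coeff_natDegree, Polynomial.leadingCoeff_eq_zero] at h0
    rw [h0] at hn
    simp at hn
  exact
    { hD := by omega
      dlr := EE_disj he dis
      drl := EE_disj he dis.symm
      ll := EE_self he _
      rr := EE_self he _
      hl := EE_mem _
      hr := EE_mem _
      her := rfl
      TS := sum_smul_mul_sum_smul he _ _ _ fun j hj => inv_mul_cancel₀ (hn j hj)
      ST := sum_smul_mul_sum_smul he _ _ _ fun j hj => mul_inv_cancel₀ (hn j hj)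
      cT := cor_sum_smul he _ _
      hσ := pmat_one_comm s }

theorem FF_left' (X : ℕ → Matrix S S ℂ) (N : Matrix S S ℂ) {l : FTree ι} (vl : l.Valid q)
    {p : Polynomial ℂ} {d : ℕ} (hl : ∀ j ∈ l.leaves, (q j - p).natDegree < d + 2) {O : LMat S S}
    (hO : O ∈ Fil S S (-1)) :
    FF e q X N l + O - pmat p 1 * EE e l.leaves ∈ Fil S S (1 - ((d : ℤ) + 2)) := by
  have h1 := FF_left he X N vl hl
  rw [pmat_eq] at h1
  convert add_mem (fil_mono (l := 1 - ((d : ℤ) + 2)) (by omega) h1) (fil_mono (by omega) hO) using 1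
  rw [EE]; abel

theorem FF_right' (X : ℕ → Matrix S S ℂ) (N : Matrix S S ℂ) {r : FTree ι} (vr : r.Valid q)
    {p : Polynomial ℂ} {d : ℕ} (hr : ∀ j ∈ r.leaves, (q j - p).natDegree = d + 2) {O : LMat S S}
    (hO : O ∈ Fil S S (-1)) :
    FF e q X N r + O - pmat p 1 * EE e r.leaves - mono (-((d : ℤ) + 2)) (lead e q p d r.leaves)
      ∈ Fil S S (1 - ((d : ℤ) + 2)) := by
  have h1 := FF_right he X N vr hr
  rw [pmat_eq] at h1
  convert add_mem (fil_mono (l := 1 - ((d : ℤ) + 2)) (by omega) h1) (fil_mono (by omega) hO) using 1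
  rw [EE]; abel

omit he in
theorem mul_expand4 {R : Type*} [Ring R] {A L O E : R} (hAl : E * A = A)
    (hLE : L * E = L) (hLL : L * L = 0) (hOE : O * E = O) (hEO : E * O = O) :
    ((1 + L) * A * (1 - L) + O) * (E + L) - (E + L) * (A * E + O) = O * L - L * O := by
  simp only [mul_add, add_mul, mul_sub, sub_mul, mul_one, one_mul, mul_assoc, hLE, hLL, hOE,
    hEO, mul_zero, sub_zero, zero_add]
  simp only [← mul_assoc, hAl]
  abel

omit he in
theorem corner_decomp {R : Type*} [Ring R] {El Er O : R} (h : Cor (El + Er) (El + Er) O) :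
    O = El * O * El + Er * O * El + El * O * Er + Er * O * Er := by
  have : O = (El + Er) * O * (El + Er) := by rw [h.1, h.2]
  nth_rewrite 1 [this]
  simp only [add_mul, mul_add]
  abel

theorem e_block_cf {O : LMat S S} {s t : Finset ι} {j j' : ι} (hj : j ∈ s) (hj' : j' ∈ t) (n : ℤ) :
    e j * cf (EE e s * O * EE e t) n * e j' = e j * cf O n * e j' := by
  rw [EE, EE, cf_mul_mono, sub_zero, cf_mono_mul, sub_zero, ← mul_assoc, ← mul_assoc,
    e_mul_idem he, if_pos hj, mul_assoc _ (idem e t) (e j'), idem_mul_e he, if_pos hj']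

/-- Every perturbation of the normal form by off-diagonal residues is gauge equivalent to the
block diagonal normal form. -/
theorem rel_of_FF (X : ℕ → Matrix S S ℂ) (N : Matrix S S ℂ) {t : FTree ι} (ht : t.Valid q)
    {O : LMat S S} (hO : O ∈ Fil S S (-1)) (cO : Cor (EE e t.leaves) (EE e t.leaves) O)
    (hd : ∀ j ∈ t.leaves, e j * cf O (-1) * e j = 0) :
    Rel (EE e t.leaves) (FF e q X N t + O) (BB e q N t.leaves) := by
  induction t generalizing O with
  | leaf j =>
    refine ⟨EE e {j}, ⟨⟨EE_self he _, EE_self he _⟩, by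
      rw [FTree.leaves, sub_self]; exact zero_mem _⟩, ?_⟩
    have cO' : Cor (EE e {j}) (EE e {j}) O := cO
    have h1 := (cor_FF he (q := q) X N (.leaf j)).2
    have h2 := (cor_BB he (q := q) N {j}).1
    simp only [FTree.leaves] at h1 ⊢
    rw [add_mul, h1, cO'.2, h2, FF, BB, Finset.sum_singleton, add_sub_cancel_left]
    intro n hn
    rcases lt_or_eq_of_le (show n ≤ -1 by omega) with h | rfl
    · exact hO n h
    · have h3 := cor_cf cO' (-1)
      have h4 := hd j (Finset.mem_singleton_self j)
      simp only [idem, Finset.sum_singleton] at h3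
      rw [← h4, h3.1, h3.2]
  | node d l r ihl ihr =>
    obtain ⟨vl, vr, dis, s, hsl, hsr⟩ := ht
    have hsp := split_node (e := e) he (l := l.leaves) dis hsr
    have hE : EE e (FTree.node d l r).leaves = EE e l.leaves + EE e r.leaves := EE_union dis
    rw [hE] at cO ⊢
    have hBB : BB e q N (FTree.node d l r).leaves = BB e q N l.leaves + BB e q N r.leaves :=
      Finset.sum_union dis
    have cL := cor_lowr he X d l.leaves r.leaves
    have cP := cor_uppr he X d l.leaves r.leaves
    have cl := cor_FF he (q := q) X N l
    have cr := cor_FF he (q := q) X N r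
    have sand : ∀ s t : Finset ι, EE e s * O * EE e t ∈ Fil S S (-1) := fun s t =>
      mul_mem_fil' (c := -1) (mul_mem_fil' (c := -1) (EE_mem s) hO (by omega)) (EE_mem t) (by omega)
    have s11 := sand l.leaves l.leaves
    have s12 := sand l.leaves r.leaves
    have s21 := sand r.leaves l.leaves
    have s22 := sand r.leaves r.leaves
    have hd1 : ∀ j ∈ l.leaves, e j * cf (EE e l.leaves * O * EE e l.leaves) (-1) * e j = 0 :=
      fun j hj => by rw [e_block_cf he hj hj]; exact hd j (Finset.mem_union_left _ hj)
    have hd2 : ∀ j ∈ r.leaves, e j * cf (EE e r.leaves * O * EE e r.leaves) (-1) * e j = 0 :=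
      fun j hj => by rw [e_block_cf he hj hj]; exact hd j (Finset.mem_union_right _ hj)
    have i1 := ihl vl s11 (Cor.of_mul hsp.ll hsp.ll) hd1
    have i2 := ihr vr s22 (Cor.of_mul hsp.rr hsp.rr) hd2
    have l1 := FF_left' he X N vl hsl s11
    have l2 := FF_right' he X N vr hsr s22
    have cA : Cor (EE e l.leaves + EE e r.leaves) (EE e l.leaves + EE e r.leaves)
        (FF e q X N l + FF e q X N r + uppr e X d l.leaves r.leaves) :=
      ((cl.mono hsp.EEl hsp.ElE).add (cr.mono hsp.EEr hsp.ErE)).add (hsp.corlr cP)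
    set El := EE e l.leaves
    set Er := EE e r.leaves
    have h1 : Rel (El + Er) (FF e q X N (.node d l r) + O)
        ((FF e q X N l + FF e q X N r + uppr e X d l.leaves r.leaves) * (El + Er) + O) := by
      refine ⟨El + Er + lowr e X d l.leaves r.leaves,
        Gau.add_of hsp.EE (hsp.corrl cL) (lowr_mem X d _ _), ?_⟩
      rw [FF, mul_expand4 cA.1 (hsp.corrl cL).2
        (cL.mul_eq_zero cL hsp.dlr) cO.2 cO.1]
      exact sub_mem (mul_mem_fil' hO (lowr_mem X d _ _) (by omega))
        (mul_mem_fil' (lowr_mem X d _ _) hO (by omega))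
    rw [cA.2] at h1
    have c11 : Cor El El (El * O * El) := Cor.of_mul hsp.ll hsp.ll
    have c22 : Cor Er Er (Er * O * Er) := Cor.of_mul hsp.rr hsp.rr
    have c12 : Cor El Er (El * O * Er) := Cor.of_mul hsp.ll hsp.rr
    have c21 : Cor Er El (Er * O * El) := Cor.of_mul hsp.rr hsp.ll
    have hP : uppr e X d l.leaves r.leaves + El * O * Er ∈ Fil S S (1 - ((d : ℤ) + 2)) :=
      add_mem (fil_mono (by omega) (uppr_mem X d _ _)) (fil_mono (by omega) s12)
    have h2 := hsp.stepA (cl.add c11) (cr.add c22) (cP.add c12) c21 l1 l2 hP s21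
    have h3 := hsp.stepB (cl.add c11) (cr.add c22) (cP.add c12) l1 l2 hP
    have h4 := Rel.add hsp.dlr hsp.drl (cl.add c11) (cr.add c22) (cor_BB he N _) (cor_BB he N _)
      i1 i2
    rw [hBB]
    refine h1.trans hsp.memE (Rel.trans hsp.memE ?_ (h3.trans hsp.memE h4))
    convert h2 using 1
    nth_rewrite 1 [corner_decomp cO]
    abel

end Param
end HTL

namespace HTL
set_option linter.unusedSectionVars false
set_option linter.unusedSimpArgs false

section Extract

theorem lu_decomp {R : Type*} [Ring R] {El Er c11 c12 c21 c22 b1' b2 b2' : R} (dlr : El * Er = 0)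
    (drl : Er * El = 0) (c1 : Cor El El c11) (c2 : Cor El Er c12) (c3 : Cor Er El c21)
    (c5 : Cor El El b1') (c6 : Cor Er Er b2') (c7 : Cor Er Er b2) (h1 : b1' * c11 = El)
    (hb2 : b2 = c22 - c21 * b1' * c12) (h2 : b2' * b2 = Er) :
    (El + Er + c21 * b1') * ((El + Er + c12 * b2') * (c11 + b2)) = c11 + c21 + c12 + c22 := by
  have cL : Cor Er El (c21 * b1') := c3.mul c5
  have cp : Cor El Er (c12 * b2') := c2.mul c6
  have e1 : c21 * b1' * c11 = c21 := by rw [mul_assoc, h1, c3.2]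
  have e2 : c12 * b2' * b2 = c12 := by rw [mul_assoc, h2, c2.2]
  have e3 := cp.mul_eq_zero c1 drl
  have e4 := cL.mul_eq_zero c7 dlr
  have e5 : (El + Er + c12 * b2') * (c11 + b2) = c11 + b2 + c12 := by
    simp only [add_mul, mul_add, c1.1, c7.1, c7.left_zero dlr, c1.left_zero drl, e2, e3]
    abel
  have e6 : (El + Er + c21 * b1') * (c11 + b2 + c12) = c11 + b2 + c12 + c21 + c21 * b1' * c12 := by
    simp only [add_mul, mul_add, c1.1, c2.1, c7.1, c7.left_zero dlr, c1.left_zero drl,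
      c2.left_zero drl, e1, e4]
    abel
  rw [e5, e6, hb2]
  abel

theorem conj_decomp {R : Type*} [Ring R] {El Er M1 M2 b1 b2 b1' b2' p Bl Br : R}
    (dlr : El * Er = 0) (drl : Er * El = 0) (cb1 : Cor El El b1) (cb2 : Cor Er Er b2)
    (cp : Cor El Er p) (cBl : Cor El El Bl) (cBr : Cor Er Er Br) (cb1' : Cor El El b1')
    (cb2' : Cor Er Er b2') (h1 : b1' * b1 = El)
    (h2 : b2' * b2 = Er) (hM1 : M1 = b1 * Bl * b1') (hM2 : M2 = b2 * Br * b2') :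
    (El + Er + p) * (b1 + b2) * (Bl + Br) =
      (M1 + M2 + (p * M2 - M1 * p)) * ((El + Er + p) * (b1 + b2)) := by
  have cM1 : Cor El El M1 := by rw [hM1]; exact (cb1.mul cBl).mul cb1'
  have cM2 : Cor Er Er M2 := by rw [hM2]; exact (cb2.mul cBr).mul cb2'
  have e1 : M1 * b1 = b1 * Bl := by rw [hM1, mul_assoc, h1, mul_assoc, cBl.2]
  have e2 : M2 * b2 = b2 * Br := by rw [hM2, mul_assoc, h2, mul_assoc, cBr.2]
  have e3 : (b1 + b2) * (Bl + Br) = (M1 + M2) * (b1 + b2) := by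
    simp only [add_mul, mul_add, e1, e2, cb1.mul_eq_zero cBr dlr, cb2.mul_eq_zero cBl drl,
      cM1.mul_eq_zero cb2 dlr, cM2.mul_eq_zero cb1 drl]
  have e4 : (El + Er + p) * (M1 + M2) = (M1 + M2 + (p * M2 - M1 * p)) * (El + Er + p) := by
    have z1 := cM2.mul_eq_zero cp drl
    have z2 := (cp.mul cM2).mul_eq_zero cp drl
    have z3 := (cM1.mul cp).mul_eq_zero cp drl
    simp only [add_mul, mul_add, sub_mul, cM1.1, cM2.1, cM1.2, cM2.2, cM2.left_zero dlr,
      cM1.left_zero drl, cM1.right_zero dlr, cM2.right_zero drl, cp.mul_eq_zero cM1 drl, z1, z2, z3,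
      (cp.mul cM2).2, (cM1.mul cp).2, (cp.mul cM2).right_zero drl, (cM1.mul cp).right_zero drl]
    abel
  rw [mul_assoc, e3, ← mul_assoc, e4, mul_assoc]

theorem inv_decomp {R : Type*} [Ring R] {El Er b1 b2 b1' b2' p : R}
    (dlr : El * Er = 0) (drl : Er * El = 0) (ll : El * El = El) (rr : Er * Er = Er)
    (cb1 : Cor El El b1) (cb2 : Cor Er Er b2)
    (cp : Cor El Er p) (cb1' : Cor El El b1')
    (cb2' : Cor Er Er b2') (h1 : b1 * b1' = El)
    (h2 : b2 * b2' = Er) :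
    (El + Er + p) * (b1 + b2) * ((b1' + b2') * (El + Er - p)) = El + Er := by
  have e1 : (b1 + b2) * (b1' + b2') = El + Er := by
    simp only [add_mul, mul_add, h1, h2, cb1.mul_eq_zero cb2' dlr, cb2.mul_eq_zero cb1' drl]
    abel
  rw [mul_assoc, ← mul_assoc (b1 + b2), e1]
  simp only [add_mul, mul_add, mul_sub, ll, rr, dlr, drl, cp.1, cp.2, cp.left_zero drl,
    cp.right_zero drl, cp.mul_eq_zero cp drl]
  abel_nf
  simp

variable {S : Type} [Fintype S] [DecidableEq S]
variable {D : ℤ} {El Er σ : LMat S S} {er Sg T : Matrix S S ℂ}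

theorem exists_lu (h : Split D El Er er Sg T σ) {b : LMat S S} (hb : Gau (El + Er) b) :
    ∃ b1 b2 L p, Gau El b1 ∧ Gau Er b2 ∧ Cor Er El L ∧ L ∈ Fil S S 1 ∧ Cor El Er p ∧
      p ∈ Fil S S 1 ∧ (El + Er + L) * ((El + Er + p) * (b1 + b2)) = b := by
  have c11 : Cor El El (El * b * El) := Cor.of_mul h.ll h.ll
  have c12 : Cor El Er (El * b * Er) := Cor.of_mul h.ll h.rr
  have c21 : Cor Er El (Er * b * El) := Cor.of_mul h.rr h.ll
  have c22 : Cor Er Er (Er * b * Er) := Cor.of_mul h.rr h.rr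
  have f : ∀ {E F : LMat S S}, E ∈ Fil S S 0 → F ∈ Fil S S 0 →
      E * b * F - E * (El + Er) * F ∈ Fil S S 1 := by
    intro E F hE hF
    have := mul_mem_fil' (c := 1) (mul_mem_fil hE hb.2) hF (by omega)
    rwa [mul_sub, sub_mul] at this
  have f11 := f h.hl h.hl
  have f12 := f h.hl h.hr
  have f21 := f h.hr h.hl
  have f22 := f h.hr h.hr
  rw [h.ElE, h.ll] at f11
  rw [h.ElE, h.dlr, sub_zero] at f12
  rw [h.ErE, h.drl, sub_zero] at f21
  rw [h.ErE, h.rr] at f22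
  have g1 : Gau El (El * b * El) := ⟨c11, f11⟩
  obtain ⟨b1', g1', -, i1⟩ := g1.exists_inv h.ll h.hl
  have cL : Cor Er El (Er * b * El * b1') := c21.mul g1'.1
  have fL : Er * b * El * b1' ∈ Fil S S 1 := mul_mem_fil' f21 (g1'.mem_fil h.hl) (by omega)
  have g2 : Gau Er (Er * b * Er - Er * b * El * b1' * (El * b * Er)) := by
    refine ⟨c22.sub (cL.mul c12), ?_⟩
    convert sub_mem f22 (mul_mem_fil' (c := 1) fL f12 (by omega)) using 1
    abel
  obtain ⟨b2', g2', -, i2⟩ := g2.exists_inv h.rr h.hr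
  refine ⟨_, _, _, El * b * Er * b2', g1, g2, cL, fL, c12.mul g2'.1,
    mul_mem_fil' f12 (g2'.mem_fil h.hr) (by omega), ?_⟩
  rw [lu_decomp h.dlr h.drl c11 c12 c21 g1'.1 g2'.1 g2.1 i1 rfl i2]
  exact (corner_decomp hb.1).symm

theorem exists_blocks (h : Split D El Er er Sg T σ) {M Bl Br : LMat S S}
    (cM : Cor (El + Er) (El + Er) M) (cBl : Cor El El Bl) (cBr : Cor Er Er Br)
    (hM : Rel (El + Er) M (Bl + Br)) :
    ∃ M1 M2 L p, Cor El El M1 ∧ Cor Er Er M2 ∧ Rel El M1 Bl ∧ Rel Er M2 Br ∧ Cor Er El L ∧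
      L ∈ Fil S S 1 ∧ Cor El Er p ∧ p ∈ Fil S S 1 ∧
      M - (1 + L) * (M1 + M2 + (p * M2 - M1 * p)) * (1 - L) ∈ Fil S S 0 := by
  obtain ⟨b, hb, hr⟩ := hM
  obtain ⟨b1, b2, L, p, g1, g2, cL, fL, cp, fp, rfl⟩ := exists_lu h hb
  obtain ⟨b1', g1', i1, i1'⟩ := g1.exists_inv h.ll h.hl
  obtain ⟨b2', g2', i2, i2'⟩ := g2.exists_inv h.rr h.hr
  have cM1 : Cor El El (b1 * Bl * b1') := (g1.1.mul cBl).mul g1'.1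
  have cM2 : Cor Er Er (b2 * Br * b2') := (g2.1.mul cBr).mul g2'.1
  refine ⟨b1 * Bl * b1', b2 * Br * b2', L, p, cM1, cM2, ⟨b1, g1, ?_⟩, ⟨b2, g2, ?_⟩, cL, fL, cp,
    fp, ?_⟩
  · rw [mul_assoc (b1 * Bl), i1', mul_assoc, cBl.2, sub_self]; exact zero_mem _
  · rw [mul_assoc (b2 * Br), i2', mul_assoc, cBr.2, sub_self]; exact zero_mem _
  have hc := conj_decomp h.dlr h.drl g1.1 g2.1 cp cBl cBr g1'.1 g2'.1 i1' i2' rfl rfl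
  have hi := inv_decomp h.dlr h.drl h.ll h.rr g1.1 g2.1 cp g1'.1 g2'.1 i1 i2
  have cH := ((cM1.mono h.EEl h.ElE).add (cM2.mono h.EEr h.ErE)).add
    (h.corlr ((cp.mul cM2).sub (cM1.mul cp)))
  generalize b1 * Bl * b1' + b2 * Br * b2' + (p * (b2 * Br * b2') - b1 * Bl * b1' * p) = H at *
  rw [mul_assoc (El + Er + L), hc] at hr
  have hf : (b1' + b2') * (El + Er - p) ∈ Fil S S 0 :=
    mul_mem_fil' (add_mem (g1'.mem_fil h.hl) (g2'.mem_fil h.hr))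
      (sub_mem h.memE (fil_mono (by omega) fp)) (by omega)
  have hf2 : El + Er - L ∈ Fil S S 0 := sub_mem h.memE (fil_mono (by omega) fL)
  have h1 := mul_mem_fil' (c := 0) (mul_mem_fil hr hf) hf2 (by omega)
  generalize (El + Er + p) * (b1 + b2) = c at *
  generalize (b1' + b2') * (El + Er - p) = c' at *
  have cL' := h.corrl cL
  have hLL : L * L = 0 := cL.mul_eq_zero cL h.dlr
  have hEE := h.EE
  convert h1 using 1
  generalize El + Er = E at *
  rw [sub_mul, sub_mul]
  have e1 : M * ((E + L) * c) * c' * (E - L) = M := by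
    rw [← mul_assoc, mul_assoc _ c c', hi, mul_assoc M, mul_assoc M]
    have : (E + L) * E * (E - L) = E := by
      simp only [add_mul, mul_sub, hEE, cL'.1, cL'.2, hLL]
      abel
    rw [this, cM.2]
  have e2 : (E + L) * (H * c) * c' * (E - L) = (1 + L) * H * (1 - L) := by
    have : (E + L) * (H * c) * c' * (E - L) = (E + L) * (H * (c * c')) * (E - L) := by
      simp only [mul_assoc]
    rw [this, hi, cH.2, add_mul, cH.1, mul_sub, add_mul, cH.2, mul_assoc L, cH.2, mul_sub, add_mul,
      Matrix.mul_one, Matrix.add_mul 1 L, Matrix.one_mul, add_mul]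
  rw [e1, e2]

theorem conj_perturb {R : Type*} [Ring R] {El Er M1 M2 P P' L L' O1 O2 A1 A2 Q : R}
    (dlr : El * Er = 0) (cM1 : Cor El El M1) (cM2 : Cor Er Er M2)
    (cL : Cor Er El L) (cL' : Cor Er El L')
    (h1 : M1 = A1 + O1) (h2 : M2 = A2 + O2) (h3 : Q = P + P') :
    (1 + (L + L')) * (M1 + M2 + Q) * (1 - (L + L')) - (1 + L) * (A1 + A2 + P) * (1 - L) =
      (1 + L) * (L' * Q - Q * L' - L' * Q * L') * (1 - L) +
        (1 + L) * (O1 + O2 + P' + (L' * M1 - M2 * L')) * (1 - L) := by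
  have z1 := cL.mul_eq_zero cL' dlr
  have z2 := cL'.mul_eq_zero cL dlr
  have e1 : 1 + (L + L') = (1 + L) * (1 + L') := by
    simp only [mul_add, add_mul, mul_one, one_mul, z1]; abel
  have e2 : 1 - (L + L') = (1 - L') * (1 - L) := by
    simp only [mul_sub, sub_mul, mul_one, one_mul, z2]; abel
  have z3 := cL'.mul_eq_zero cM2 dlr
  have z4 := cM1.mul_eq_zero cL' dlr
  have z6 := (cL'.mul cM1).mul_eq_zero cL' dlr
  have e3 : (1 + L') * (M1 + M2 + Q) * (1 - L') = (A1 + A2 + P) +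
      ((L' * Q - Q * L' - L' * Q * L') + (O1 + O2 + P' + (L' * M1 - M2 * L'))) := by
    have : (1 + L') * (M1 + M2 + Q) * (1 - L') = (M1 + M2 + Q) +
      ((L' * Q - Q * L' - L' * Q * L') + (L' * M1 - M2 * L')) := by
      simp only [mul_add, add_mul, mul_sub, mul_one, one_mul, z3, z4, z6, zero_mul]; abel
    rw [this]
    generalize L' * Q - Q * L' - L' * Q * L' = x
    generalize L' * M1 - M2 * L' = y
    rw [h1, h2, h3]
    abel
  have e4 : (1 + (L + L')) * (M1 + M2 + Q) * (1 - (L + L')) =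
      (1 + L) * ((1 + L') * (M1 + M2 + Q) * (1 - L')) * (1 - L) := by
    rw [e1, e2]; simp only [mul_assoc]
  rw [e4, e3, mul_add (1 + L), add_mul, add_sub_cancel_left, mul_add (1 + L), add_mul]

variable {ι : Type} [DecidableEq ι] {e : ι → Matrix S S ℂ} {q : ι → Polynomial ℂ}

/-- Every matrix gauge equivalent to the block diagonal normal form is parametrized. -/
theorem exists_FF (he : Orth e) (N : Matrix S S ℂ) {t : FTree ι} (ht : t.Valid q) {M : LMat S S}
    (cM : Cor (EE e t.leaves) (EE e t.leaves) M)
    (hM : Rel (EE e t.leaves) M (BB e q N t.leaves)) :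
    ∃ X, M - FF e q X N t ∈ Fil S S (-1) ∧
      ∀ j ∈ t.leaves, e j * cf (M - FF e q X N t) (-1) * e j = 0 := by
  induction t generalizing M with
  | leaf j =>
    suffices h : ∃ X : ℕ → Matrix S S ℂ, M - FF e q X N (.leaf j) ∈ Fil S S 0 by
      obtain ⟨X, hX⟩ := h
      refine ⟨X, fil_mono (by omega) hX, fun i _ => ?_⟩
      rw [hX (-1) (by omega), mul_zero, zero_mul]
    refine ⟨fun _ => 0, ?_⟩
    obtain ⟨b, hb, hr⟩ := hM
    simp only [FTree.leaves] at cM hb hr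
    have hEE := EE_self he {j}
    have hE0 : EE e {j} ∈ Fil S S 0 := EE_mem _
    have hBB : BB e q N {j} = pmat (q j) 1 * EE e {j} + mono (-1) (e j * N * e j) := by
      rw [BB, Finset.sum_singleton, EE, ← pmat_eq, idem, Finset.sum_singleton]
    rw [hBB] at hr
    rw [FF, show (pmat (q j) (e j) : LMat S S) = pmat (q j) 1 * EE e {j} by
      rw [EE, ← pmat_eq, idem, Finset.sum_singleton]]
    obtain ⟨b', hb', i1, i2⟩ := hb.exists_inv hEE hE0
    have h1 := mul_mem_fil' (c := 0) hr (hb'.mem_fil hE0) (by omega)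
    have hm : mono (-1) (e j * N * e j) ∈ Fil S S (-1) := mono_mem_fil le_rfl _
    have h2 := mul_mem_fil' (c := 0) (mul_mem_fil hb.2 hm) (hb'.mem_fil hE0) (by omega)
    have h3 := mul_mem_fil' (c := 0) hm hb'.2 (by omega)
    have cm : Cor (EE e {j}) (EE e {j}) (mono (-1) (e j * N * e j)) := by
      have hs : e j * e j = e j := by rw [he, if_pos rfl]
      rw [EE, idem, Finset.sum_singleton]
      exact cor_mono (Cor.of_mul hs hs) _
    convert add_mem (add_mem h1 h2) h3 using 1
    generalize mono (-1) (e j * N * e j) = m at *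
    have hσ := pmat_one_comm (q j) b
    generalize (pmat (q j) (1 : Matrix S S ℂ)) = σ at *
    generalize EE e {j} = E at *
    have e1 : M * b * b' = M := by rw [mul_assoc, i1, cM.2]
    have e2 : b * (σ * E) * b' = σ * E := by
      rw [← mul_assoc, ← hσ, mul_assoc σ, hb.1.2, mul_assoc, i1]
    have e3 : b * m * b' = (b - E) * m * b' + m * (b' - E) + m := by
      rw [sub_mul, sub_mul, mul_sub, cm.1, cm.2]; abel
    rw [sub_mul, e1, mul_add, add_mul, e2, e3]
    abel
  | node d l r ihl ihr =>
    obtain ⟨vl, vr, dis, s, hsl, hsr⟩ := ht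
    have hsp := split_node (e := e) he (l := l.leaves) dis hsr
    have hE : EE e (FTree.node d l r).leaves = EE e l.leaves + EE e r.leaves := EE_union dis
    have hBB : BB e q N (FTree.node d l r).leaves = BB e q N l.leaves + BB e q N r.leaves :=
      Finset.sum_union dis
    rw [hE] at cM hM
    rw [hBB] at hM
    obtain ⟨M1, M2, L, p, cM1, cM2, r1, r2, cL, fL, cp, fp, hr⟩ :=
      exists_blocks hsp cM (cor_BB he N _) (cor_BB he N _) hM
    obtain ⟨X1, f1, d1⟩ := ihl vl cM1 r1
    obtain ⟨X2, f2, d2⟩ := ihr vr cM2 r2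
    have hM1 : M1 = FF e q X1 N l + (M1 - FF e q X1 N l) := by abel
    have hM2 : M2 = FF e q X2 N r + (M2 - FF e q X2 N r) := by abel
    have l1 := FF_left' he X1 N vl hsl f1
    have l2 := FF_right' he X2 N vr hsr f2
    rw [← hM1] at l1
    rw [← hM2] at l2
    have cQ : Cor (EE e l.leaves) (EE e r.leaves) (p * M2 - M1 * p) := (cp.mul cM2).sub (cM1.mul cp)
    have fQ : p * M2 - M1 * p ∈ Fil S S (1 - ((d : ℤ) + 2)) := by
      have h1 := fil_mono (l := 1 - ((d : ℤ) + 2)) (by omega) (hsp.sylv_l l1 l2 cp fp)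
      have h2 : p * mono (-((d : ℤ) + 2)) (lead e q s d r.leaves) ∈ Fil S S (1 - ((d : ℤ) + 2)) :=
        mul_mem_fil' fp (mono_mem_fil le_rfl _) (by omega)
      convert sub_mem h2 h1 using 1
      abel
    set Q := p * M2 - M1 * p
    let X : ℕ → Matrix S S ℂ := fun k =>
      idem e l.leaves * X1 k * idem e l.leaves + idem e r.leaves * X2 k * idem e r.leaves +
        cf L ((k : ℤ) + 1) + cf Q (-((k : ℤ) + 2))
    have nl : ∀ {j}, j ∈ l.leaves → j ∉ r.leaves := fun h => Finset.disjoint_left.1 dis h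
    have nr : ∀ {j}, j ∈ r.leaves → j ∉ l.leaves := fun h => Finset.disjoint_right.1 dis h
    have hXl : FF e q X N l = FF e q X1 N l := by
      refine FF_congr vl (fun j hj j' hj' k => ?_) fun _ _ => rfl
      have z1 : e j * idem e r.leaves = 0 := by rw [e_mul_idem he, if_neg (nl hj)]
      have z2 : idem e r.leaves * e j' = 0 := by rw [idem_mul_e he, if_neg (nl hj')]
      have z3 : e j * idem e l.leaves = e j := by rw [e_mul_idem he, if_pos hj]
      have z4 : idem e l.leaves * e j' = e j' := by rw [idem_mul_e he, if_pos hj']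
      have z5 := (cor_cf cL ((k : ℤ) + 1)).left_zero z1
      have z6 := (cor_cf cQ (-((k : ℤ) + 2))).right_zero z2
      simp only [X, mul_add, add_mul, ← mul_assoc, z5, z1, z3, zero_mul, zero_add, add_zero]
      rw [mul_assoc _ (idem e l.leaves) (e j'), z4, mul_assoc (e j) (cf Q _) (e j'), z6, mul_zero, add_zero]
    have hXr : FF e q X N r = FF e q X2 N r := by
      refine FF_congr vr (fun j hj j' hj' k => ?_) fun _ _ => rfl
      have z1 : e j * idem e l.leaves = 0 := by rw [e_mul_idem he, if_neg (nr hj)]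
      have z2 : idem e l.leaves * e j' = 0 := by rw [idem_mul_e he, if_neg (nr hj')]
      have z3 : e j * idem e r.leaves = e j := by rw [e_mul_idem he, if_pos hj]
      have z4 : idem e r.leaves * e j' = e j' := by rw [idem_mul_e he, if_pos hj']
      have z5 := (cor_cf cL ((k : ℤ) + 1)).right_zero z2
      have z6 := (cor_cf cQ (-((k : ℤ) + 2))).left_zero z1
      simp only [X, mul_add, add_mul, ← mul_assoc, z6, z1, z3, zero_mul, zero_add, add_zero]
      rw [mul_assoc _ (idem e r.leaves) (e j'), z4, mul_assoc (e j) (cf L _) (e j'), z5, mul_zero, add_zero]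
    have dE : idem e l.leaves * idem e r.leaves = 0 := by
      rw [idem_mul he, Finset.disjoint_iff_inter_eq_empty.1 dis]; rfl
    have dE' : idem e r.leaves * idem e l.leaves = 0 := by
      rw [idem_mul he, Finset.disjoint_iff_inter_eq_empty.1 dis.symm]; rfl
    have bL : ∀ k : ℕ, idem e r.leaves * X k * idem e l.leaves = cf L ((k : ℤ) + 1) := by
      intro k
      have z5 := cor_cf cL ((k : ℤ) + 1)
      have z6 := (cor_cf cQ (-((k : ℤ) + 2))).left_zero dE'
      simp only [X, mul_add, add_mul, ← mul_assoc, z5.1, z5.2, z6, dE', idem_self he, zero_mul,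
        zero_add, add_zero]
      rw [mul_assoc _ _ (idem e l.leaves), dE', mul_zero, zero_add]
    have bQ : ∀ k : ℕ, idem e l.leaves * X k * idem e r.leaves = cf Q (-((k : ℤ) + 2)) := by
      intro k
      have z5 := (cor_cf cL ((k : ℤ) + 1)).left_zero dE
      have z6 := cor_cf cQ (-((k : ℤ) + 2))
      simp only [X, mul_add, add_mul, ← mul_assoc, z6.1, z6.2, z5, dE, idem_self he, zero_mul,
        zero_add, add_zero]
      rw [mul_assoc _ _ (idem e r.leaves), dE, mul_zero, zero_add]
    have tL : L - lowr e X d l.leaves r.leaves ∈ Fil S S (d + 1) := by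
      intro n hn
      rw [cf_sub]
      rcases lt_or_ge n 1 with h | h
      · rw [fL n h, lowr_mem X d _ _ n h, sub_zero]
      · obtain ⟨k, rfl⟩ : ∃ k : ℕ, n = k + 1 := ⟨(n - 1).toNat, by omega⟩
        rw [cf_lowr _ _ _ _ (by omega), bL, sub_self]
    have tQ : Q - uppr e X d l.leaves r.leaves ∈ Fil S S (-1) := by
      intro n hn
      rw [cf_sub]
      rcases lt_or_ge n (1 - ((d : ℤ) + 2)) with h | h
      · rw [fQ n h, uppr_mem X d _ _ n (by omega), sub_zero]
      · obtain ⟨k, rfl⟩ : ∃ k : ℕ, n = -((k : ℤ) + 2) := ⟨(-n - 2).toNat, by omega⟩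
        rw [cf_uppr _ _ _ _ (by omega), bQ, sub_self]
    have cl := cor_lowr he X d l.leaves r.leaves
    have cu := cor_uppr he X d l.leaves r.leaves
    have ml := lowr_mem (e := e) X d l.leaves r.leaves
    have hFF : FF e q X N (.node d l r) = (1 + lowr e X d l.leaves r.leaves) *
        (FF e q X1 N l + FF e q X2 N r + uppr e X d l.leaves r.leaves) *
        (1 - lowr e X d l.leaves r.leaves) := by
      rw [FF, hXl, hXr]
    generalize lowr e X d l.leaves r.leaves = v at *
    generalize uppr e X d l.leaves r.leaves = u at *
    have cL' : Cor (EE e r.leaves) (EE e l.leaves) (L - v) := cL.sub cl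
    have key := conj_perturb (P' := Q - u) (P := u) (Q := Q) hsp.dlr cM1 cM2 cl cL' hM1 hM2
      (by abel)
    rw [add_sub_cancel, ← hFF] at key
    have sy := hsp.sylv_r l1 l2 cL' tL
    have fS : mono (-((d : ℤ) + 2)) (lead e q s d r.leaves) * (L - v) ∈ Fil S S (-1) :=
      mul_mem_fil' (mono_mem_fil le_rfl _) tL (by omega)
    have fY : (L - v) * M1 - M2 * (L - v) ∈ Fil S S (-1) := by
      convert neg_mem (add_mem (fil_mono (l := -1) (by omega) sy) fS) using 1
      abel
    have c1 := cM1.sub (cor_FF (q := q) he X1 N l)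
    have c2 := cM2.sub (cor_FF (q := q) he X2 N r)
    have cP := cQ.sub cu
    have cY : Cor (EE e r.leaves) (EE e l.leaves) ((L - v) * M1 - M2 * (L - v)) :=
      (cL'.mul cM1).sub (cM2.mul cL')
    have fW := add_mem (add_mem (add_mem f1 f2) tQ) fY
    have fZ : (L - v) * Q - Q * (L - v) - (L - v) * Q * (L - v) ∈ Fil S S 0 :=
      sub_mem (sub_mem (mul_mem_fil' tL fQ (by omega)) (mul_mem_fil' fQ tL (by omega)))
        (mul_mem_fil' (c := 0) (mul_mem_fil tL fQ) tL (by omega))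
    have fv1 : 1 + v ∈ Fil S S 0 := add_mem one_mem_fil (fil_mono (by omega) ml)
    have fv2 : 1 - v ∈ Fil S S 0 := sub_mem one_mem_fil (fil_mono (by omega) ml)
    have fZ' := mul_mem_fil' (c := 0) (mul_mem_fil fv1 fZ) fv2 (by omega)
    have van : ∀ {a b : Finset ι} {z : LMat S S} {j : ι}, Cor (EE e a) (EE e b) z →
        (j ∉ a ∨ j ∉ b) → e j * cf z (-1) * e j = 0 := by
      intro a b z j hz hj
      have hz' := cor_cf hz (-1)
      rcases hj with hj | hj
      · rw [hz'.left_zero (by rw [e_mul_idem he, if_neg hj]), zero_mul]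
      · rw [mul_assoc, hz'.right_zero (by rw [idem_mul_e he, if_neg hj]), mul_zero]
    have dW : ∀ j ∈ (FTree.node d l r).leaves, e j * cf (M1 - FF e q X1 N l +
        (M2 - FF e q X2 N r) + (Q - u) + ((L - v) * M1 - M2 * (L - v))) (-1) * e j = 0 := by
      intro j hj
      simp only [cf_add, mul_add, add_mul]
      rcases Finset.mem_union.1 hj with hj | hj
      · rw [d1 j hj, van c2 (Or.inl (nl hj)), van cP (Or.inr (nl hj)), van cY (Or.inl (nl hj))]
        simp
      · rw [d2 j hj, van c1 (Or.inl (nr hj)), van cP (Or.inl (nr hj)), van cY (Or.inr (nr hj))]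
        simp
    generalize M1 - FF e q X1 N l + (M2 - FF e q X2 N r) + (Q - u) +
      ((L - v) * M1 - M2 * (L - v)) = W at *
    generalize (L - v) * Q - Q * (L - v) - (L - v) * Q * (L - v) = Z at *
    have fV : v * W * (1 - v) - W * v ∈ Fil S S 0 :=
      sub_mem (mul_mem_fil' (c := 0) (mul_mem_fil ml fW) fv2 (by omega))
        (mul_mem_fil' fW ml (by omega))
    have fall : M - FF e q X N (.node d l r) - W ∈ Fil S S 0 := by
      convert add_mem (add_mem hr fZ') fV using 1
      rw [sub_eq_iff_eq_add] at key
      rw [key, add_mul (1 : LMat S S) v W, Matrix.one_mul, add_mul W, mul_sub W, Matrix.mul_one]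
      abel
    have hW : M - FF e q X N (.node d l r) = (M - FF e q X N (.node d l r) - W) + W := by abel
    refine ⟨X, ?_, fun j hj => ?_⟩
    · rw [hW]; exact add_mem (fil_mono (by omega) fall) fW
    · rw [hW, cf_add, fall (-1) (by omega), zero_add, dW j hj]

end Extract
end HTL

namespace HTL
set_option linter.unusedSectionVars false
set_option linter.unusedSimpArgs false

section Similar

open Module

variable {V W E : Type} [AddCommGroup V] [Module ℂ V] [FiniteDimensional ℂ V]
  [AddCommGroup W] [Module ℂ W] [FiniteDimensional ℂ W]
  [AddCommGroup E] [Module ℂ E] [FiniteDimensional ℂ E]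

/-- Two maps with the same full rank reversed product are intertwined by an isomorphism. -/
theorem exists_equiv_of_comp_eq (hVW : finrank ℂ V = finrank ℂ W) {U : E →ₗ[ℂ] V} {U' : E →ₗ[ℂ] W}
    {P : V →ₗ[ℂ] E} {P' : W →ₗ[ℂ] E} (hU : Function.Injective U) (hU' : Function.Injective U')
    (hP : Function.Surjective P) (hP' : Function.Surjective P') (h : P ∘ₗ U = P' ∘ₗ U') :
    ∃ φ : V ≃ₗ[ℂ] W, (∀ x, φ (U x) = U' x) ∧ ∀ v, P' (φ v) = P v := by
  obtain ⟨l, hl⟩ := LinearMap.exists_leftInverse_of_injective U (LinearMap.ker_eq_bot.2 hU)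
  obtain ⟨s, hs⟩ := LinearMap.exists_rightInverse_of_surjective P' (LinearMap.range_eq_top.2 hP')
  have hl' : ∀ x, l (U x) = x := fun x => LinearMap.congr_fun hl x
  have hs' : ∀ x, P' (s x) = x := fun x => LinearMap.congr_fun hs x
  have h' : ∀ x, P (U x) = P' (U' x) := fun x => LinearMap.congr_fun h x
  let h0 : V →ₗ[ℂ] W := U' ∘ₗ l + s ∘ₗ P ∘ₗ (LinearMap.id - U ∘ₗ l)
  have h0U : ∀ x, h0 (U x) = U' x := fun x => by simp [h0, hl']
  have h0P : ∀ v, P' (h0 v) = P v := fun v => by simp [h0, hs', h']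
  let K := LinearMap.ker P
  let L := LinearMap.ker P'
  let Z := LinearMap.ker (P ∘ₗ U)
  have hKL : finrank ℂ K = finrank ℂ L := by
    have h1 := P.finrank_range_add_finrank_ker
    have h2 := P'.finrank_range_add_finrank_ker
    rw [LinearMap.range_eq_top.2 hP] at h1
    rw [LinearMap.range_eq_top.2 hP'] at h2
    simp only [K, L]
    omega
  let ZK : Submodule ℂ K := (Z.map U).comap K.subtype
  let ZL : Submodule ℂ L := (Z.map U').comap L.subtype
  have hZK : finrank ℂ ZK = finrank ℂ Z := by
    have h1 : Z.map U ≤ K := by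
      rintro _ ⟨z, hz, rfl⟩
      exact hz
    have h2 := (Submodule.comapSubtypeEquivOfLe h1).finrank_eq
    have h3 := (Submodule.equivMapOfInjective U hU Z).finrank_eq
    rw [h3, ← h2]
  have hZL : finrank ℂ ZL = finrank ℂ Z := by
    have h1 : Z.map U' ≤ L := by
      rintro _ ⟨z, hz, rfl⟩
      have : P (U z) = 0 := hz
      rw [h'] at this
      exact this
    have h2 := (Submodule.comapSubtypeEquivOfLe h1).finrank_eq
    have h3 := (Submodule.equivMapOfInjective U' hU' Z).finrank_eq
    rw [h3, ← h2]
  obtain ⟨K', hK'⟩ := Submodule.exists_isCompl ZK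
  obtain ⟨L', hL'⟩ := Submodule.exists_isCompl ZL
  have hfr : finrank ℂ K' = finrank ℂ L' := by
    have h1 := Submodule.finrank_add_eq_of_isCompl hK'
    have h2 := Submodule.finrank_add_eq_of_isCompl hL'
    omega
  let ψ : K' ≃ₗ[ℂ] L' := LinearEquiv.ofFinrankEq _ _ hfr
  let R := LinearMap.range U
  let incK : K' →ₗ[ℂ] V := K.subtype ∘ₗ K'.subtype
  let incL : L' →ₗ[ℂ] W := L.subtype ∘ₗ L'.subtype
  have hinj : LinearMap.ker (R.mkQ ∘ₗ incK) = ⊥ := by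
    rw [LinearMap.ker_eq_bot']
    intro k hk
    have h1 : incK k ∈ R := (Submodule.Quotient.mk_eq_zero R).1 hk
    obtain ⟨z, hz⟩ := h1
    have hz' : P (U z) = 0 := by rw [hz]; exact (k : K).2
    have h2 : (k : K) ∈ ZK := ⟨z, hz', hz⟩
    have h3 := Submodule.disjoint_def.1 hK'.disjoint _ h2 k.2
    exact Subtype.ext h3
  obtain ⟨ρ, hρ⟩ := LinearMap.exists_leftInverse_of_injective _ hinj
  have hρ' : ∀ k, ρ (R.mkQ (incK k)) = k := fun k => LinearMap.congr_fun hρ k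
  let φ : V →ₗ[ℂ] W := h0 + (incL ∘ₗ ψ.toLinearMap - h0 ∘ₗ incK) ∘ₗ ρ ∘ₗ R.mkQ
  have hφU : ∀ x, φ (U x) = U' x := by
    intro x
    have : R.mkQ (U x) = 0 := (Submodule.Quotient.mk_eq_zero R).2 ⟨x, rfl⟩
    simp only [φ, LinearMap.add_apply, LinearMap.comp_apply, this, map_zero, h0U, add_zero]
  have hφK : ∀ k, φ (incK k) = incL (ψ k) := by
    intro k
    simp only [φ, LinearMap.add_apply, LinearMap.comp_apply, LinearMap.sub_apply, hρ']
    simp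
  have hLz : ∀ l, P' (incL l) = 0 := fun l => (l : L).2
  have hKz : ∀ k, P (incK k) = 0 := fun k => (k : K).2
  have hφP : ∀ v, P' (φ v) = P v := by
    intro v
    simp only [φ, LinearMap.add_apply, LinearMap.comp_apply, LinearMap.sub_apply, map_add, map_sub,
      h0P]
    rw [hKz, show P' (incL (ψ.toLinearMap (ρ (R.mkQ v)))) = 0 from hLz _]
    simp
  have hφ : Function.Injective φ := by
    rw [← LinearMap.ker_eq_bot, LinearMap.ker_eq_bot']
    intro v hv
    have hvK : P v = 0 := by rw [← hφP, hv, map_zero]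
    obtain ⟨a, ha, b, hb, hab⟩ := Submodule.mem_sup.1
      (hK'.sup_eq_top ▸ Submodule.mem_top : (⟨v, hvK⟩ : K) ∈ ZK ⊔ K')
    obtain ⟨z, hz, hza⟩ := ha
    have hv2 : v = U z + incK ⟨b, hb⟩ := by
      have := congrArg Subtype.val hab
      rw [hza]
      exact this.symm
    rw [hv2, map_add, hφU, hφK] at hv
    have hz' : P' (U' z) = 0 := by rw [← h']; exact hz
    have m1 : (⟨U' z, hz'⟩ : L) ∈ ZL := ⟨z, hz, rfl⟩
    have m2 : (⟨U' z, hz'⟩ : L) ∈ L' := by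
      have : (⟨U' z, hz'⟩ : L) = -((ψ ⟨b, hb⟩ : L') : L) := Subtype.ext (eq_neg_of_add_eq_zero_left hv)
      rw [this]
      exact neg_mem (ψ ⟨b, hb⟩).2
    have m3 := Submodule.disjoint_def.1 hL'.disjoint _ m1 m2
    have m4 : U' z = 0 := congrArg Subtype.val m3
    have m5 : z = 0 := hU' (by rw [m4, map_zero])
    rw [m4, zero_add] at hv
    have m6 : ψ ⟨b, hb⟩ = 0 := by
      apply Subtype.ext; apply Subtype.ext; exact hv
    have m7 : (⟨b, hb⟩ : K') = 0 := ψ.injective (by rw [m6, map_zero])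
    rw [hv2, m5, m7, map_zero, map_zero, add_zero]
  exact ⟨LinearEquiv.ofInjectiveOfFinrankEq φ hφ hVW, hφU, hφP⟩

end Similar

section MatrixForm

variable {β β' ε : Type} [Fintype β] [DecidableEq β] [Fintype β'] [DecidableEq β']
  [Fintype ε] [DecidableEq ε]

/-- A full rank factorization `P = U V`. -/
def Fac (P : Matrix β β ℂ) (U : Matrix β ε ℂ) (V : Matrix ε β ℂ) : Prop :=
  U * V = P ∧ (∃ U' : Matrix ε β ℂ, U' * U = 1) ∧ ∃ V' : Matrix β ε ℂ, V * V' = 1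

theorem exists_left_inv {U : Matrix β ε ℂ} (h : Function.Injective U.mulVec) :
    ∃ U' : Matrix ε β ℂ, U' * U = 1 := by
  obtain ⟨l, hl⟩ := LinearMap.exists_leftInverse_of_injective (Matrix.toLin' U)
    (LinearMap.ker_eq_bot.2 h)
  refine ⟨LinearMap.toMatrix' l, ?_⟩
  apply Matrix.toLin'.injective
  rw [Matrix.toLin'_mul, Matrix.toLin'_toMatrix', hl, Matrix.toLin'_one]

theorem exists_right_inv {V : Matrix ε β ℂ} (h : Function.Surjective V.mulVec) :
    ∃ V' : Matrix β ε ℂ, V * V' = 1 := by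
  obtain ⟨l, hl⟩ := LinearMap.exists_rightInverse_of_surjective (Matrix.toLin' V)
    (LinearMap.range_eq_top.2 h)
  refine ⟨LinearMap.toMatrix' l, ?_⟩
  apply Matrix.toLin'.injective
  rw [Matrix.toLin'_mul, Matrix.toLin'_toMatrix', hl, Matrix.toLin'_one]

theorem injective_of_left_inv {U : Matrix β ε ℂ} {U' : Matrix ε β ℂ} (h : U' * U = 1) :
    Function.Injective U.mulVec := fun v w hvw => by
  have := congrArg (U' *ᵥ ·) hvw
  simpa [Matrix.mulVec_mulVec, h] using this

theorem surjective_of_right_inv {V : Matrix ε β ℂ} {V' : Matrix β ε ℂ} (h : V * V' = 1) :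
    Function.Surjective V.mulVec := fun v => ⟨V' *ᵥ v, by
  rw [Matrix.mulVec_mulVec, h, Matrix.one_mulVec]⟩

theorem exists_fac (P : Matrix β β ℂ) {r : ℕ} (hr : P.rank = r) :
    ∃ (U : Matrix β (Fin r) ℂ) (V : Matrix (Fin r) β ℂ), Fac P U V := by
  let f := Matrix.toLin' P
  have hf : Module.finrank ℂ (LinearMap.range f) = Module.finrank ℂ (Fin r → ℂ) := by
    rw [Module.finrank_fin_fun, ← hr]; rfl
  let φ := LinearEquiv.ofFinrankEq _ _ hf
  let u := (LinearMap.range f).subtype ∘ₗ φ.symm.toLinearMap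
  let v := φ.toLinearMap ∘ₗ f.rangeRestrict
  refine ⟨LinearMap.toMatrix' u, LinearMap.toMatrix' v, ?_, exists_left_inv ?_,
    exists_right_inv ?_⟩
  · rw [← LinearMap.toMatrix'_comp]
    apply Matrix.toLin'.injective
    rw [Matrix.toLin'_toMatrix']
    apply LinearMap.ext
    intro x
    simp [u, v, f]
  · have : (LinearMap.toMatrix' u).mulVec = u := by
      funext x; rw [LinearMap.toMatrix'_mulVec]
    rw [this]
    exact Subtype.val_injective.comp φ.symm.injective
  · have : (LinearMap.toMatrix' v).mulVec = v := by
      funext x; rw [LinearMap.toMatrix'_mulVec]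
    rw [this]
    exact φ.surjective.comp f.surjective_rangeRestrict

theorem rank_mul_mul {P : Matrix ε ε ℂ} {U : Matrix β ε ℂ} {V : Matrix ε β ℂ}
    {U' : Matrix ε β ℂ} {V' : Matrix β ε ℂ} (hU : U' * U = 1) (hV : V * V' = 1) :
    (U * P * V).rank = P.rank := by
  apply le_antisymm
  · exact (Matrix.rank_mul_le_left _ _).trans (Matrix.rank_mul_le_right _ _)
  · have : P = U' * (U * P * V) * V' := by
      rw [← Matrix.mul_assoc, ← Matrix.mul_assoc, hU, Matrix.one_mul, Matrix.mul_assoc, hV,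
        Matrix.mul_one]
    conv_lhs => rw [this]
    exact (Matrix.rank_mul_le_left _ _).trans (Matrix.rank_mul_le_right _ _)

theorem Fac.rank_eq {P : Matrix β β ℂ} {U : Matrix β ε ℂ} {V : Matrix ε β ℂ} (h : Fac P U V) :
    P.rank = Fintype.card ε := by
  obtain ⟨h1, ⟨U', h2⟩, V', h3⟩ := h
  have := rank_mul_mul (P := (1 : Matrix ε ε ℂ)) h2 h3
  rw [Matrix.mul_one, h1, Matrix.rank_one] at this
  exact this

theorem exists_mat_equiv (hc : Fintype.card β = Fintype.card β') {U : Matrix β ε ℂ}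
    {U' : Matrix β' ε ℂ} {V : Matrix ε β ℂ} {V' : Matrix ε β' ℂ}
    (hU : Function.Injective U.mulVec) (hU' : Function.Injective U'.mulVec)
    (hV : Function.Surjective V.mulVec) (hV' : Function.Surjective V'.mulVec)
    (h : V * U = V' * U') :
    ∃ (g : Matrix β' β ℂ) (g' : Matrix β β' ℂ), g * g' = 1 ∧ g' * g = 1 ∧ g * U = U' ∧
      V' * g = V := by
  obtain ⟨φ, h1, h2⟩ := exists_equiv_of_comp_eq (V := β → ℂ) (W := β' → ℂ) (by simpa using hc)
    (U := Matrix.toLin' U) (U' := Matrix.toLin' U') (P := Matrix.toLin' V) (P' := Matrix.toLin' V')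
    hU hU' hV hV' (by rw [← Matrix.toLin'_mul, ← Matrix.toLin'_mul, h])
  refine ⟨LinearMap.toMatrix' φ.toLinearMap, LinearMap.toMatrix' φ.symm.toLinearMap, ?_, ?_, ?_, ?_⟩
  · rw [← LinearMap.toMatrix'_comp]; simp
  · rw [← LinearMap.toMatrix'_comp]; simp
  · apply Matrix.toLin'.injective
    rw [Matrix.toLin'_mul, Matrix.toLin'_toMatrix']
    apply LinearMap.ext
    intro x
    simpa using h1 x
  · apply Matrix.toLin'.injective
    rw [Matrix.toLin'_mul, Matrix.toLin'_toMatrix']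
    apply LinearMap.ext
    intro x
    exact h2 x

/-- The partial products `∏_{l < k} (M - ξ_l)`. -/
def pr (M : Matrix β β ℂ) (ξ : ℕ → ℂ) : ℕ → Matrix β β ℂ
  | 0 => 1
  | k + 1 => pr M ξ k * (M - ξ k • 1)

theorem pr_comm (M : Matrix β β ℂ) (ξ : ℕ → ℂ) (c : ℂ) (k : ℕ) :
    (M - c • 1) * pr M ξ k = pr M ξ k * (M - c • 1) := by
  induction k with
  | zero => simp [pr]
  | succ k ih =>
    have h : (M - c • 1) * (M - ξ k • 1) = (M - ξ k • 1) * (M - c • 1) := by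
      simp only [mul_sub, sub_mul, mul_smul_comm, smul_mul_assoc, mul_one, one_mul, smul_sub]
      rw [smul_comm]
      abel
    rw [pr, ← mul_assoc, ih, mul_assoc, h, mul_assoc]

theorem pr_succ' (M : Matrix β β ℂ) (ξ : ℕ → ℂ) (k : ℕ) :
    pr M ξ (k + 1) = (M - ξ 0 • 1) * pr M (fun i => ξ (i + 1)) k := by
  induction k with
  | zero => simp [pr]
  | succ k ih => rw [pr, ih, pr, mul_assoc]

theorem pr_factor {V : Matrix ε β ℂ} {M : Matrix β β ℂ} {M1 : Matrix ε ε ℂ}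
    (h : V * M = M1 * V) (ξ : ℕ → ℂ) (k : ℕ) : V * pr M ξ k = pr M1 ξ k * V := by
  induction k with
  | zero => simp [pr]
  | succ k ih =>
    rw [pr, ← Matrix.mul_assoc, ih, pr, Matrix.mul_assoc, Matrix.mul_assoc]
    congr 1
    rw [Matrix.mul_sub, Matrix.sub_mul, h, Matrix.mul_smul, Matrix.smul_mul, Matrix.mul_one,
      Matrix.one_mul]

/-- Matrices annihilated by the same product of linear factors, with equal ranks of all
partial products, are similar. -/
theorem exists_similar (N : ℕ) {β β' : Type} [Fintype β] [DecidableEq β] [Fintype β']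
    [DecidableEq β'] {M : Matrix β β ℂ} {M' : Matrix β' β' ℂ} {ξ : ℕ → ℂ}
    (hr : ∀ k ≤ N, (pr M ξ k).rank = (pr M' ξ k).rank) (h : pr M ξ N = 0) (h' : pr M' ξ N = 0) :
    ∃ (g : Matrix β' β ℂ) (g' : Matrix β β' ℂ), g * g' = 1 ∧ g' * g = 1 ∧ g * M = M' * g := by
  induction N generalizing β β' ξ with
  | zero =>
    have h1 : (1 : Matrix β β ℂ) = 0 := h
    have h2 : (1 : Matrix β' β' ℂ) = 0 := h'
    refine ⟨0, 0, ?_, ?_, ?_⟩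
    · rw [h2]; simp
    · rw [h1]; simp
    · simp
  | succ N ih =>
    have hc : Fintype.card β = Fintype.card β' := by
      have := hr 0 (by omega)
      simpa only [pr, Matrix.rank_one] using this
    obtain ⟨U, V, hUV, ⟨Ui, hUi⟩, Vi, hVi⟩ := exists_fac (M - ξ 0 • 1) rfl
    have hr1 : (M' - ξ 0 • 1).rank = (M - ξ 0 • 1).rank := by
      have := hr 1 (by omega)
      simp only [pr, Matrix.one_mul] at this
      exact this.symm
    obtain ⟨U', V', hUV', ⟨Ui', hUi'⟩, Vi', hVi'⟩ := exists_fac (M' - ξ 0 • 1) hr1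
    have key : ∀ {β : Type} [Fintype β] [DecidableEq β] {r : ℕ} {M : Matrix β β ℂ}
        {U : Matrix β (Fin r) ℂ} {V : Matrix (Fin r) β ℂ}, U * V = M - ξ 0 • 1 → ∀ k,
        pr M ξ (k + 1) = U * pr (V * U + ξ 0 • 1) (fun i => ξ (i + 1)) k * V := by
      intro β _ _ r M U V hUV k
      have hM : V * M = (V * U + ξ 0 • 1) * V := by
        rw [sub_eq_iff_eq_add.1 hUV.symm]
        simp [Matrix.mul_add, Matrix.add_mul, Matrix.mul_assoc]
      rw [pr_succ', ← hUV, Matrix.mul_assoc, pr_factor hM, Matrix.mul_assoc]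
    have cancel : ∀ {β : Type} [Fintype β] [DecidableEq β] {r : ℕ} {P : Matrix (Fin r) (Fin r) ℂ}
        {U : Matrix β (Fin r) ℂ} {V : Matrix (Fin r) β ℂ} {Ui : Matrix (Fin r) β ℂ}
        {Vi : Matrix β (Fin r) ℂ}, Ui * U = 1 → V * Vi = 1 → U * P * V = 0 → P = 0 := by
      intro β _ _ r P U V Ui Vi h1 h2 h3
      have : P = Ui * (U * P * V) * Vi := by
        rw [← Matrix.mul_assoc, ← Matrix.mul_assoc, h1, Matrix.one_mul, Matrix.mul_assoc, h2,
          Matrix.mul_one]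
      rw [this, h3]; simp
    obtain ⟨g, g', e1, e2, e3⟩ := ih (M := V * U + ξ 0 • 1) (M' := V' * U' + ξ 0 • 1)
      (ξ := fun i => ξ (i + 1)) (fun k hk => by
        have := hr (k + 1) (by omega)
        rwa [key hUV, key hUV', rank_mul_mul hUi hVi, rank_mul_mul hUi' hVi'] at this)
      (cancel hUi hVi (by rw [← key hUV, h])) (cancel hUi' hVi' (by rw [← key hUV', h']))
    have e4 : g * (V * U) = V' * U' * g := by
      rw [Matrix.mul_add, Matrix.add_mul] at e3
      simpa using e3
    obtain ⟨a, a', f1, f2, f3, f4⟩ := exists_mat_equiv hc (U := U) (U' := U' * g) (V := g * V)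
      (V' := V') (injective_of_left_inv hUi)
      (injective_of_left_inv (U' := g' * Ui') (by
        rw [Matrix.mul_assoc, ← Matrix.mul_assoc Ui', hUi', Matrix.one_mul, e2]))
      (surjective_of_right_inv (V' := Vi * g') (by
        rw [Matrix.mul_assoc, ← Matrix.mul_assoc V, hVi, Matrix.one_mul, e1]))
      (surjective_of_right_inv hVi') (by rw [Matrix.mul_assoc, e4, Matrix.mul_assoc])
    refine ⟨a, a', f1, f2, ?_⟩
    have e5 : a * (M - ξ 0 • 1) = (M' - ξ 0 • 1) * a := by
      rw [← hUV, ← hUV', ← Matrix.mul_assoc, f3, Matrix.mul_assoc, Matrix.mul_assoc, ← f4]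
    simpa [Matrix.mul_sub, Matrix.sub_mul] using e5

end MatrixForm
end HTL

namespace HTL
set_option linter.unusedSectionVars false
set_option linter.unusedSimpArgs false

/-- The data of a leg of the quiver attached to a space with basis `β`. -/
structure LegData (β : Type) (N : ℕ) (r : Fin N → ℕ) where
  u0 : (h : 0 < N) → Matrix β (Fin (r ⟨0, h⟩)) ℂ
  v0 : (h : 0 < N) → Matrix (Fin (r ⟨0, h⟩)) β ℂ
  u : (t : ℕ) → (h : t + 1 < N) → Matrix (Fin (r ⟨t, by omega⟩)) (Fin (r ⟨t + 1, h⟩)) ℂ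
  v : (t : ℕ) → (h : t + 1 < N) → Matrix (Fin (r ⟨t + 1, h⟩)) (Fin (r ⟨t, by omega⟩)) ℂ

namespace LegData

variable {β β' : Type} [Fintype β] [DecidableEq β] [Fintype β'] [DecidableEq β']
  {N : ℕ} {r : Fin N → ℕ}

/-- Composition of the maps along the leg towards the base. -/
def U (L : LegData β N r) : (t : ℕ) → (h : t < N) → Matrix β (Fin (r ⟨t, h⟩)) ℂ
  | 0, h => L.u0 h
  | t + 1, h => U L t (Nat.lt_of_succ_lt h) * L.u t h

/-- Composition of the maps along the leg away from the base. -/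
def V (L : LegData β N r) : (t : ℕ) → (h : t < N) → Matrix (Fin (r ⟨t, h⟩)) β ℂ
  | 0, h => L.v0 h
  | t + 1, h => L.v t h * V L t (Nat.lt_of_succ_lt h)

/-- The endomorphism of the base space defined by a leg. -/
def base (L : LegData β N r) (c : ℂ) : Matrix β β ℂ :=
  (if h : 0 < N then L.u0 h * L.v0 h else 0) + c • 1

/-- The incoming part of the moment map. -/
def uv (L : LegData β N r) (t : ℕ) (h : t < N) : Matrix (Fin (r ⟨t, h⟩)) (Fin (r ⟨t, h⟩)) ℂ :=
  if h' : t + 1 < N then L.u t h' * L.v t h' else 0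

/-- The outgoing part of the moment map. -/
def vu (L : LegData β N r) : (t : ℕ) → (h : t < N) → Matrix (Fin (r ⟨t, h⟩)) (Fin (r ⟨t, h⟩)) ℂ
  | 0, h => L.v0 h * L.u0 h
  | t + 1, h => L.v t h * L.u t h

/-- The moment map equations along the leg. -/
def Mom (L : LegData β N r) (ξ : ℕ → ℂ) : Prop :=
  ∀ t h, L.uv t h - L.vu t h = (ξ t - ξ (t + 1)) • 1

/-- The compositions towards the base are injective, those away from it surjective. -/
def Full (L : LegData β N r) : Prop :=
  ∀ t h, (∃ U' : Matrix (Fin (r ⟨t, h⟩)) β ℂ, U' * L.U t h = 1) ∧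
    ∃ V' : Matrix β (Fin (r ⟨t, h⟩)) ℂ, L.V t h * V' = 1

variable {L : LegData β N r} {L' : LegData β' N r} {ξ : ℕ → ℂ}

theorem base_sub (h : 0 < N) (c : ℂ) : L.base c - c • 1 = L.u0 h * L.v0 h := by
  rw [base, dif_pos h, add_sub_cancel_right]

theorem Mom.base_mul_U (hL : L.Mom ξ) (t : ℕ) (h : t < N) :
    (L.base (ξ 0) - ξ (t + 1) • 1) * L.U t h = L.U t h * L.uv t h := by
  suffices h1 : (L.base (ξ 0) - ξ t • 1) * L.U t h = L.U t h * L.vu t h by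
    rw [sub_eq_iff_eq_add.1 (hL t h), Matrix.mul_add, ← h1]
    simp only [Matrix.sub_mul, Matrix.smul_mul, Matrix.mul_smul, Matrix.one_mul, Matrix.mul_one,
      sub_smul, Matrix.mul_sub]
    abel
  induction t with
  | zero => rw [base_sub h, U, vu, Matrix.mul_assoc]
  | succ t ih =>
    have ht : t < N := Nat.lt_of_succ_lt h
    have ih' := ih ht
    have h2 : (L.base (ξ 0) - ξ (t + 1) • 1) * L.U t ht = L.U t ht * L.uv t ht := by
      rw [sub_eq_iff_eq_add.1 (hL t ht), Matrix.mul_add, ← ih']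
      simp only [Matrix.sub_mul, Matrix.smul_mul, Matrix.mul_smul, Matrix.one_mul, Matrix.mul_one,
        sub_smul, Matrix.mul_sub]
      abel
    rw [U, ← Matrix.mul_assoc, h2, uv, dif_pos h, vu, Matrix.mul_assoc, Matrix.mul_assoc,
      Matrix.mul_assoc]

theorem Mom.V_mul_base (hL : L.Mom ξ) (t : ℕ) (h : t < N) :
    L.V t h * (L.base (ξ 0) - ξ (t + 1) • 1) = L.uv t h * L.V t h := by
  suffices h1 : L.V t h * (L.base (ξ 0) - ξ t • 1) = L.vu t h * L.V t h by
    rw [sub_eq_iff_eq_add.1 (hL t h), Matrix.add_mul, ← h1]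
    simp only [Matrix.mul_sub, Matrix.smul_mul, Matrix.mul_smul, Matrix.one_mul, Matrix.mul_one,
      sub_smul, Matrix.sub_mul]
    abel
  induction t with
  | zero => rw [base_sub h, V, vu, Matrix.mul_assoc]
  | succ t ih =>
    have ht : t < N := Nat.lt_of_succ_lt h
    have ih' := ih ht
    have h2 : L.V t ht * (L.base (ξ 0) - ξ (t + 1) • 1) =
        L.uv t ht * L.V t ht := by
      rw [sub_eq_iff_eq_add.1 (hL t ht), Matrix.add_mul, ← ih']
      simp only [Matrix.mul_sub, Matrix.smul_mul, Matrix.mul_smul, Matrix.one_mul, Matrix.mul_one,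
        sub_smul, Matrix.sub_mul]
      abel
    rw [V, Matrix.mul_assoc, h2, uv, dif_pos h, vu, Matrix.mul_assoc, Matrix.mul_assoc]

theorem Mom.U_mul_V (hL : L.Mom ξ) (t : ℕ) (h : t < N) :
    L.U t h * L.V t h = pr (L.base (ξ 0)) ξ (t + 1) := by
  induction t with
  | zero => rw [U, V, pr, pr, Matrix.one_mul, base_sub h]
  | succ t ih =>
    rw [U, V, pr, ← pr_comm, ← ih (by omega), ← Matrix.mul_assoc (_ - _), hL.base_mul_U, uv,
      dif_pos h]
    simp only [Matrix.mul_assoc]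

theorem Mom.pr_eq_zero (hL : L.Mom ξ) : pr (L.base (ξ 0)) ξ (N + 1) = 0 := by
  rcases Nat.eq_zero_or_pos N with rfl | h
  · simp [pr, base]
  · obtain ⟨k, rfl⟩ : ∃ k, N = k + 1 := ⟨N - 1, by omega⟩
    rw [pr, ← pr_comm, ← hL.U_mul_V k (by omega), ← Matrix.mul_assoc, hL.base_mul_U, uv,
      dif_neg (by omega), Matrix.mul_zero, Matrix.zero_mul]

theorem Mom.rank_pr (hL : L.Mom ξ) (hF : L.Full) (t : ℕ) (h : t < N) :
    (pr (L.base (ξ 0)) ξ (t + 1)).rank = r ⟨t, h⟩ := by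
  have : Fac (pr (L.base (ξ 0)) ξ (t + 1)) (L.U t h) (L.V t h) :=
    ⟨hL.U_mul_V t h, (hF t h).1, (hF t h).2⟩
  rw [this.rank_eq, Fintype.card_fin]

/-- Every matrix with the right ranks is the base endomorphism of a leg. -/
theorem exists_leg (M : Matrix β β ℂ) (hr : ∀ t (h : t < N), (pr M ξ (t + 1)).rank = r ⟨t, h⟩)
    (h0 : pr M ξ (N + 1) = 0) :
    ∃ L : LegData β N r, L.base (ξ 0) = M ∧ L.Mom ξ ∧ L.Full := by
  have h1 := fun t h => exists_fac _ (hr t h)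
  choose Us Vs hUV Ui Vi using h1
  choose Ui hUi using Ui
  choose Vi hVi using Vi
  have cR : ∀ {γ : Type} {t} {h : t < N} {a b : Matrix γ (Fin (r ⟨t, h⟩)) ℂ},
      a * Vs t h = b * Vs t h → a = b := by
    intro γ t h a b hab
    have := congrArg (· * Vi t h) hab
    simpa only [Matrix.mul_assoc, hVi, Matrix.mul_one] using this
  have cL : ∀ {γ : Type} {t} {h : t < N} {a b : Matrix (Fin (r ⟨t, h⟩)) γ ℂ},
      Us t h * a = Us t h * b → a = b := by
    intro γ t h a b hab
    have := congrArg (Ui t h * ·) hab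
    simpa only [← Matrix.mul_assoc, hUi, Matrix.one_mul] using this
  have hp : ∀ t, pr M ξ t * (M - ξ t • 1) = pr M ξ (t + 1) := fun _ => rfl
  let L : LegData β N r :=
    { u0 := fun h => Us 0 h
      v0 := fun h => Vs 0 h
      u := fun t h => Vs t (Nat.lt_of_succ_lt h) * (M - ξ (t + 1) • 1) * Vi (t + 1) h
      v := fun t h => Ui (t + 1) h * (M - ξ (t + 1) • 1) * Us t (Nat.lt_of_succ_lt h) }
  have hU : ∀ t h, L.U t h = Us t h := by
    intro t h
    induction t with
    | zero => rfl
    | succ t ih =>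
      rw [U, ih (Nat.lt_of_succ_lt h)]
      simp only [L]
      rw [← Matrix.mul_assoc, ← Matrix.mul_assoc, hUV, hp, ← hUV (t + 1) h, Matrix.mul_assoc, hVi,
        Matrix.mul_one]
  have hV : ∀ t h, L.V t h = Vs t h := by
    intro t h
    induction t with
    | zero => rfl
    | succ t ih =>
      rw [V, ih (Nat.lt_of_succ_lt h)]
      simp only [L]
      rw [Matrix.mul_assoc, Matrix.mul_assoc, hUV, pr_comm, hp, ← hUV (t + 1) h,
        ← Matrix.mul_assoc, hUi, Matrix.one_mul]
  have hb : L.base (ξ 0) = M := by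
    rw [base]
    split_ifs with h
    · simp only [L]
      rw [hUV]
      simp [pr]
    · have : N = 0 := by omega
      subst this
      have : M - ξ 0 • 1 = 0 := by simpa [pr] using h0
      rw [zero_add, sub_eq_zero.1 this]
  have huv : ∀ t h, Us t h * L.uv t h = (M - ξ (t + 1) • 1) * Us t h := by
    intro t h
    apply cR
    rw [Matrix.mul_assoc (_ - _), hUV, pr_comm, hp, uv]
    split_ifs with h'
    · rw [Matrix.mul_assoc, Matrix.mul_assoc]
      have e1 := hU (t + 1) h'
      have e2 := hV (t + 1) h'
      rw [U, hU] at e1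
      rw [V, hV] at e2
      rw [e2, ← Matrix.mul_assoc, e1, hUV]
    · have : t + 1 = N := by omega
      subst this
      rw [h0]; simp
  have hvu : ∀ t h, Us t h * L.vu t h = (M - ξ t • 1) * Us t h := by
    intro t h
    cases t with
    | zero =>
      simp only [vu, L]
      rw [← Matrix.mul_assoc, hUV]
      simp [pr]
    | succ t =>
      have e1 := hU (t + 1) h
      rw [U, hU] at e1
      have e2 := huv t (by omega)
      rw [uv, dif_pos h, ← Matrix.mul_assoc, e1] at e2
      rw [vu, ← Matrix.mul_assoc, e2, Matrix.mul_assoc, e1]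
  refine ⟨L, hb, fun t h => cL ?_, fun t h => ⟨⟨Ui t h, ?_⟩, Vi t h, ?_⟩⟩
  · rw [Matrix.mul_sub, huv, hvu]
    simp only [Matrix.sub_mul, Matrix.smul_mul, Matrix.mul_smul, Matrix.one_mul, Matrix.mul_one,
      sub_smul, Matrix.mul_sub]
    abel
  · rw [hU, hUi]
  · rw [hV, hVi]

/-- Intertwining of two legs. -/
def Int (L : LegData β N r) (L' : LegData β' N r) (g : Matrix β' β ℂ)
    (gt : ∀ t (h : t < N), Matrix (Fin (r ⟨t, h⟩)) (Fin (r ⟨t, h⟩)) ℂ) : Prop :=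
  (∀ h, g * L.u0 h = L'.u0 h * gt 0 h ∧ gt 0 h * L.v0 h = L'.v0 h * g) ∧
  ∀ (t : ℕ) (h : t + 1 < N), gt t (Nat.lt_of_succ_lt h) * L.u t h = L'.u t h * gt (t + 1) h ∧
    gt (t + 1) h * L.v t h = L'.v t h * gt t (Nat.lt_of_succ_lt h)

theorem Int.base {g : Matrix β' β ℂ} {gt} (hI : L.Int L' g gt) (c : ℂ) :
    g * L.base c = L'.base c * g := by
  rw [LegData.base, LegData.base]
  split_ifs with h
  · rw [Matrix.mul_add, Matrix.add_mul, ← Matrix.mul_assoc, (hI.1 h).1, Matrix.mul_assoc,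
      (hI.1 h).2]
    simp [Matrix.mul_assoc]
  · simp

theorem exists_int (hL : L.Mom ξ) (hF : L.Full) (hL' : L'.Mom ξ) (hF' : L'.Full)
    {g : Matrix β' β ℂ} (hg : g * L.base (ξ 0) = L'.base (ξ 0) * g) :
    ∃ gt, L.Int L' g gt ∧ ∀ t h, L'.U t h * gt t h = g * L.U t h := by
  have hpr : ∀ k, g * pr (L.base (ξ 0)) ξ k = pr (L'.base (ξ 0)) ξ k * g := pr_factor hg ξ
  have h1 : ∀ t h, ∃ a : Matrix (Fin (r ⟨t, h⟩)) (Fin (r ⟨t, h⟩)) ℂ,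
      L'.U t h * a = g * L.U t h ∧ a * L.V t h = L'.V t h * g := by
    intro t h
    obtain ⟨-, Vi, hVi⟩ := hF t h
    obtain ⟨⟨Ui, hUi⟩, -⟩ := hF' t h
    have e1 := hpr (t + 1)
    rw [← hL.U_mul_V t h, ← hL'.U_mul_V t h] at e1
    refine ⟨Ui * g * L.U t h, ?_, ?_⟩
    · have : g * L.U t h = L'.U t h * (L'.V t h * g * Vi) := by
        rw [← Matrix.mul_assoc, ← Matrix.mul_assoc, ← e1, Matrix.mul_assoc, Matrix.mul_assoc, hVi,
          Matrix.mul_one]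
      rw [Matrix.mul_assoc Ui, this, ← Matrix.mul_assoc Ui, hUi, Matrix.one_mul]
    · rw [Matrix.mul_assoc, Matrix.mul_assoc, e1, Matrix.mul_assoc, ← Matrix.mul_assoc, hUi,
        Matrix.one_mul]
  choose gt hU hV using h1
  have cL : ∀ {γ : Type} {t} {h : t < N} {a b : Matrix (Fin (r ⟨t, h⟩)) γ ℂ},
      L'.U t h * a = L'.U t h * b → a = b := by
    intro γ t h a b hab
    obtain ⟨⟨Ui, hUi⟩, -⟩ := hF' t h
    have := congrArg (Ui * ·) hab
    simpa only [← Matrix.mul_assoc, hUi, Matrix.one_mul] using this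
  have cR : ∀ {γ : Type} {t} {h : t < N} {a b : Matrix γ (Fin (r ⟨t, h⟩)) ℂ},
      a * L.V t h = b * L.V t h → a = b := by
    intro γ t h a b hab
    obtain ⟨-, Vi, hVi⟩ := hF t h
    have := congrArg (· * Vi) hab
    simpa only [Matrix.mul_assoc, hVi, Matrix.mul_one] using this
  refine ⟨gt, ⟨fun h => ⟨(hU 0 h).symm, hV 0 h⟩, fun t h => ⟨cL ?_, cR ?_⟩⟩, hU⟩
  · rw [← Matrix.mul_assoc, hU, ← Matrix.mul_assoc]
    exact (Matrix.mul_assoc g _ _).trans (hU (t + 1) h).symm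
  · rw [Matrix.mul_assoc, Matrix.mul_assoc, hV]
    have := hV (t + 1) h
    rw [V, V, Matrix.mul_assoc] at this
    exact this

/-- An isomorphism of base endomorphisms lifts to the legs. -/
theorem exists_int_equiv (hL : L.Mom ξ) (hF : L.Full) (hL' : L'.Mom ξ) (hF' : L'.Full)
    {g : Matrix β' β ℂ} {g' : Matrix β β' ℂ} (h1 : g * g' = 1) (h2 : g' * g = 1)
    (hg : g * L.base (ξ 0) = L'.base (ξ 0) * g) :
    ∃ gt gt' : ∀ t (h : t < N), Matrix (Fin (r ⟨t, h⟩)) (Fin (r ⟨t, h⟩)) ℂ, L.Int L' g gt ∧ ∀ t h, gt t h * gt' t h = 1 ∧ gt' t h * gt t h = 1 := by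
  have hg' : g' * L'.base (ξ 0) = L.base (ξ 0) * g' := by
    have := congrArg (g' * · * g') hg
    simp only [← Matrix.mul_assoc, h2, Matrix.one_mul] at this
    rw [Matrix.mul_assoc, h1, Matrix.mul_one] at this
    exact this.symm
  obtain ⟨gt, hI, hU⟩ := exists_int hL hF hL' hF' hg
  obtain ⟨gt', -, hU'⟩ := exists_int hL' hF' hL hF hg'
  refine ⟨gt, gt', hI, fun t h => ⟨?_, ?_⟩⟩
  · obtain ⟨⟨Ui, hUi⟩, -⟩ := hF' t h
    have : L'.U t h * (gt t h * gt' t h) = L'.U t h := by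
      rw [← Matrix.mul_assoc, hU, Matrix.mul_assoc, hU', ← Matrix.mul_assoc, h1, Matrix.one_mul]
    have := congrArg (Ui * ·) this
    simpa only [← Matrix.mul_assoc, hUi, Matrix.one_mul] using this
  · obtain ⟨⟨Ui, hUi⟩, -⟩ := hF t h
    have : L.U t h * (gt' t h * gt t h) = L.U t h := by
      rw [← Matrix.mul_assoc, hU', Matrix.mul_assoc, hU, ← Matrix.mul_assoc, h2, Matrix.one_mul]
    have := congrArg (Ui * ·) this
    simpa only [← Matrix.mul_assoc, hUi, Matrix.one_mul] using this

/-- Families of subspaces invariant under the maps of a leg. -/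
def Inv (L : LegData β N r) (W : Submodule ℂ (β → ℂ))
    (Wt : ∀ t (h : t < N), Submodule ℂ (Fin (r ⟨t, h⟩) → ℂ)) : Prop :=
  (∀ h, (∀ x ∈ Wt 0 h, L.u0 h *ᵥ x ∈ W) ∧ ∀ x ∈ W, L.v0 h *ᵥ x ∈ Wt 0 h) ∧
  ∀ (t : ℕ) (h : t + 1 < N), (∀ x ∈ Wt (t + 1) h, L.u t h *ᵥ x ∈ Wt t (Nat.lt_of_succ_lt h)) ∧
    ∀ x ∈ Wt t (Nat.lt_of_succ_lt h), L.v t h *ᵥ x ∈ Wt (t + 1) h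

theorem Inv.base {W : Submodule ℂ (β → ℂ)} {Wt : ∀ t (h : t < N), Submodule ℂ (Fin (r ⟨t, h⟩) → ℂ)}
    (hI : L.Inv W Wt) (c : ℂ) :
    ∀ x ∈ W, L.base c *ᵥ x ∈ W := by
  intro x hx
  rw [LegData.base, Matrix.add_mulVec]
  refine add_mem ?_ ?_
  · split_ifs with h
    · rw [← Matrix.mulVec_mulVec]
      exact (hI.1 h).1 _ ((hI.1 h).2 _ hx)
    · simp
  · rw [Matrix.smul_mulVec, Matrix.one_mulVec]
    exact W.smul_mem _ hx

theorem Mom.inv_ker (hL : L.Mom ξ) :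
    L.Inv ⊥ fun t h => LinearMap.ker (Matrix.mulVecLin (L.U t h)) := by
  refine ⟨fun h => ⟨fun x hx => hx, fun x hx => ?_⟩, fun t h => ⟨fun x hx => ?_, fun x hx => ?_⟩⟩
  · rw [Submodule.mem_bot] at hx
    rw [hx, Matrix.mulVec_zero]
    exact zero_mem _
  · rw [LinearMap.mem_ker, Matrix.mulVecLin_apply] at hx ⊢
    rw [Matrix.mulVec_mulVec]
    exact hx
  · rw [LinearMap.mem_ker, Matrix.mulVecLin_apply] at hx ⊢
    have := hL.base_mul_U t (by omega)
    rw [uv, dif_pos h] at this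
    rw [Matrix.mulVec_mulVec, U, Matrix.mul_assoc, ← this, ← Matrix.mulVec_mulVec, hx,
      Matrix.mulVec_zero]

theorem Mom.inv_map (hL : L.Mom ξ) {W : Submodule ℂ (β → ℂ)}
    (hW : ∀ x ∈ W, L.base (ξ 0) *ᵥ x ∈ W) :
    L.Inv W fun t h => W.map (Matrix.mulVecLin (L.V t h)) := by
  have hW' : ∀ c : ℂ, ∀ x ∈ W, (L.base (ξ 0) - c • 1) *ᵥ x ∈ W := by
    intro c x hx
    rw [Matrix.sub_mulVec, Matrix.smul_mulVec, Matrix.one_mulVec]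
    exact sub_mem (hW x hx) (W.smul_mem _ hx)
  refine ⟨fun h => ⟨?_, fun x hx => ⟨x, hx, rfl⟩⟩, fun t h => ⟨?_, ?_⟩⟩
  · rintro _ ⟨x, hx, rfl⟩
    rw [Matrix.mulVecLin_apply, Matrix.mulVec_mulVec, V, ← base_sub h (ξ 0)]
    exact hW' _ x hx
  · rintro _ ⟨x, hx, rfl⟩
    refine ⟨(L.base (ξ 0) - ξ (t + 1) • 1) *ᵥ x, hW' _ x hx, ?_⟩
    rw [Matrix.mulVecLin_apply, Matrix.mulVecLin_apply, Matrix.mulVec_mulVec, hL.V_mul_base, uv,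
      dif_pos h, Matrix.mulVec_mulVec, V, Matrix.mul_assoc]
  · rintro _ ⟨x, hx, rfl⟩
    refine ⟨x, hx, ?_⟩
    rw [Matrix.mulVecLin_apply, Matrix.mulVecLin_apply, Matrix.mulVec_mulVec, V]

theorem Inv.eq_bot {Wt : ∀ t (h : t < N), Submodule ℂ (Fin (r ⟨t, h⟩) → ℂ)}
    (hI : L.Inv ⊥ Wt) (hF : L.Full) (t : ℕ) (h : t < N) : Wt t h = ⊥ := by
  have h1 : ∀ x ∈ Wt t h, L.U t h *ᵥ x = 0 := by
    induction t with
    | zero => exact fun x hx => (hI.1 h).1 x hx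
    | succ t ih =>
      intro x hx
      rw [U, ← Matrix.mulVec_mulVec]
      exact ih (by omega) _ ((hI.2 t h).1 x hx)
  obtain ⟨⟨Ui, hUi⟩, -⟩ := hF t h
  rw [eq_bot_iff]
  intro x hx
  have := congrArg (Ui *ᵥ ·) (h1 x hx)
  simpa [Matrix.mulVec_mulVec, hUi] using this

theorem Inv.eq_top {Wt : ∀ t (h : t < N), Submodule ℂ (Fin (r ⟨t, h⟩) → ℂ)}
    (hI : L.Inv ⊤ Wt) (hF : L.Full) (t : ℕ) (h : t < N) : Wt t h = ⊤ := by
  have h1 : ∀ x, L.V t h *ᵥ x ∈ Wt t h := by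
    induction t with
    | zero => exact fun x => (hI.1 h).2 x trivial
    | succ t ih =>
      intro x
      rw [V, ← Matrix.mulVec_mulVec]
      exact (hI.2 t h).2 _ (ih (by omega) x)
  obtain ⟨-, Vi, hVi⟩ := hF t h
  rw [eq_top_iff]
  intro x _
  have := h1 (Vi *ᵥ x)
  rwa [Matrix.mulVec_mulVec, hVi, Matrix.one_mulVec] at this

end LegData
end HTL

namespace HTL
set_option linter.unusedSectionVars false
set_option linter.unusedSimpArgs false

section Blocks

variable {ι κ : Type} [Fintype ι] [DecidableEq ι] [Fintype κ] [DecidableEq κ]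
  {β : ι → Type} [∀ j, Fintype (β j)] [∀ j, DecidableEq (β j)]
  {γ : κ → Type} [∀ j, Fintype (γ j)] [∀ j, DecidableEq (γ j)] {τ : Type} [Fintype τ]

/-- The inclusion of a block. -/
def inj (β : ι → Type) [∀ j, DecidableEq (β j)] (j : ι) : Matrix (Σ j, β j) (β j) ℂ :=
  Matrix.of fun s r => if s = ⟨j, r⟩ then 1 else 0

/-- The projection to a block. -/
def prj (β : ι → Type) [∀ j, DecidableEq (β j)] (j : ι) : Matrix (β j) (Σ j, β j) ℂ :=
  Matrix.of fun r s => if s = ⟨j, r⟩ then 1 else 0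

/-- The block projections as endomorphisms. -/
def eb (β : ι → Type) [∀ j, Fintype (β j)] [∀ j, DecidableEq (β j)] (j : ι) :
    Matrix (Σ j, β j) (Σ j, β j) ℂ := inj β j * prj β j

/-- A block of a matrix. -/
def blk (M : Matrix (Σ j, β j) (Σ j, γ j) ℂ) (j : ι) (j' : κ) : Matrix (β j) (γ j') ℂ :=
  Matrix.of fun r c => M ⟨j, r⟩ ⟨j', c⟩

theorem prj_mul_apply (M : Matrix (Σ j, β j) τ ℂ) (j : ι) (r : β j) (t : τ) :
    (prj β j * M) r t = M ⟨j, r⟩ t := by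
  simp [prj, Matrix.mul_apply]

theorem mul_inj_apply (M : Matrix τ (Σ j, β j) ℂ) (j : ι) (r : β j) (t : τ) :
    (M * inj β j) t r = M t ⟨j, r⟩ := by
  simp [inj, Matrix.mul_apply]

theorem prj_mulVec_apply (v : (Σ j, β j) → ℂ) (j : ι) (r : β j) :
    (prj β j *ᵥ v) r = v ⟨j, r⟩ := by
  simp [prj, Matrix.mulVec, dotProduct]

theorem blk_eq (M : Matrix (Σ j, β j) (Σ j, γ j) ℂ) (j : ι) (j' : κ) :
    blk M j j' = prj β j * M * inj γ j' := by
  ext r c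
  rw [mul_inj_apply, prj_mul_apply]
  rfl

theorem prj_inj (j : ι) : prj β j * inj β j = 1 := by
  ext r c
  rw [prj_mul_apply]
  simp [inj, Matrix.one_apply]

theorem prj_inj_ne {j j' : ι} (h : j ≠ j') : prj β j * inj β j' = 0 := by
  ext r c
  rw [prj_mul_apply]
  simp only [inj, Matrix.of_apply, Matrix.zero_apply]
  rw [if_neg]
  intro h'
  exact h (congrArg Sigma.fst h')

theorem sum_inj_prj : ∑ j, inj β j * prj β j = 1 := by
  ext ⟨i, r⟩ t
  rw [Matrix.sum_apply, Finset.sum_eq_single i]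
  · simp only [inj, prj, Matrix.mul_apply, Matrix.of_apply, Matrix.one_apply]
    rw [Finset.sum_eq_single r]
    · by_cases h : t = ⟨i, r⟩
      · simp [h]
      · simp [h, Ne.symm h]
    · intro b _ hb
      rw [if_neg, zero_mul]
      intro h
      apply hb
      simpa using h.symm
    · simp
  · intro j _ hj
    simp only [inj, prj, Matrix.mul_apply, Matrix.of_apply]
    apply Finset.sum_eq_zero
    intro b _
    rw [if_neg, zero_mul]
    intro h
    exact hj (congrArg Sigma.fst h).symm
  · simp

theorem orth_eb : Orth (eb β) := by
  intro i j
  simp only [eb]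
  rw [Matrix.mul_assoc, ← Matrix.mul_assoc (prj β i)]
  split_ifs with h
  · subst h
    rw [prj_inj, Matrix.one_mul]
  · rw [prj_inj_ne h, Matrix.zero_mul, Matrix.mul_zero]

theorem idem_eb : idem (eb β) Finset.univ = 1 := sum_inj_prj

theorem EE_eb : EE (eb β) Finset.univ = 1 := by
  rw [EE, idem_eb, mono_one]

theorem prj_eb (j : ι) : prj β j * eb β j = prj β j := by
  rw [eb, ← Matrix.mul_assoc, prj_inj, Matrix.one_mul]

theorem eb_inj (j : ι) : eb β j * inj β j = inj β j := by
  rw [eb, Matrix.mul_assoc, prj_inj, Matrix.mul_one]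

theorem eb_mul_eb (M : Matrix (Σ j, β j) (Σ j, γ j) ℂ) (j : ι) (j' : κ) :
    eb β j * M * eb γ j' = inj β j * blk M j j' * prj γ j' := by
  rw [blk_eq]
  simp only [eb, Matrix.mul_assoc]

theorem blk_eb_mul_eb (M : Matrix (Σ j, β j) (Σ j, γ j) ℂ) (j : ι) (j' : κ) :
    blk (eb β j * M * eb γ j') j j' = blk M j j' := by
  rw [blk_eq, blk_eq, ← Matrix.mul_assoc, ← Matrix.mul_assoc, prj_eb, Matrix.mul_assoc _ _ (inj γ j'),
    eb_inj]

theorem eb_mul_eb_inj {M M' : Matrix (Σ j, β j) (Σ j, γ j) ℂ} {j : ι} {j' : κ} :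
    eb β j * M * eb γ j' = eb β j * M' * eb γ j' ↔ blk M j j' = blk M' j j' := by
  constructor
  · intro h
    rw [← blk_eb_mul_eb, h, blk_eb_mul_eb]
  · intro h
    rw [eb_mul_eb, h, eb_mul_eb]

theorem blk_mul {σ : Type} [Fintype σ] [DecidableEq σ] {δ : σ → Type} [∀ j, Fintype (δ j)]
    (M : Matrix (Σ j, β j) (Σ j, δ j) ℂ) (M' : Matrix (Σ j, δ j) (Σ j, γ j) ℂ) (j : ι) (j' : κ) :
    blk (M * M') j j' = ∑ s, blk M j s * blk M' s j' := by
  ext r c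
  simp only [blk, Matrix.of_apply, Matrix.mul_apply, Matrix.sum_apply, Fintype.sum_sigma]

theorem blk_ext {M M' : Matrix (Σ j, β j) (Σ j, γ j) ℂ} (h : ∀ j j', blk M j j' = blk M' j j') :
    M = M' := by
  ext ⟨j, r⟩ ⟨j', c⟩
  exact congrFun (congrFun (h j j') r) c

theorem blk_add (M M' : Matrix (Σ j, β j) (Σ j, γ j) ℂ) (j : ι) (j' : κ) :
    blk (M + M') j j' = blk M j j' + blk M' j j' := rfl

theorem blk_neg (M : Matrix (Σ j, β j) (Σ j, γ j) ℂ) (j : ι) (j' : κ) :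
    blk (-M) j j' = -blk M j j' := rfl

theorem blk_sub (M M' : Matrix (Σ j, β j) (Σ j, γ j) ℂ) (j : ι) (j' : κ) :
    blk (M - M') j j' = blk M j j' - blk M' j j' := rfl

theorem blk_smul (c : ℂ) (M : Matrix (Σ j, β j) (Σ j, γ j) ℂ) (j : ι) (j' : κ) :
    blk (c • M) j j' = c • blk M j j' := rfl

theorem blk_sum {σ : Type} (s : Finset σ) (M : σ → Matrix (Σ j, β j) (Σ j, γ j) ℂ) (j : ι)
    (j' : κ) : blk (∑ t ∈ s, M t) j j' = ∑ t ∈ s, blk (M t) j j' := by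
  ext r c
  simp only [blk, Matrix.of_apply, Matrix.sum_apply]

theorem blk_one (j : ι) : blk (1 : Matrix (Σ j, β j) (Σ j, β j) ℂ) j j = 1 := by
  rw [blk_eq, Matrix.mul_one, prj_inj]

/-- A block diagonal matrix. -/
def bd (N : ∀ j, Matrix (β j) (β j) ℂ) : Matrix (Σ j, β j) (Σ j, β j) ℂ :=
  Matrix.blockDiagonal' N

theorem prj_bd (N : ∀ j, Matrix (β j) (β j) ℂ) (j : ι) : prj β j * bd N = N j * prj β j := by
  ext r ⟨i, c⟩
  rw [prj_mul_apply, bd, Matrix.blockDiagonal'_apply]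
  simp only [prj, Matrix.mul_apply, Matrix.of_apply]
  split_ifs with h
  · have h : j = i := h
    subst h
    rw [Finset.sum_eq_single c]
    · simp
    · intro b _ hb
      rw [if_neg, mul_zero]
      intro h
      apply hb
      simpa using h.symm
    · simp
  · symm
    apply Finset.sum_eq_zero
    intro b _
    rw [if_neg, mul_zero]
    intro h'
    exact h (congrArg Sigma.fst h').symm

theorem bd_inj (N : ∀ j, Matrix (β j) (β j) ℂ) (j : ι) : bd N * inj β j = inj β j * N j := by
  have h : ∀ i, prj β i * (bd N * inj β j) = prj β i * (inj β j * N j) := by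
    intro i
    rw [← Matrix.mul_assoc, prj_bd, Matrix.mul_assoc, ← Matrix.mul_assoc (prj β i)]
    by_cases hij : i = j
    · subst hij
      rw [prj_inj, Matrix.one_mul, Matrix.mul_one]
    · rw [prj_inj_ne hij, Matrix.mul_zero, Matrix.zero_mul]
  rw [← Matrix.one_mul (bd N * _), ← Matrix.one_mul (inj β j * N j), ← sum_inj_prj,
    Matrix.sum_mul, Matrix.sum_mul]
  refine Finset.sum_congr rfl fun i _ => ?_
  rw [Matrix.mul_assoc, h, ← Matrix.mul_assoc]

theorem eb_bd (N : ∀ j, Matrix (β j) (β j) ℂ) (j : ι) : eb β j * bd N = bd N * eb β j := by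
  rw [eb, Matrix.mul_assoc, prj_bd, ← Matrix.mul_assoc, ← Matrix.mul_assoc, bd_inj]

theorem blk_bd (N : ∀ j, Matrix (β j) (β j) ℂ) (j : ι) : blk (bd N) j j = N j := by
  rw [blk_eq, Matrix.mul_assoc, bd_inj, ← Matrix.mul_assoc, prj_inj, Matrix.one_mul]

theorem blk_bd_mul (N : ∀ j, Matrix (β j) (β j) ℂ) (M : Matrix (Σ j, β j) (Σ j, γ j) ℂ) (j : ι)
    (j' : κ) : blk (bd N * M) j j' = N j * blk M j j' := by
  rw [blk_eq, blk_eq, ← Matrix.mul_assoc, prj_bd, Matrix.mul_assoc, Matrix.mul_assoc,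
    Matrix.mul_assoc]

theorem blk_mul_bd (N : ∀ j, Matrix (γ j) (γ j) ℂ) (M : Matrix (Σ j, β j) (Σ j, γ j) ℂ) (j : ι)
    (j' : κ) : blk (M * bd N) j j' = blk M j j' * N j' := by
  rw [blk_eq, blk_eq, Matrix.mul_assoc, Matrix.mul_assoc, bd_inj, Matrix.mul_assoc,
    Matrix.mul_assoc]

theorem bd_mul (N N' : ∀ j, Matrix (β j) (β j) ℂ) : bd N * bd N' = bd fun j => N j * N' j :=
  (Matrix.blockDiagonal'_mul _ _).symm

theorem bd_one : bd (fun j => (1 : Matrix (β j) (β j) ℂ)) = 1 := Matrix.blockDiagonal'_one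

theorem eq_bd_of_comm {h : Matrix (Σ j, β j) (Σ j, β j) ℂ} (hh : ∀ j, h * eb β j = eb β j * h) :
    h = bd fun j => blk h j j := by
  have h1 : ∀ j, eb β j * h = eb β j * bd fun j => blk h j j := by
    intro j
    have e1 : eb β j * h = eb β j * h * eb β j := by
      rw [Matrix.mul_assoc, hh, ← Matrix.mul_assoc]
      have := orth_eb (β := β) j j
      rw [if_pos rfl] at this
      rw [this]
    rw [e1, eb_mul_eb, eb, Matrix.mul_assoc (inj β j) _ (bd _), prj_bd, Matrix.mul_assoc]
  have h2 : ∀ M : Matrix (Σ j, β j) (Σ j, β j) ℂ, M = ∑ j, eb β j * M := by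
    intro M
    rw [← Matrix.sum_mul]
    exact ((congrArg (· * M) idem_eb).trans (Matrix.one_mul M)).symm
  exact (h2 h).trans ((Finset.sum_congr rfl fun j _ => h1 j).trans (h2 _).symm)

/-- The pairs of matrices intertwined by `h`. -/
def homAlg {S : Type} [Fintype S] [DecidableEq S] (h : Matrix S S ℂ) :
    Subalgebra ℂ (Matrix S S ℂ × Matrix S S ℂ) where
  carrier := {a | h * a.1 = a.2 * h}
  mul_mem' := by
    intro a b ha hb
    simp only [Set.mem_ofPred_eq, Prod.fst_mul, Prod.snd_mul] at *
    rw [← Matrix.mul_assoc, ha, Matrix.mul_assoc, hb, Matrix.mul_assoc]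
  add_mem' := by
    intro a b ha hb
    simp only [Set.mem_ofPred_eq, Prod.fst_add, Prod.snd_add] at *
    rw [Matrix.mul_add, ha, hb, Matrix.add_mul]
  algebraMap_mem' := by
    intro r
    simp [Algebra.algebraMap_eq_smul_one]

theorem mem_homAlg {S : Type} [Fintype S] [DecidableEq S] {h : Matrix S S ℂ} {a b : Matrix S S ℂ} :
    (a, b) ∈ homAlg h ↔ h * a = b * h := Iff.rfl

/-- The matrices preserving a subspace. -/
def invAlg {S : Type} [Fintype S] [DecidableEq S] (W : Submodule ℂ (S → ℂ)) :
    Subalgebra ℂ (Matrix S S ℂ × Matrix S S ℂ) where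
  carrier := {a | ∀ w ∈ W, a.1 *ᵥ w ∈ W}
  mul_mem' := by
    intro a b ha hb w hw
    rw [Prod.fst_mul, ← Matrix.mulVec_mulVec]
    exact ha _ (hb _ hw)
  add_mem' := by
    intro a b ha hb w hw
    rw [Prod.fst_add, Matrix.add_mulVec]
    exact add_mem (ha _ hw) (hb _ hw)
  algebraMap_mem' := by
    intro r w hw
    simp only [Algebra.algebraMap_eq_smul_one, Prod.smul_fst, Prod.fst_one, Matrix.smul_mulVec,
      Matrix.one_mulVec]
    exact W.smul_mem _ hw

theorem mem_invAlg {S : Type} [Fintype S] [DecidableEq S] {W : Submodule ℂ (S → ℂ)}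
    {a b : Matrix S S ℂ} : (a, b) ∈ invAlg W ↔ ∀ w ∈ W, a *ᵥ w ∈ W := Iff.rfl

theorem blk_mem_homAlg {g : ∀ j, Matrix (β j) (β j) ℂ} {X X' : Matrix (Σ j, β j) (Σ j, β j) ℂ}
    {j j' : ι} : (eb β j * X * eb β j', eb β j * X' * eb β j') ∈ homAlg (bd g) ↔
      g j * blk X j j' = blk X' j j' * g j' := by
  rw [mem_homAlg, Matrix.mul_assoc _ _ (bd g), eb_bd, ← Matrix.mul_assoc, ← Matrix.mul_assoc, ← Matrix.mul_assoc, ← eb_bd,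
    Matrix.mul_assoc (eb β j) (bd g), Matrix.mul_assoc (eb β j) X', eb_mul_eb_inj, blk_bd_mul,
    blk_mul_bd]

/-- The subspace assembled from subspaces of the blocks. -/
def tot (W : ∀ j, Submodule ℂ (β j → ℂ)) : Submodule ℂ ((Σ j, β j) → ℂ) :=
  ⨅ j, (W j).comap (Matrix.mulVecLin (prj β j))

theorem mem_tot {W : ∀ j, Submodule ℂ (β j → ℂ)} {v : (Σ j, β j) → ℂ} :
    v ∈ tot W ↔ ∀ j, prj β j *ᵥ v ∈ W j := by
  simp [tot, Submodule.mem_iInf]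

theorem inj_mem_tot {W : ∀ j, Submodule ℂ (β j → ℂ)} {j : ι} {v : β j → ℂ} :
    inj β j *ᵥ v ∈ tot W ↔ v ∈ W j := by
  rw [mem_tot]
  constructor
  · intro h
    have := h j
    rwa [Matrix.mulVec_mulVec, prj_inj, Matrix.one_mulVec] at this
  · intro h i
    rw [Matrix.mulVec_mulVec]
    by_cases hij : i = j
    · subst hij
      rwa [prj_inj, Matrix.one_mulVec]
    · rw [prj_inj_ne hij, Matrix.zero_mulVec]
      exact zero_mem _

theorem sum_inj_prj_mulVec (v : (Σ j, β j) → ℂ) : ∑ j, inj β j *ᵥ (prj β j *ᵥ v) = v := by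
  simp only [Matrix.mulVec_mulVec]
  rw [← Matrix.sum_mulVec, sum_inj_prj, Matrix.one_mulVec]

theorem eb_mem_tot {W : ∀ j, Submodule ℂ (β j → ℂ)} (j : ι) :
    ∀ v ∈ tot W, eb β j *ᵥ v ∈ tot W := by
  intro v hv
  rw [eb, ← Matrix.mulVec_mulVec, inj_mem_tot]
  exact mem_tot.1 hv j

theorem mul_mem_tot {W : ∀ j, Submodule ℂ (β j → ℂ)} {W' : ∀ j, Submodule ℂ (γ j → ℂ)}
    {M : Matrix (Σ j, β j) (Σ j, γ j) ℂ} :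
    (∀ v ∈ tot W', M *ᵥ v ∈ tot W) ↔ ∀ j j', ∀ v ∈ W' j', blk M j j' *ᵥ v ∈ W j := by
  constructor
  · intro h j j' v hv
    rw [blk_eq, ← Matrix.mulVec_mulVec, ← Matrix.mulVec_mulVec]
    exact mem_tot.1 (h _ (inj_mem_tot.2 hv)) j
  · intro h v hv
    rw [mem_tot]
    intro j
    rw [← sum_inj_prj_mulVec v, Matrix.mulVec_sum, Matrix.mulVec_sum]
    refine sum_mem fun j' _ => ?_
    have := h j j' _ (mem_tot.1 hv j')
    rwa [blk_eq, ← Matrix.mulVec_mulVec, ← Matrix.mulVec_mulVec] at this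

theorem eb_mul_mem_tot {W : ∀ j, Submodule ℂ (β j → ℂ)} {M : Matrix (Σ j, β j) (Σ j, β j) ℂ}
    {j j' : ι} : (∀ v ∈ tot W, (eb β j * M * eb β j') *ᵥ v ∈ tot W) ↔
      ∀ v ∈ W j', blk M j j' *ᵥ v ∈ W j := by
  constructor
  · intro h v hv
    have := mul_mem_tot.1 h j j' v hv
    rwa [blk_eb_mul_eb] at this
  · intro h v hv
    rw [eb_mul_eb, ← Matrix.mulVec_mulVec, ← Matrix.mulVec_mulVec, inj_mem_tot]
    exact h _ (mem_tot.1 hv j')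

theorem tot_comap {W : Submodule ℂ ((Σ j, β j) → ℂ)} (h : ∀ j, ∀ v ∈ W, eb β j *ᵥ v ∈ W) :
    tot (fun j => W.comap (Matrix.mulVecLin (inj β j))) = W := by
  ext v
  rw [mem_tot]
  simp only [Submodule.mem_comap, Matrix.mulVecLin_apply]
  constructor
  · intro hv
    rw [← sum_inj_prj_mulVec v]
    exact sum_mem fun j _ => hv j
  · intro hv j
    rw [Matrix.mulVec_mulVec]
    exact h j v hv

theorem finrank_tot (W : ∀ j, Submodule ℂ (β j → ℂ)) :
    Module.finrank ℂ (tot W) = ∑ j, Module.finrank ℂ (W j) := by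
  rw [← Module.finrank_pi_fintype]
  apply LinearEquiv.finrank_eq
  refine LinearEquiv.ofBijective
    (LinearMap.pi fun j => ((Matrix.mulVecLin (prj β j)).comp (tot W).subtype).codRestrict (W j)
      fun v => mem_tot.1 v.2 j) ⟨?_, ?_⟩
  · rw [injective_iff_map_eq_zero]
    intro v hv
    apply Subtype.ext
    rw [← sum_inj_prj_mulVec v.1]
    refine Finset.sum_eq_zero fun j _ => ?_
    have : prj β j *ᵥ v.1 = 0 := congrArg Subtype.val (congrFun hv j)
    rw [this, Matrix.mulVec_zero]
  · intro w
    refine ⟨⟨fun s => (w s.1).1 s.2, ?_⟩, ?_⟩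
    · rw [mem_tot]
      intro j
      convert (w j).2
      ext r
      rw [prj_mulVec_apply]
    · funext j
      apply Subtype.ext
      ext r
      exact prj_mulVec_apply _ _ _

theorem tot_eq_bot {W : ∀ j, Submodule ℂ (β j → ℂ)} : tot W = ⊥ ↔ ∀ j, W j = ⊥ := by
  constructor
  · intro h j
    rw [eq_bot_iff]
    intro v hv
    have := inj_mem_tot.2 hv
    rw [h, Submodule.mem_bot] at this
    have := congrArg (prj β j *ᵥ ·) this
    simpa [Matrix.mulVec_mulVec, prj_inj] using this
  · intro h
    rw [eq_bot_iff]
    intro v hv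
    rw [Submodule.mem_bot, ← sum_inj_prj_mulVec v]
    refine Finset.sum_eq_zero fun j _ => ?_
    have := mem_tot.1 hv j
    rw [h j, Submodule.mem_bot] at this
    rw [this, Matrix.mulVec_zero]

theorem tot_eq_top {W : ∀ j, Submodule ℂ (β j → ℂ)} : tot W = ⊤ ↔ ∀ j, W j = ⊤ := by
  constructor
  · intro h j
    rw [eq_top_iff]
    intro v _
    rw [← inj_mem_tot, h]
    trivial
  · intro h
    rw [eq_top_iff]
    intro v _
    rw [mem_tot]
    intro j
    rw [h j]
    trivial

end Blocks
end HTL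

namespace HTL
set_option linter.unusedSectionVars false
set_option linter.unusedSimpArgs false

theorem sum_dite_fibre {E T M : Type*} [Fintype E] [Fintype T] [AddCommMonoid M] {p : E → Prop}
    [DecidablePred p] (F : ∀ e, p e → M) (φ : T → E) (hφ : ∀ t, p (φ t))
    (hi : Function.Injective φ) (hs : ∀ e, p e → ∃ t, φ t = e) :
    ∑ e, (if h : p e then F e h else 0) = ∑ t, F (φ t) (hφ t) := by
  classical
  have h1 : ∑ t, F (φ t) (hφ t) = ∑ t, (if h : p (φ t) then F (φ t) h else 0) :=
    Finset.sum_congr rfl fun t _ => by rw [dif_pos (hφ t)]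
  rw [h1, ← Finset.sum_image (f := fun e => if h : p e then F e h else 0) (s := Finset.univ) (g := φ)
    fun a _ b _ h => hi h]
  symm
  apply Finset.sum_subset (Finset.subset_univ _)
  intro e _ he
  rw [dif_neg]
  intro h
  obtain ⟨t, rfl⟩ := hs e h
  exact he (Finset.mem_image_of_mem _ (Finset.mem_univ _))

theorem sum_dite_zero {E M : Type*} [Fintype E] [AddCommMonoid M] {p : E → Prop}
    [DecidablePred p] (F : ∀ e, p e → M) (hp : ∀ e, ¬ p e) :
    ∑ e, (if h : p e then F e h else 0) = 0 :=
  Finset.sum_eq_zero fun e _ => dif_neg (hp e)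

theorem sum_subtype_dite {E M : Type*} [Fintype E] [AddCommMonoid M] {p : E → Prop}
    [DecidablePred p] (F : ∀ e, p e → M) :
    ∑ t : {e // p e}, F t.1 t.2 = ∑ e, (if h : p e then F e h else 0) :=
  (sum_dite_fibre F Subtype.val (fun t => t.2) Subtype.val_injective fun e h => ⟨⟨e, h⟩, rfl⟩).symm

open ConnData

variable {D : ConnData}

/-- The index type of the blocks of the `i`-th normal form. -/
abbrev Sg (D : ConnData) (i : Fin (D.p + 1)) := Σ j : Fin (D.m i), Fin (D.nb i j)

/-- The regular indices. -/
abbrev RegIdx (D : ConnData) := {i : Fin (D.p + 1) // ¬ D.isIrr i}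

/-- The irregular index underlying a nonzero irregular index. -/
abbrev toIrr (i : D.IrrNz) : D.IrrIdx := ⟨i.1, i.2.1⟩

/-- The representation space attached to `D`. -/
abbrev RepD (D : ConnData) := ∀ e : D.Arr,
  Matrix (Fin (D.alphaV (D.qtgt e))) (Fin (D.alphaV (D.qsrc e))) ℂ ×
    Matrix (Fin (D.alphaV (D.qsrc e))) (Fin (D.alphaV (D.qtgt e))) ℂ

/-- The components of a representation on the arrows inside a component. -/
noncomputable def arr2 (x : RepD D) (i : D.IrrIdx) {j j' : Fin (D.m i.1)} (h : j < j') (k : Fin (D.dd i.1 j j')) :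
    Matrix (Fin (D.nb i.1 j')) (Fin (D.nb i.1 j)) ℂ :=
  (x (.inr (.inl ⟨i, ⟨(j, j'), h⟩, k⟩))).1

/-- The components of a representation on the reversed arrows inside a component. -/
noncomputable def arr2' (x : RepD D) (i : D.IrrIdx) {j j' : Fin (D.m i.1)} (h : j < j')
    (k : Fin (D.dd i.1 j j')) : Matrix (Fin (D.nb i.1 j)) (Fin (D.nb i.1 j')) ℂ :=
  (x (.inr (.inl ⟨i, ⟨(j, j'), h⟩, k⟩))).2

/-- The dimensions along a leg. -/
noncomputable abbrev lr (D : ConnData) (i : Fin (D.p + 1)) (j : Fin (D.m i)) : Fin (D.e i j - 1) → ℕ :=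
  fun k => D.alphaV (D.vleg i j k)

theorem two_le_natDegree (i : Fin (D.p + 1)) {j j' : Fin (D.m i)} (h : j ≠ j') :
    2 ≤ (D.q i j - D.q i j').natDegree := by
  by_contra hlt
  apply D.hqd i j j' h
  rw [← sub_eq_zero]
  ext k
  rcases k with _ | _ | k
  · simp [D.hq0]
  · simp [D.hq1]
  · rw [Polynomial.coeff_eq_zero_of_natDegree_lt (by omega), Polynomial.coeff_zero]

theorem exists_tree (D : ConnData) (i : Fin (D.p + 1)) :
    ∃ t : FTree (Fin (D.m i)), t.leaves = Finset.univ ∧ t.Valid (D.q i) :=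
  FTree.exists_valid (D.q i) Finset.univ ⟨⟨0, D.hm i⟩, Finset.mem_univ _⟩
    fun _ _ _ _ h => two_le_natDegree i h

/-- A splitting tree for the polar parts of the `i`-th normal form. -/
noncomputable def tr (D : ConnData) (i : Fin (D.p + 1)) : FTree (Fin (D.m i)) :=
  (exists_tree D i).choose

theorem tr_leaves (i : Fin (D.p + 1)) : (tr D i).leaves = Finset.univ :=
  (exists_tree D i).choose_spec.1

theorem tr_valid (i : Fin (D.p + 1)) : (tr D i).Valid (D.q i) :=
  (exists_tree D i).choose_spec.2

theorem mem_tr (i : Fin (D.p + 1)) (j : Fin (D.m i)) : j ∈ (tr D i).leaves := by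
  rw [tr_leaves]
  exact Finset.mem_univ _

theorem dd_comm (i : Fin (D.p + 1)) (j j' : Fin (D.m i)) : D.dd i j j' = D.dd i j' j := by
  rw [dd, dd, Polynomial.natDegree_sub]

/-- Block matrix form of a representation. -/
structure FlatData (D : ConnData) where
  a : ∀ i : D.IrrNz, Matrix (Sg D i.1) (Sg D 0) ℂ
  b : ∀ i : D.IrrNz, Matrix (Sg D 0) (Sg D i.1) ℂ
  X : ∀ i : D.IrrIdx, ℕ → Matrix (Sg D i.1) (Sg D i.1) ℂ
  LI : ∀ (i : D.IrrIdx) (j : Fin (D.m i.1)),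
    LegData (Fin (D.nb i.1 j)) (D.e i.1 j - 1) (lr D i.1 j)
  LR : ∀ i : RegIdx D, LegData (Sg D 0) (D.e i.1 (D.j1 i.1) - 1) (lr D i.1 (D.j1 i.1))

/-- The block matrices of a representation. -/
noncomputable def flat (x : RepD D) : FlatData D where
  a i := Matrix.of fun r c => (x (.inl (c.1, ⟨i, r.1⟩))).1 r.2 c.2
  b i := Matrix.of fun r c => (x (.inl (r.1, ⟨i, c.1⟩))).2 r.2 c.2
  X i k := Matrix.of fun r c =>
    if h : c.1 < r.1 then
      if hk : k < D.dd i.1 c.1 r.1 then arr2 x i h ⟨k, hk⟩ r.2 c.2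
      else 0
    else if h : r.1 < c.1 then
      if hk : k < D.dd i.1 r.1 c.1 then
        (tr D i.1).sg c.1 r.1 * arr2' x i h ⟨k, hk⟩ r.2 c.2
      else 0
    else 0
  LI i j :=
    { u0 := fun h => (x (.inr (.inr (.inr (.inl ⟨i, j, by omega⟩))))).1
      v0 := fun h => (x (.inr (.inr (.inr (.inl ⟨i, j, by omega⟩))))).2
      u := fun t h => (x (.inr (.inr (.inl ⟨i.1, j, ⟨t, by omega⟩⟩)))).1
      v := fun t h => (x (.inr (.inr (.inl ⟨i.1, j, ⟨t, by omega⟩⟩)))).2 }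
  LR i :=
    { u0 := fun h => Matrix.of fun r c =>
        (x (.inr (.inr (.inr (.inr (⟨i.1, i.2, by omega⟩, r.1)))))).1 r.2 c
      v0 := fun h => Matrix.of fun r c =>
        (x (.inr (.inr (.inr (.inr (⟨i.1, i.2, by omega⟩, c.1)))))).2 r c.2
      u := fun t h => (x (.inr (.inr (.inl ⟨i.1, D.j1 i.1, ⟨t, by omega⟩⟩)))).1
      v := fun t h => (x (.inr (.inr (.inl ⟨i.1, D.j1 i.1, ⟨t, by omega⟩⟩)))).2 }

theorem eq_j1 {i : Fin (D.p + 1)} (h : ¬ D.isIrr i) (j : Fin (D.m i)) : D.j1 i = j := by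
  have h1 : ¬ 1 < D.m i := fun h' => h (Or.inl h')
  have h2 := j.2
  apply Fin.ext
  simp only [j1]
  omega

theorem lt_pred {t k : ℕ} (h : t < k - 2) : t + 1 < k - 1 := by omega

/-- The components along a leg at a regular index. -/
noncomputable def regArr (F : FlatData D) {i : Fin (D.p + 1)} (h : ¬ D.isIrr i) :
    ∀ (j : Fin (D.m i)), D.j1 i = j → ∀ t : Fin (D.e i j - 2),
      Matrix (Fin (lr D i j ⟨t.1, by omega⟩)) (Fin (lr D i j ⟨t.1 + 1, by omega⟩)) ℂ ×
      Matrix (Fin (lr D i j ⟨t.1 + 1, by omega⟩)) (Fin (lr D i j ⟨t.1, by omega⟩)) ℂ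
  | _, rfl, t => ((F.LR ⟨i, h⟩).u t.1 (lt_pred t.2),
      (F.LR ⟨i, h⟩).v t.1 (lt_pred t.2))

/-- The representation with given block matrices. -/
noncomputable def unflat (F : FlatData D) : RepD D
  | .inl (j, ⟨i, j'⟩) => (blk (F.a i) j' j, blk (F.b i) j j')
  | .inr (.inl ⟨i, ⟨(j, j'), _⟩, k⟩) =>
    (blk (F.X i k.1) j' j, (tr D i.1).sg j' j • blk (F.X i k.1) j j')
  | .inr (.inr (.inl ⟨i, j, t⟩)) =>
    if h : D.isIrr i then
      ((F.LI ⟨i, h⟩ j).u t.1 (lt_pred t.2), (F.LI ⟨i, h⟩ j).v t.1 (lt_pred t.2))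
    else regArr F h j (eq_j1 h j) t
  | .inr (.inr (.inr (.inl ⟨i, ⟨j, h⟩⟩))) =>
    ((F.LI i j).u0 (by omega), (F.LI i j).v0 (by omega))
  | .inr (.inr (.inr (.inr (⟨i, h⟩, j)))) =>
    (Matrix.of fun r c => (F.LR ⟨i, h.1⟩).u0 (Nat.sub_pos_of_lt h.2) ⟨j, r⟩ c,
     Matrix.of fun r c => (F.LR ⟨i, h.1⟩).v0 (Nat.sub_pos_of_lt h.2) r ⟨j, c⟩)

theorem flat_unflat_a (F : FlatData D) : (flat (unflat F)).a = F.a := rfl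
theorem flat_unflat_b (F : FlatData D) : (flat (unflat F)).b = F.b := rfl

theorem legData_ext {β : Type} [Fintype β] [DecidableEq β] {N : ℕ} {r : Fin N → ℕ} {L L' : LegData β N r}
    (h1 : L.u0 = L'.u0) (h2 : L.v0 = L'.v0) (h3 : L.u = L'.u) (h4 : L.v = L'.v) : L = L' := by
  cases L
  cases L'
  subst h1 h2 h3 h4
  rfl

theorem unflat_leg_irr (F : FlatData D) (i : D.IrrIdx) (j : Fin (D.m i.1)) (t : Fin (D.e i.1 j - 2)) :
    unflat F (.inr (.inr (.inl ⟨i.1, j, t⟩))) =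
      ((F.LI i j).u t.1 (lt_pred t.2), (F.LI i j).v t.1 (lt_pred t.2)) :=
  dif_pos i.2

theorem unflat_leg_reg (F : FlatData D) (i : RegIdx D) (t : Fin (D.e i.1 (D.j1 i.1) - 2)) :
    unflat F (.inr (.inr (.inl ⟨i.1, D.j1 i.1, t⟩))) =
      ((F.LR i).u t.1 (lt_pred t.2), (F.LR i).v t.1 (lt_pred t.2)) :=
  dif_neg i.2

theorem flat_unflat_LI (F : FlatData D) : (flat (unflat F)).LI = F.LI := by
  funext i j
  refine legData_ext rfl rfl ?_ ?_
  · funext t h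
    exact congrArg Prod.fst (unflat_leg_irr F i j ⟨t, by omega⟩)
  · funext t h
    exact congrArg Prod.snd (unflat_leg_irr F i j ⟨t, by omega⟩)

theorem flat_unflat_LR (F : FlatData D) : (flat (unflat F)).LR = F.LR := by
  funext i
  refine legData_ext rfl rfl ?_ ?_
  · funext t h
    exact congrArg Prod.fst (unflat_leg_reg F i ⟨t, by omega⟩)
  · funext t h
    exact congrArg Prod.snd (unflat_leg_reg F i ⟨t, by omega⟩)

theorem blk_flat_X_lt (x : RepD D) (i : D.IrrIdx) {j j' : Fin (D.m i.1)} (h : j < j') (k : ℕ)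
    (hk : k < D.dd i.1 j j') :
    blk ((flat x).X i k) j' j = arr2 x i h ⟨k, hk⟩ := by
  ext r c
  simp only [blk, flat, Matrix.of_apply]
  rw [dif_pos h, dif_pos hk]

theorem blk_flat_X_gt (x : RepD D) (i : D.IrrIdx) {j j' : Fin (D.m i.1)} (h : j < j') (k : ℕ)
    (hk : k < D.dd i.1 j j') :
    blk ((flat x).X i k) j j' =
      (tr D i.1).sg j' j • arr2' x i h ⟨k, hk⟩ := by
  ext r c
  simp only [blk, flat, Matrix.of_apply]
  rw [dif_neg h.asymm, dif_pos h, dif_pos hk]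
  rfl

theorem sg_mul (i : Fin (D.p + 1)) {j j' : Fin (D.m i)} (h : j ≠ j') :
    (tr D i).sg j j' * (tr D i).sg j j' = 1 :=
  FTree.sg_mul_self (tr_valid i) (mem_tr i j) (mem_tr i j') h

theorem blk_flat_unflat_X (F : FlatData D) (i : D.IrrIdx) {j j' : Fin (D.m i.1)} (h : j ≠ j')
    (k : ℕ) (hk : k < D.dd i.1 j j') :
    blk ((flat (unflat F)).X i k) j j' = blk (F.X i k) j j' := by
  rcases lt_or_gt_of_ne h with h' | h'
  · rw [blk_flat_X_gt _ i h' k hk]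
    have : arr2' (unflat F) i h' ⟨k, hk⟩ = (tr D i.1).sg j' j • blk (F.X i k) j j' := rfl
    rw [this, smul_smul, sg_mul _ h.symm, one_smul]
  · rw [blk_flat_X_lt _ i h' k (by rwa [dd_comm])]
    rfl

/-- The contribution of the arrows inside a component to the moment map. -/
noncomputable def muX (F : FlatData D) (i : D.IrrIdx) (j : Fin (D.m i.1)) :
    Matrix (Fin (D.nb i.1 j)) (Fin (D.nb i.1 j)) ℂ :=
  ∑ j', (tr D i.1).sg j j' •
    ∑ k ∈ Finset.range (D.dd i.1 j j'), blk (F.X i k) j j' * blk (F.X i k) j' j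

/-- Transport of a square matrix along an equality of vertices. -/
noncomputable def cst {a b : D.Vq} (h : a = b) (M : Matrix (Fin (D.alphaV a)) (Fin (D.alphaV a)) ℂ) :
    Matrix (Fin (D.alphaV b)) (Fin (D.alphaV b)) ℂ :=
  Matrix.reindex (finCongr (congrArg D.alphaV h)) (finCongr (congrArg D.alphaV h)) M

theorem mu_eq (x : RepD D) (a : D.Vq) :
    FinQuiver.mu (Q := D.quiv) (α := D.alphaV) x a =
      (∑ e : D.Arr, if h : D.qtgt e = a then cst h ((x e).1 * (x e).2) else 0) -
      ∑ e : D.Arr, if h : D.qsrc e = a then cst h ((x e).2 * (x e).1) else 0 := rfl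

theorem arr_two (x : RepD D) (i : D.IrrIdx) (j : Fin (D.m i.1)) :
    (∑ e : D.Arr2, if h : D.qtgt (.inr (.inl e)) = D.vmid i j then
        cst h ((x (.inr (.inl e))).1 * (x (.inr (.inl e))).2) else 0) -
    (∑ e : D.Arr2, if h : D.qsrc (.inr (.inl e)) = D.vmid i j then
        cst h ((x (.inr (.inl e))).2 * (x (.inr (.inl e))).1) else 0) = muX (flat x) i j := by
  have e1 : (∑ e : D.Arr2, if h : D.qtgt (.inr (.inl e)) = D.vmid i j then
        cst h ((x (.inr (.inl e))).1 * (x (.inr (.inl e))).2) else 0) =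
      ∑ t : Σ j' : {j' : Fin (D.m i.1) // j' < j}, Fin (D.dd i.1 j'.1 j),
        arr2 x i t.1.2 t.2 * arr2' x i t.1.2 t.2 :=
    (sum_dite_fibre (T := Σ j' : {j' : Fin (D.m i.1) // j' < j}, Fin (D.dd i.1 j'.1 j))
      (F := fun (e : D.Arr2) h => cst h ((x (.inr (.inl e))).1 * (x (.inr (.inl e))).2))
      (φ := fun t => ⟨i, ⟨(t.1.1, j), t.1.2⟩, t.2⟩) (hφ := fun _ => rfl)
      (hi := by
        rintro ⟨⟨s, hs⟩, k⟩ ⟨⟨s', hs'⟩, k'⟩ h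
        cases h
        rfl)
      (hs := by
        rintro ⟨i', ⟨⟨s, s'⟩, hs⟩, k⟩ h
        cases h
        exact ⟨⟨⟨s, hs⟩, k⟩, rfl⟩)).trans rfl
  have e2 : (∑ e : D.Arr2, if h : D.qsrc (.inr (.inl e)) = D.vmid i j then
        cst h ((x (.inr (.inl e))).2 * (x (.inr (.inl e))).1) else 0) =
      ∑ t : Σ j' : {j' : Fin (D.m i.1) // j < j'}, Fin (D.dd i.1 j j'.1),
        arr2' x i t.1.2 t.2 * arr2 x i t.1.2 t.2 :=
    (sum_dite_fibre (T := Σ j' : {j' : Fin (D.m i.1) // j < j'}, Fin (D.dd i.1 j j'.1))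
      (F := fun (e : D.Arr2) h => cst h ((x (.inr (.inl e))).2 * (x (.inr (.inl e))).1))
      (φ := fun t => ⟨i, ⟨(j, t.1.1), t.1.2⟩, t.2⟩) (hφ := fun _ => rfl)
      (hi := by
        rintro ⟨⟨s, hs⟩, k⟩ ⟨⟨s', hs'⟩, k'⟩ h
        cases h
        rfl)
      (hs := by
        rintro ⟨i', ⟨⟨s, s'⟩, hs⟩, k⟩ h
        cases h
        exact ⟨⟨⟨s', hs⟩, k⟩, rfl⟩)).trans rfl
  refine (congrArg₂ (· - ·) e1 e2).trans ?_
  show (∑ t : Σ j' : {j' : Fin (D.m i.1) // j' < j}, Fin (D.dd i.1 j'.1 j),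
        arr2 x i t.1.2 t.2 * arr2' x i t.1.2 t.2) -
      ∑ t : Σ j' : {j' : Fin (D.m i.1) // j < j'}, Fin (D.dd i.1 j j'.1),
        arr2' x i t.1.2 t.2 * arr2 x i t.1.2 t.2 = _
  rw [Fintype.sum_sigma, Fintype.sum_sigma,
    sum_subtype_dite (p := fun j' => j' < j) (F := fun j' h => ∑ k : Fin (D.dd i.1 j' j),
      arr2 x i h k * arr2' x i h k),
    sum_subtype_dite (p := fun j' => j < j') (F := fun j' h => ∑ k : Fin (D.dd i.1 j j'),
      arr2' x i h k * arr2 x i h k),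
    ← Finset.sum_sub_distrib, muX]
  refine Finset.sum_congr rfl fun j' _ => ?_
  rcases lt_trichotomy j j' with h | h | h
  · rw [dif_neg h.asymm, dif_pos h, Finset.sum_range, zero_sub, Finset.smul_sum,
      ← Finset.sum_neg_distrib]
    refine Finset.sum_congr rfl fun k _ => ?_
    rw [blk_flat_X_lt x i h k.1 k.2, blk_flat_X_gt x i h k.1 k.2, Matrix.smul_mul, smul_smul,
      FTree.sg_swap, neg_mul, sg_mul _ h.ne', neg_smul, one_smul]
  · subst h
    simp [dd]
  · rw [dif_pos h, dif_neg h.asymm, sub_zero, dd_comm i.1 j j', Finset.sum_range, Finset.smul_sum]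
    refine Finset.sum_congr rfl fun k _ => ?_
    rw [blk_flat_X_lt x i h k.1 k.2, blk_flat_X_gt x i h k.1 k.2, Matrix.mul_smul, smul_smul,
      sg_mul _ h.ne', one_smul]

end HTL

namespace HTL
set_option linter.unusedSectionVars false
set_option linter.unusedSimpArgs false
open ConnData
variable {D : ConnData}

/-- Part of the moment map coming from arrows with given target. -/
noncomputable def tS {E : Type} [Fintype E] (x : RepD D) (ι : E → D.Arr) (a : D.Vq) :
    Matrix (Fin (D.alphaV a)) (Fin (D.alphaV a)) ℂ :=
  ∑ e, if h : D.qtgt (ι e) = a then cst h ((x (ι e)).1 * (x (ι e)).2) else 0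

/-- Part of the moment map coming from arrows with given source. -/
noncomputable def sS {E : Type} [Fintype E] (x : RepD D) (ι : E → D.Arr) (a : D.Vq) :
    Matrix (Fin (D.alphaV a)) (Fin (D.alphaV a)) ℂ :=
  ∑ e, if h : D.qsrc (ι e) = a then cst h ((x (ι e)).2 * (x (ι e)).1) else 0

/-- Inclusion of a family of arrows. -/
abbrev ar1 (D : ConnData) : D.Arr1 → D.Arr := Sum.inl
/-- Inclusion of a family of arrows. -/
abbrev ar2 (D : ConnData) : D.Arr2 → D.Arr := fun e => .inr (.inl e)
/-- Inclusion of a family of arrows. -/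
abbrev ar3 (D : ConnData) : D.Arr3 → D.Arr := fun e => .inr (.inr (.inl e))
/-- Inclusion of a family of arrows. -/
abbrev ar4 (D : ConnData) : D.Arr4 → D.Arr := fun e => .inr (.inr (.inr (.inl e)))
/-- Inclusion of a family of arrows. -/
abbrev ar5 (D : ConnData) : D.Arr5 → D.Arr := fun e => .inr (.inr (.inr (.inr e)))

theorem mu_split (x : RepD D) (a : D.Vq) :
    FinQuiver.mu (Q := D.quiv) (α := D.alphaV) x a =
      (tS x (ar1 D) a + (tS x (ar2 D) a + (tS x (ar3 D) a + (tS x (ar4 D) a + tS x (ar5 D) a)))) -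
      (sS x (ar1 D) a + (sS x (ar2 D) a + (sS x (ar3 D) a + (sS x (ar4 D) a + sS x (ar5 D) a)))) := by
  rw [mu_eq, Fintype.sum_sum_type, Fintype.sum_sum_type, Fintype.sum_sum_type,
    Fintype.sum_sum_type, Fintype.sum_sum_type, Fintype.sum_sum_type, Fintype.sum_sum_type,
    Fintype.sum_sum_type]
  rfl

theorem tS_zero {E : Type} [Fintype E] (x : RepD D) (ι : E → D.Arr) (a : D.Vq)
    (h : ∀ e, D.qtgt (ι e) ≠ a) : tS x ι a = 0 := sum_dite_zero _ h

theorem sS_zero {E : Type} [Fintype E] (x : RepD D) (ι : E → D.Arr) (a : D.Vq)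
    (h : ∀ e, D.qsrc (ι e) ≠ a) : sS x ι a = 0 := sum_dite_zero _ h

theorem arr_one_tgt (x : RepD D) (i : D.IrrNz) (j : Fin (D.m i.1)) :
    tS x (ar1 D) (D.vmid (toIrr i) j) = blk ((flat x).a i * (flat x).b i) j j := by
  rw [blk_mul]
  refine (sum_dite_fibre (T := Fin (D.m 0))
      (F := fun (e : D.Arr1) h => cst h ((x (.inl e)).1 * (x (.inl e)).2))
      (φ := fun t => (t, ⟨i, j⟩)) (hφ := fun _ => rfl)
      (hi := by
        intro s t h
        cases h
        rfl)
      (hs := by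
        rintro ⟨s, ⟨i', hi⟩, j'⟩ h
        obtain ⟨i, hi2⟩ := i
        cases h
        exact ⟨s, rfl⟩)).trans rfl

theorem arr_one_src (x : RepD D) (j : Fin (D.m 0)) :
    sS x (ar1 D) (D.vmid0 j) = ∑ i : D.IrrNz, blk ((flat x).b i * (flat x).a i) j j := by
  simp only [blk_mul]
  rw [← Fintype.sum_sigma']
  refine (sum_dite_fibre (T := Σ i : D.IrrNz, Fin (D.m i.1))
      (F := fun (e : D.Arr1) h => cst h ((x (.inl e)).2 * (x (.inl e)).1))
      (φ := fun t => (j, t)) (hφ := fun _ => rfl)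
      (hi := by
        intro s t h
        cases h
        rfl)
      (hs := by
        rintro ⟨s, ⟨i', hi⟩, j'⟩ h
        cases h
        exact ⟨⟨⟨i', hi⟩, j'⟩, rfl⟩)).trans rfl

theorem arr_four_tgt (x : RepD D) (i : D.IrrIdx) (j : Fin (D.m i.1)) :
    tS x (ar4 D) (D.vmid i j) = ((flat x).LI i j).base 0 := by
  have e1 : tS x (ar4 D) (D.vmid i j) = ∑ t : PLift (2 ≤ D.e i.1 j),
      (((flat x).LI i j).u0 (Nat.sub_pos_of_lt t.down) *
        ((flat x).LI i j).v0 (Nat.sub_pos_of_lt t.down)) :=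
    (sum_dite_fibre (T := PLift (2 ≤ D.e i.1 j))
      (F := fun (e : D.Arr4) h => cst h ((x (ar4 D e)).1 * (x (ar4 D e)).2))
      (φ := fun t => ⟨i, ⟨j, t.down⟩⟩) (hφ := fun _ => rfl)
      (hi := by
        intro s t h
        exact Subsingleton.elim _ _)
      (hs := by
        rintro ⟨i', ⟨s, h2⟩⟩ h
        cases h
        exact ⟨⟨h2⟩, rfl⟩)).trans rfl
  rw [e1, LegData.base, zero_smul, add_zero]
  by_cases h : 2 ≤ D.e i.1 j
  · rw [dif_pos (Nat.sub_pos_of_lt h)]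
    have : Unique (PLift (2 ≤ D.e i.1 j)) := ⟨⟨⟨h⟩⟩, fun _ => Subsingleton.elim _ _⟩
    rw [Fintype.sum_unique]
  · rw [dif_neg (by omega)]
    have : IsEmpty (PLift (2 ≤ D.e i.1 j)) := ⟨fun t => h t.down⟩
    exact Fintype.sum_empty _

theorem arr_five_tgt (x : RepD D) (j : Fin (D.m 0)) :
    tS x (ar5 D) (D.vmid0 j) = ∑ i : RegIdx D, blk (((flat x).LR i).base 0) j j := by
  have e1 : tS x (ar5 D) (D.vmid0 j) =
      ∑ t : {i : RegIdx D // 2 ≤ D.e i.1 (D.j1 i.1)},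
        blk (((flat x).LR t.1).u0 (Nat.sub_pos_of_lt t.2) *
          ((flat x).LR t.1).v0 (Nat.sub_pos_of_lt t.2)) j j :=
    (sum_dite_fibre (T := {i : RegIdx D // 2 ≤ D.e i.1 (D.j1 i.1)})
      (F := fun (e : D.Arr5) h => cst h ((x (ar5 D e)).1 * (x (ar5 D e)).2))
      (φ := fun t => (⟨t.1.1, t.1.2, t.2⟩, j)) (hφ := fun _ => rfl)
      (hi := by
        rintro ⟨⟨s, h1⟩, h2⟩ ⟨⟨t, h1'⟩, h2'⟩ h
        cases h
        rfl)
      (hs := by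
        rintro ⟨⟨s, h1, h2⟩, j'⟩ h
        cases h
        exact ⟨⟨⟨s, h1⟩, h2⟩, rfl⟩)).trans rfl
  rw [e1, sum_subtype_dite (F := fun (i : RegIdx D) (h : 2 ≤ D.e i.1 (D.j1 i.1)) =>
    blk (((flat x).LR i).u0 (Nat.sub_pos_of_lt h) * ((flat x).LR i).v0 (Nat.sub_pos_of_lt h)) j j)]
  refine Finset.sum_congr rfl fun i _ => ?_
  rw [LegData.base, zero_smul, add_zero]
  by_cases h : 2 ≤ D.e i.1 (D.j1 i.1)
  · rw [dif_pos h, dif_pos (Nat.sub_pos_of_lt h)]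
  · rw [dif_neg h, dif_neg (by omega)]
    rfl

/-- Part of the moment map coming from arrows with given target. -/
noncomputable def tM {E : Type} [Fintype E] (x : RepD D) (ι : E → D.Arr) (i : D.IrrIdx)
    (j : Fin (D.m i.1)) : Matrix (Fin (D.nb i.1 j)) (Fin (D.nb i.1 j)) ℂ :=
  tS x ι (D.vmid i j)

/-- Part of the moment map coming from arrows with given source. -/
noncomputable def sM {E : Type} [Fintype E] (x : RepD D) (ι : E → D.Arr) (i : D.IrrIdx)
    (j : Fin (D.m i.1)) : Matrix (Fin (D.nb i.1 j)) (Fin (D.nb i.1 j)) ℂ :=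
  sS x ι (D.vmid i j)

/-- The moment map at a middle vertex. -/
noncomputable def muM (x : RepD D) (i : D.IrrIdx)
    (j : Fin (D.m i.1)) : Matrix (Fin (D.nb i.1 j)) (Fin (D.nb i.1 j)) ℂ :=
  FinQuiver.mu (Q := D.quiv) (α := D.alphaV) x (D.vmid i j)

theorem muM_eq (x : RepD D) (i : D.IrrIdx) (j : Fin (D.m i.1)) :
    muM x i j = (tM x (ar1 D) i j - sM x (ar1 D) i j + tM x (ar5 D) i j) + muX (flat x) i j +
      ((flat x).LI i j).base 0 := by
  have h0 : muM x i j = (tM x (ar1 D) i j + (tM x (ar2 D) i j + (tM x (ar3 D) i j +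
      (tM x (ar4 D) i j + tM x (ar5 D) i j)))) - (sM x (ar1 D) i j + (sM x (ar2 D) i j +
      (sM x (ar3 D) i j + (sM x (ar4 D) i j + sM x (ar5 D) i j)))) := mu_split x _
  have h3 : tM x (ar3 D) i j = 0 := tS_zero _ _ _ (by
    rintro ⟨i', j', t⟩ h
    cases h)
  have h3' : sM x (ar3 D) i j = 0 := sS_zero _ _ _ (by
    rintro ⟨i', j', t⟩ h
    cases h)
  have h4 : sM x (ar4 D) i j = 0 := sS_zero _ _ _ (by
    rintro ⟨i', j', t⟩ h
    cases h)
  have h5 : sM x (ar5 D) i j = 0 := sS_zero _ _ _ (by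
    rintro ⟨i', j'⟩ h
    cases h)
  have h6 : tM x (ar4 D) i j = ((flat x).LI i j).base 0 := arr_four_tgt x i j
  have h2 : tM x (ar2 D) i j - sM x (ar2 D) i j = muX (flat x) i j := arr_two x i j
  rw [h0, h3, h3', h4, h5, h6, ← h2]
  abel

theorem muM_toIrr (x : RepD D) (i : D.IrrNz) (j : Fin (D.m i.1)) :
    muM x (toIrr i) j = blk ((flat x).a i * (flat x).b i) j j + muX (flat x) (toIrr i) j +
        ((flat x).LI (toIrr i) j).base 0 := by
  have h1 : sM x (ar1 D) (toIrr i) j = 0 := sS_zero _ _ _ (by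
    rintro ⟨s, ⟨i', hi⟩, j'⟩ h
    obtain ⟨i, hi2⟩ := i
    cases h
    exact hi2.2 rfl)
  have h6 : tM x (ar5 D) (toIrr i) j = 0 := tS_zero _ _ _ (by
    rintro ⟨i', j'⟩ h
    obtain ⟨i, hi2⟩ := i
    cases h
    exact hi2.2 rfl)
  have h2 : tM x (ar1 D) (toIrr i) j = blk ((flat x).a i * (flat x).b i) j j := arr_one_tgt x i j
  rw [muM_eq, h1, h6, h2, sub_zero, add_zero]

/-- The values of the normal form parameters, extended by zero. -/
noncomputable def xz (D : ConnData) (i : Fin (D.p + 1)) (j : Fin (D.m i)) (k : ℕ) : ℂ :=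
  if h : k < D.e i j then D.xi i j ⟨k, h⟩ else 0

/-- The residue at a regular index. -/
noncomputable def Yr (F : FlatData D) (i : RegIdx D) : Matrix (Sg D 0) (Sg D 0) ℂ :=
  (F.LR i).base (xz D i.1 (D.j1 i.1) 0)

/-- The residue at the index zero. -/
noncomputable def C0 (F : FlatData D) : Matrix (Sg D 0) (Sg D 0) ℂ :=
  ∑ i, F.b i * F.a i - ∑ i, Yr F i

/-- The residues at the irregular indices. -/
noncomputable def Cm (F : FlatData D) : ∀ i : D.IrrIdx, Matrix (Sg D i.1) (Sg D i.1) ℂ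
  | ⟨i, hi⟩ => if h : i = 0 then h ▸ C0 F else -(F.a ⟨i, hi, h⟩ * F.b ⟨i, hi, h⟩)

theorem Cm_toIrr (F : FlatData D) (i : D.IrrNz) : Cm F (toIrr i) = -(F.a i * F.b i) :=
  dif_neg i.2.2

theorem irr_cases {P : D.IrrIdx → Prop} (h0 : P D.irr0) (h : ∀ i : D.IrrNz, P (toIrr i))
    (i : D.IrrIdx) : P i := by
  obtain ⟨i, hi⟩ := i
  by_cases hz : i = 0
  · subst hz
    exact h0
  · exact h ⟨i, hi, hz⟩

theorem regSumXi_eq : D.regSumXi = ∑ i : RegIdx D, xz D i.1 (D.j1 i.1) 0 := by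
  have : D.regSumXi = ∑ i, if _h : ¬ D.isIrr i then xz D i (D.j1 i) 0 else 0 := by
    refine Finset.sum_congr rfl fun i _ => ?_
    by_cases h : D.isIrr i
    · rw [if_pos h, dif_neg (not_not.2 h)]
    · rw [if_neg h, dif_pos h, xz, dif_pos (D.he _ _)]
  rw [this, ← sum_subtype_dite (p := fun i => ¬ D.isIrr i) (F := fun i _ => xz D i (D.j1 i) 0)]

theorem base_eq {β : Type} [Fintype β] [DecidableEq β] {N : ℕ} {r : Fin N → ℕ}
    (L : LegData β N r) (c : ℂ) : L.base c = L.base 0 + c • 1 := by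
  rw [LegData.base, LegData.base, zero_smul, add_zero]

theorem blk_C0 (x : RepD D) (j : Fin (D.m 0)) :
    blk (C0 (flat x)) j j = ∑ i : D.IrrNz, blk ((flat x).b i * (flat x).a i) j j -
      ∑ i : RegIdx D, blk (((flat x).LR i).base 0) j j - D.regSumXi • 1 := by
  rw [C0, blk_sub, blk_sum, blk_sum, sub_sub, regSumXi_eq, Finset.sum_smul,
    ← Finset.sum_add_distrib]
  congr 1
  refine Finset.sum_congr rfl fun i _ => ?_
  rw [Yr, base_eq, blk_add, blk_smul, blk_one]

theorem muM_irr0 (x : RepD D) (j : Fin (D.m D.irr0.1)) :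
    muM x D.irr0 j + D.regSumXi • 1 = -blk (Cm (flat x) D.irr0) j j + muX (flat x) D.irr0 j +
        ((flat x).LI D.irr0 j).base 0 := by
  have h1 : tM x (ar1 D) D.irr0 j = 0 := tS_zero _ _ _ (by
    rintro ⟨s, ⟨i', hi⟩, j'⟩ h
    cases h
    exact hi.2 rfl)
  have h2 : sM x (ar1 D) D.irr0 j - tM x (ar5 D) D.irr0 j - D.regSumXi • 1 =
      blk (Cm (flat x) D.irr0) j j :=
    (congrArg₂ (fun a b => a - b - D.regSumXi • 1) (arr_one_src x j) (arr_five_tgt x j)).trans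
      (blk_C0 x j).symm
  rw [muM_eq, h1, ← h2]
  abel

theorem neg_add_add_eq_zero_iff {G : Type*} [AddCommGroup G] (a b c d : G) :
    -a + b + c + d = 0 ↔ b + (c + d) = a := by
  rw [← sub_eq_zero (a := b + (c + d))]
  apply Eq.congr_left
  abel

theorem moment_mid_iff (x : RepD D) (i : D.IrrIdx) (j : Fin (D.m i.1)) :
    FinQuiver.mu (Q := D.quiv) (α := D.alphaV) x (D.vmid i j) = D.lamV (D.vmid i j) • 1 ↔
      muX (flat x) i j + ((flat x).LI i j).base (xz D i.1 j 0) = blk (Cm (flat x) i) j j := by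
  show muM x i j = D.lamV (D.vmid i j) • 1 ↔ _
  revert j
  induction i using irr_cases with
  | h0 =>
    intro j
    have : D.lamV (D.vmid D.irr0 j) = - xz D D.irr0.1 j 0 - D.regSumXi := by
      rw [xz, dif_pos (D.he _ _)]
      rfl
    rw [this, ← add_left_inj (D.regSumXi • 1), muM_irr0, sub_smul, sub_add_cancel,
      base_eq _ (xz D D.irr0.1 j 0),
      neg_smul, eq_neg_iff_add_eq_zero]
    exact neg_add_add_eq_zero_iff _ _ _ _
  | h i =>
    intro j
    have : D.lamV (D.vmid (toIrr i) j) = - xz D (toIrr i).1 j 0 := by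
      rw [xz, dif_pos (D.he _ _)]
      exact dif_neg i.2.2
    rw [this, muM_toIrr, Cm_toIrr, blk_neg, base_eq _ (xz D (toIrr i).1 j 0),
      neg_smul, eq_neg_iff_add_eq_zero, eq_neg_iff_add_eq_zero]
    apply Eq.congr_left
    abel

end HTL

namespace HTL
set_option linter.unusedSectionVars false
set_option linter.unusedSimpArgs false
open ConnData
variable {D : ConnData}

/-- The components along the inner part of a leg. -/
noncomputable def x3 (x : RepD D) (i : Fin (D.p + 1)) (j : Fin (D.m i)) (t : ℕ)
    (h : t + 1 < D.e i j - 1) :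
    Matrix (Fin (lr D i j ⟨t, Nat.lt_of_succ_lt h⟩)) (Fin (lr D i j ⟨t + 1, h⟩)) ℂ ×
    Matrix (Fin (lr D i j ⟨t + 1, h⟩)) (Fin (lr D i j ⟨t, Nat.lt_of_succ_lt h⟩)) ℂ :=
  x (.inr (.inr (.inl ⟨i, j, ⟨t, by omega⟩⟩)))

theorem leg_three_tgt (x : RepD D) (i : Fin (D.p + 1)) (j : Fin (D.m i)) (t : ℕ)
    (h : t < D.e i j - 1) :
    tS x (ar3 D) (D.vleg i j ⟨t, h⟩) =
      if h' : t + 1 < D.e i j - 1 then (x3 x i j t h').1 * (x3 x i j t h').2 else 0 := by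
  have e1 : tS x (ar3 D) (D.vleg i j ⟨t, h⟩) = ∑ s : PLift (t + 1 < D.e i j - 1),
      (x3 x i j t s.down).1 * (x3 x i j t s.down).2 :=
    (sum_dite_fibre (T := PLift (t + 1 < D.e i j - 1))
      (F := fun (e : D.Arr3) h => cst h ((x (ar3 D e)).1 * (x (ar3 D e)).2))
      (φ := fun s => ⟨i, j, ⟨t, by have := s.down; omega⟩⟩) (hφ := fun _ => rfl)
      (hi := by
        intro s t h
        exact Subsingleton.elim _ _)
      (hs := by
        rintro ⟨i', j', ⟨s, h2⟩⟩ h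
        cases h
        exact ⟨⟨by omega⟩, rfl⟩)).trans rfl
  rw [e1]
  by_cases h' : t + 1 < D.e i j - 1
  · rw [dif_pos h']
    have : Unique (PLift (t + 1 < D.e i j - 1)) := ⟨⟨⟨h'⟩⟩, fun _ => Subsingleton.elim _ _⟩
    rw [Fintype.sum_unique]
  · rw [dif_neg h']
    have : IsEmpty (PLift (t + 1 < D.e i j - 1)) := ⟨fun t => h' t.down⟩
    exact Fintype.sum_empty _

theorem leg_three_src_zero (x : RepD D) (i : Fin (D.p + 1)) (j : Fin (D.m i))
    (h : 0 < D.e i j - 1) : sS x (ar3 D) (D.vleg i j ⟨0, h⟩) = 0 :=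
  sS_zero _ _ _ (by
    rintro ⟨i', j', ⟨s, h2⟩⟩ h
    cases h)

theorem leg_three_src_succ (x : RepD D) (i : Fin (D.p + 1)) (j : Fin (D.m i)) (t : ℕ)
    (h : t + 1 < D.e i j - 1) : sS x (ar3 D) (D.vleg i j ⟨t + 1, h⟩) =
      (x3 x i j t h).2 * (x3 x i j t h).1 := by
  have e1 : sS x (ar3 D) (D.vleg i j ⟨t + 1, h⟩) = ∑ s : Unit,
      (x3 x i j t h).2 * (x3 x i j t h).1 :=
    (sum_dite_fibre (T := Unit)
      (F := fun (e : D.Arr3) h => cst h ((x (ar3 D e)).2 * (x (ar3 D e)).1))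
      (φ := fun s => ⟨i, j, ⟨t, by omega⟩⟩) (hφ := fun _ => rfl)
      (hi := by
        intro s t h
        exact Subsingleton.elim _ _)
      (hs := by
        rintro ⟨i', j', ⟨s, h2⟩⟩ h
        cases h
        exact ⟨(), rfl⟩)).trans rfl
  rw [e1, Fintype.sum_unique]

theorem leg_four_src (x : RepD D) (i : D.IrrIdx) (j : Fin (D.m i.1))
    (h : 0 < D.e i.1 j - 1) : sS x (ar4 D) (D.vleg i.1 j ⟨0, h⟩) =
      ((flat x).LI i j).v0 h * ((flat x).LI i j).u0 h := by
  have e1 : sS x (ar4 D) (D.vleg i.1 j ⟨0, h⟩) = ∑ s : Unit,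
      ((flat x).LI i j).v0 h * ((flat x).LI i j).u0 h :=
    (sum_dite_fibre (T := Unit)
      (F := fun (e : D.Arr4) h => cst h ((x (ar4 D e)).2 * (x (ar4 D e)).1))
      (φ := fun s => ⟨i, ⟨j, by omega⟩⟩) (hφ := fun _ => rfl)
      (hi := by
        intro s t h
        exact Subsingleton.elim _ _)
      (hs := by
        rintro ⟨⟨i', hi⟩, j', h2⟩ h
        obtain ⟨i, hi'⟩ := i
        cases h
        exact ⟨(), rfl⟩)).trans rfl
  rw [e1, Fintype.sum_unique]

theorem leg_five_src (x : RepD D) (i : RegIdx D)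
    (h : 0 < D.e i.1 (D.j1 i.1) - 1) : sS x (ar5 D) (D.vleg i.1 (D.j1 i.1) ⟨0, h⟩) =
      ((flat x).LR i).v0 h * ((flat x).LR i).u0 h := by
  have e1 : sS x (ar5 D) (D.vleg i.1 (D.j1 i.1) ⟨0, h⟩) = ∑ s : Fin (D.m 0),
      (Matrix.of fun r c => ((flat x).LR i).v0 h r ⟨s, c⟩) *
        (Matrix.of fun r c => ((flat x).LR i).u0 h ⟨s, r⟩ c) :=
    (sum_dite_fibre (T := Fin (D.m 0))
      (F := fun (e : D.Arr5) h => cst h ((x (ar5 D e)).2 * (x (ar5 D e)).1))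
      (φ := fun s => (⟨i.1, i.2, by omega⟩, s)) (hφ := fun _ => rfl)
      (hi := by
        intro s t h
        cases h
        rfl)
      (hs := by
        rintro ⟨⟨i', hi⟩, j'⟩ h
        obtain ⟨i, hi'⟩ := i
        cases h
        exact ⟨j', rfl⟩)).trans rfl
  rw [e1]
  ext r c
  rw [Matrix.sum_apply, Matrix.mul_apply, Fintype.sum_sigma]
  rfl

theorem leg_tgt_zero (x : RepD D) (i : Fin (D.p + 1)) (j : Fin (D.m i)) (k : Fin (D.e i j - 1)) :
    FinQuiver.mu (Q := D.quiv) (α := D.alphaV) x (D.vleg i j k) = tS x (ar3 D) (D.vleg i j k) -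
      (sS x (ar3 D) (D.vleg i j k) + (sS x (ar4 D) (D.vleg i j k) + sS x (ar5 D) (D.vleg i j k))) := by
  refine (mu_split x _).trans ?_
  rw [tS_zero x (ar1 D) _ (by rintro ⟨s, i', j'⟩ h; cases h),
    tS_zero x (ar2 D) _ (by rintro ⟨s, i', j'⟩ h; cases h),
    tS_zero x (ar4 D) _ (by rintro ⟨s, i'⟩ h; cases h),
    tS_zero x (ar5 D) _ (by rintro ⟨s, i'⟩ h; cases h),
    sS_zero x (ar1 D) _ (by rintro ⟨s, i', j'⟩ h; cases h),
    sS_zero x (ar2 D) _ (by rintro ⟨s, i', j'⟩ h; cases h)]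
  simp only [zero_add, add_zero]

theorem mu_leg_irr (x : RepD D) (i : D.IrrIdx) (j : Fin (D.m i.1)) (t : ℕ)
    (h : t < D.e i.1 j - 1) :
    FinQuiver.mu (Q := D.quiv) (α := D.alphaV) x (D.vleg i.1 j ⟨t, h⟩) =
      ((flat x).LI i j).uv t h - ((flat x).LI i j).vu t h := by
  refine (leg_tgt_zero x i.1 j ⟨t, h⟩).trans ?_
  have h5 : sS x (ar5 D) (D.vleg i.1 j ⟨t, h⟩) = 0 := sS_zero _ _ _ (by
    rintro ⟨⟨i', hi⟩, j'⟩ h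
    obtain ⟨i, hi'⟩ := i
    cases h
    exact hi.1 hi')
  rw [h5, leg_three_tgt]
  rcases t with _ | t
  · rw [leg_three_src_zero, leg_four_src, zero_add (_ + _), add_zero]
    rfl
  · have h4 : sS x (ar4 D) (D.vleg i.1 j ⟨t + 1, h⟩) = 0 := sS_zero _ _ _ (by
      rintro ⟨⟨i', hi⟩, j', h2⟩ h
      obtain ⟨i, hi'⟩ := i
      cases h)
    rw [leg_three_src_succ, h4, add_zero, add_zero]
    rfl

theorem mu_leg_reg (x : RepD D) (i : RegIdx D) (t : ℕ)
    (h : t < D.e i.1 (D.j1 i.1) - 1) :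
    FinQuiver.mu (Q := D.quiv) (α := D.alphaV) x (D.vleg i.1 (D.j1 i.1) ⟨t, h⟩) =
      ((flat x).LR i).uv t h - ((flat x).LR i).vu t h := by
  refine (leg_tgt_zero x i.1 (D.j1 i.1) ⟨t, h⟩).trans ?_
  have h4 : sS x (ar4 D) (D.vleg i.1 (D.j1 i.1) ⟨t, h⟩) = 0 := sS_zero _ _ _ (by
    rintro ⟨⟨i', hi⟩, j', h2⟩ h
    obtain ⟨i, hi'⟩ := i
    cases h
    exact hi' hi)
  rw [h4, leg_three_tgt]
  rcases t with _ | t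
  · rw [leg_three_src_zero, leg_five_src, zero_add (_ + _), zero_add (_ * _)]
    rfl
  · have h5 : sS x (ar5 D) (D.vleg i.1 (D.j1 i.1) ⟨t + 1, h⟩) = 0 := sS_zero _ _ _ (by
      rintro ⟨⟨i', hi⟩, j'⟩ h
      obtain ⟨i, hi'⟩ := i
      cases h)
    rw [leg_three_src_succ, h5, add_zero, add_zero]
    rfl

theorem lamV_leg (i : Fin (D.p + 1)) (j : Fin (D.m i)) (t : ℕ) (h : t < D.e i j - 1) :
    D.lamV (D.vleg i j ⟨t, h⟩) = xz D i j t - xz D i j (t + 1) := by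
  rw [xz, dif_pos (by omega), xz, dif_pos (by omega)]
  rfl

/-- The moment map equations in terms of block matrices. -/
structure MomF (F : FlatData D) : Prop where
  mid : ∀ (i : D.IrrIdx) (j : Fin (D.m i.1)),
    muX F i j + (F.LI i j).base (xz D i.1 j 0) = blk (Cm F i) j j
  legI : ∀ (i : D.IrrIdx) (j : Fin (D.m i.1)), (F.LI i j).Mom (xz D i.1 j)
  legR : ∀ i : RegIdx D, (F.LR i).Mom (xz D i.1 (D.j1 i.1))

theorem moment_iff (x : RepD D) :
    (∀ a, FinQuiver.mu (Q := D.quiv) (α := D.alphaV) x a =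
      D.lamV a • (1 : Matrix (Fin (D.alphaV a)) (Fin (D.alphaV a)) ℂ)) ↔ MomF (flat x) := by
  constructor
  · intro h
    refine ⟨fun i j => (moment_mid_iff x i j).1 (h _), fun i j t ht => ?_, fun i t ht => ?_⟩
    · rw [← mu_leg_irr, ← lamV_leg]
      exact h _
    · rw [← mu_leg_reg, ← lamV_leg]
      exact h _
  · rintro ⟨h1, h2, h3⟩ (⟨i, j⟩ | ⟨i, j, ⟨t, ht⟩⟩)
    · exact (moment_mid_iff x i j).2 (h1 i j)
    · by_cases hi : D.isIrr i
      · refine (mu_leg_irr x ⟨i, hi⟩ j t ht).trans ((h2 ⟨i, hi⟩ j t ht).trans ?_)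
        rw [← lamV_leg]
        rfl
      · obtain rfl := eq_j1 hi j
        refine (mu_leg_reg x ⟨i, hi⟩ t ht).trans ((h3 ⟨i, hi⟩ t ht).trans ?_)
        rw [← lamV_leg]
        rfl

end HTL

namespace HTL
set_option linter.unusedSectionVars false
set_option linter.unusedSimpArgs false
open ConnData

section rows
variable {ι : Type} [Fintype ι] [DecidableEq ι]
  {β : ι → Type} [∀ j, Fintype (β j)] [∀ j, DecidableEq (β j)] {τ : Type} [Fintype τ]

/-- A block row. -/
def rowb (M : Matrix (Σ j, β j) τ ℂ) (j : ι) : Matrix (β j) τ ℂ := Matrix.of fun r c => M ⟨j, r⟩ c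

/-- A block column. -/
def colb (M : Matrix τ (Σ j, β j) ℂ) (j : ι) : Matrix τ (β j) ℂ := Matrix.of fun r c => M r ⟨j, c⟩

theorem rowb_eq (M : Matrix (Σ j, β j) τ ℂ) (j : ι) : rowb M j = prj β j * M := by
  ext r c
  rw [prj_mul_apply]
  rfl

theorem colb_eq (M : Matrix τ (Σ j, β j) ℂ) (j : ι) : colb M j = M * inj β j := by
  ext r c
  rw [mul_inj_apply]
  rfl

theorem rowb_bd_mul (N : ∀ j, Matrix (β j) (β j) ℂ) (M : Matrix (Σ j, β j) τ ℂ) (j : ι) :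
    rowb (bd N * M) j = N j * rowb M j := by
  rw [rowb_eq, rowb_eq, ← Matrix.mul_assoc, prj_bd, Matrix.mul_assoc]

theorem colb_mul_bd (N : ∀ j, Matrix (β j) (β j) ℂ) (M : Matrix τ (Σ j, β j) ℂ) (j : ι) :
    colb (M * bd N) j = colb M j * N j := by
  rw [colb_eq, colb_eq, Matrix.mul_assoc, bd_inj, Matrix.mul_assoc]

theorem rowb_mul {σ : Type} [Fintype σ] (M : Matrix (Σ j, β j) τ ℂ) (M' : Matrix τ σ ℂ) (j : ι) :
    rowb (M * M') j = rowb M j * M' := by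
  rw [rowb_eq, rowb_eq, Matrix.mul_assoc]

theorem colb_mul {σ : Type} [Fintype σ] (M' : Matrix σ τ ℂ) (M : Matrix τ (Σ j, β j) ℂ) (j : ι) :
    colb (M' * M) j = M' * colb M j := by
  rw [colb_eq, colb_eq, Matrix.mul_assoc]

theorem rowb_ext {M M' : Matrix (Σ j, β j) τ ℂ} (h : ∀ j, rowb M j = rowb M' j) : M = M' := by
  ext ⟨j, r⟩ c
  exact congrFun (congrFun (h j) r) c

theorem colb_ext {M M' : Matrix τ (Σ j, β j) ℂ} (h : ∀ j, colb M j = colb M' j) : M = M' := by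
  ext r ⟨j, c⟩
  exact congrFun (congrFun (h j) r) c

theorem mulVec_mem_tot {W : ∀ j, Submodule ℂ (β j → ℂ)} {M : Matrix (Σ j, β j) τ ℂ} {v : τ → ℂ} :
    M *ᵥ v ∈ tot W ↔ ∀ j, rowb M j *ᵥ v ∈ W j := by
  rw [mem_tot]
  simp only [rowb_eq, Matrix.mulVec_mulVec]

theorem tot_mulVec_mem {W : ∀ j, Submodule ℂ (β j → ℂ)} {M : Matrix τ (Σ j, β j) ℂ}
    {W' : Submodule ℂ (τ → ℂ)} :
    (∀ v ∈ tot W, M *ᵥ v ∈ W') ↔ ∀ j, ∀ v ∈ W j, colb M j *ᵥ v ∈ W' := by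
  constructor
  · intro h j v hv
    rw [colb_eq, ← Matrix.mulVec_mulVec]
    exact h _ (inj_mem_tot.2 hv)
  · intro h v hv
    rw [← sum_inj_prj_mulVec v, Matrix.mulVec_sum]
    refine sum_mem fun j _ => ?_
    rw [Matrix.mulVec_mulVec, ← colb_eq]
    exact h j _ (mem_tot.1 hv j)

end rows

variable {D : ConnData}

/-- Matrices at all vertices. -/
abbrev VMat (D : ConnData) := ∀ a : D.Vq, Matrix (Fin (D.alphaV a)) (Fin (D.alphaV a)) ℂ

/-- The matrices at the middle vertices. -/
def hm (h : VMat D) (i : D.IrrIdx) (j : Fin (D.m i.1)) :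
    Matrix (Fin (D.nb i.1 j)) (Fin (D.nb i.1 j)) ℂ := h (D.vmid i j)

/-- The matrices at the middle vertices over zero. -/
def hm0 (h : VMat D) (j : Fin (D.m 0)) :
    Matrix (Fin (D.nb 0 j)) (Fin (D.nb 0 j)) ℂ := h (D.vmid0 j)

/-- The matrices at the leg vertices. -/
noncomputable def hl (h : VMat D) (i : Fin (D.p + 1)) (j : Fin (D.m i)) (t : ℕ) (ht : t < D.e i j - 1) :
    Matrix (Fin (lr D i j ⟨t, ht⟩)) (Fin (lr D i j ⟨t, ht⟩)) ℂ := h (D.vleg i j ⟨t, ht⟩)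

/-- A homomorphism of representations. -/
def HomR (h : VMat D) (x y : RepD D) : Prop := ∀ e : D.Arr,
  h (D.qtgt e) * (x e).1 = (y e).1 * h (D.qsrc e) ∧ h (D.qsrc e) * (x e).2 = (y e).2 * h (D.qtgt e)

/-- A homomorphism in terms of block matrices. -/
structure HomF (h : VMat D) (F F' : FlatData D) : Prop where
  a : ∀ i : D.IrrNz, bd (hm h (toIrr i)) * F.a i = F'.a i * bd (hm0 h)
  b : ∀ i : D.IrrNz, bd (hm0 h) * F.b i = F'.b i * bd (hm h (toIrr i))
  X : ∀ (i : D.IrrIdx) (j j' : Fin (D.m i.1)), j ≠ j' → ∀ k, k < D.dd i.1 j j' →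
    hm h i j * blk (F.X i k) j j' = blk (F'.X i k) j j' * hm h i j'
  LI : ∀ (i : D.IrrIdx) (j : Fin (D.m i.1)), (F.LI i j).Int (F'.LI i j) (hm h i j) (hl h i.1 j)
  LR : ∀ i : RegIdx D, (F.LR i).Int (F'.LR i) (bd (hm0 h)) (hl h i.1 (D.j1 i.1))

theorem homF_of_homR {h : VMat D} {x y : RepD D} (H : HomR h x y) : HomF h (flat x) (flat y) where
  a i := by
    apply blk_ext
    intro j j'
    rw [blk_bd_mul, blk_mul_bd]
    exact (H (.inl (j', ⟨i, j⟩))).1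
  b i := by
    apply blk_ext
    intro j j'
    rw [blk_bd_mul, blk_mul_bd]
    exact (H (.inl (j, ⟨i, j'⟩))).2
  X i j j' hne k hk := by
    rcases lt_or_gt_of_ne hne with hlt | hlt
    · rw [blk_flat_X_gt _ _ hlt _ hk, blk_flat_X_gt _ _ hlt _ hk, Matrix.mul_smul, Matrix.smul_mul]
      exact congrArg _ (H (.inr (.inl ⟨i, ⟨(j, j'), hlt⟩, ⟨k, hk⟩⟩))).2
    · rw [blk_flat_X_lt _ _ hlt _ (by rwa [dd_comm]), blk_flat_X_lt _ _ hlt _ (by rwa [dd_comm])]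
      exact (H (.inr (.inl ⟨i, ⟨(j', j), hlt⟩, ⟨k, by rwa [dd_comm]⟩⟩))).1
  LI i j := ⟨fun ht => H (.inr (.inr (.inr (.inl ⟨i, ⟨j, by omega⟩⟩)))),
    fun t ht => H (.inr (.inr (.inl ⟨i.1, j, ⟨t, by omega⟩⟩)))⟩
  LR i := by
    refine ⟨fun ht => ⟨?_, ?_⟩, fun t ht => H (.inr (.inr (.inl ⟨i.1, D.j1 i.1, ⟨t, by omega⟩⟩)))⟩
    · apply rowb_ext
      intro j
      rw [rowb_bd_mul, rowb_mul]
      exact (H (.inr (.inr (.inr (.inr (⟨i.1, i.2, by omega⟩, j)))))).1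
    · apply colb_ext
      intro j
      rw [colb_mul_bd, colb_mul]
      exact (H (.inr (.inr (.inr (.inr (⟨i.1, i.2, by omega⟩, j)))))).2

theorem homR_of_homF {h : VMat D} {x y : RepD D} (H : HomF h (flat x) (flat y)) : HomR h x y := by
  rintro (⟨j, ⟨i, j'⟩⟩ | ⟨i, ⟨⟨j, j'⟩, hlt⟩, ⟨k, hk⟩⟩ | ⟨i, j, ⟨t, ht⟩⟩ | ⟨i, ⟨j, hj⟩⟩ | ⟨⟨i, hi, h2⟩, j⟩)
  · refine ⟨?_, ?_⟩
    · have := congrArg (fun M => blk M j' j) (H.a i)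
      simp only [blk_bd_mul, blk_mul_bd] at this
      exact this
    · have := congrArg (fun M => blk M j j') (H.b i)
      simp only [blk_bd_mul, blk_mul_bd] at this
      exact this
  · replace hlt : j < j' := hlt
    replace hk : k < D.dd i.1 j j' := hk
    refine ⟨?_, ?_⟩
    · have := H.X i j' j hlt.ne' k (by rwa [dd_comm])
      rw [blk_flat_X_lt _ _ hlt _ hk, blk_flat_X_lt _ _ hlt _ hk] at this
      exact this
    · have := H.X i j j' hlt.ne k hk
      rw [blk_flat_X_gt _ _ hlt _ hk, blk_flat_X_gt _ _ hlt _ hk, Matrix.mul_smul,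
        Matrix.smul_mul] at this
      have h2 := congrArg ((tr D i.1).sg j' j • ·) this
      simp only [smul_smul, sg_mul i.1 hlt.ne', one_smul] at h2
      exact h2
  · by_cases hi : D.isIrr i
    · exact (H.LI ⟨i, hi⟩ j).2 t (lt_pred ht)
    · obtain rfl := eq_j1 hi j
      exact (H.LR ⟨i, hi⟩).2 t (lt_pred ht)
  · exact (H.LI i j).1 (by omega)
  · have := (H.LR ⟨i, hi⟩).1 (Nat.sub_pos_of_lt h2)
    refine ⟨?_, ?_⟩
    · exact ((rowb_bd_mul _ _ j).symm.trans (congrArg (fun M => rowb M j) this.1)).trans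
        (rowb_mul _ _ j)
    · exact ((colb_mul _ _ j).symm.trans (congrArg (fun M => colb M j) this.2)).trans
        (colb_mul_bd _ _ j)

/-- The action of the group in terms of block matrices. -/
theorem act_eq_iff (g : D.quiv.GGroup D.alphaV) (x y : RepD D) :
    FinQuiver.act (Q := D.quiv) (α := D.alphaV) g x = y ↔
      HomF (fun a => (g a).val) (flat x) (flat y) := by
  have : FinQuiver.act (Q := D.quiv) (α := D.alphaV) g x = y ↔ HomR (fun a => (g a).val) x y := by
    constructor
    · rintro rfl e
      refine ⟨?_, ?_⟩
      · show _ = ((g (D.qtgt e)).val * (x e).1 * ((g (D.qsrc e))⁻¹).val) * (g (D.qsrc e)).val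
        rw [Matrix.mul_assoc _ _ (g (D.qsrc e)).val, Units.inv_mul, Matrix.mul_one]
      · show _ = ((g (D.qsrc e)).val * (x e).2 * ((g (D.qtgt e))⁻¹).val) * (g (D.qtgt e)).val
        rw [Matrix.mul_assoc _ _ (g (D.qtgt e)).val, Units.inv_mul, Matrix.mul_one]
    · intro H
      funext e
      refine Prod.ext ?_ ?_
      · show (g (D.qtgt e)).val * (x e).1 * ((g (D.qsrc e))⁻¹).val = (y e).1
        rw [(H e).1, Matrix.mul_assoc, Units.mul_inv, Matrix.mul_one]
      · show (g (D.qsrc e)).val * (x e).2 * ((g (D.qtgt e))⁻¹).val = (y e).2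
        rw [(H e).2, Matrix.mul_assoc, Units.mul_inv, Matrix.mul_one]
  rw [this]
  exact ⟨homF_of_homR, homR_of_homF⟩

/-- Subspaces at all vertices. -/
abbrev VSub (D : ConnData) := ∀ a : D.Vq, Submodule ℂ (Fin (D.alphaV a) → ℂ)

/-- The subspaces at the middle vertices. -/
def wm (W : VSub D) (i : D.IrrIdx) (j : Fin (D.m i.1)) :
    Submodule ℂ (Fin (D.nb i.1 j) → ℂ) := W (D.vmid i j)

/-- The subspaces at the middle vertices over zero. -/
def wm0 (W : VSub D) (j : Fin (D.m 0)) : Submodule ℂ (Fin (D.nb 0 j) → ℂ) := W (D.vmid0 j)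

/-- The subspaces at the leg vertices. -/
noncomputable def wl (W : VSub D) (i : Fin (D.p + 1)) (j : Fin (D.m i)) (t : ℕ)
    (ht : t < D.e i j - 1) : Submodule ℂ (Fin (lr D i j ⟨t, ht⟩) → ℂ) := W (D.vleg i j ⟨t, ht⟩)

/-- Invariance of a family of subspaces in terms of block matrices. -/
structure InvF (W : VSub D) (F : FlatData D) : Prop where
  a : ∀ i : D.IrrNz, ∀ v ∈ tot (wm0 W), F.a i *ᵥ v ∈ tot (wm W (toIrr i))
  b : ∀ i : D.IrrNz, ∀ v ∈ tot (wm W (toIrr i)), F.b i *ᵥ v ∈ tot (wm0 W)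
  X : ∀ (i : D.IrrIdx) (j j' : Fin (D.m i.1)), j ≠ j' → ∀ k, k < D.dd i.1 j j' →
    ∀ v ∈ wm W i j', blk (F.X i k) j j' *ᵥ v ∈ wm W i j
  LI : ∀ (i : D.IrrIdx) (j : Fin (D.m i.1)), (F.LI i j).Inv (wm W i j) (wl W i.1 j)
  LR : ∀ i : RegIdx D, (F.LR i).Inv (tot (wm0 W)) (wl W i.1 (D.j1 i.1))

theorem invF_of_invFamily {W : VSub D} {x : RepD D}
    (H : FinQuiver.InvFamily (Q := D.quiv) (α := D.alphaV) x W) : InvF W (flat x) where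
  a i := mul_mem_tot.2 fun j j' => (H (.inl (j', ⟨i, j⟩))).1
  b i := mul_mem_tot.2 fun j j' => (H (.inl (j, ⟨i, j'⟩))).2
  X i j j' hne k hk v hv := by
    rcases lt_or_gt_of_ne hne with hlt | hlt
    · rw [blk_flat_X_gt _ _ hlt _ hk, Matrix.smul_mulVec]
      exact Submodule.smul_mem _ _ ((H (.inr (.inl ⟨i, ⟨(j, j'), hlt⟩, ⟨k, hk⟩⟩))).2 v hv)
    · rw [blk_flat_X_lt _ _ hlt _ (by rwa [dd_comm])]
      exact (H (.inr (.inl ⟨i, ⟨(j', j), hlt⟩, ⟨k, by rwa [dd_comm]⟩⟩))).1 v hv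
  LI i j := ⟨fun ht => H (.inr (.inr (.inr (.inl ⟨i, ⟨j, by omega⟩⟩)))),
    fun t ht => H (.inr (.inr (.inl ⟨i.1, j, ⟨t, by omega⟩⟩)))⟩
  LR i := by
    refine ⟨fun ht => ⟨?_, ?_⟩, fun t ht => H (.inr (.inr (.inl ⟨i.1, D.j1 i.1, ⟨t, by omega⟩⟩)))⟩
    · intro v hv
      exact mulVec_mem_tot.2 fun j => (H (.inr (.inr (.inr (.inr (⟨i.1, i.2, by omega⟩, j)))))).1 v hv
    · exact tot_mulVec_mem.2 fun j => (H (.inr (.inr (.inr (.inr (⟨i.1, i.2, by omega⟩, j)))))).2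

theorem invFamily_of_invF {W : VSub D} {x : RepD D} (H : InvF W (flat x)) :
    FinQuiver.InvFamily (Q := D.quiv) (α := D.alphaV) x W := by
  rintro (⟨j, ⟨i, j'⟩⟩ | ⟨i, ⟨⟨j, j'⟩, hlt⟩, ⟨k, hk⟩⟩ | ⟨i, j, ⟨t, ht⟩⟩ | ⟨i, ⟨j, hj⟩⟩ | ⟨⟨i, hi, h2⟩, j⟩)
  · exact ⟨mul_mem_tot.1 (H.a i) j' j, mul_mem_tot.1 (H.b i) j j'⟩
  · replace hlt : j < j' := hlt
    replace hk : k < D.dd i.1 j j' := hk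
    refine ⟨?_, ?_⟩
    · have := H.X i j' j hlt.ne' k (by rwa [dd_comm])
      rw [blk_flat_X_lt _ _ hlt _ hk] at this
      exact this
    · have key : ∀ v ∈ wm W i j', arr2' x i hlt ⟨k, hk⟩ *ᵥ v ∈ wm W i j := by
        intro v hv
        have := H.X i j j' hlt.ne k hk v hv
        rw [blk_flat_X_gt _ _ hlt _ hk, Matrix.smul_mulVec] at this
        have h2 := Submodule.smul_mem _ ((tr D i.1).sg j' j) this
        rw [smul_smul, sg_mul i.1 hlt.ne', one_smul] at h2
        exact h2
      exact key
  · by_cases hi : D.isIrr i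
    · exact (H.LI ⟨i, hi⟩ j).2 t (lt_pred ht)
    · obtain rfl := eq_j1 hi j
      exact (H.LR ⟨i, hi⟩).2 t (lt_pred ht)
  · exact (H.LI i j).1 (by omega)
  · have := (H.LR ⟨i, hi⟩).1 (Nat.sub_pos_of_lt h2)
    exact ⟨fun v hv => mulVec_mem_tot.1 (this.1 v hv) j, tot_mulVec_mem.1 this.2 j⟩

end HTL

namespace HTL
set_option linter.unusedSectionVars false
set_option linter.unusedSimpArgs false
open ConnData

theorem ofFn_prod_eq_pr {β : Type} [Fintype β] [DecidableEq β] (M : Matrix β β ℂ) (ξ : ℕ → ℂ) :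
    ∀ (k : ℕ) (f : Fin k → ℂ), (∀ l, ξ l.1 = f l) →
      (List.ofFn fun l : Fin k => M - f l • (1 : Matrix β β ℂ)).prod = pr M ξ k := by
  intro k
  induction k with
  | zero => intro f _; simp [pr]
  | succ k ih =>
    intro f hf
    rw [List.ofFn_succ', List.concat_eq_append, List.prod_append, ih _ fun l => hf l.castSucc, pr]
    have := hf (Fin.last k)
    rw [Fin.val_last] at this
    simp [this]

theorem exists_left_inv_of_ker {α β : Type} [Fintype α] [DecidableEq α] [Fintype β] [DecidableEq β]
    {M : Matrix α β ℂ} (h : LinearMap.ker (Matrix.mulVecLin M) = ⊥) :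
    ∃ M' : Matrix β α ℂ, M' * M = 1 := exists_left_inv (LinearMap.ker_eq_bot.1 h)

theorem exists_right_inv_of_range {α β : Type} [Fintype α] [DecidableEq α] [Fintype β]
    [DecidableEq β] {M : Matrix α β ℂ} (h : LinearMap.range (Matrix.mulVecLin M) = ⊤) :
    ∃ M' : Matrix β α ℂ, M * M' = 1 := exists_right_inv (LinearMap.range_eq_top.1 h)

variable {D : ConnData}

theorem lr_eq (i : Fin (D.p + 1)) (j : Fin (D.m i)) (t : ℕ) (h : t < D.e i j - 1) :
    (pr (D.R i j) (xz D i j) (t + 1)).rank = lr D i j ⟨t, h⟩ := by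
  rw [← ofFn_prod_eq_pr (D.R i j) (xz D i j) (t + 1)
    (fun l => D.xi i j ⟨l.1, by have := l.isLt; omega⟩)]
  · rfl
  · intro l
    rw [xz, dif_pos]

theorem pr_R_zero (i : Fin (D.p + 1)) (j : Fin (D.m i)) :
    pr (D.R i j) (xz D i j) (D.e i j - 1 + 1) = 0 := by
  rw [Nat.sub_add_cancel (D.he i j), ← D.hxi i j]
  refine (ofFn_prod_eq_pr _ _ _ _ fun l => ?_).symm
  rw [xz, dif_pos l.isLt]

/-- Subspaces along a leg at a regular index. -/
def regSub (WR : ∀ (i : RegIdx D) (t : ℕ) (ht : t < D.e i.1 (D.j1 i.1) - 1),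
      Submodule ℂ (Fin (lr D i.1 (D.j1 i.1) ⟨t, ht⟩) → ℂ)) {i : Fin (D.p + 1)} (h : ¬ D.isIrr i) :
    ∀ (j : Fin (D.m i)), D.j1 i = j → ∀ t : Fin (D.e i j - 1),
      Submodule ℂ (Fin (lr D i j t) → ℂ)
  | _, rfl, t => WR ⟨i, h⟩ t.1 t.2

/-- A family of subspaces at all vertices. -/
def mkSub (W : ∀ (i : D.IrrIdx) (j : Fin (D.m i.1)), Submodule ℂ (Fin (D.nb i.1 j) → ℂ))
    (WI : ∀ (i : D.IrrIdx) (j : Fin (D.m i.1)) (t : ℕ) (ht : t < D.e i.1 j - 1),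
      Submodule ℂ (Fin (lr D i.1 j ⟨t, ht⟩) → ℂ))
    (WR : ∀ (i : RegIdx D) (t : ℕ) (ht : t < D.e i.1 (D.j1 i.1) - 1),
      Submodule ℂ (Fin (lr D i.1 (D.j1 i.1) ⟨t, ht⟩) → ℂ)) : VSub D
  | .inl ⟨i, j⟩ => W i j
  | .inr ⟨i, j, t⟩ => if h : D.isIrr i then WI ⟨i, h⟩ j t.1 t.2 else regSub WR h j (eq_j1 h j) t

section mk
variable (W : ∀ (i : D.IrrIdx) (j : Fin (D.m i.1)), Submodule ℂ (Fin (D.nb i.1 j) → ℂ))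
    (WI : ∀ (i : D.IrrIdx) (j : Fin (D.m i.1)) (t : ℕ) (ht : t < D.e i.1 j - 1),
      Submodule ℂ (Fin (lr D i.1 j ⟨t, ht⟩) → ℂ))
    (WR : ∀ (i : RegIdx D) (t : ℕ) (ht : t < D.e i.1 (D.j1 i.1) - 1),
      Submodule ℂ (Fin (lr D i.1 (D.j1 i.1) ⟨t, ht⟩) → ℂ))

theorem wm_mkSub : wm (mkSub W WI WR) = W := rfl
theorem wm0_mkSub : wm0 (mkSub W WI WR) = W D.irr0 := rfl

theorem tot_wm0_bot : tot (wm0 (mkSub (fun _ _ => ⊥) WI WR)) = ⊥ := tot_eq_bot.2 fun _ => rfl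
theorem tot_wm0_top : tot (wm0 (mkSub (fun _ _ => ⊤) WI WR)) = ⊤ := tot_eq_top.2 fun _ => rfl
theorem tot_wm_bot (i : D.IrrIdx) : tot (wm (mkSub (fun _ _ => ⊥) WI WR) i) = ⊥ :=
  tot_eq_bot.2 fun _ => rfl
theorem tot_wm_top (i : D.IrrIdx) : tot (wm (mkSub (fun _ _ => ⊤) WI WR) i) = ⊤ :=
  tot_eq_top.2 fun _ => rfl

theorem wl_mkSub_irr (i : D.IrrIdx) (j : Fin (D.m i.1)) : wl (mkSub W WI WR) i.1 j = WI i j := by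
  funext t ht
  exact dif_pos i.2

theorem wl_mkSub_reg (i : RegIdx D) : wl (mkSub W WI WR) i.1 (D.j1 i.1) = WR i := by
  funext t ht
  exact dif_neg i.2

end mk

theorem latt_iff (W : VSub D) : (fun a => (Module.finrank ℂ (W a) : ℤ)) ∈ D.latt ↔
    ∀ i : D.IrrNz, Module.finrank ℂ (tot (wm0 W)) = Module.finrank ℂ (tot (wm W (toIrr i))) := by
  refine forall_congr' fun i => ?_
  rw [finrank_tot, finrank_tot, ← Nat.cast_inj (R := ℤ), Nat.cast_sum, Nat.cast_sum]
  rfl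

/-- Irreducibility with respect to the lattice in terms of block matrices. -/
def LIrrF (F : FlatData D) : Prop := ∀ W : VSub D, InvF W F →
  (∀ i : D.IrrNz, Module.finrank ℂ (tot (wm0 W)) = Module.finrank ℂ (tot (wm W (toIrr i)))) →
    (∀ a, W a = ⊥) ∨ ∀ a, W a = ⊤

theorem lIrred_iff (x : RepD D) : D.LIrred (αd := D.alphaV) x ↔ LIrrF (flat x) :=
  forall_congr' fun W => by
    constructor
    · intro h h1 h2
      exact h (invFamily_of_invF h1) ((latt_iff W).2 h2)
    · intro h h1 h2
      exact h (invF_of_invFamily h1) ((latt_iff W).1 h2)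

/-- All legs are full. -/
structure FullF (F : FlatData D) : Prop where
  LI : ∀ (i : D.IrrIdx) (j : Fin (D.m i.1)), (F.LI i j).Full
  LR : ∀ i : RegIdx D, (F.LR i).Full

/-- Invariance of the subspaces at the middle vertices. -/
structure InvM (W : ∀ (i : D.IrrIdx) (j : Fin (D.m i.1)), Submodule ℂ (Fin (D.nb i.1 j) → ℂ))
    (F : FlatData D) : Prop where
  a : ∀ i : D.IrrNz, ∀ v ∈ tot (W D.irr0), F.a i *ᵥ v ∈ tot (W (toIrr i))
  b : ∀ i : D.IrrNz, ∀ v ∈ tot (W (toIrr i)), F.b i *ᵥ v ∈ tot (W D.irr0)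
  X : ∀ (i : D.IrrIdx) (j j' : Fin (D.m i.1)), j ≠ j' → ∀ k, k < D.dd i.1 j j' →
    ∀ v ∈ W i j', blk (F.X i k) j j' *ᵥ v ∈ W i j
  LI : ∀ (i : D.IrrIdx) (j : Fin (D.m i.1)), ∀ v ∈ W i j,
    (F.LI i j).base (xz D i.1 j 0) *ᵥ v ∈ W i j
  LR : ∀ i : RegIdx D, ∀ v ∈ tot (W D.irr0), Yr F i *ᵥ v ∈ tot (W D.irr0)

/-- Irreducibility at the middle vertices. -/
def MidIrr (F : FlatData D) : Prop :=
  ∀ W : ∀ (i : D.IrrIdx) (j : Fin (D.m i.1)), Submodule ℂ (Fin (D.nb i.1 j) → ℂ), InvM W F →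
  (∀ i : D.IrrNz, Module.finrank ℂ (tot (W D.irr0)) = Module.finrank ℂ (tot (W (toIrr i)))) →
    (∀ i j, W i j = ⊥) ∨ ∀ i j, W i j = ⊤

theorem mulVec_bot {α β : Type} [Fintype α] [Fintype β] (M : Matrix α β ℂ)
    {v : β → ℂ} (hv : v ∈ (⊥ : Submodule ℂ (β → ℂ))) {W : Submodule ℂ (α → ℂ)} : M *ᵥ v ∈ W := by
  rw [(Submodule.mem_bot ℂ).1 hv, Matrix.mulVec_zero]
  exact zero_mem _

theorem bot_ne_top_mid (i : D.IrrIdx) (j : Fin (D.m i.1)) :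
    (⊥ : Submodule ℂ (Fin (D.nb i.1 j) → ℂ)) ≠ ⊤ := by
  intro h
  have h1 : Module.finrank ℂ (⊤ : Submodule ℂ (Fin (D.nb i.1 j) → ℂ)) = D.nb i.1 j := by
    rw [finrank_top, Module.finrank_fin_fun]
  rw [← h, finrank_bot] at h1
  have := D.hnb i.1 j
  omega

theorem finrank_tot_top (D : ConnData) (i : Fin (D.p + 1)) :
    Module.finrank ℂ (⊤ : Submodule ℂ (Sg D i → ℂ)) = D.n := by
  rw [finrank_top, Module.finrank_fintype_fun_eq_card, Fintype.card_sigma]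
  simpa using D.hsum i

theorem fullF_of_lIrrF {F : FlatData D} (hM : MomF F) (hI : LIrrF F) : FullF F := by
  have k1 : ∀ a, mkSub (fun i j => ⊥)
      (fun i j t ht => LinearMap.ker (Matrix.mulVecLin ((F.LI i j).U t ht)))
      (fun i t ht => LinearMap.ker (Matrix.mulVecLin ((F.LR i).U t ht))) a = ⊥ := by
    refine (hI (mkSub (fun i j => ⊥)
      (fun i j t ht => LinearMap.ker (Matrix.mulVecLin ((F.LI i j).U t ht)))
      (fun i t ht => LinearMap.ker (Matrix.mulVecLin ((F.LR i).U t ht)))) ⟨?_, ?_, ?_, ?_, ?_⟩ ?_).resolve_right ?_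
    · intro i v hv
      rw [tot_wm0_bot] at hv
      exact mulVec_bot _ hv
    · intro i v hv
      rw [tot_wm_bot] at hv
      exact mulVec_bot _ hv
    · intro i j j' _ k _ v hv
      exact mulVec_bot _ hv
    · intro i j
      rw [wl_mkSub_irr, wm_mkSub]
      exact (hM.legI i j).inv_ker
    · intro i
      rw [wl_mkSub_reg, tot_wm0_bot]
      exact (hM.legR i).inv_ker
    · intro i
      rw [tot_wm0_bot, tot_wm_bot, finrank_bot, finrank_bot]
    · intro h
      exact bot_ne_top_mid D.irr0 ⟨0, D.hm 0⟩ (h (D.vmid D.irr0 ⟨0, D.hm 0⟩))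
  have k2 : ∀ a, mkSub (fun i j => ⊤)
      (fun i j t ht => Submodule.map (Matrix.mulVecLin ((F.LI i j).V t ht)) ⊤)
      (fun i t ht => Submodule.map (Matrix.mulVecLin ((F.LR i).V t ht)) ⊤) a = ⊤ := by
    refine (hI (mkSub (fun i j => ⊤)
      (fun i j t ht => Submodule.map (Matrix.mulVecLin ((F.LI i j).V t ht)) ⊤)
      (fun i t ht => Submodule.map (Matrix.mulVecLin ((F.LR i).V t ht)) ⊤)) ⟨?_, ?_, ?_, ?_, ?_⟩ ?_).resolve_left ?_
    · intro i v hv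
      rw [tot_wm_top]
      trivial
    · intro i v hv
      rw [tot_wm0_top]
      trivial
    · intro i j j' _ k _ v hv
      trivial
    · intro i j
      rw [wl_mkSub_irr, wm_mkSub]
      exact (hM.legI i j).inv_map fun _ _ => trivial
    · intro i
      rw [wl_mkSub_reg, tot_wm0_top]
      exact (hM.legR i).inv_map fun _ _ => trivial
    · intro i
      rw [tot_wm0_top, tot_wm_top]
      exact (finrank_tot_top D 0).trans (finrank_tot_top D i.1).symm
    · intro h
      exact bot_ne_top_mid D.irr0 ⟨0, D.hm 0⟩ (h (D.vmid D.irr0 ⟨0, D.hm 0⟩)).symm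
  refine ⟨fun i j t ht => ⟨exists_left_inv_of_ker ?_, exists_right_inv_of_range ?_⟩,
    fun i t ht => ⟨exists_left_inv_of_ker ?_, exists_right_inv_of_range ?_⟩⟩
  · exact (dif_pos i.2).symm.trans (k1 (D.vleg i.1 j ⟨t, ht⟩))
  · rw [LinearMap.range_eq_map]
    exact (dif_pos i.2).symm.trans (k2 (D.vleg i.1 j ⟨t, ht⟩))
  · exact (dif_neg i.2).symm.trans (k1 (D.vleg i.1 (D.j1 i.1) ⟨t, ht⟩))
  · rw [LinearMap.range_eq_map]
    exact (dif_neg i.2).symm.trans (k2 (D.vleg i.1 (D.j1 i.1) ⟨t, ht⟩))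

theorem midIrr_of_lIrrF {F : FlatData D} (hM : MomF F) (hI : LIrrF F) : MidIrr F := by
  intro W hW hd
  have := hI (mkSub W
      (fun i j t ht => Submodule.map (Matrix.mulVecLin ((F.LI i j).V t ht)) (W i j))
      (fun i t ht => Submodule.map (Matrix.mulVecLin ((F.LR i).V t ht)) (tot (W D.irr0))))
      ⟨hW.a, hW.b, hW.X, fun i j => ?_, fun i => ?_⟩ hd
  · rcases this with h | h
    · exact Or.inl fun i j => h (D.vmid i j)
    · exact Or.inr fun i j => h (D.vmid i j)
  · rw [wl_mkSub_irr, wm_mkSub]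
    exact (hM.legI i j).inv_map (hW.LI i j)
  · rw [wl_mkSub_reg, wm0_mkSub]
    exact (hM.legR i).inv_map (hW.LR i)

theorem lIrrF_of_midIrr {F : FlatData D} (hF : FullF F) (hI : MidIrr F) : LIrrF F := by
  intro W hW hd
  rcases hI (wm W) ⟨hW.a, hW.b, hW.X, fun i j => (hW.LI i j).base _,
    fun i => (hW.LR i).base _⟩ hd with h | h
  · left
    have h0 : tot (wm0 W) = ⊥ := tot_eq_bot.2 fun j => h D.irr0 j
    rintro (⟨i, j⟩ | ⟨i, j, ⟨t, ht⟩⟩)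
    · exact h i j
    · by_cases hi : D.isIrr i
      · have h1 := hW.LI ⟨i, hi⟩ j
        rw [h ⟨i, hi⟩ j] at h1
        exact h1.eq_bot (hF.LI _ _) t ht
      · obtain rfl := eq_j1 hi j
        have h1 := hW.LR ⟨i, hi⟩
        rw [h0] at h1
        exact h1.eq_bot (hF.LR _) t ht
  · right
    have h0 : tot (wm0 W) = ⊤ := tot_eq_top.2 fun j => h D.irr0 j
    rintro (⟨i, j⟩ | ⟨i, j, ⟨t, ht⟩⟩)
    · exact h i j
    · by_cases hi : D.isIrr i
      · have h1 := hW.LI ⟨i, hi⟩ j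
        rw [h ⟨i, hi⟩ j] at h1
        exact h1.eq_top (hF.LI _ _) t ht
      · obtain rfl := eq_j1 hi j
        have h1 := hW.LR ⟨i, hi⟩
        rw [h0] at h1
        exact h1.eq_top (hF.LR _) t ht

theorem detCond_iff (x : RepD D) : D.DetCond (αd := D.alphaV) x ↔
    ∀ i, ∃ a' : Matrix (Sg D 0) (Sg D i.1) ℂ, a' * (flat x).a i = 1 ∧ (flat x).a i * a' = 1 := by
  refine forall_congr' fun i => ?_
  show Function.Bijective (Matrix.mulVecLin ((flat x).a i)) ↔ _
  constructor
  · rintro ⟨h1, h2⟩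
    obtain ⟨l, hl⟩ := exists_left_inv h1
    obtain ⟨r, hr⟩ := exists_right_inv h2
    have : l = r := by
      rw [← Matrix.mul_one l, ← hr, ← Matrix.mul_assoc, hl, Matrix.one_mul]
    exact ⟨l, hl, by rw [this, hr]⟩
  · rintro ⟨a', h1, h2⟩
    refine Function.bijective_iff_has_inverse.2 ⟨Matrix.mulVecLin a', fun v => ?_, fun v => ?_⟩
    · rw [Matrix.mulVecLin_apply, Matrix.mulVecLin_apply, Matrix.mulVec_mulVec, h1,
        Matrix.one_mulVec]
    · rw [Matrix.mulVecLin_apply, Matrix.mulVecLin_apply, Matrix.mulVec_mulVec, h2,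
        Matrix.one_mulVec]

end HTL

namespace HTL
set_option linter.unusedSectionVars false
set_option linter.unusedSimpArgs false
open ConnData
variable {D : ConnData}

/-- The polar part in normalised form at an irregular index. -/
noncomputable def Fx (F : FlatData D) (i : D.IrrIdx) : LMat (Sg D i.1) (Sg D i.1) :=
  FF (eb fun j => Fin (D.nb i.1 j)) (D.q i.1) (F.X i)
    (bd fun j => (F.LI i j).base (xz D i.1 j 0)) (tr D i.1)

/-- A frame at zero. -/
def fr0 (G : ∀ i : D.IrrIdx, Matrix (Sg D i.1) (Fin D.n) ℂ) : Matrix (Sg D 0) (Fin D.n) ℂ :=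
  G D.irr0

/-- A dual frame at zero. -/
def cofr0 (G' : ∀ i : D.IrrIdx, Matrix (Fin D.n) (Sg D i.1) ℂ) : Matrix (Fin D.n) (Sg D 0) ℂ :=
  G' D.irr0

/-- Compatibility of a tuple of polar parts with the block matrices of a representation. -/
structure Compat (A : Fin (D.p + 1) → LMat (Fin D.n) (Fin D.n)) (F : FlatData D)
    (G : ∀ i : D.IrrIdx, Matrix (Sg D i.1) (Fin D.n) ℂ)
    (G' : ∀ i : D.IrrIdx, Matrix (Fin D.n) (Sg D i.1) ℂ) : Prop where
  inv1 : ∀ i, G i * G' i = 1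
  inv2 : ∀ i, G' i * G i = 1
  a : ∀ i : D.IrrNz, G (toIrr i) = F.a i * fr0 G
  low : ∀ i : D.IrrIdx, ∀ n < -1, G i * cf (A i.1) n = cf (Fx F i) n * G i
  res : ∀ i : D.IrrIdx, G i * cf (A i.1) (-1) = Cm F i * G i
  rres : ∀ i : RegIdx D, fr0 G * cf (A i.1) (-1) = Yr F i * fr0 G
  rlow : ∀ i : RegIdx D, ∀ n < -1, cf (A i.1) n = 0
  pos : ∀ i n, 0 ≤ n → cf (A i) n = 0

theorem conj_symm {α β : Type} [Fintype α] [DecidableEq α] [Fintype β] [DecidableEq β]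
    {G : Matrix α β ℂ} {G' : Matrix β α ℂ} {M : Matrix α α ℂ} {N : Matrix β β ℂ}
    (h1 : G * G' = 1) (h2 : G' * G = 1) (h : G * N = M * G) : G' * M = N * G' := by
  calc G' * M = G' * (M * G) * G' := by
        rw [Matrix.mul_assoc, Matrix.mul_assoc, h1, Matrix.mul_one]
    _ = N * G' := by rw [← h, ← Matrix.mul_assoc, h2, Matrix.one_mul]

namespace Compat
variable {A : Fin (D.p + 1) → LMat (Fin D.n) (Fin D.n)} {F : FlatData D}
    {G : ∀ i : D.IrrIdx, Matrix (Sg D i.1) (Fin D.n) ℂ}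
    {G' : ∀ i : D.IrrIdx, Matrix (Fin D.n) (Sg D i.1) ℂ}

theorem inv01 (h : Compat A F G G') : fr0 G * cofr0 G' = 1 := h.inv1 D.irr0
theorem inv02 (h : Compat A F G G') : cofr0 G' * fr0 G = 1 := h.inv2 D.irr0

theorem a_eq (h : Compat A F G G') (i : D.IrrNz) : F.a i = G (toIrr i) * cofr0 G' := by
  rw [h.a, Matrix.mul_assoc, h.inv01, Matrix.mul_one]

theorem a' (h : Compat A F G G') (i : D.IrrNz) : G' (toIrr i) * F.a i = cofr0 G' := by
  rw [h.a_eq, ← Matrix.mul_assoc, h.inv2, Matrix.one_mul]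

theorem low' (h : Compat A F G G') (i : D.IrrIdx) (n : ℤ) (hn : n < -1) :
    G' i * cf (Fx F i) n = cf (A i.1) n * G' i := conj_symm (h.inv1 i) (h.inv2 i) (h.low i n hn)

theorem res' (h : Compat A F G G') (i : D.IrrIdx) :
    G' i * Cm F i = cf (A i.1) (-1) * G' i := conj_symm (h.inv1 i) (h.inv2 i) (h.res i)

theorem rres' (h : Compat A F G G') (i : RegIdx D) :
    cofr0 G' * Yr F i = cf (A i.1) (-1) * cofr0 G' := conj_symm h.inv01 h.inv02 (h.rres i)

end Compat

/-- Invariance of a subspace under all coefficients. -/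
def InvA (A : Fin (D.p + 1) → LMat (Fin D.n) (Fin D.n)) (W : Submodule ℂ (Fin D.n → ℂ)) : Prop :=
  ∀ i k, ∀ v ∈ W, cf (A i) k *ᵥ v ∈ W

theorem irr_of_midIrr {A : Fin (D.p + 1) → LMat (Fin D.n) (Fin D.n)} {F : FlatData D}
    {G : ∀ i : D.IrrIdx, Matrix (Sg D i.1) (Fin D.n) ℂ}
    {G' : ∀ i : D.IrrIdx, Matrix (Fin D.n) (Sg D i.1) ℂ} (h : Compat A F G G') (hM : MomF F)
    (hI : MidIrr F) (W : Submodule ℂ (Fin D.n → ℂ)) (hW : InvA A W) : W = ⊥ ∨ W = ⊤ := by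
  have key : ∀ i : D.IrrIdx, (∀ j, ∀ v ∈ W.comap (Matrix.mulVecLin (G' i)),
      eb (fun j => Fin (D.nb i.1 j)) j *ᵥ v ∈ W.comap (Matrix.mulVecLin (G' i))) ∧
      ∀ j j', j ≠ j' → ∀ k < (D.q i.1 j - D.q i.1 j').natDegree - 2,
        ∀ v ∈ W.comap (Matrix.mulVecLin (G' i)),
        (eb (fun j => Fin (D.nb i.1 j)) j * F.X i k * eb (fun j => Fin (D.nb i.1 j)) j') *ᵥ v
          ∈ W.comap (Matrix.mulVecLin (G' i)) := by
    intro i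
    have := mem_of_RC_FF (ρ := invAlg (W.comap (Matrix.mulVecLin (G' i)))) orth_eb
      (tr_valid i.1) (X := F.X i) (X' := F.X i)
      (N := bd fun j => (F.LI i j).base (xz D i.1 j 0))
      (N' := bd fun j => (F.LI i j).base (xz D i.1 j 0)) (by
        rw [tr_leaves, idem_eb]
        exact Subalgebra.one_mem _) (fun n hn => by
        rw [mem_invAlg]
        intro w hw
        rw [Submodule.mem_comap, Matrix.mulVecLin_apply] at hw ⊢
        rw [Matrix.mulVec_mulVec]
        have := h.low' i n (by omega)
        rw [Fx] at this
        rw [this, ← Matrix.mulVec_mulVec]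
        exact hW _ _ _ hw)
    exact ⟨fun j => this.1 j (mem_tr _ _),
      fun j j' hj k hk => this.2 j (mem_tr _ _) j' (mem_tr _ _) hj k hk⟩
  have htot : ∀ i : D.IrrIdx, tot (fun j => (W.comap (Matrix.mulVecLin (G' i))).comap
      (Matrix.mulVecLin (inj (fun j => Fin (D.nb i.1 j)) j))) =
      W.comap (Matrix.mulVecLin (G' i)) := fun i => tot_comap (key i).1
  have htot0 : tot (fun j => (W.comap (Matrix.mulVecLin (G' D.irr0))).comap
      (Matrix.mulVecLin (inj (fun j => Fin (D.nb 0 j)) j))) =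
      W.comap (Matrix.mulVecLin (cofr0 G')) := htot D.irr0
  have hX : ∀ (i : D.IrrIdx) (j j' : Fin (D.m i.1)), j ≠ j' → ∀ k, k < D.dd i.1 j j' →
      ∀ v ∈ (W.comap (Matrix.mulVecLin (G' i))).comap
        (Matrix.mulVecLin (inj (fun j => Fin (D.nb i.1 j)) j')),
      blk (F.X i k) j j' *ᵥ v ∈ (W.comap (Matrix.mulVecLin (G' i))).comap
        (Matrix.mulVecLin (inj (fun j => Fin (D.nb i.1 j)) j)) := by
    intro i j j' hj k hk
    refine eb_mul_mem_tot (W := fun j => (W.comap (Matrix.mulVecLin (G' i))).comap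
        (Matrix.mulVecLin (inj (fun j => Fin (D.nb i.1 j)) j))).1 ?_
    rw [htot]
    exact (key i).2 j j' hj k hk
  have hC : ∀ i : D.IrrIdx, ∀ v ∈ W.comap (Matrix.mulVecLin (G' i)),
      Cm F i *ᵥ v ∈ W.comap (Matrix.mulVecLin (G' i)) := by
    intro i v hv
    rw [Submodule.mem_comap, Matrix.mulVecLin_apply] at hv ⊢
    rw [Matrix.mulVec_mulVec, h.res', ← Matrix.mulVec_mulVec]
    exact hW _ _ _ hv
  have hfin : ∀ i : D.IrrIdx, Module.finrank ℂ (W.comap (Matrix.mulVecLin (G' i))) =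
      Module.finrank ℂ W := by
    intro i
    have e : W.comap (Matrix.mulVecLin (G' i)) = W.map (Matrix.mulVecLin (G i)) := by
      ext v
      rw [Submodule.mem_comap, Submodule.mem_map, Matrix.mulVecLin_apply]
      constructor
      · intro hv
        exact ⟨_, hv, by
          rw [Matrix.mulVecLin_apply, Matrix.mulVec_mulVec, h.inv1, Matrix.one_mulVec]⟩
      · rintro ⟨w, hw, rfl⟩
        rwa [Matrix.mulVecLin_apply, Matrix.mulVec_mulVec, h.inv2, Matrix.one_mulVec]
    rw [e]
    refine ((Submodule.equivMapOfInjective _ (fun v w hvw => ?_) W).finrank_eq).symm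
    rw [Matrix.mulVecLin_apply, Matrix.mulVecLin_apply] at hvw
    rw [← Matrix.one_mulVec v, ← Matrix.one_mulVec w, ← h.inv2 i, ← Matrix.mulVec_mulVec, hvw,
      Matrix.mulVec_mulVec]
  have hmem : ∀ (i : D.IrrIdx) v, v ∈ W ↔ G i *ᵥ v ∈ W.comap (Matrix.mulVecLin (G' i)) := by
    intro i v
    rw [Submodule.mem_comap, Matrix.mulVecLin_apply, Matrix.mulVec_mulVec, h.inv2,
      Matrix.one_mulVec]
  refine (hI (fun i j => (W.comap (Matrix.mulVecLin (G' i))).comap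
      (Matrix.mulVecLin (inj (fun j => Fin (D.nb i.1 j)) j))) ⟨?_, ?_, hX, ?_, ?_⟩ ?_).elim
      (fun h' => ?_) (fun h' => ?_)
  · intro i (v : Sg D 0 → ℂ) hv
    have hv' : v ∈ W.comap (Matrix.mulVecLin (cofr0 G')) := by
      rw [← htot0]
      exact hv
    rw [htot, Submodule.mem_comap, Matrix.mulVecLin_apply, Matrix.mulVec_mulVec, h.a']
    exact hv'
  · intro i v hv
    rw [htot] at hv
    have h3 : F.b i *ᵥ v ∈ W.comap (Matrix.mulVecLin (cofr0 G')) := by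
      rw [Submodule.mem_comap, Matrix.mulVecLin_apply, ← h.a' i, Matrix.mulVec_mulVec,
        Matrix.mul_assoc]
      have := hC _ _ hv
      rw [Cm_toIrr, Matrix.neg_mulVec, Submodule.neg_mem_iff, Submodule.mem_comap,
        Matrix.mulVecLin_apply, Matrix.mulVec_mulVec] at this
      exact this
    rw [← htot0] at h3
    exact h3
  · intro i j
    have h4 := eb_mul_mem_tot (M := Cm F i) (j := j) (j' := j)
      (W := fun j => (W.comap (Matrix.mulVecLin (G' i))).comap
        (Matrix.mulVecLin (inj (fun j => Fin (D.nb i.1 j)) j)))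
    rw [htot] at h4
    have h5 := h4.1 (fun v hv => by
      rw [← Matrix.mulVec_mulVec, ← Matrix.mulVec_mulVec]
      exact (key i).1 j _ (hC i _ ((key i).1 j _ hv)))
    intro v hv
    rw [← hM.mid i j] at h5
    have h6 := h5 v hv
    rw [Matrix.add_mulVec] at h6
    refine (Submodule.add_mem_iff_right _ ?_).1 h6
    rw [muX, Matrix.sum_mulVec]
    refine Submodule.sum_mem _ fun j' _ => ?_
    by_cases hj : j = j'
    · subst hj
      have : D.dd i.1 j j = 0 := by simp [dd]
      rw [this, Finset.range_zero, Finset.sum_empty, smul_zero, Matrix.zero_mulVec]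
      exact Submodule.zero_mem _
    · rw [Matrix.smul_mulVec, Matrix.sum_mulVec]
      refine Submodule.smul_mem _ _ (Submodule.sum_mem _ fun k hk => ?_)
      rw [Finset.mem_range] at hk
      rw [← Matrix.mulVec_mulVec]
      exact hX i j j' hj k hk _ (hX i j' j (Ne.symm hj) k (by rwa [dd_comm]) _ hv)
  · intro i (v : Sg D 0 → ℂ) hv
    have hv' : v ∈ W.comap (Matrix.mulVecLin (cofr0 G')) := by
      rw [← htot0]
      exact hv
    have h3 : Yr F i *ᵥ v ∈ W.comap (Matrix.mulVecLin (cofr0 G')) := by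
      rw [Submodule.mem_comap, Matrix.mulVecLin_apply] at hv' ⊢
      rw [Matrix.mulVec_mulVec, h.rres', ← Matrix.mulVec_mulVec]
      exact hW _ _ _ hv'
    rw [← htot0] at h3
    exact h3
  · intro i
    rw [htot, htot, hfin, hfin]
  · left
    have : W.comap (Matrix.mulVecLin (G' D.irr0)) = ⊥ :=
      (htot D.irr0).symm.trans (tot_eq_bot.2 (h' D.irr0))
    rw [eq_bot_iff]
    intro v hv
    rw [hmem D.irr0, this, Submodule.mem_bot] at hv
    rw [Submodule.mem_bot, ← Matrix.one_mulVec v, ← h.inv2 D.irr0, ← Matrix.mulVec_mulVec, hv,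
      Matrix.mulVec_zero]
  · right
    have : W.comap (Matrix.mulVecLin (G' D.irr0)) = ⊤ :=
      (htot D.irr0).symm.trans (tot_eq_top.2 (h' D.irr0))
    rw [eq_top_iff]
    intro v _
    rw [hmem D.irr0, this]
    exact Submodule.mem_top

end HTL

namespace HTL
set_option linter.unusedSectionVars false
set_option linter.unusedSimpArgs false
open ConnData
variable {D : ConnData}

/-- The total subspace over zero. -/
def totz (W : ∀ (i : D.IrrIdx) (j : Fin (D.m i.1)), Submodule ℂ (Fin (D.nb i.1 j) → ℂ)) :
    Submodule ℂ (Sg D 0 → ℂ) := tot (W D.irr0)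

theorem mulVec_mulVec_inv {α β : Type} [Fintype α] [DecidableEq α] [Fintype β] [DecidableEq β]
    {G : Matrix α β ℂ} {G' : Matrix β α ℂ} (h : G * G' = 1) (v : α → ℂ) : G *ᵥ (G' *ᵥ v) = v := by
  rw [Matrix.mulVec_mulVec, h, Matrix.one_mulVec]

theorem midIrr_of_irr {A : Fin (D.p + 1) → LMat (Fin D.n) (Fin D.n)} {F : FlatData D}
    {G : ∀ i : D.IrrIdx, Matrix (Sg D i.1) (Fin D.n) ℂ}
    {G' : ∀ i : D.IrrIdx, Matrix (Fin D.n) (Sg D i.1) ℂ} (h : Compat A F G G')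
    (hI : ∀ W, InvA A W → W = ⊥ ∨ W = ⊤) : MidIrr F := by
  intro W hW hd
  have ha : ∀ i : D.IrrNz, ∀ v ∈ totz W, F.a i *ᵥ v ∈ tot (W (toIrr i)) := hW.a
  have hb : ∀ i : D.IrrNz, ∀ v ∈ tot (W (toIrr i)), F.b i *ᵥ v ∈ totz W := hW.b
  have hY : ∀ i : RegIdx D, ∀ v ∈ totz W, Yr F i *ᵥ v ∈ totz W := hW.LR
  have hd' : ∀ i : D.IrrNz, Module.finrank ℂ (totz W) = Module.finrank ℂ (tot (W (toIrr i))) := hd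
  have ainj : ∀ i : D.IrrNz, Function.Injective (Matrix.mulVecLin (F.a i)) := by
    intro i v w hvw
    rw [Matrix.mulVecLin_apply, Matrix.mulVecLin_apply] at hvw
    have := congrArg (fun u => fr0 G *ᵥ (G' (toIrr i) *ᵥ u)) hvw
    simpa only [Matrix.mulVec_mulVec, h.a', Matrix.mul_assoc, h.inv01, Matrix.one_mulVec] using this
  have hmap : ∀ i : D.IrrNz, (totz W).map (Matrix.mulVecLin (F.a i)) = tot (W (toIrr i)) := by
    intro i
    refine Submodule.eq_of_le_of_finrank_eq ?_ ?_
    · rintro _ ⟨v, hv, rfl⟩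
      exact ha i v hv
    · rw [← hd']
      exact ((Submodule.equivMapOfInjective _ (ainj i) (totz W)).finrank_eq).symm
  have hmem : ∀ (i : D.IrrIdx) v, fr0 G *ᵥ v ∈ totz W ↔ G i *ᵥ v ∈ tot (W i) := by
    intro i v
    induction i using irr_cases with
    | h0 => exact Iff.rfl
    | h i =>
      rw [h.a, ← Matrix.mulVec_mulVec, ← hmap i]
      constructor
      · intro hv
        exact ⟨_, hv, rfl⟩
      · rintro ⟨w, hw, hw'⟩
        rwa [← ainj i hw']
  have hF : ∀ (i : D.IrrIdx) n, ∀ v ∈ tot (W i), cf (Fx F i) n *ᵥ v ∈ tot (W i) := by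
    intro i n
    refine RC_FF (ρ := invAlg (tot (W i))) (tr_valid i.1) (X' := F.X i)
      (N' := bd fun j => (F.LI i j).base (xz D i.1 j 0)) (fun j _ => ?_)
      (fun j _ j' _ hj k hk => ?_) (fun j _ => ?_) n n le_rfl
    · exact mem_invAlg.2 (eb_mem_tot j)
    · exact mem_invAlg.2 (eb_mul_mem_tot.2 (hW.X i j j' hj k hk))
    · refine mem_invAlg.2 (eb_mul_mem_tot.2 ?_)
      rw [blk_bd]
      exact hW.LI i j
  have hC : ∀ i : D.IrrIdx, ∀ v ∈ tot (W i), Cm F i *ᵥ v ∈ tot (W i) := by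
    intro i
    induction i using irr_cases with
    | h0 =>
      have : ∀ v ∈ totz W, C0 F *ᵥ v ∈ totz W := by
        intro v hv
        rw [C0, Matrix.sub_mulVec, Matrix.sum_mulVec, Matrix.sum_mulVec]
        refine Submodule.sub_mem _ (Submodule.sum_mem _ fun i _ => ?_)
          (Submodule.sum_mem _ fun i _ => hY i v hv)
        rw [← Matrix.mulVec_mulVec]
        exact hb i _ (ha i v hv)
      exact this
    | h i =>
      intro v hv
      rw [Cm_toIrr, Matrix.neg_mulVec, Submodule.neg_mem_iff, ← Matrix.mulVec_mulVec]
      exact ha i _ (hb i v hv)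
  have hA : InvA A ((totz W).comap (Matrix.mulVecLin (fr0 G))) := by
    intro i n v hv
    rw [Submodule.mem_comap, Matrix.mulVecLin_apply] at hv ⊢
    by_cases hn : 0 ≤ n
    · rw [h.pos i n hn, Matrix.zero_mulVec, Matrix.mulVec_zero]
      exact Submodule.zero_mem _
    by_cases hi : D.isIrr i
    · rw [hmem ⟨i, hi⟩] at hv ⊢
      rw [Matrix.mulVec_mulVec]
      by_cases hn1 : n < -1
      · have e : G ⟨i, hi⟩ * cf (A i) n = cf (Fx F ⟨i, hi⟩) n * G ⟨i, hi⟩ := h.low ⟨i, hi⟩ n hn1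
        rw [e, ← Matrix.mulVec_mulVec]
        exact hF _ _ _ hv
      · obtain rfl : n = -1 := by omega
        have e : G ⟨i, hi⟩ * cf (A i) (-1) = Cm F ⟨i, hi⟩ * G ⟨i, hi⟩ := h.res ⟨i, hi⟩
        rw [e, ← Matrix.mulVec_mulVec]
        exact hC _ _ hv
    · by_cases hn1 : n < -1
      · rw [h.rlow ⟨i, hi⟩ n hn1, Matrix.zero_mulVec, Matrix.mulVec_zero]
        exact Submodule.zero_mem _
      · obtain rfl : n = -1 := by omega
        have e : fr0 G * cf (A i) (-1) = Yr F ⟨i, hi⟩ * fr0 G := h.rres ⟨i, hi⟩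
        rw [Matrix.mulVec_mulVec, e, ← Matrix.mulVec_mulVec]
        exact hY _ _ hv
  rcases hI _ hA with h' | h'
  · left
    intro i
    refine tot_eq_bot.1 ((Submodule.eq_bot_iff _).2 fun v hv => ?_)
    rw [← mulVec_mulVec_inv (h.inv1 i) v, ← hmem] at hv
    have hv' : G' i *ᵥ v ∈ (totz W).comap (Matrix.mulVecLin (fr0 G)) := hv
    rw [h', Submodule.mem_bot] at hv'
    rw [← mulVec_mulVec_inv (h.inv1 i) v, hv', Matrix.mulVec_zero]
  · right
    intro i
    refine tot_eq_top.1 ((Submodule.eq_top_iff').2 fun v => ?_)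
    rw [← mulVec_mulVec_inv (h.inv1 i) v, ← hmem]
    have hv' : G' i *ᵥ v ∈ (totz W).comap (Matrix.mulVecLin (fr0 G)) := by
      rw [h']
      exact Submodule.mem_top
    exact hv'

end HTL

namespace HTL
set_option linter.unusedSectionVars false
set_option linter.unusedSimpArgs false
open ConnData
variable {D : ConnData}

theorem int_comp {α β γ : Type} [Fintype α] [DecidableEq α] [Fintype β] [DecidableEq β]
    [Fintype γ] [DecidableEq γ] {G1' : Matrix γ α ℂ} {G2 : Matrix β γ ℂ}
    {g : Matrix γ γ ℂ} {M : Matrix α α ℂ} {M' : Matrix β β ℂ} {N N' : Matrix γ γ ℂ}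
    (h1 : G1' * M = N * G1') (h2 : g * N = N' * g) (h3 : G2 * N' = M' * G2) :
    G2 * g * G1' * M = M' * (G2 * g * G1') := by
  rw [Matrix.mul_assoc, h1, ← Matrix.mul_assoc, Matrix.mul_assoc G2, h2, ← Matrix.mul_assoc, h3,
    Matrix.mul_assoc, Matrix.mul_assoc, Matrix.mul_assoc]

theorem inv_comp {α β γ : Type} [Fintype α] [DecidableEq α] [Fintype β] [DecidableEq β]
    [Fintype γ] [DecidableEq γ] {G1 : Matrix α γ ℂ} {G1' : Matrix γ α ℂ} {G2 : Matrix β γ ℂ}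
    {G2' : Matrix γ β ℂ} {g g' : Matrix γ γ ℂ} (h1 : G1' * G1 = 1) (hg : g * g' = 1)
    (h2 : G2 * G2' = 1) : G2 * g * G1' * (G1 * g' * G2') = 1 := by
  rw [Matrix.mul_assoc G1, Matrix.mul_assoc, ← Matrix.mul_assoc G1', h1, Matrix.one_mul,
    Matrix.mul_assoc G2, ← Matrix.mul_assoc g, hg, Matrix.one_mul, h2]

theorem cancel_left {α β : Type} [Fintype α] [DecidableEq α] [Fintype β] [DecidableEq β]
    {a a' : Matrix α β ℂ} {b b' : Matrix β α ℂ} {l : Matrix β α ℂ} {h0 : Matrix β β ℂ}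
    {h : Matrix α α ℂ} (hl : l * a' = 1) (ha : h * a = a' * h0) (e : h * (a * b) = a' * b' * h) :
    h0 * b = b' * h := by
  have := congrArg (l * ·) e
  beta_reduce at this
  rwa [← Matrix.mul_assoc h, ha, Matrix.mul_assoc, ← Matrix.mul_assoc l, hl, Matrix.one_mul,
    Matrix.mul_assoc, ← Matrix.mul_assoc l, hl, Matrix.one_mul] at this

/-- A family over a leg at a regular index. -/
def regFam {P : ℕ → Type} (PR : ∀ (i : RegIdx D) (t : ℕ) (ht : t < D.e i.1 (D.j1 i.1) - 1),
      P (lr D i.1 (D.j1 i.1) ⟨t, ht⟩)) {i : Fin (D.p + 1)} (h : ¬ D.isIrr i) :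
    ∀ (j : Fin (D.m i)), D.j1 i = j → ∀ t : Fin (D.e i j - 1), P (lr D i j t)
  | _, rfl, t => PR ⟨i, h⟩ t.1 t.2

/-- A family over all vertices. -/
def mkFam (P : ℕ → Type) (PM : ∀ (i : D.IrrIdx) (j : Fin (D.m i.1)), P (D.nb i.1 j))
    (PI : ∀ (i : D.IrrIdx) (j : Fin (D.m i.1)) (t : ℕ) (ht : t < D.e i.1 j - 1),
      P (lr D i.1 j ⟨t, ht⟩))
    (PR : ∀ (i : RegIdx D) (t : ℕ) (ht : t < D.e i.1 (D.j1 i.1) - 1),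
      P (lr D i.1 (D.j1 i.1) ⟨t, ht⟩)) : ∀ a : D.Vq, P (D.alphaV a)
  | .inl ⟨i, j⟩ => PM i j
  | .inr ⟨i, j, t⟩ => if h : D.isIrr i then PI ⟨i, h⟩ j t.1 t.2 else regFam PR h j (eq_j1 h j) t

section mk
variable {P : ℕ → Type} (PM : ∀ (i : D.IrrIdx) (j : Fin (D.m i.1)), P (D.nb i.1 j))
    (PI : ∀ (i : D.IrrIdx) (j : Fin (D.m i.1)) (t : ℕ) (ht : t < D.e i.1 j - 1),
      P (lr D i.1 j ⟨t, ht⟩))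
    (PR : ∀ (i : RegIdx D) (t : ℕ) (ht : t < D.e i.1 (D.j1 i.1) - 1),
      P (lr D i.1 (D.j1 i.1) ⟨t, ht⟩))

theorem mkFam_irr (i : D.IrrIdx) (j : Fin (D.m i.1)) (t : ℕ) (ht : t < D.e i.1 j - 1) :
    mkFam P PM PI PR (D.vleg i.1 j ⟨t, ht⟩) = PI i j t ht := dif_pos i.2

theorem mkFam_reg (i : RegIdx D) (t : ℕ) (ht : t < D.e i.1 (D.j1 i.1) - 1) :
    mkFam P PM PI PR (D.vleg i.1 (D.j1 i.1) ⟨t, ht⟩) = PR i t ht := dif_neg i.2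

end mk

section conj

variable {A A' : Fin (D.p + 1) → LMat (Fin D.n) (Fin D.n)} {F F' : FlatData D}
    {G1 G2 : ∀ i : D.IrrIdx, Matrix (Sg D i.1) (Fin D.n) ℂ}
    {G1' G2' : ∀ i : D.IrrIdx, Matrix (Fin D.n) (Sg D i.1) ℂ}

theorem comm_of_conj (h1 : Compat A F G1 G1') (h2 : Compat A' F' G2 G2')
    {g : Matrix (Fin D.n) (Fin D.n) ℂ} (hg : ∀ i n, g * cf (A i) n = cf (A' i) n * g)
    (i : D.IrrIdx) :
    (∀ j, G2 i * g * G1' i * eb (fun j => Fin (D.nb i.1 j)) j =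
      eb (fun j => Fin (D.nb i.1 j)) j * (G2 i * g * G1' i)) ∧
    ∀ j j', j ≠ j' → ∀ k < D.dd i.1 j j',
      (eb (fun j => Fin (D.nb i.1 j)) j * F.X i k * eb (fun j => Fin (D.nb i.1 j)) j',
        eb (fun j => Fin (D.nb i.1 j)) j * F'.X i k * eb (fun j => Fin (D.nb i.1 j)) j') ∈
      homAlg (G2 i * g * G1' i) := by
  have := mem_of_RC_FF (ρ := homAlg (G2 i * g * G1' i)) orth_eb
      (tr_valid i.1) (X := F.X i) (X' := F'.X i)
      (N := bd fun j => (F.LI i j).base (xz D i.1 j 0))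
      (N' := bd fun j => (F'.LI i j).base (xz D i.1 j 0)) (by
        rw [tr_leaves, idem_eb]
        exact Subalgebra.one_mem _) (fun n hn =>
        mem_homAlg.2 (int_comp (h1.low' i n (by omega)) (hg i.1 n) (h2.low i n (by omega))))
  exact ⟨fun j => mem_homAlg.1 (this.1 j (mem_tr _ _)),
    fun j j' hj k hk => this.2 j (mem_tr _ _) j' (mem_tr _ _) hj k hk⟩

theorem homF_of_conj (h1 : Compat A F G1 G1') (h2 : Compat A' F' G2 G2')
    (hM : MomF F) (hM' : MomF F') (hF : FullF F) (hF' : FullF F')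
    {g g' : Matrix (Fin D.n) (Fin D.n) ℂ} (hgg : g * g' = 1) (hgg' : g' * g = 1)
    (hg : ∀ i n, g * cf (A i) n = cf (A' i) n * g) :
    ∃ u : ∀ a : D.Vq, (Matrix (Fin (D.alphaV a)) (Fin (D.alphaV a)) ℂ)ˣ,
      HomF (fun a => (u a).val) F F' := by
  have hg' : ∀ i n, g' * cf (A' i) n = cf (A i) n * g' := fun i n => conj_symm hgg hgg' (hg i n)
  have hbd : ∀ i, G2 i * g * G1' i = bd fun j => blk (G2 i * g * G1' i) j j := fun i =>
    eq_bd_of_comm (comm_of_conj h1 h2 hg i).1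
  have hbd' : ∀ i, G1 i * g' * G2' i = bd fun j => blk (G1 i * g' * G2' i) j j := fun i =>
    eq_bd_of_comm (comm_of_conj h2 h1 hg' i).1
  let γ : ∀ (i : D.IrrIdx) (j : Fin (D.m i.1)), Matrix (Fin (D.nb i.1 j)) (Fin (D.nb i.1 j)) ℂ :=
    fun i j => blk (G2 i * g * G1' i) j j
  let γ' : ∀ (i : D.IrrIdx) (j : Fin (D.m i.1)), Matrix (Fin (D.nb i.1 j)) (Fin (D.nb i.1 j)) ℂ :=
    fun i j => blk (G1 i * g' * G2' i) j j
  have hγ : ∀ i, bd (γ i) = G2 i * g * G1' i := fun i => (hbd i).symm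
  have hγ' : ∀ i, bd (γ' i) = G1 i * g' * G2' i := fun i => (hbd' i).symm
  have u1 : ∀ i j, γ i j * γ' i j = 1 := by
    intro i j
    have : bd (γ i) * bd (γ' i) = 1 := by
      rw [hγ, hγ']
      exact inv_comp (h1.inv2 i) hgg (h2.inv1 i)
    have e := congrArg (fun M => blk M j j) this
    beta_reduce at e
    rwa [bd_mul, blk_bd, blk_one] at e
  have u2 : ∀ i j, γ' i j * γ i j = 1 := by
    intro i j
    have : bd (γ' i) * bd (γ i) = 1 := by
      rw [hγ, hγ']
      exact inv_comp (h2.inv2 i) hgg' (h1.inv1 i)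
    have e := congrArg (fun M => blk M j j) this
    beta_reduce at e
    rwa [bd_mul, blk_bd, blk_one] at e
  have hX : ∀ (i : D.IrrIdx) (j j' : Fin (D.m i.1)), j ≠ j' → ∀ k, k < D.dd i.1 j j' →
      γ i j * blk (F.X i k) j j' = blk (F'.X i k) j j' * γ i j' := by
    intro i j j' hj k hk
    have := (comm_of_conj h1 h2 hg i).2 j j' hj k hk
    rw [hbd] at this
    exact blk_mem_homAlg.1 this
  have hC : ∀ i, bd (γ i) * Cm F i = Cm F' i * bd (γ i) := by
    intro i
    rw [hγ]
    exact int_comp (h1.res' i) (hg i.1 (-1)) (h2.res i)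
  have hCb : ∀ i j, γ i j * blk (Cm F i) j j = blk (Cm F' i) j j * γ i j := by
    intro i j
    rw [← blk_bd_mul, hC, blk_mul_bd]
  have hmu : ∀ i j, γ i j * muX F i j = muX F' i j * γ i j := by
    intro i j
    rw [muX, muX, Finset.mul_sum, Finset.sum_mul]
    refine Finset.sum_congr rfl fun j' _ => ?_
    rw [Matrix.mul_smul, Matrix.smul_mul, Finset.mul_sum, Finset.sum_mul]
    by_cases hj : j = j'
    · subst hj
      have : D.dd i.1 j j = 0 := by simp [dd]
      rw [this, Finset.range_zero, Finset.sum_empty, Finset.sum_empty]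
    · congr 1
      refine Finset.sum_congr rfl fun k hk => ?_
      rw [Finset.mem_range] at hk
      rw [← Matrix.mul_assoc, hX i j j' hj k hk, Matrix.mul_assoc,
        hX i j' j (Ne.symm hj) k (by rwa [dd_comm]), Matrix.mul_assoc]
  have hbase : ∀ i j, γ i j * (F.LI i j).base (xz D i.1 j 0) =
      (F'.LI i j).base (xz D i.1 j 0) * γ i j := by
    intro i j
    have e1 := hCb i j
    rw [← hM.mid, ← hM'.mid, mul_add, add_mul, hmu] at e1
    exact add_left_cancel e1
  have hY : ∀ i, fr0 G2 * g * cofr0 G1' * Yr F i = Yr F' i * (fr0 G2 * g * cofr0 G1') :=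
    fun i => int_comp (h1.rres' i) (hg i.1 (-1)) (h2.rres i)
  have v1 : fr0 G2 * g * cofr0 G1' * (fr0 G1 * g' * cofr0 G2') = 1 :=
    inv_comp h1.inv02 hgg h2.inv01
  have v2 : fr0 G1 * g' * cofr0 G2' * (fr0 G2 * g * cofr0 G1') = 1 :=
    inv_comp h2.inv02 hgg' h1.inv01
  choose li li' hli hli' using fun i j => LegData.exists_int_equiv (hM.legI i j) (hF.LI i j)
    (hM'.legI i j) (hF'.LI i j) (u1 i j) (u2 i j) (hbase i j)
  choose lg lg' hlg hlg' using fun i => LegData.exists_int_equiv (hM.legR i) (hF.LR i)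
    (hM'.legR i) (hF'.LR i) v1 v2 (hY i)
  have hγ0 : bd (γ D.irr0) = fr0 G2 * g * cofr0 G1' := hγ D.irr0
  refine ⟨mkFam (fun k => (Matrix (Fin k) (Fin k) ℂ)ˣ)
    (fun i j => ⟨γ i j, γ' i j, u1 i j, u2 i j⟩)
    (fun i j t ht => ⟨li i j t ht, li' i j t ht, (hli' i j t ht).1, (hli' i j t ht).2⟩)
    (fun i t ht => ⟨lg i t ht, lg' i t ht, (hlg' i t ht).1, (hlg' i t ht).2⟩), ?_⟩
  have ha : ∀ i : D.IrrNz, bd (γ (toIrr i)) * F.a i = F'.a i * (fr0 G2 * g * cofr0 G1') := by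
    intro i
    rw [hγ, Matrix.mul_assoc, h1.a', h2.a, Matrix.mul_assoc, Matrix.mul_assoc, Matrix.mul_assoc]
  have hb : ∀ i : D.IrrNz, (fr0 G2 * g * cofr0 G1') * F.b i = F'.b i * bd (γ (toIrr i)) := by
    intro i
    have e := hC (toIrr i)
    rw [Cm_toIrr, Cm_toIrr, Matrix.mul_neg, Matrix.neg_mul, neg_inj] at e
    refine cancel_left (l := fr0 G2 * G2' (toIrr i)) ?_ (ha i) e
    rw [Matrix.mul_assoc, h2.a', h2.inv01]
  refine ⟨fun i => ?_, fun i => ?_, hX, fun i j => ?_, fun i => ?_⟩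
  · exact (ha i).trans (congrArg (F'.a i * ·) hγ0.symm)
  · have e : ∀ N : Matrix (Sg D 0) (Sg D 0) ℂ, N = fr0 G2 * g * cofr0 G1' →
        N * F.b i = F'.b i * bd (γ (toIrr i)) := by
      rintro _ rfl
      exact hb i
    exact e _ hγ0
  · have e : ∀ li', li' = li i j → (F.LI i j).Int (F'.LI i j) (γ i j) li' := by
      rintro _ rfl
      exact hli i j
    refine e _ (funext fun t => funext fun ht => ?_)
    exact congrArg Units.val (mkFam_irr (P := fun k => (Matrix (Fin k) (Fin k) ℂ)ˣ) _ _ _ i j t ht)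
  · have e : ∀ N lg', N = fr0 G2 * g * cofr0 G1' → lg' = lg i →
        (F.LR i).Int (F'.LR i) N lg' := by
      rintro _ _ rfl rfl
      exact hlg i
    refine e _ _ hγ0 (funext fun t => funext fun ht => ?_)
    exact congrArg Units.val (mkFam_reg (P := fun k => (Matrix (Fin k) (Fin k) ℂ)ˣ) _ _ _ i t ht)

end conj
end HTL

namespace HTL
set_option linter.unusedSectionVars false
set_option linter.unusedSimpArgs false
open ConnData
variable {D : ConnData}

theorem HomF.Fx {h : VMat D} {F F' : FlatData D} (H : HomF h F F') (i : D.IrrIdx) (n : ℤ) :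
    bd (hm h i) * cf (Fx F i) n = cf (HTL.Fx F' i) n * bd (hm h i) := by
  refine mem_homAlg.1 (RC_FF (ρ := homAlg (bd (hm h i))) (tr_valid i.1) (fun j _ => ?_)
    (fun j _ j' _ hj k hk => ?_) (fun j _ => ?_) n n le_rfl)
  · exact mem_homAlg.2 (eb_bd _ j).symm
  · exact blk_mem_homAlg.2 (H.X i j j' hj k hk)
  · refine blk_mem_homAlg.2 ?_
    rw [blk_bd, blk_bd]
    exact (H.LI i j).base _

theorem HomF.Yr {h : VMat D} {F F' : FlatData D} (H : HomF h F F') (i : RegIdx D) :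
    bd (hm0 h) * Yr F i = HTL.Yr F' i * bd (hm0 h) := (H.LR i).base _

theorem HomF.C0 {h : VMat D} {F F' : FlatData D} (H : HomF h F F') :
    bd (hm0 h) * C0 F = HTL.C0 F' * bd (hm0 h) := by
  rw [HTL.C0, HTL.C0, Matrix.mul_sub, Matrix.sub_mul, Finset.mul_sum, Finset.mul_sum,
    Finset.sum_mul, Finset.sum_mul]
  congr 1
  · refine Finset.sum_congr rfl fun i _ => ?_
    rw [← Matrix.mul_assoc, H.b, Matrix.mul_assoc, H.a, Matrix.mul_assoc]
  · exact Finset.sum_congr rfl fun i _ => H.Yr i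

theorem HomF.Cm {h : VMat D} {F F' : FlatData D} (H : HomF h F F') (i : D.IrrIdx) :
    bd (hm h i) * Cm F i = HTL.Cm F' i * bd (hm h i) := by
  refine irr_cases (P := fun i => bd (hm h i) * HTL.Cm F i = HTL.Cm F' i * bd (hm h i)) H.C0 ?_ i
  intro i
  rw [Cm_toIrr, Cm_toIrr, Matrix.mul_neg, Matrix.neg_mul, ← Matrix.mul_assoc, H.a,
    Matrix.mul_assoc, H.b, Matrix.mul_assoc]

section conj

variable {A A' : Fin (D.p + 1) → LMat (Fin D.n) (Fin D.n)} {F F' : FlatData D}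
    {G1 G2 : ∀ i : D.IrrIdx, Matrix (Sg D i.1) (Fin D.n) ℂ}
    {G1' G2' : ∀ i : D.IrrIdx, Matrix (Fin D.n) (Sg D i.1) ℂ}

theorem conj_of_homF (h1 : Compat A F G1 G1') (h2 : Compat A' F' G2 G2') {h : VMat D}
    (H : HomF h F F') (i : Fin (D.p + 1)) (n : ℤ) :
    cofr0 G2' * bd (hm0 h) * fr0 G1 * cf (A i) n =
      cf (A' i) n * (cofr0 G2' * bd (hm0 h) * fr0 G1) := by
  rcases le_or_gt 0 n with hn | hn
  · rw [h1.pos i n hn, h2.pos i n hn, Matrix.mul_zero, Matrix.zero_mul]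
  by_cases hi : D.isIrr i
  · have e : ∀ i : D.IrrIdx, G2' i * bd (hm h i) * G1 i = cofr0 G2' * bd (hm0 h) * fr0 G1 := by
      refine irr_cases (P := fun i => G2' i * bd (hm h i) * G1 i =
        cofr0 G2' * bd (hm0 h) * fr0 G1) rfl fun i => ?_
      rw [h1.a, Matrix.mul_assoc, ← Matrix.mul_assoc (bd _), H.a, ← Matrix.mul_assoc,
        ← Matrix.mul_assoc, h2.a']
    rw [← e ⟨i, hi⟩]
    rcases (by omega : n < -1 ∨ n = -1) with hn | rfl
    · exact int_comp (h1.low ⟨i, hi⟩ n hn) (H.Fx _ n) (h2.low' ⟨i, hi⟩ n hn)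
    · exact int_comp (h1.res ⟨i, hi⟩) (H.Cm _) (h2.res' ⟨i, hi⟩)
  · rcases (by omega : n < -1 ∨ n = -1) with hn | rfl
    · rw [h1.rlow ⟨i, hi⟩ n hn, h2.rlow ⟨i, hi⟩ n hn, Matrix.mul_zero, Matrix.zero_mul]
    · exact int_comp (h1.rres ⟨i, hi⟩) (H.Yr _) (h2.rres' ⟨i, hi⟩)

theorem exists_conj_of_homF (h1 : Compat A F G1 G1') (h2 : Compat A' F' G2 G2')
    (u : ∀ a : D.Vq, (Matrix (Fin (D.alphaV a)) (Fin (D.alphaV a)) ℂ)ˣ)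
    (H : HomF (fun a => (u a).val) F F') :
    ∃ g : (Matrix (Fin D.n) (Fin D.n) ℂ)ˣ, ∀ i n, g.val * cf (A i) n = cf (A' i) n * g.val := by
  have e1 : bd (hm0 fun a => (u a).val) * bd (hm0 fun a => (u a)⁻¹.val) = 1 := by
    rw [bd_mul, ← bd_one]
    exact congrArg bd (funext fun j => (u (D.vmid0 j)).mul_inv)
  have e2 : bd (hm0 fun a => (u a)⁻¹.val) * bd (hm0 fun a => (u a).val) = 1 := by
    rw [bd_mul, ← bd_one]
    exact congrArg bd (funext fun j => (u (D.vmid0 j)).inv_mul)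
  exact ⟨⟨_, _, inv_comp h1.inv01 e1 h2.inv02, inv_comp h2.inv01 e2 h1.inv02⟩,
    conj_of_homF h1 h2 H⟩

end conj
end HTL

namespace HTL
set_option linter.unusedSectionVars false
set_option linter.unusedSimpArgs false
open ConnData
variable {D : ConnData}

/-- The matrix identifying `ℂⁿ` with the sum of the blocks. -/
noncomputable def Pm (D : ConnData) (i : Fin (D.p + 1)) : Matrix (Sg D i) (Fin D.n) ℂ :=
  (1 : Matrix (Sg D i) (Sg D i) ℂ).submatrix id (D.sigmaEquiv i).symm

/-- The inverse of `Pm`. -/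
noncomputable def Pm' (D : ConnData) (i : Fin (D.p + 1)) : Matrix (Fin D.n) (Sg D i) ℂ :=
  (1 : Matrix (Sg D i) (Sg D i) ℂ).submatrix (D.sigmaEquiv i).symm id

theorem Pm_mul_Pm' (i : Fin (D.p + 1)) : Pm D i * Pm' D i = 1 := by
  rw [Pm, Pm', Matrix.submatrix_mul_equiv, Matrix.one_mul, Matrix.submatrix_id_id]

theorem Pm'_mul_Pm (i : Fin (D.p + 1)) : Pm' D i * Pm D i = 1 := by
  have := Matrix.submatrix_mul_equiv (1 : Matrix (Sg D i) (Sg D i) ℂ) (1 : Matrix (Sg D i) (Sg D i) ℂ)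
    (D.sigmaEquiv i).symm (Equiv.refl _) (D.sigmaEquiv i).symm
  rw [Matrix.one_mul, Matrix.submatrix_one_equiv] at this
  exact this

theorem bd_eq_sum {ι : Type} [Fintype ι] [DecidableEq ι] {β : ι → Type} [∀ j, Fintype (β j)]
    [∀ j, DecidableEq (β j)] (T : ∀ j, Matrix (β j) (β j) ℂ) :
    bd T = ∑ j, inj β j * T j * prj β j := by
  rw [← Matrix.one_mul (bd T), ← sum_inj_prj, Matrix.sum_mul]
  refine Finset.sum_congr rfl fun j _ => ?_
  rw [Matrix.mul_assoc, prj_bd, Matrix.mul_assoc]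

theorem cf_blockDiagonal' {ι : Type} [Fintype ι] [DecidableEq ι] {β : ι → Type} [∀ j, Fintype (β j)]
    [∀ j, DecidableEq (β j)] (M : ∀ j, LMat (β j) (β j)) (n : ℤ) :
    cf (Matrix.blockDiagonal' M) n = bd fun j => cf (M j) n := by
  ext r c
  rw [cf, bd, Matrix.blockDiagonal'_apply, Matrix.blockDiagonal'_apply]
  split_ifs
  · rfl
  · exact HahnSeries.coeff_zero

theorem BmatAt_eq (i : Fin (D.p + 1)) : D.BmatAt i =
    mono 0 (Pm' D i) * BB (eb fun j => Fin (D.nb i j)) (D.q i) (bd (D.R i)) Finset.univ *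
      mono 0 (Pm D i) := by
  refine cf_ext fun n => ?_
  have h : cf (BB (eb fun j => Fin (D.nb i j)) (D.q i) (bd (D.R i)) Finset.univ) n =
      bd fun j => (polyZinv (D.q i j)).coeff n • (1 : Matrix _ _ ℂ) +
        if n = -1 then D.R i j else 0 := by
    rw [BB, cf_sum]
    refine (Finset.sum_congr rfl fun j _ => ?_).trans (bd_eq_sum _).symm
    rw [cf_add, cf_pmat, cf_mono, eb_mul_eb, blk_bd, Matrix.mul_add, Matrix.add_mul,
      Matrix.mul_smul, Matrix.smul_mul, Matrix.mul_one, ← eb]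
    split_ifs
    · rfl
    · rw [Matrix.mul_zero, Matrix.zero_mul]
  rw [cf_mul_mono, cf_mono_mul, sub_zero, sub_zero, h, Pm, Pm', ← Matrix.submatrix_id_id (bd _),
    ← Equiv.coe_refl, Matrix.submatrix_mul_equiv, Matrix.submatrix_mul_equiv, Matrix.one_mul,
    Matrix.mul_one]
  have h2 := cf_blockDiagonal' (fun j => (Matrix.of fun a b =>
    (if a = b then polyZinv (D.q i j) else 0) + HahnSeries.single (-1 : ℤ) (D.R i j a b) :
      LMat (Fin (D.nb i j)) (Fin (D.nb i j)))) n
  refine (congrArg (fun M => M.submatrix (D.sigmaEquiv i).symm (D.sigmaEquiv i).symm) h2).trans ?_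
  congr 2
  funext j
  ext a b
  rw [cf, Matrix.of_apply, HahnSeries.coeff_add, HahnSeries.coeff_single, Matrix.add_apply,
    Matrix.smul_apply, Matrix.one_apply]
  congr 1
  · split_ifs <;> simp
  · split_ifs <;> rfl

/-- Membership in the truncated orbit of a normal form, up to regular terms. -/
def Loc (D : ConnData) (i : Fin (D.p + 1)) (A : LMat (Fin D.n) (Fin D.n)) : Prop :=
  ∃ X : GLps D.n, ∀ a b, Tame ((A - conjPS X (D.BmatAt i)) a b)

theorem loc_iff_fil {i : Fin (D.p + 1)} {A : LMat (Fin D.n) (Fin D.n)} :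
    Loc D i A ↔ ∃ X : GLps D.n, A - psMap _ X.val * D.BmatAt i * psMap _ (X⁻¹).val ∈
      Fil (Fin D.n) (Fin D.n) 0 := by
  refine exists_congr fun X => ⟨fun h n hn => ?_, fun h a b n hn => ?_⟩
  · ext a b
    exact h a b n hn
  · exact congrFun (congrFun (h n hn) a) b

theorem mono_cancel {α β : Type} [Fintype α] [DecidableEq α] [Fintype β] [DecidableEq β]
    {P : Matrix α β ℂ} {P' : Matrix β α ℂ} (h : P * P' = 1) : mono 0 P * mono 0 P' = 1 := by
  rw [mono_mul_mono, h, add_zero, mono_one]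

theorem Loc.exists_rel {i : Fin (D.p + 1)} {A : LMat (Fin D.n) (Fin D.n)} (h : Loc D i A) :
    ∃ (G : Matrix (Sg D i) (Fin D.n) ℂ) (G' : Matrix (Fin D.n) (Sg D i) ℂ), G * G' = 1 ∧
      G' * G = 1 ∧ Rel 1 (mono 0 G * A * mono 0 G')
        (BB (eb fun j => Fin (D.nb i j)) (D.q i) (bd (D.R i)) Finset.univ) := by
  obtain ⟨X, hX⟩ := loc_iff_fil.1 h
  obtain ⟨Z, hZ⟩ : ∃ Z, Z = psMap (Fin D.n) X.val := ⟨_, rfl⟩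
  obtain ⟨Y, hY⟩ : ∃ Y, Y = psMap (Fin D.n) (X⁻¹).val := ⟨_, rfl⟩
  have hZf : Z ∈ Fil _ _ 0 := hZ ▸ psMap_mem_fil _
  have hYf : Y ∈ Fil _ _ 0 := hY ▸ psMap_mem_fil _
  have hZY : Z * Y = 1 := by rw [hZ, hY, ← map_mul, X.mul_inv, map_one]
  have hYZ : Y * Z = 1 := by rw [hZ, hY, ← map_mul, X.inv_mul, map_one]
  rw [← hZ, ← hY] at hX
  have cone : cf (1 : LMat (Fin D.n) (Fin D.n)) 0 = 1 := by rw [← mono_one, cf_mono, if_pos rfl]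
  have h1 : cf Z 0 * cf Y 0 = 1 := by rw [← cf_mul_zero hZf hYf, hZY, cone]
  have h2 : cf Y 0 * cf Z 0 = 1 := by rw [← cf_mul_zero hYf hZf, hYZ, cone]
  have hP := Pm_mul_Pm' (D := D) i
  have hP' := Pm'_mul_Pm (D := D) i
  refine ⟨Pm D i * cf Y 0, cf Z 0 * Pm' D i, ?_, ?_, mono 0 (Pm D i * cf Y 0) * Z * mono 0 (Pm' D i),
    ⟨⟨Matrix.one_mul _, Matrix.mul_one _⟩, fun n hn => ?_⟩, ?_⟩
  · rw [Matrix.mul_assoc, ← Matrix.mul_assoc (cf Y 0), h2, Matrix.one_mul, hP]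
  · rw [Matrix.mul_assoc, ← Matrix.mul_assoc (Pm' D i), hP', Matrix.one_mul, h1]
  · rw [cf_sub, cf_mul_mono, cf_mono_mul, sub_zero, sub_zero]
    rcases (by omega : n = 0 ∨ n < 0) with rfl | hn
    · rw [Matrix.mul_assoc (Pm D i), h2, Matrix.mul_one, hP, ← mono_one, cf_mono, if_pos rfl,
        sub_self]
    · rw [hZf n hn, Matrix.mul_zero, Matrix.zero_mul, ← mono_one, cf_mono, if_neg hn.ne, sub_self]
  · have e : mono 0 (Pm D i * cf Y 0) * A * mono 0 (cf Z 0 * Pm' D i) *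
        (mono 0 (Pm D i * cf Y 0) * Z * mono 0 (Pm' D i)) -
        mono 0 (Pm D i * cf Y 0) * Z * mono 0 (Pm' D i) *
          BB (eb fun j => Fin (D.nb i j)) (D.q i) (bd (D.R i)) Finset.univ =
        mono 0 (Pm D i * cf Y 0) * ((A - Z * D.BmatAt i * Y) * Z) * mono 0 (Pm' D i) := by
      have e1 : mono 0 (cf Z 0 * Pm' D i) * (mono 0 (Pm D i * cf Y 0) * Z * mono 0 (Pm' D i)) =
          Z * mono 0 (Pm' D i) := by
        rw [← Matrix.mul_assoc, ← Matrix.mul_assoc, mono_cancel, Matrix.one_mul]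
        rw [Matrix.mul_assoc, ← Matrix.mul_assoc (Pm' D i), hP', Matrix.one_mul, h1]
      rw [Matrix.mul_assoc _ _ (mono 0 (Pm D i * cf Y 0) * Z * mono 0 (Pm' D i)), e1,
        Matrix.sub_mul, Matrix.mul_assoc (Z * _) Y, hYZ, Matrix.mul_one, Matrix.mul_sub,
        Matrix.sub_mul, BmatAt_eq]
      simp only [Matrix.mul_assoc]
      rw [mono_cancel hP, Matrix.mul_one]
    rw [e]
    exact mul_mem_fil' (c := 0) (mul_mem_fil (mono_mem_fil le_rfl _) (mul_mem_fil hX hZf))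
      (mono_mem_fil le_rfl _) (by omega)

theorem Loc.of_rel {i : Fin (D.p + 1)} {A : LMat (Fin D.n) (Fin D.n)}
    {G : Matrix (Sg D i) (Fin D.n) ℂ} {G' : Matrix (Fin D.n) (Sg D i) ℂ} (h1 : G * G' = 1)
    (h2 : G' * G = 1) (h : Rel 1 (mono 0 G * A * mono 0 G')
        (BB (eb fun j => Fin (D.nb i j)) (D.q i) (bd (D.R i)) Finset.univ)) : Loc D i A := by
  obtain ⟨b, hb, hr⟩ := h
  have hbf := hb.mem_fil one_mem_fil
  have hP := Pm_mul_Pm' (D := D) i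
  have hP' := Pm'_mul_Pm (D := D) i
  have hb0 : cf b 0 = 1 := by
    have := hb.2 0 (by omega)
    rw [cf_sub, ← mono_one, cf_mono, if_pos rfl, sub_eq_zero] at this
    exact this
  have hZf : mono 0 G' * b * mono 0 (Pm D i) ∈ Fil (Fin D.n) (Fin D.n) 0 :=
    mul_mem_fil' (c := 0) (mul_mem_fil (mono_mem_fil le_rfl _) hbf) (mono_mem_fil le_rfl _) (by omega)
  obtain ⟨X, hX⟩ := exists_units_of_cf_zero hZf (by
    rw [cf_mul_mono, cf_mono_mul, sub_zero, sub_zero, hb0, Matrix.mul_one]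
    refine (⟨G' * Pm D i, Pm' D i * G, ?_, ?_⟩ : (Matrix (Fin D.n) (Fin D.n) ℂ)ˣ).isUnit
    · rw [Matrix.mul_assoc, ← Matrix.mul_assoc (Pm D i), hP, Matrix.one_mul, h2]
    · rw [Matrix.mul_assoc, ← Matrix.mul_assoc G, h1, Matrix.one_mul, hP'])
  have hXX : psMap (Fin D.n) X.val * psMap (Fin D.n) (X⁻¹).val = 1 := by
    rw [← map_mul, X.mul_inv, map_one]
  refine loc_iff_fil.2 ⟨X, ?_⟩
  have e : A - psMap _ X.val * D.BmatAt i * psMap _ (X⁻¹).val =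
      mono 0 G' * (mono 0 G * A * mono 0 G' * b -
        b * BB (eb fun j => Fin (D.nb i j)) (D.q i) (bd (D.R i)) Finset.univ) * mono 0 (Pm D i) *
        psMap _ (X⁻¹).val := by
    have e1 : A = A * (psMap _ X.val * psMap _ (X⁻¹).val) := by rw [hXX, Matrix.mul_one]
    have e2 : ∀ (M : LMat (Sg D i) (Fin D.n)), mono 0 (Pm D i) * (mono 0 (Pm' D i) * M) = M := by
      intro M
      rw [← Matrix.mul_assoc, mono_cancel hP, Matrix.one_mul]
    have e3 : ∀ (M : LMat (Fin D.n) (Fin D.n)), mono 0 G' * (mono 0 G * M) = M := by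
      intro M
      rw [← Matrix.mul_assoc, mono_cancel h2, Matrix.one_mul]
    nth_rw 1 [e1]
    rw [hX, BmatAt_eq]
    simp only [Matrix.mul_assoc, Matrix.mul_sub, Matrix.sub_mul, e2, e3]
  rw [e]
  exact mul_mem_fil' (c := 0) (mul_mem_fil (mul_mem_fil (mono_mem_fil le_rfl _) hr)
    (mono_mem_fil le_rfl _)) (psMap_mem_fil _) (by omega)

end HTL

namespace HTL
set_option linter.unusedSectionVars false
set_option linter.unusedSimpArgs false
open ConnData
variable {D : ConnData}

/-- The normalised polar part with off-diagonal data `X` and residue blocks `N`. -/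
noncomputable def FD (i : Fin (D.p + 1)) (X : ℕ → Matrix (Sg D i) (Sg D i) ℂ)
    (N : ∀ j, Matrix (Fin (D.nb i j)) (Fin (D.nb i j)) ℂ) : LMat (Sg D i) (Sg D i) :=
  FF (eb fun j => Fin (D.nb i j)) (D.q i) X (bd N) (tr D i)

/-- The quadratic expression in `X` entering the residue blocks. -/
noncomputable def muD (i : Fin (D.p + 1)) (X : ℕ → Matrix (Sg D i) (Sg D i) ℂ) (j : Fin (D.m i)) :
    Matrix (Fin (D.nb i j)) (Fin (D.nb i j)) ℂ :=
  ∑ j', (tr D i).sg j j' • ∑ k ∈ Finset.range (D.dd i j j'), blk (X k) j j' * blk (X k) j' j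

theorem blk_cf_FD (i : Fin (D.p + 1)) (X : ℕ → Matrix (Sg D i) (Sg D i) ℂ)
    (N : ∀ j, Matrix (Fin (D.nb i j)) (Fin (D.nb i j)) ℂ) (j : Fin (D.m i)) :
    blk (cf (FD i X N) (-1)) j j = N j + muD i X j := by
  have h := congrArg (fun M => blk M j j)
    (cf_FF_diag (orth_eb (β := fun j => Fin (D.nb i j))) (D.hq1 i) X (bd N) (tr_valid i)
      (j := j) (by rw [tr_leaves]; exact Finset.mem_univ j))
  beta_reduce at h
  rw [blk_eb_mul_eb, blk_add, blk_eb_mul_eb, blk_bd, blk_sum, tr_leaves] at h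
  refine h.trans (congrArg (fun M => N j + M) (Finset.sum_congr rfl fun j' _ => ?_))
  rw [blk_smul, blk_sum]
  congr 1
  refine Finset.sum_congr rfl fun k _ => ?_
  simp only [blk_eq, eb, Matrix.mul_assoc]
  have e1 : ∀ M : Matrix (Fin (D.nb i j)) (Fin (D.nb i j)) ℂ,
      prj (fun j => Fin (D.nb i j)) j * (inj (fun j => Fin (D.nb i j)) j * M) = M := fun M => by
    rw [← Matrix.mul_assoc, prj_inj, Matrix.one_mul]
  rw [e1, prj_inj, Matrix.mul_one]

theorem rel_FD (i : Fin (D.p + 1)) (X : ℕ → Matrix (Sg D i) (Sg D i) ℂ)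
    (N : ∀ j, Matrix (Fin (D.nb i j)) (Fin (D.nb i j)) ℂ) {M : LMat (Sg D i) (Sg D i)}
    (hlow : ∀ n < -1, cf M n = cf (FD i X N) n)
    (hd : ∀ j, blk (cf M (-1)) j j = N j + muD i X j) :
    Rel 1 M (BB (eb fun j => Fin (D.nb i j)) (D.q i) (bd N) Finset.univ) := by
  have hO : M - FD i X N ∈ Fil (Sg D i) (Sg D i) (-1) := by
    rw [mem_fil]
    intro n hn
    rw [cf_sub, hlow n hn, sub_self]
  have hE : EE (eb fun j => Fin (D.nb i j)) (tr D i).leaves = 1 := by rw [tr_leaves, EE_eb]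
  have h := rel_of_FF (orth_eb (β := fun j => Fin (D.nb i j))) X (bd N) (tr_valid i) hO
    (by rw [hE]; exact ⟨one_mul _, mul_one _⟩) (fun j _ => by
      rw [show (0 : Matrix (Sg D i) (Sg D i) ℂ) =
        eb (fun j => Fin (D.nb i j)) j * 0 * eb (fun j => Fin (D.nb i j)) j by simp,
        eb_mul_eb_inj, cf_sub, blk_sub, hd, blk_cf_FD, sub_self]
      rfl)
  rw [hE, tr_leaves] at h
  have e : FF (eb fun j => Fin (D.nb i j)) (D.q i) X (bd N) (tr D i) + (M - FD i X N) = M :=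
    add_sub_cancel (FD i X N) M
  rwa [e] at h

theorem mono_bd_mul_BB (i : Fin (D.p + 1))
    {N N' g : ∀ j, Matrix (Fin (D.nb i j)) (Fin (D.nb i j)) ℂ} (h : ∀ j, g j * N j = N' j * g j) :
    mono 0 (bd g) * BB (eb fun j => Fin (D.nb i j)) (D.q i) (bd N) Finset.univ =
      BB (eb fun j => Fin (D.nb i j)) (D.q i) (bd N') Finset.univ * mono 0 (bd g) := by
  rw [BB, BB, Finset.mul_sum, Finset.sum_mul]
  refine Finset.sum_congr rfl fun j _ => ?_
  have hb : bd g * bd N = bd N' * bd g := by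
    rw [bd_mul, bd_mul]
    congr 1
    funext j
    exact h j
  rw [mul_add, add_mul, mono_mul_pmat, pmat_mul_mono, mono_mul_mono, mono_mul_mono, ← eb_bd,
    zero_add, add_zero]
  congr 2
  calc bd g * (eb (fun j => Fin (D.nb i j)) j * bd N * eb (fun j => Fin (D.nb i j)) j)
      = eb (fun j => Fin (D.nb i j)) j * (bd g * bd N) * eb (fun j => Fin (D.nb i j)) j := by
        simp only [← Matrix.mul_assoc]; rw [eb_bd]
    _ = _ := by
        rw [hb]; simp only [Matrix.mul_assoc]; rw [eb_bd]

theorem Rel.conj {S : Type} [Fintype S] [DecidableEq S] {M B B' : LMat S S} {g g' : Matrix S S ℂ}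
    (h1 : g * g' = 1) (h2 : g' * g = 1) (hB : mono 0 g * B = B' * mono 0 g) (h : Rel 1 M B) :
    Rel 1 (mono 0 g * M * mono 0 g') B' := by
  obtain ⟨b, ⟨_, hb⟩, hM⟩ := h
  have k1 := mono_cancel h1
  have k2 := mono_cancel h2
  have hB' : B * mono 0 g' = mono 0 g' * B' := by
    calc B * mono 0 g' = mono 0 g' * (mono 0 g * B) * mono 0 g' := by
          rw [← mul_assoc, k2, one_mul]
      _ = _ := by rw [hB, mul_assoc, mul_assoc, k1, mul_one]
  refine ⟨mono 0 g * b * mono 0 g', ⟨⟨one_mul _, mul_one _⟩, ?_⟩, ?_⟩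
  · have e : mono 0 g * b * mono 0 g' - 1 = mono 0 g * (b - 1) * mono 0 g' := by
      rw [mul_sub, sub_mul, mul_one, k1]
    rw [e]
    exact mul_mem_fil' (c := 1) (mul_mem_fil' (c := 1) (mono_mem_fil (l := 0) le_rfl _) hb (by simp))
      (mono_mem_fil (l := 0) le_rfl _) (by simp)
  · have e : mono 0 g * M * mono 0 g' * (mono 0 g * b * mono 0 g')
        - mono 0 g * b * mono 0 g' * B' = mono 0 g * (M * b - b * B) * mono 0 g' := by
      have e1 : mono 0 g * M * mono 0 g' * (mono 0 g * b * mono 0 g')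
          = mono 0 g * M * (mono 0 g' * mono 0 g) * b * mono 0 g' := by simp only [mul_assoc]
      rw [e1, k2, mul_one, mul_assoc (mono 0 g * b), ← hB']
      simp only [mul_sub, sub_mul, mul_assoc]
    rw [e]
    exact mul_mem_fil' (c := 0) (mul_mem_fil' (c := 0) (mono_mem_fil (l := 0) le_rfl _) hM (by simp))
      (mono_mem_fil (l := 0) le_rfl _) (by simp)

/-- A polar part with prescribed normalised coefficients lies in the truncated orbit. -/
theorem Loc.of_FD {i : Fin (D.p + 1)} {A : LMat (Fin D.n) (Fin D.n)}
    {G : Matrix (Sg D i) (Fin D.n) ℂ} {G' : Matrix (Fin D.n) (Sg D i) ℂ}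
    (h1 : G * G' = 1) (h2 : G' * G = 1) (X : ℕ → Matrix (Sg D i) (Sg D i) ℂ)
    {N g g' : ∀ j, Matrix (Fin (D.nb i j)) (Fin (D.nb i j)) ℂ}
    (hg1 : ∀ j, g j * g' j = 1) (hg2 : ∀ j, g' j * g j = 1) (hN : ∀ j, g j * N j = D.R i j * g j)
    (hlow : ∀ n < -1, G * cf A n = cf (FD i X N) n * G)
    (hd : ∀ j, blk (G * cf A (-1) * G') j j = N j + muD i X j) : Loc D i A := by
  have cfe : ∀ n, cf (mono 0 G * A * mono 0 G') n = G * cf A n * G' := fun n => by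
    rw [cf_mul_mono, cf_mono_mul, sub_zero, sub_zero]
  have hb1 : bd g * bd g' = 1 := by
    rw [bd_mul, show (fun j => g j * g' j) = fun j => 1 from funext hg1, bd_one]
  have hb2 : bd g' * bd g = 1 := by
    rw [bd_mul, show (fun j => g' j * g j) = fun j => 1 from funext hg2, bd_one]
  have hr := Rel.conj hb1 hb2 (mono_bd_mul_BB i hN)
    (rel_FD i X N (M := mono 0 G * A * mono 0 G') (fun n hn => by
      rw [cfe, hlow n hn, Matrix.mul_assoc, h1, Matrix.mul_one]) (fun j => by rw [cfe, hd]))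
  have e : mono 0 (bd g) * (mono 0 G * A * mono 0 G') * mono 0 (bd g') =
      mono 0 (bd g * G) * A * mono 0 (G' * bd g') := by
    rw [← zero_add (0 : ℤ), ← mono_mul_mono, ← mono_mul_mono]
    simp only [Matrix.mul_assoc, zero_add]
  rw [e] at hr
  refine Loc.of_rel ?_ ?_ hr
  · rw [Matrix.mul_assoc, ← Matrix.mul_assoc G, h1, Matrix.one_mul, hb1]
  · rw [Matrix.mul_assoc, ← Matrix.mul_assoc _ (bd g), hb2, Matrix.one_mul, h2]

/-- Normalisation of a polar part in a truncated orbit. -/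
theorem Loc.exists_FD {i : Fin (D.p + 1)} {A : LMat (Fin D.n) (Fin D.n)} (h : Loc D i A) :
    ∃ (G : Matrix (Sg D i) (Fin D.n) ℂ) (G' : Matrix (Fin D.n) (Sg D i) ℂ)
      (X : ℕ → Matrix (Sg D i) (Sg D i) ℂ), G * G' = 1 ∧ G' * G = 1 ∧
      (∀ n < -1, G * cf A n = cf (FD i X (D.R i)) n * G) ∧
      ∀ j, blk (G * cf A (-1) * G') j j = D.R i j + muD i X j := by
  obtain ⟨G, G', h1, h2, hr⟩ := h.exists_rel
  have hE : EE (eb fun j => Fin (D.nb i j)) (tr D i).leaves = 1 := by rw [tr_leaves, EE_eb]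
  obtain ⟨X, hX, hX'⟩ := exists_FF (orth_eb (β := fun j => Fin (D.nb i j))) (bd (D.R i))
    (tr_valid i) (M := mono 0 G * A * mono 0 G')
    (by rw [hE]; exact ⟨one_mul _, mul_one _⟩) (by rw [hE, tr_leaves]; exact hr)
  have cfe : ∀ n, cf (mono 0 G * A * mono 0 G') n = G * cf A n * G' := fun n => by
    rw [cf_mul_mono, cf_mono_mul, sub_zero, sub_zero]
  refine ⟨G, G', X, h1, h2, fun n hn => ?_, fun j => ?_⟩
  · have k := (mem_fil.1 hX) n hn
    rw [cf_sub, cfe, sub_eq_zero] at k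
    have k' : G * cf A n * G' = cf (FD i X (D.R i)) n := k
    rw [← k', Matrix.mul_assoc, h2, Matrix.mul_one]
  · have k := hX' j (by rw [tr_leaves]; exact Finset.mem_univ j)
    rw [show (0 : Matrix (Sg D i) (Sg D i) ℂ) =
        eb (fun j => Fin (D.nb i j)) j * 0 * eb (fun j => Fin (D.nb i j)) j by simp,
        eb_mul_eb_inj, cf_sub, blk_sub, cfe] at k
    have k' := sub_eq_zero.1 (k.trans (show _ = 0 from rfl))
    exact k'.trans (blk_cf_FD i X (D.R i) j)

end HTL

namespace HTL
set_option linter.unusedSectionVars false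
set_option linter.unusedSimpArgs false
open ConnData
variable {D : ConnData}

/-- The leading block of a full leg is similar to the prescribed residue block. -/
theorem exists_similar_R (i : Fin (D.p + 1)) (j : Fin (D.m i)) {β : Type} [Fintype β]
    [DecidableEq β] (hc : Fintype.card β = D.nb i j) (L : LegData β (D.e i j - 1) (lr D i j))
    (hM : L.Mom (xz D i j)) (hF : L.Full) :
    ∃ (g : Matrix (Fin (D.nb i j)) β ℂ) (g' : Matrix β (Fin (D.nb i j)) ℂ),
      g * g' = 1 ∧ g' * g = 1 ∧ g * L.base (xz D i j 0) = D.R i j * g := by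
  refine exists_similar (D.e i j - 1 + 1) (fun k hk => ?_) hM.pr_eq_zero (pr_R_zero i j)
  rcases k with _ | t
  · show (1 : Matrix β β ℂ).rank = (1 : Matrix (Fin (D.nb i j)) (Fin (D.nb i j)) ℂ).rank
    rw [Matrix.rank_one, Matrix.rank_one, hc, Fintype.card_fin]
  · rcases Nat.lt_or_ge t (D.e i j - 1) with h | h
    · rw [lr_eq i j t h]
      exact LegData.Mom.rank_pr hM hF t h
    · obtain rfl : t = D.e i j - 1 := by omega
      rw [hM.pr_eq_zero, pr_R_zero i j, Matrix.rank_zero, Matrix.rank_zero]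

/-- A matrix similar to a residue block is the leading block of a full leg. -/
theorem exists_leg_R (i : Fin (D.p + 1)) (j : Fin (D.m i)) {β : Type} [Fintype β]
    [DecidableEq β] {M : Matrix β β ℂ} {V : Matrix (Fin (D.nb i j)) β ℂ}
    {V' : Matrix β (Fin (D.nb i j)) ℂ} (h1 : V * V' = 1) (h2 : V' * V = 1)
    (h : V * M = D.R i j * V) :
    ∃ L : LegData β (D.e i j - 1) (lr D i j),
      L.base (xz D i j 0) = M ∧ L.Mom (xz D i j) ∧ L.Full := by
  have e : ∀ k, pr M (xz D i j) k = V' * pr (D.R i j) (xz D i j) k * V := fun k => by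
    rw [Matrix.mul_assoc, ← pr_factor h, ← Matrix.mul_assoc, h2, Matrix.one_mul]
  refine LegData.exists_leg M (fun t ht => ?_) ?_
  · rw [← lr_eq i j t ht, e]
    refine le_antisymm ?_ ?_
    · exact (Matrix.rank_mul_le_left _ _).trans (Matrix.rank_mul_le_right _ _)
    · have e2 : pr (D.R i j) (xz D i j) (t + 1) =
          V * (V' * pr (D.R i j) (xz D i j) (t + 1) * V) * V' := by
        simp only [Matrix.mul_assoc]
        rw [h1, Matrix.mul_one, ← Matrix.mul_assoc, h1, Matrix.one_mul]
      conv_lhs => rw [e2]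
      exact (Matrix.rank_mul_le_left _ _).trans (Matrix.rank_mul_le_right _ _)
  · rw [e, pr_R_zero, Matrix.mul_zero, Matrix.zero_mul]

theorem subsingleton_reg {i : Fin (D.p + 1)} (hi : ¬ D.isIrr i) : Subsingleton (Fin (D.m i)) :=
  ⟨fun a b => (eq_j1 hi a).symm.trans (eq_j1 hi b)⟩

theorem cf_FD_reg {i : Fin (D.p + 1)} (hi : ¬ D.isIrr i) (X : ℕ → Matrix (Sg D i) (Sg D i) ℂ)
    (N : ∀ j, Matrix (Fin (D.nb i j)) (Fin (D.nb i j)) ℂ) {n : ℤ} (hn : n < -1) :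
    cf (FD i X N) n = 0 := by
  have hs := subsingleton_reg hi
  have hz : i ≠ 0 := fun h => hi (Or.inr h)
  have hm1 : D.m i = 1 := by
    have := D.hm i
    have h' : ¬ 1 < D.m i := fun h => hi (Or.inl h)
    omega
  have hv := tr_valid i
  rw [FD]
  revert hv
  generalize tr D i = t
  intro hv
  rcases t with j | ⟨d, l, r⟩
  · rw [FF, cf_add, cf_mono, if_neg (by omega), add_zero, D.hreg i hz hm1 j, cf_pmat]
    simp [polyZinv]
  · obtain ⟨-, -, hd, -⟩ := hv
    obtain ⟨x, hx⟩ := l.leaves_nonempty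
    obtain ⟨y, hy⟩ := r.leaves_nonempty
    exact absurd (Subsingleton.elim x y ▸ hy) (Finset.disjoint_left.1 hd hx)

theorem muD_reg {i : Fin (D.p + 1)} (hi : ¬ D.isIrr i) (X : ℕ → Matrix (Sg D i) (Sg D i) ℂ)
    (j : Fin (D.m i)) : muD i X j = 0 := by
  have hs := subsingleton_reg hi
  refine Finset.sum_eq_zero fun j' _ => ?_
  rw [Subsingleton.elim j' j, dd, sub_self]
  simp

theorem inj_prj_reg {i : Fin (D.p + 1)} (hi : ¬ D.isIrr i) :
    inj (fun j => Fin (D.nb i j)) (D.j1 i) * prj (fun j => Fin (D.nb i j)) (D.j1 i) = 1 := by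
  rw [← sum_inj_prj, Fintype.sum_eq_single (D.j1 i) fun j hj => absurd (eq_j1 hi j).symm hj]

theorem nb_reg {i : Fin (D.p + 1)} (hi : ¬ D.isIrr i) : D.nb i (D.j1 i) = D.n := by
  rw [← D.hsum i, Fintype.sum_eq_single (D.j1 i) fun j hj => absurd (eq_j1 hi j).symm hj]

theorem Loc.exists_reg {i : Fin (D.p + 1)} (hi : ¬ D.isIrr i) {A : LMat (Fin D.n) (Fin D.n)}
    (h : Loc D i A) : (∀ n < -1, cf A n = 0) ∧
      ∃ (V : Matrix (Fin (D.nb i (D.j1 i))) (Fin D.n) ℂ)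
        (V' : Matrix (Fin D.n) (Fin (D.nb i (D.j1 i))) ℂ), V * V' = 1 ∧ V' * V = 1 ∧
        V * cf A (-1) = D.R i (D.j1 i) * V := by
  obtain ⟨G, G', X, h1, h2, hl, hd⟩ := h.exists_FD
  have k2 : (G' * inj (fun j => Fin (D.nb i j)) (D.j1 i)) *
      (prj (fun j => Fin (D.nb i j)) (D.j1 i) * G) = 1 := by
    rw [Matrix.mul_assoc, ← Matrix.mul_assoc (inj (fun j => Fin (D.nb i j)) (D.j1 i)), inj_prj_reg hi, Matrix.one_mul, h2]
  refine ⟨fun n hn => ?_, prj (fun j => Fin (D.nb i j)) (D.j1 i) * G,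
    G' * inj (fun j => Fin (D.nb i j)) (D.j1 i), ?_, k2, ?_⟩
  · have := hl n hn
    rw [cf_FD_reg hi _ _ hn, Matrix.zero_mul] at this
    rw [← Matrix.one_mul (cf A n), ← h2, Matrix.mul_assoc, this, Matrix.mul_zero]
  · rw [Matrix.mul_assoc, ← Matrix.mul_assoc G, h1, Matrix.one_mul, prj_inj]
  · have := hd (D.j1 i)
    rw [muD_reg hi, add_zero, blk_eq] at this
    rw [← this]
    simp only [Matrix.mul_assoc]
    rw [← Matrix.mul_assoc (inj (fun j => Fin (D.nb i j)) (D.j1 i)), inj_prj_reg hi, Matrix.one_mul, h2, Matrix.mul_one]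

theorem Loc.of_reg {i : Fin (D.p + 1)} (hi : ¬ D.isIrr i) {A : LMat (Fin D.n) (Fin D.n)}
    (hl : ∀ n < -1, cf A n = 0) {V : Matrix (Fin (D.nb i (D.j1 i))) (Fin D.n) ℂ}
    {V' : Matrix (Fin D.n) (Fin (D.nb i (D.j1 i))) ℂ} (h1 : V * V' = 1) (h2 : V' * V = 1)
    (hV : V * cf A (-1) = D.R i (D.j1 i) * V) : Loc D i A := by
  refine Loc.of_FD (G := inj (fun j => Fin (D.nb i j)) (D.j1 i) * V)
    (G' := V' * prj (fun j => Fin (D.nb i j)) (D.j1 i)) ?_ ?_ (fun _ => 0) (N := D.R i)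
    (g := fun _ => 1) (g' := fun _ => 1) (fun _ => mul_one _) (fun _ => mul_one _)
    (fun j => by rw [Matrix.one_mul, Matrix.mul_one]) (fun n hn => ?_) (fun j => ?_)
  · rw [Matrix.mul_assoc, ← Matrix.mul_assoc V, h1, Matrix.one_mul, inj_prj_reg hi]
  · rw [Matrix.mul_assoc, ← Matrix.mul_assoc (prj (fun j => Fin (D.nb i j)) (D.j1 i)), prj_inj, Matrix.one_mul, h2]
  · rw [hl n hn, cf_FD_reg hi _ _ hn, Matrix.mul_zero, Matrix.zero_mul]
  · obtain rfl := eq_j1 hi j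
    rw [muD_reg hi, add_zero, blk_eq, Matrix.mul_assoc (inj (fun j => Fin (D.nb i j)) (D.j1 i)), hV]
    simp only [Matrix.mul_assoc]
    rw [prj_inj, Matrix.mul_one, h1, Matrix.mul_one, ← Matrix.mul_assoc, prj_inj, Matrix.one_mul]

end HTL

namespace HTL
set_option linter.unusedSectionVars false
set_option linter.unusedSimpArgs false
open ConnData
variable {D : ConnData}

/-- A family over the irregular indices from its values at zero and away from zero. -/
def mkIrr {T : Fin (D.p + 1) → Type} (t0 : T 0) (t : ∀ i : D.IrrNz, T i.1) : ∀ i : D.IrrIdx, T i.1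
  | ⟨i, hi⟩ => if h : i = 0 then by subst h; exact t0 else t ⟨i, hi, h⟩

theorem mkIrr_toIrr {T : Fin (D.p + 1) → Type} (t0 : T 0) (t : ∀ i : D.IrrNz, T i.1)
    (i : D.IrrNz) : mkIrr (T := T) t0 t (toIrr i) = t i := dif_neg i.2.2

theorem sum_split {M : Type} [AddCommGroup M] (f : Fin (D.p + 1) → M) :
    ∑ i, f i = f 0 + ∑ i : D.IrrNz, f i.1 + ∑ i : RegIdx D, f i.1 := by
  have h : ∀ (P : Fin (D.p + 1) → Prop) [DecidablePred P],
      ∑ i : {i // P i}, f i.1 = ∑ i, if P i then f i else 0 := fun P _ => by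
    rw [← Finset.sum_filter]
    exact (Finset.sum_subtype _ (fun x => by simp) f).symm
  have h0 : f 0 = ∑ i, if i = 0 then f i else 0 := by
    rw [Finset.sum_ite_eq' Finset.univ (0 : Fin (D.p + 1)) f, if_pos (Finset.mem_univ _)]
  rw [h fun i => D.isIrr i ∧ i ≠ 0, h fun i => ¬ D.isIrr i, h0, ← Finset.sum_add_distrib,
    ← Finset.sum_add_distrib]
  refine Finset.sum_congr rfl fun i _ => ?_
  by_cases hz : i = 0
  · subst hz
    have h1 : D.isIrr 0 := Or.inr rfl
    simp [h1]
  · by_cases hi : D.isIrr i <;> simp [hz, hi]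

theorem exists_polar {ι : Type} [Fintype ι] [DecidableEq ι] (M : LMat ι ι) (R : Matrix ι ι ℂ) :
    ∃ A : LMat ι ι, (∀ n < -1, cf A n = cf M n) ∧ cf A (-1) = R ∧ ∀ n, 0 ≤ n → cf A n = 0 := by
  obtain ⟨a, ha⟩ := exists_fil M
  have hs : ∀ n, -1 ≤ n → ∑ i ∈ Finset.Ico a (-1), cf (mono i (cf M i)) n = 0 := fun n hn => by
    refine Finset.sum_eq_zero fun i hi => ?_
    rw [cf_mono, if_neg]
    have := (Finset.mem_Ico.1 hi).2
    omega
  refine ⟨∑ i ∈ Finset.Ico a (-1), mono i (cf M i) + mono (-1) R, fun n hn => ?_, ?_,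
    fun n hn => ?_⟩
  · have := mem_fil.1 (sub_sum_mono_mem_fil (b := -1) ha) n hn
    rw [cf_sub, sub_eq_zero] at this
    rw [cf_add, ← this, cf_mono, if_neg (by omega), add_zero]
  · rw [cf_add, cf_sum, hs _ le_rfl, cf_mono, if_pos rfl, zero_add]
  · rw [cf_add, cf_sum, hs _ (by omega), cf_mono, if_neg (by omega), zero_add]

theorem card_Sg (i : Fin (D.p + 1)) : Fintype.card (Sg D i) = D.n := by
  simpa using D.hsum i

/-- Every stable solution of the moment map equations comes from a tuple of polar parts. -/
theorem exists_compat_of_flat {F : FlatData D} (hM : MomF F) (hF : FullF F) (hI : MidIrr F)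
    (ha : ∀ i, ∃ a' : Matrix (Sg D 0) (Sg D i.1) ℂ, a' * F.a i = 1 ∧ F.a i * a' = 1) :
    ∃ A G G', Compat A F G G' ∧ D.MBMem A := by
  choose a' ha1 ha2 using ha
  obtain ⟨P, P', hP, hP'⟩ : ∃ (P : Matrix (Sg D 0) (Fin D.n) ℂ) (P' : Matrix (Fin D.n) (Sg D 0) ℂ),
    P * P' = 1 ∧ P' * P = 1 := ⟨Pm D 0, Pm' D 0, Pm_mul_Pm' 0, Pm'_mul_Pm 0⟩
  obtain ⟨G, hG0, hG⟩ : ∃ G : ∀ i : D.IrrIdx, Matrix (Sg D i.1) (Fin D.n) ℂ, fr0 G = P ∧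
      ∀ i : D.IrrNz, G (toIrr i) = F.a i * P :=
    ⟨mkIrr (T := fun i => Matrix (Sg D i) (Fin D.n) ℂ) P fun i => F.a i * P, rfl,
      fun i => mkIrr_toIrr (T := fun i => Matrix (Sg D i) (Fin D.n) ℂ) _ _ i⟩
  obtain ⟨G', hG0', hG'⟩ : ∃ G' : ∀ i : D.IrrIdx, Matrix (Fin D.n) (Sg D i.1) ℂ, cofr0 G' = P' ∧
      ∀ i : D.IrrNz, G' (toIrr i) = P' * a' i :=
    ⟨mkIrr (T := fun i => Matrix (Fin D.n) (Sg D i) ℂ) P' fun i => P' * a' i, rfl,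
      fun i => mkIrr_toIrr (T := fun i => Matrix (Fin D.n) (Sg D i) ℂ) _ _ i⟩
  have i1 : ∀ i, G i * G' i = 1 := irr_cases
    (show fr0 G * cofr0 G' = 1 by rw [hG0, hG0', hP]) fun i => by
      rw [hG, hG', Matrix.mul_assoc, ← Matrix.mul_assoc P, hP, Matrix.one_mul]
      exact ha2 i
  have i2 : ∀ i, G' i * G i = 1 := irr_cases
    (show cofr0 G' * fr0 G = 1 by rw [hG0, hG0', hP']) fun i => by
      rw [hG, hG', Matrix.mul_assoc, ← Matrix.mul_assoc (a' i), ha1, Matrix.one_mul, hP']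
  have HA : ∀ i : Fin (D.p + 1), ∃ A : LMat (Fin D.n) (Fin D.n),
      (∀ hi : D.isIrr i, (∀ n < -1, cf A n = G' ⟨i, hi⟩ * cf (Fx F ⟨i, hi⟩) n * G ⟨i, hi⟩) ∧
        cf A (-1) = G' ⟨i, hi⟩ * Cm F ⟨i, hi⟩ * G ⟨i, hi⟩) ∧
      (∀ hi : ¬ D.isIrr i, (∀ n < -1, cf A n = 0) ∧ cf A (-1) = P' * Yr F ⟨i, hi⟩ * P) ∧
      ∀ n, 0 ≤ n → cf A n = 0 := fun i => by
    by_cases hi : D.isIrr i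
    · obtain ⟨A, h1, h2, h3⟩ := exists_polar (mono 0 (G' ⟨i, hi⟩) * Fx F ⟨i, hi⟩ * mono 0 (G ⟨i, hi⟩))
        (G' ⟨i, hi⟩ * Cm F ⟨i, hi⟩ * G ⟨i, hi⟩)
      refine ⟨A, fun _ => ⟨fun n hn => ?_, h2⟩, fun h => absurd hi h, h3⟩
      rw [h1 n hn, cf_mul_mono, cf_mono_mul, sub_zero, sub_zero]
    · obtain ⟨A, h1, h2, h3⟩ := exists_polar (0 : LMat (Fin D.n) (Fin D.n)) (P' * Yr F ⟨i, hi⟩ * P)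
      exact ⟨A, fun h => absurd h hi, fun _ => ⟨fun n hn => by rw [h1 n hn, cf_zero], h2⟩, h3⟩
  choose A hA1 hA2 hA3 using HA
  have hl : ∀ i : D.IrrIdx, ∀ n < -1, G i * cf (A i.1) n = cf (Fx F i) n * G i := fun i n hn => by
    rw [(hA1 i.1 i.2).1 n hn, ← Matrix.mul_assoc, ← Matrix.mul_assoc, i1, Matrix.one_mul]
  have hr : ∀ i : D.IrrIdx, G i * cf (A i.1) (-1) = Cm F i * G i := fun i => by
    rw [(hA1 i.1 i.2).2, ← Matrix.mul_assoc, ← Matrix.mul_assoc, i1, Matrix.one_mul]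
  have hrr : ∀ i : RegIdx D, P * cf (A i.1) (-1) = Yr F i * P := fun i => by
    rw [(hA2 i.1 i.2).2, ← Matrix.mul_assoc, ← Matrix.mul_assoc, hP, Matrix.one_mul]
  have hC : Compat A F G G' := ⟨i1, i2, fun i => by rw [hG, hG0], hl, hr,
    fun i => by rw [hG0]; exact hrr i, fun i => (hA2 i.1 i.2).1, hA3⟩
  refine ⟨A, G, G', hC, fun i a b k hk => congrFun (congrFun (hA3 i k hk) a) b, fun i => ?_, ?_,
    irr_of_midIrr hC hM hI⟩
  · show Loc D i (A i)
    by_cases hi : D.isIrr i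
    · have hs := fun j => exists_similar_R i j (Fintype.card_fin _) (F.LI ⟨i, hi⟩ j)
        (hM.legI ⟨i, hi⟩ j) (hF.LI ⟨i, hi⟩ j)
      choose g g' g1 g2 hg using hs
      refine Loc.of_FD (i1 ⟨i, hi⟩) (i2 ⟨i, hi⟩) (F.X ⟨i, hi⟩) g1 g2 hg (hl ⟨i, hi⟩) fun j => ?_
      have e := hr ⟨i, hi⟩
      have e' : G ⟨i, hi⟩ * cf (A i) (-1) * G' ⟨i, hi⟩ = Cm F ⟨i, hi⟩ := by
        refine (congrArg (fun M => M * G' ⟨i, hi⟩) e).trans ?_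
        rw [Matrix.mul_assoc, i1, Matrix.mul_one]
      rw [e']
      exact (hM.mid ⟨i, hi⟩ j).symm.trans (add_comm _ _)
    · obtain ⟨g, g', g1, g2, hg⟩ := exists_similar_R i (D.j1 i) ((card_Sg 0).trans (nb_reg hi).symm)
        (F.LR ⟨i, hi⟩) (hM.legR ⟨i, hi⟩) (hF.LR ⟨i, hi⟩)
      refine Loc.of_reg hi (hA2 i hi).1 (V := g * P) (V' := P' * g') ?_ ?_ ?_
      · rw [Matrix.mul_assoc, ← Matrix.mul_assoc P, hP, Matrix.one_mul, g1]
      · rw [Matrix.mul_assoc, ← Matrix.mul_assoc g', g2, Matrix.one_mul, hP']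
      · rw [Matrix.mul_assoc]
        refine (congrArg (fun M => g * M) (hrr ⟨i, hi⟩)).trans ?_
        rw [← Matrix.mul_assoc, ← Matrix.mul_assoc]
        exact congrArg (fun M => M * P) hg
  · show ∑ i, cf (A i) (-1) = 0
    have e0 : cf (A 0) (-1) = P' * C0 F * P := by
      have := (hA1 0 (Or.inr rfl)).2
      rw [← hG0, ← hG0']
      exact this
    have e1 : ∀ i : D.IrrNz, cf (A i.1) (-1) = -(P' * (F.b i * F.a i) * P) := fun i => by
      rw [(hA1 i.1 i.2.1).2]
      have k : Cm F ⟨i.1, i.2.1⟩ = -(F.a i * F.b i) := Cm_toIrr F i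
      have k1 : G ⟨i.1, i.2.1⟩ = F.a i * P := hG i
      have k2 : G' ⟨i.1, i.2.1⟩ = P' * a' i := hG' i
      rw [k, k1, k2, Matrix.mul_neg, Matrix.neg_mul]
      congr 1
      calc P' * a' i * (F.a i * F.b i) * (F.a i * P)
          = P' * (a' i * F.a i) * F.b i * F.a i * P := by simp only [Matrix.mul_assoc]
        _ = _ := by rw [ha1, Matrix.mul_one]; simp only [Matrix.mul_assoc]
    rw [sum_split, e0, Finset.sum_congr rfl fun i _ => e1 i,
      Finset.sum_congr rfl fun (i : RegIdx D) _ => (hA2 i.1 i.2).2, C0, Finset.sum_neg_distrib]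
    simp only [Matrix.mul_sub, Matrix.sub_mul, Matrix.mul_sum, Matrix.sum_mul]
    abel

end HTL

namespace HTL
set_option linter.unusedSectionVars false
set_option linter.unusedSimpArgs false
open ConnData
variable {D : ConnData}

/-- Every stable tuple of polar parts comes from a solution of the moment map equations. -/
theorem exists_flat_of_mem {A : Fin (D.p + 1) → LMat (Fin D.n) (Fin D.n)} (hA : D.MBMem A) :
    ∃ F G G', Compat A F G G' ∧ MomF F ∧ FullF F := by
  obtain ⟨hpos, hloc, hsum, -⟩ := hA
  have hloc' : ∀ i, Loc D i (A i) := hloc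
  have hsum' : ∑ i, cf (A i) (-1) = 0 := hsum
  have hI := fun i : D.IrrIdx => (hloc' i.1).exists_FD
  choose G G' X i1 i2 hl hd using hI
  have i10 : fr0 G * cofr0 G' = 1 := i1 D.irr0
  have i20 : cofr0 G' * fr0 G = 1 := i2 D.irr0
  have hLI : ∀ (i : D.IrrIdx) (j : Fin (D.m i.1)),
      ∃ L : LegData (Fin (D.nb i.1 j)) (D.e i.1 j - 1) (lr D i.1 j),
        L.base (xz D i.1 j 0) = D.R i.1 j ∧ L.Mom (xz D i.1 j) ∧ L.Full := fun i j =>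
    exists_leg_R i.1 j (V := 1) (V' := 1) (Matrix.one_mul 1) (Matrix.one_mul 1)
      (by rw [Matrix.one_mul, Matrix.mul_one])
  have hLR : ∀ i : RegIdx D,
      ∃ L : LegData (Sg D 0) (D.e i.1 (D.j1 i.1) - 1) (lr D i.1 (D.j1 i.1)),
        L.base (xz D i.1 (D.j1 i.1) 0) = fr0 G * cf (A i.1) (-1) * cofr0 G' ∧
          L.Mom (xz D i.1 (D.j1 i.1)) ∧ L.Full := fun i => by
    obtain ⟨-, V, V', h1, h2, hV⟩ := (hloc' i.1).exists_reg i.2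
    refine exists_leg_R i.1 (D.j1 i.1) (V := V * cofr0 G') (V' := fr0 G * V') ?_ ?_ ?_
    · rw [Matrix.mul_assoc, ← Matrix.mul_assoc (cofr0 G'), i20, Matrix.one_mul, h1]
    · rw [Matrix.mul_assoc, ← Matrix.mul_assoc V', h2, Matrix.one_mul, i10]
    · calc V * cofr0 G' * (fr0 G * cf (A i.1) (-1) * cofr0 G')
          = V * (cofr0 G' * fr0 G) * cf (A i.1) (-1) * cofr0 G' := by
            simp only [Matrix.mul_assoc]
        _ = _ := by rw [i20, Matrix.mul_one, hV, Matrix.mul_assoc]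
  choose LI bI mI fI using hLI
  choose LR bR mR fR using hLR
  obtain ⟨F, hF⟩ : ∃ F : FlatData D, F = ⟨fun i => G (toIrr i) * cofr0 G',
      fun i => -(fr0 G * cf (A i.1) (-1) * G' (toIrr i)), X, LI, LR⟩ := ⟨_, rfl⟩
  have Fa : ∀ i, F.a i = G (toIrr i) * cofr0 G' := fun i => by rw [hF]
  have Fb : ∀ i, F.b i = -(fr0 G * cf (A i.1) (-1) * G' (toIrr i)) := fun i => by rw [hF]
  have FY : ∀ i, Yr F i = fr0 G * cf (A i.1) (-1) * cofr0 G' := fun i => by rw [Yr, hF, bR]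
  have FC0 : C0 F = fr0 G * cf (A 0) (-1) * cofr0 G' := by
    have e1 : ∀ i : D.IrrNz, F.b i * F.a i = -(fr0 G * cf (A i.1) (-1) * cofr0 G') := fun i => by
      rw [Fa, Fb, Matrix.neg_mul]
      congr 1
      calc fr0 G * cf (A i.1) (-1) * G' (toIrr i) * (G (toIrr i) * cofr0 G')
          = fr0 G * cf (A i.1) (-1) * (G' (toIrr i) * G (toIrr i)) * cofr0 G' := by
            simp only [Matrix.mul_assoc]
        _ = _ := by rw [i2, Matrix.mul_one]
    rw [sum_split] at hsum'
    rw [C0, Finset.sum_congr rfl fun i _ => e1 i, Finset.sum_congr rfl fun i _ => FY i,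
      Finset.sum_neg_distrib, ← Matrix.sum_mul, ← Matrix.mul_sum, ← Matrix.sum_mul,
      ← Matrix.mul_sum, eq_neg_of_add_eq_zero_left (((add_assoc _ _ _).symm.trans hsum'))]
    simp only [Matrix.mul_neg, Matrix.neg_mul, Matrix.mul_add, Matrix.add_mul]
    abel
  have FC : ∀ i, Cm F i = G i * cf (A i.1) (-1) * G' i := irr_cases FC0 fun i => by
    rw [Cm_toIrr, Fa, Fb, Matrix.mul_neg, neg_neg]
    calc G (toIrr i) * cofr0 G' * (fr0 G * cf (A i.1) (-1) * G' (toIrr i))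
        = G (toIrr i) * (cofr0 G' * fr0 G) * cf (A i.1) (-1) * G' (toIrr i) := by
          simp only [Matrix.mul_assoc]
      _ = _ := by rw [i20, Matrix.mul_one]
  have FX : ∀ i, Fx F i = FD i.1 (X i) (D.R i.1) := fun i => by
    have : (fun j => (LI i j).base (xz D i.1 j 0)) = D.R i.1 := funext fun j => bI i j
    rw [Fx, FD, hF, ← this]
  refine ⟨F, G, G', ⟨i1, i2, fun i => ?_, fun i n hn => ?_, fun i => ?_, fun i => ?_,
    fun i => ((hloc' i.1).exists_reg i.2).1, fun i n hn => ?_⟩, ⟨fun i j => ?_, ?_, ?_⟩, ?_, ?_⟩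
  · rw [Fa, Matrix.mul_assoc, i20, Matrix.mul_one]
  · rw [FX]
    exact hl i n hn
  · rw [FC, Matrix.mul_assoc _ (G' i), i2, Matrix.mul_one]
  · rw [FY, Matrix.mul_assoc _ (cofr0 G'), i20, Matrix.mul_one]
  · ext a b
    exact hpos i a b n hn
  · rw [FC, hd i j]
    rw [hF]
    refine (congrArg (fun M => muX _ i j + M) (bI i j)).trans (add_comm _ _)
  · rw [hF]; exact mI
  · rw [hF]; exact mR
  · rw [hF]; exact fI
  · rw [hF]; exact fR

section FlatUnflat

theorem muX_flat_unflat (F : FlatData D) (i : D.IrrIdx) (j : Fin (D.m i.1)) :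
    muX (flat (unflat F)) i j = muX F i j := by
  refine Finset.sum_congr rfl fun j' _ => congrArg _ (Finset.sum_congr rfl fun k hk => ?_)
  have hk' := Finset.mem_range.1 hk
  have hne : j ≠ j' := by
    rintro rfl
    simp [dd] at hk'
  rw [blk_flat_unflat_X F i hne k hk', blk_flat_unflat_X F i hne.symm k (by rwa [dd_comm])]

theorem Fx_flat_unflat (F : FlatData D) (i : D.IrrIdx) (n : ℤ) :
    cf (Fx (flat (unflat F)) i) n = cf (Fx F i) n := by
  have h := RC_FF (ρ := homAlg 1) (X := (flat (unflat F)).X i) (X' := F.X i)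
    (e := eb fun j => Fin (D.nb i.1 j))
    (N := bd fun j => ((flat (unflat F)).LI i j).base (xz D i.1 j 0))
    (N' := bd fun j => (F.LI i j).base (xz D i.1 j 0)) (tr_valid i.1)
    (fun j _ => by rw [mem_homAlg, Matrix.one_mul, Matrix.mul_one])
    (fun j _ j' _ hne k hk => by
      rw [mem_homAlg, Matrix.one_mul, Matrix.mul_one, eb_mul_eb_inj]
      exact blk_flat_unflat_X F i hne k hk)
    (fun j _ => by rw [mem_homAlg, Matrix.one_mul, Matrix.mul_one, flat_unflat_LI]) n n le_rfl
  rw [mem_homAlg, Matrix.one_mul, Matrix.mul_one] at h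
  exact h

theorem Yr_flat_unflat (F : FlatData D) : Yr (flat (unflat F)) = Yr F := by
  funext i
  rw [Yr, flat_unflat_LR, Yr]

theorem C0_flat_unflat (F : FlatData D) : C0 (flat (unflat F)) = C0 F := by
  rw [C0, flat_unflat_a, flat_unflat_b, Yr_flat_unflat, C0]

theorem Cm_flat_unflat (F : FlatData D) : ∀ i, Cm (flat (unflat F)) i = Cm F i :=
  irr_cases (C0_flat_unflat F) fun i => by
    rw [Cm_toIrr, Cm_toIrr, flat_unflat_a, flat_unflat_b]

theorem MomF.flat_unflat {F : FlatData D} (h : MomF F) : MomF (flat (unflat F)) :=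
  ⟨fun i j => by rw [muX_flat_unflat, Cm_flat_unflat, flat_unflat_LI]; exact h.mid i j,
    by rw [flat_unflat_LI]; exact h.legI, by rw [flat_unflat_LR]; exact h.legR⟩

theorem FullF.flat_unflat {F : FlatData D} (h : FullF F) : FullF (flat (unflat F)) :=
  ⟨by rw [flat_unflat_LI]; exact h.LI, by rw [flat_unflat_LR]; exact h.LR⟩

theorem Compat.flat_unflat {A : Fin (D.p + 1) → LMat (Fin D.n) (Fin D.n)} {F : FlatData D}
    {G : ∀ i : D.IrrIdx, Matrix (Sg D i.1) (Fin D.n) ℂ}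
    {G' : ∀ i : D.IrrIdx, Matrix (Fin D.n) (Sg D i.1) ℂ} (h : Compat A F G G') :
    Compat A (flat (unflat F)) G G' :=
  ⟨h.inv1, h.inv2, h.a, fun i n hn => by rw [Fx_flat_unflat]; exact h.low i n hn,
    fun i => by rw [Cm_flat_unflat]; exact h.res i,
    fun i => by rw [Yr_flat_unflat]; exact h.rres i, h.rlow, h.pos⟩

end FlatUnflat

/-- The points of the quiver side attached to a point of the connection side. -/
def Assoc (A : D.MBSub) (x : D.MdifSub D.lamV D.alphaV) : Prop :=
  ∃ G G', Compat A.1 (flat x.1) G G'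

theorem momF_of_mem (x : D.MdifSub D.lamV D.alphaV) : MomF (flat x.1) :=
  (moment_iff x.1).1 x.2.1

theorem lIrrF_of_mem (x : D.MdifSub D.lamV D.alphaV) : LIrrF (flat x.1) :=
  (lIrred_iff x.1).1 x.2.2.1

theorem fullF_of_mem (x : D.MdifSub D.lamV D.alphaV) : FullF (flat x.1) :=
  fullF_of_lIrrF (momF_of_mem x) (lIrrF_of_mem x)

theorem exists_assoc_left (x : D.MdifSub D.lamV D.alphaV) : ∃ A : D.MBSub, Assoc A x := by
  obtain ⟨A, G, G', h, hA⟩ := exists_compat_of_flat (momF_of_mem x) (fullF_of_mem x)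
    (midIrr_of_lIrrF (momF_of_mem x) (lIrrF_of_mem x)) ((detCond_iff x.1).1 x.2.2.2)
  exact ⟨⟨A, hA⟩, G, G', h⟩

theorem exists_assoc_right (A : D.MBSub) : ∃ x : D.MdifSub D.lamV D.alphaV, Assoc A x := by
  obtain ⟨F, G, G', h, hM, hF⟩ := exists_flat_of_mem A.2
  have h' := h.flat_unflat
  have hI : MidIrr (flat (unflat F)) := midIrr_of_irr h' A.2.2.2.2
  refine ⟨⟨unflat F, (moment_iff _).2 hM.flat_unflat,
    (lIrred_iff _).2 (lIrrF_of_midIrr hF.flat_unflat hI), (detCond_iff _).2 fun i => ?_⟩, G, G', h'⟩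
  refine ⟨fr0 G * G' (toIrr i), ?_, ?_⟩
  · rw [h'.a_eq, Matrix.mul_assoc, ← Matrix.mul_assoc (G' _), h.inv2, Matrix.one_mul, h.inv01]
  · rw [h'.a_eq, Matrix.mul_assoc, ← Matrix.mul_assoc (cofr0 G'), h.inv02, Matrix.one_mul, h.inv1]

theorem cf_conjC (g : GLc D.n) (A : LMat (Fin D.n) (Fin D.n)) (n : ℤ) :
    cf (conjC g A) n = g.val * cf A n * g⁻¹.val := by
  have e : conjC g A = mono 0 g.val * A * mono 0 g⁻¹.val := rfl
  rw [e, cf_mul_mono, cf_mono_mul, sub_zero, sub_zero]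

theorem conjC_eq_iff (g : GLc D.n) (A A' : LMat (Fin D.n) (Fin D.n)) :
    conjC g A = A' ↔ ∀ n, g.val * cf A n = cf A' n * g.val := by
  constructor
  · rintro rfl n
    rw [cf_conjC, Matrix.mul_assoc, ← Units.val_mul, inv_mul_cancel, Units.val_one, Matrix.mul_one]
  · intro h
    refine cf_ext fun n => ?_
    rw [cf_conjC, h, Matrix.mul_assoc, ← Units.val_mul, mul_inv_cancel, Units.val_one,
      Matrix.mul_one]

theorem Assoc.act {A A' : D.MBSub} {x x' : D.MdifSub D.lamV D.alphaV} (h : Assoc A x)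
    (h' : Assoc A' x') (hg : ∃ g : GLc D.n, ∀ i, conjC g (A.1 i) = A'.1 i) :
    ∃ g : D.quiv.GGroup D.alphaV, FinQuiver.act g x.1 = x'.1 := by
  obtain ⟨G, G', hC⟩ := h
  obtain ⟨H, H', hC'⟩ := h'
  obtain ⟨g, hg⟩ := hg
  obtain ⟨u, hu⟩ := homF_of_conj hC hC' (momF_of_mem x) (momF_of_mem x') (fullF_of_mem x)
    (fullF_of_mem x') (g := g.val) (g' := g⁻¹.val)
    (by rw [← Units.val_mul, mul_inv_cancel, Units.val_one])
    (by rw [← Units.val_mul, inv_mul_cancel, Units.val_one])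
    fun i => (conjC_eq_iff g _ _).1 (hg i)
  exact ⟨u, (act_eq_iff u _ _).2 hu⟩

theorem Assoc.conj {A A' : D.MBSub} {x x' : D.MdifSub D.lamV D.alphaV} (h : Assoc A x)
    (h' : Assoc A' x') (hg : ∃ g : D.quiv.GGroup D.alphaV, FinQuiver.act g x.1 = x'.1) :
    ∃ g : GLc D.n, ∀ i, conjC g (A.1 i) = A'.1 i := by
  obtain ⟨G, G', hC⟩ := h
  obtain ⟨H, H', hC'⟩ := h'
  obtain ⟨u, hu⟩ := hg
  obtain ⟨g, hg⟩ := exists_conj_of_homF hC hC' u ((act_eq_iff u _ _).1 hu)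
  exact ⟨g, fun i => (conjC_eq_iff g _ _).2 (hg i)⟩

/-- A relation that is total on both sides and matches two equivalences identifies the quotients. -/
theorem nonempty_quot_equiv {α β : Type} {r : α → α → Prop} {s : β → β → Prop}
    (T : α → β → Prop) (hr : ∀ a, r a a) (hs : ∀ b, s b b) (h1 : ∀ a, ∃ b, T a b)
    (h2 : ∀ b, ∃ a, T a b) (h3 : ∀ a a' b b', T a b → T a' b' → (r a a' ↔ s b b')) :
    Nonempty (Quot r ≃ Quot s) := by
  choose f hf using h1
  choose k hk using h2
  refine ⟨⟨Quot.map f fun a a' h => (h3 _ _ _ _ (hf a) (hf a')).1 h,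
    Quot.map k fun b b' h => (h3 _ _ _ _ (hk b) (hk b')).2 h, ?_, ?_⟩⟩
  · rintro ⟨a⟩
    exact Quot.sound ((h3 _ _ _ _ (hk (f a)) (hf a)).2 (hs _))
  · rintro ⟨b⟩
    exact Quot.sound ((h3 _ _ _ _ (hf (k b)) (hk b)).1 (hr _))

theorem act_one (x : RepD D) : FinQuiver.act (Q := D.quiv) (α := D.alphaV) 1 x = x := by
  funext e
  simp [FinQuiver.act]
  rfl

theorem conjC_one (A : LMat (Fin D.n) (Fin D.n)) : conjC 1 A = A := by
  simp [conjC]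

end HTL

open ConnData in
/-- STATEMENT 8: there is a bijection `Φ_B : M(B) → M_λ(Q,α)^dif`. -/
theorem moduli_space_bijective_to_quiver_variety_dif (D : ConnData) :
    Nonempty (D.MB ≃ D.Mdif D.lamV D.alphaV) :=
  HTL.nonempty_quot_equiv HTL.Assoc (fun _ => ⟨1, fun _ => HTL.conjC_one _⟩)
    (fun x => ⟨1, HTL.act_one x.1⟩) HTL.exists_assoc_right HTL.exists_assoc_left
    fun _ _ _ _ h h' => ⟨h.act h', h.conj h'⟩
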